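/- For every real number ε₂ with ε₂ ≠ 0 and every p ∈ (1, ∞), there exists a constant C = C(p, ε₂) > 0 such that for every Schwartz function f : ℝ → ℂ one has ‖C_{ε₂}^{odd} f‖_{L^p(ℝ)} ≤ C ‖f‖_{L^p(ℝ)}. -/

import Mathlib

open MeasureTheory Filter Set
open scoped ENNReal Topology

/-- Principal value integral: the limit, as `δ → 0⁺` and `R → ∞`, of
`∫_{δ ≤ |y| ≤ R} g(y) dy`. -/
noncomputable def pvIntegral (g : ℝ → ℂ) : ℂ :=
  limUnder ((nhdsWithin (0 : ℝ) (Set.Ioi 0)) ×ˢ Filter.atTop)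
    (fun p : ℝ × ℝ => ∫ y in {y : ℝ | p.1 ≤ |y| ∧ |y| ≤ p.2}, g y)

/-- The odd fractional Carleson operator
`C_ε^{odd} f(x) = sup_{A ∈ ℝ} | p.v. ∫ e^{i A sgn(y) |y|^ε} f(x-y) dy/y |`. -/
noncomputable def carlesonOdd (ε : ℝ) (f : ℝ → ℂ) (x : ℝ) : ℝ≥0∞ :=
  ⨆ A : ℝ, (‖pvIntegral (fun y =>
    Complex.exp (Complex.I * (A : ℂ) * ((Real.sign y * |y| ^ ε : ℝ) : ℂ)) * f (x - y) / (y : ℂ))‖₊ : ℝ≥0∞)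

namespace Car
noncomputable section

/-! weights -/
def w (u : ℝ) : ℝ := (1 + u ^ 2)⁻¹

lemma w_pos (u : ℝ) : 0 < w u := by unfold w; positivity
lemma w_nn (u : ℝ) : 0 ≤ w u := (w_pos u).le
lemma w_le_one (u : ℝ) : w u ≤ 1 := inv_le_one_of_one_le₀ (by nlinarith [sq_nonneg u])
lemma w_neg (u : ℝ) : w (-u) = w u := by simp [w]
lemma w_anti {u v : ℝ} (h : |u| ≤ |v|) : w v ≤ w u := by
  unfold w
  have := sq_le_sq.2 h
  gcongr
lemma w_peetre (u v : ℝ) : w u * w v ≤ 2 * w (u + v) := by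
  unfold w
  rw [← mul_inv, ← div_eq_mul_inv, inv_le_iff_one_le_mul₀ (by positivity), div_mul_eq_mul_div,
    one_le_div (by positivity)]
  nlinarith [sq_nonneg (u - v), sq_nonneg (u * v)]
lemma w_one : w 1 = 1 / 2 := by norm_num [w]
lemma w_near {u v : ℝ} (h : |u - v| ≤ 1) : w u ≤ 4 * w v := by
  have h1 := w_peetre u (v - u)
  have h2 : w 1 ≤ w (v - u) := w_anti (by rw [abs_sub_comm] at h; simpa using h)
  rw [w_one] at h2
  have h3 := w_pos u
  rw [add_sub_cancel] at h1
  nlinarith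
lemma w_cont : Continuous w := by
  unfold w
  exact Continuous.inv₀ (by fun_prop) (fun x => by positivity)
@[fun_prop] lemma w_cont' {f : ℝ → ℝ} (hf : Continuous f) : Continuous fun x => w (f x) :=
  w_cont.comp hf
@[fun_prop] lemma w_meas {f : ℝ → ℝ} (hf : Measurable f) : Measurable fun x => w (f x) :=
  w_cont.measurable.comp hf
lemma w_bdry {a b c y t : ℝ} (ht : 0 < t) (h1 : a ≤ c) (h2 : c ≤ b) (hy : y ∉ Set.Ico a b) :
    w ((y - c) / t) ≤ w ((y - a) / t) + w ((y - b) / t) := by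
  rw [Set.mem_Ico, not_and_or, not_le, not_lt] at hy
  rcases hy with h | h
  · refine le_trans (w_anti ?_) (le_add_of_nonneg_right (w_nn _))
    rw [abs_div, abs_div]
    gcongr 1
    rw [abs_of_nonpos (by linarith), abs_of_nonpos (by linarith)]; linarith
  · refine le_trans (w_anti ?_) (le_add_of_nonneg_left (w_nn _))
    rw [abs_div, abs_div]
    gcongr 1
    rw [abs_of_nonneg (by linarith), abs_of_nonneg (by linarith)]; linarith
lemma w_int : Integrable w := integrable_inv_one_add_sq
lemma w_int' {t : ℝ} (ht : 0 < t) (c : ℝ) : Integrable fun x => w ((x - c) / t) :=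
  (w_int.comp_div ht.ne').comp_sub_right c
lemma w_integral {t : ℝ} (ht : 0 < t) (c : ℝ) : ∫ x, w ((x - c) / t) = t * Real.pi := by
  rw [integral_sub_right_eq_self (fun x => w (x / t)) c, Measure.integral_comp_div]
  simp only [w, integral_univ_inv_one_add_sq, smul_eq_mul, abs_of_pos ht]
lemma w_lint {t : ℝ} (ht : 0 < t) (c : ℝ) :
    ∫⁻ x, ENNReal.ofReal (w ((x - c) / t)) = ENNReal.ofReal (t * Real.pi) := by
  rw [← ofReal_integral_eq_lintegral_ofReal (w_int' ht c) (ae_of_all _ fun x => w_nn _),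
    w_integral ht c]

lemma w_sum (S : Finset ℤ) (u : ℝ) : ∑ n ∈ S, w (u - n) ≤ 13 := by
  have hI : Integrable fun x => w ((x - u) / 1) := w_int' one_pos u
  have h1 : ∀ n : ℤ, w (u - n) ≤ ∫ x in Set.Ico (n : ℝ) (n + 1), 4 * w ((x - u) / 1) := by
    intro n
    have : ∫ x in Set.Ico (n : ℝ) (n + 1), w (u - n) = w (u - n) := by
      simp
    rw [← this]
    refine setIntegral_mono_on (by simp) ((hI.const_mul 4).integrableOn) measurableSet_Ico ?_
    intro x hx
    rw [← w_neg ((x - u) / 1)]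
    apply w_near
    rw [abs_le]; constructor <;> [linarith [hx.1, hx.2]; linarith [hx.1, hx.2]]
  calc ∑ n ∈ S, w (u - n) ≤ ∑ n ∈ S, ∫ x in Set.Ico (n : ℝ) (n + 1), 4 * w ((x - u) / 1) :=
        Finset.sum_le_sum fun n _ => h1 n
    _ = ∫ x in ⋃ n ∈ S, Set.Ico (n : ℝ) (n + 1), 4 * w ((x - u) / 1) := by
        rw [integral_biUnion_finset S (fun _ _ => measurableSet_Ico)
          ((Set.pairwise_disjoint_Ico_intCast ℝ).set_pairwise _)
          (fun n _ => (hI.const_mul 4).integrableOn)]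
    _ ≤ ∫ x, 4 * w ((x - u) / 1) :=
        setIntegral_le_integral (hI.const_mul 4) (ae_of_all _ fun x => by
          have := w_nn ((x - u) / 1); positivity)
    _ = 4 * (1 * Real.pi) := by rw [integral_const_mul, w_integral one_pos]
    _ ≤ 13 := by linarith [Real.pi_lt_d2]

/-! dyadic intervals -/
def z (s : ℤ) : ℝ := (2 : ℝ) ^ s
lemma z_pos (s : ℤ) : 0 < z s := by unfold z; positivity
lemma z_nn (s : ℤ) : 0 ≤ z s := (z_pos s).le
lemma z_ne (s : ℤ) : z s ≠ 0 := (z_pos s).ne'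
lemma z_add (s t : ℤ) : z (s + t) = z s * z t := zpow_add₀ two_ne_zero s t
lemma z_neg (s : ℤ) : z (-s) = (z s)⁻¹ := zpow_neg 2 s
lemma z_sub (s t : ℤ) : z (s - t) = z s / z t := zpow_sub₀ two_ne_zero s t
lemma z_zero : z 0 = 1 := by simp [z]
lemma z_one : z 1 = 2 := by simp [z]
lemma z_succ (s : ℤ) : z (s + 1) = 2 * z s := by rw [z_add, z_one, mul_comm]
lemma z_nat (k : ℕ) : z k = 2 ^ k := by simp [z]
lemma z_mono {s t : ℤ} (h : s ≤ t) : z s ≤ z t := zpow_le_zpow_right₀ one_le_two h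
lemma z_lt {s t : ℤ} (h : s < t) : z s < z t := zpow_lt_zpow_right₀ one_lt_two h
lemma z_le_iff {s t : ℤ} : z s ≤ z t ↔ s ≤ t := zpow_le_zpow_iff_right₀ one_lt_two

def D (s n : ℤ) : Set ℝ := Set.Ico (n * z s) ((n + 1) * z s)
def idx (s : ℤ) (x : ℝ) : ℤ := ⌊x / z s⌋
lemma mem_D {s n : ℤ} {x : ℝ} : x ∈ D s n ↔ idx s x = n := by
  rw [idx, Int.floor_eq_iff, D, Set.mem_Ico, le_div_iff₀ (z_pos s), div_lt_iff₀ (z_pos s)]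
lemma mem_D_idx (s : ℤ) (x : ℝ) : x ∈ D s (idx s x) := mem_D.2 rfl
lemma D_meas (s n : ℤ) : MeasurableSet (D s n) := measurableSet_Ico
lemma D_vol (s n : ℤ) : volume (D s n) = ENNReal.ofReal (z s) := by
  rw [D, Real.volume_Ico]; congr 1; ring
lemma idx_coarse {s t : ℤ} (h : s ≤ t) (x : ℝ) : idx t x = idx s x / (2 ^ (t - s).toNat : ℕ) := by
  have : x / z t = x / z s / ((2 ^ (t - s).toNat : ℕ) : ℝ) := by
    rw [div_div]; congr 1
    have : t = s + ((t - s).toNat : ℤ) := by omega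
    conv_lhs => rw [this, z_add, z_nat]
    push_cast; ring
  rw [idx, this, Int.floor_div_natCast, idx]
lemma D_sub {s t n m : ℤ} {x : ℝ} (h : s ≤ t) (h1 : x ∈ D s n) (h2 : x ∈ D t m) :
    D s n ⊆ D t m := by
  intro y hy
  rw [mem_D] at *
  rw [← h2, idx_coarse h, idx_coarse h, h1, hy]
lemma D_left (s n : ℤ) : (n * z s : ℝ) ∈ D s n := ⟨le_rfl, by have := z_pos s; nlinarith⟩
lemma D_le {s t n m : ℤ} (h : D s n ⊆ D t m) : s ≤ t := by
  have := measure_mono (μ := volume) h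
  rw [D_vol, D_vol, ENNReal.ofReal_le_ofReal_iff (z_nn _)] at this
  exact z_le_iff.1 this
lemma D_disj {s n m : ℤ} (h : n ≠ m) : Disjoint (D s n) (D s m) :=
  Set.disjoint_left.2 fun x h1 h2 => h ((mem_D.1 h1).symm.trans (mem_D.1 h2))
lemma D_cases {s t n m : ℤ} (h : s ≤ t) : D s n ⊆ D t m ∨ Disjoint (D s n) (D t m) := by
  by_cases hd : Disjoint (D s n) (D t m)
  · exact Or.inr hd
  · obtain ⟨x, h1, h2⟩ := Set.not_disjoint_iff.1 hd
    exact Or.inl (D_sub h h1 h2)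
/-- centre -/
def ctr (s n : ℤ) : ℝ := (n + 1 / 2) * z s
lemma ctr_mem (s n : ℤ) : ctr s n ∈ D s n := by
  have := z_pos s
  constructor <;> unfold ctr <;> nlinarith
lemma D_dist {s n : ℤ} {x y : ℝ} (hx : x ∈ D s n) (hy : y ∈ D s n) : |(x - y) / z s| ≤ 1 := by
  rw [abs_div, abs_of_pos (z_pos s), div_le_one (z_pos s), abs_le]
  constructor <;> linarith [hx.1, hx.2, hy.1, hy.2]
lemma D_dist_lt {s n : ℤ} {x y : ℝ} (hx : x ∈ D s n) (hy : y ∈ D s n) : |x - y| < z s := by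
  rw [abs_lt]
  constructor <;> linarith [hx.1, hx.2, hy.1, hy.2]
lemma w_D {s t n : ℤ} {x y : ℝ} (hx : x ∈ D s n) (hy : y ∈ D s n) (u : ℝ) (h : s ≤ t) :
    w ((u - x) / z t) ≤ 4 * w ((u - y) / z t) := by
  apply w_near
  rw [← sub_div, abs_div, abs_of_pos (z_pos t), div_le_one (z_pos t)]
  have := D_dist_lt hx hy
  rw [abs_lt] at this
  rw [abs_le]
  constructor <;> linarith [z_mono h]
lemma w_D' {s t n : ℤ} {x y : ℝ} (hx : x ∈ D s n) (hy : y ∈ D s n) (u : ℝ) (h : s ≤ t) :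
    w ((x - u) / z t) ≤ 4 * w ((y - u) / z t) := by
  have := w_D hx hy u h
  rwa [← w_neg, ← w_neg ((u - y) / z t), ← neg_div, ← neg_div, neg_sub, neg_sub] at this
lemma w_sum_ctr (S : Finset ℤ) (s : ℤ) (x : ℝ) : ∑ n ∈ S, w ((x - ctr s n) / z s) ≤ 13 := by
  refine le_trans (le_of_eq (Finset.sum_congr rfl fun n _ => ?_)) (w_sum S (x / z s - 1 / 2))
  congr 1
  unfold ctr
  field_simp [z_ne s]
  ring

/-! tiles -/
@[ext] structure Tile where
  s : ℤ
  n : ℤ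
  m : ℤ
namespace Tile
def I (P : Tile) : Set ℝ := D P.s P.n
def om (P : Tile) : Set ℝ := D (-P.s) P.m
/-- left half -/
def om1 (P : Tile) : Set ℝ := D (-P.s - 1) (2 * P.m)
/-- the part carrying N -/
def om2 (P : Tile) : Set ℝ := D (-P.s - 4) (16 * P.m + 8)
def c (P : Tile) : ℝ := ctr P.s P.n
def le (P Q : Tile) : Prop := P.I ⊆ Q.I ∧ Q.om ⊆ P.om
end Tile
lemma D_half (s m : ℤ) : D (s - 1) (2 * m) ⊆ D s m := by
  have h := z_succ (s - 1)
  rw [sub_add_cancel] at h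
  have := z_pos (s - 1)
  intro x hx
  obtain ⟨h1, h2⟩ := hx
  push_cast at h1 h2
  constructor <;> rw [h] <;> nlinarith
lemma D_sixteen (s m : ℤ) : D (s - 4) (16 * m + 8) ⊆ D (s - 1) (2 * m + 1) := by
  have h : z (s - 1) = 8 * z (s - 4) := by
    rw [show s - 1 = s - 4 + 3 by ring, z_add]; norm_num [z, mul_comm]
  have := z_pos (s - 4)
  intro x hx
  obtain ⟨h1, h2⟩ := hx
  push_cast at h1 h2
  constructor <;> rw [h] <;> push_cast <;> nlinarith
lemma D_half' (s m : ℤ) : D (s - 1) (2 * m + 1) ⊆ D s m := by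
  have h := z_succ (s - 1)
  rw [sub_add_cancel] at h
  have := z_pos (s - 1)
  intro x hx
  obtain ⟨h1, h2⟩ := hx
  push_cast at h1 h2
  constructor <;> rw [h] <;> nlinarith
lemma om1_sub (P : Tile) : P.om1 ⊆ P.om := D_half _ _
lemma om2_sub (P : Tile) : P.om2 ⊆ P.om := (D_sixteen _ _).trans (D_half' _ _)
lemma om12_lt {P : Tile} {x y : ℝ} (hx : x ∈ P.om1) (hy : y ∈ P.om2) : x < y := by
  have := D_sixteen _ _ hy
  have h1 := hx.2
  have h2 := this.1
  push_cast at h1 h2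
  linarith
lemma om_sub_om1 {P Q : Tile} {x : ℝ} (h : Q.s < P.s) (h1 : x ∈ P.om) (h2 : x ∈ Q.om1) :
    P.om ⊆ Q.om1 := D_sub (by omega) h1 h2
lemma I_vol (P : Tile) : volume P.I = ENNReal.ofReal (z P.s) := D_vol _ _
lemma I_meas (P : Tile) : MeasurableSet P.I := D_meas _ _
end
end Car

namespace Car
noncomputable section

/-- uncentred maximal function -/
def Mx (g : ℝ → ℝ≥0∞) (x : ℝ) : ℝ≥0∞ :=
  ⨆ (c : ℝ) (r : ℝ) (_ : x ∈ Metric.ball c r), (∫⁻ y in Metric.ball c r, g y) / ENNReal.ofReal (2 * r)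

lemma Mx_ge (g : ℝ → ℝ≥0∞) {x c r : ℝ} (h : x ∈ Metric.ball c r) :
    (∫⁻ y in Metric.ball c r, g y) / ENNReal.ofReal (2 * r) ≤ Mx g x :=
  le_iSup_of_le c (le_iSup_of_le r (le_iSup_of_le h le_rfl))

lemma Mx_lt_eq (g : ℝ → ℝ≥0∞) (t : ℝ≥0∞) : {x | t < Mx g x} =
    ⋃ q : {q : ℝ × ℝ // t < (∫⁻ y in Metric.ball q.1 q.2, g y) / ENNReal.ofReal (2 * q.2)},
      Metric.ball q.1.1 q.1.2 := by
  ext x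
  simp only [Mx, lt_iSup_iff, mem_ofPred_eq, mem_iUnion, Subtype.exists, Prod.exists]
  constructor
  · rintro ⟨c, r, h, h'⟩; exact ⟨c, r, h', h⟩
  · rintro ⟨c, r, h, h'⟩; exact ⟨c, r, h', h⟩

lemma Mx_meas (g : ℝ → ℝ≥0∞) : Measurable (Mx g) := by
  refine measurable_of_Ioi fun t => ?_
  have := Mx_lt_eq g t
  change MeasurableSet {x | t < Mx g x}
  rw [this]
  exact (isOpen_iUnion fun q => Metric.isOpen_ball).measurableSet

lemma Mx_weak (g : ℝ → ℝ≥0∞) (t : ℝ≥0∞) :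
    t * volume {x | t < Mx g x} ≤ 4 * ∫⁻ y, g y := by
  have ho : IsOpen {x | t < Mx g x} := by
    rw [Mx_lt_eq]; exact isOpen_iUnion fun q => Metric.isOpen_ball
  rw [ho.measure_eq_iSup_isCompact, ENNReal.mul_iSup]
  refine iSup_le fun K => ?_
  rw [ENNReal.mul_iSup]
  refine iSup_le fun hK => ?_
  rw [ENNReal.mul_iSup]
  refine iSup_le fun hKc => ?_
  rw [Mx_lt_eq] at hK
  obtain ⟨b, hb⟩ := hKc.elim_finite_subcover _ (fun q => Metric.isOpen_ball) hK
  obtain ⟨R, hR⟩ := (b.image fun q => q.1.2).bddAbove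
  obtain ⟨u, hub, hud, huc⟩ := Vitali.exists_disjoint_subfamily_covering_enlargement_closedBall
    (b : Set {q : ℝ × ℝ // t < (∫⁻ y in Metric.ball q.1 q.2, g y) / ENNReal.ofReal (2 * q.2)})
    (fun q => q.1.1) (fun q => q.1.2) R (fun a ha => hR (Finset.mem_coe.2 (Finset.mem_image_of_mem _ ha))) 4
    (by norm_num)
  have huf : u.Finite := b.finite_toSet.subset hub
  have hK2 : K ⊆ ⋃ q ∈ u, Metric.closedBall q.1.1 (4 * q.1.2) := by
    intro x hx
    obtain ⟨q, hq, hxq⟩ := mem_iUnion₂.1 (hb hx)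
    obtain ⟨q', hq', hs⟩ := huc q hq
    exact mem_iUnion₂.2 ⟨q', hq', hs (Metric.ball_subset_closedBall hxq)⟩
  calc t * volume K ≤ t * ∑ q ∈ huf.toFinset, volume (Metric.closedBall q.1.1 (4 * q.1.2)) := by
        gcongr
        refine (measure_mono hK2).trans ?_
        have := measure_biUnion_finset_le (μ := volume) huf.toFinset
          (fun q => Metric.closedBall q.1.1 (4 * q.1.2))
        simpa using this
    _ = ∑ q ∈ huf.toFinset, 4 * (t * ENNReal.ofReal (2 * q.1.2)) := by
        rw [Finset.mul_sum]
        refine Finset.sum_congr rfl fun q _ => ?_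
        rw [Real.volume_closedBall, show (2 * (4 * q.1.2) : ℝ) = 4 * (2 * q.1.2) by ring,
          ENNReal.ofReal_mul (by norm_num)]
        simp only [ENNReal.ofReal_ofNat]; ring
    _ ≤ ∑ q ∈ huf.toFinset, 4 * ∫⁻ y in Metric.ball q.1.1 q.1.2, g y := by
        gcongr with q
        have := q.2
        exact ENNReal.mul_le_of_le_div this.le
    _ = 4 * ∫⁻ y in ⋃ q ∈ huf.toFinset, Metric.ball q.1.1 q.1.2, g y := by
        rw [← Finset.mul_sum, lintegral_biUnion_finset _ (fun q _ => measurableSet_ball)]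
        intro q hq q' hq' hne
        exact ((hud (by simpa using hq) (by simpa using hq') hne)).mono
          Metric.ball_subset_closedBall Metric.ball_subset_closedBall
    _ ≤ 4 * ∫⁻ y, g y := by gcongr; exact Measure.restrict_le_self

/-- dyadic levels -/
def e2 (a : ℝ) : ℝ≥0∞ := (2 : ℝ≥0∞) ^ a
lemma e2_add (a b : ℝ) : e2 (a + b) = e2 a * e2 b := ENNReal.rpow_add _ _ (by simp) (by simp)
lemma e2_mul (a b : ℝ) : e2 (a * b) = e2 a ^ b := ENNReal.rpow_mul _ _ _
lemma e2_ne_top (a : ℝ) : e2 a ≠ ∞ := by simp [e2]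
lemma e2_ne_zero (a : ℝ) : e2 a ≠ 0 := by simp [e2]
lemma e2_mono {a b : ℝ} (h : a ≤ b) : e2 a ≤ e2 b := ENNReal.rpow_le_rpow_of_exponent_le (by simp) h
lemma e2_lt_iff {a b : ℝ} : e2 a < e2 b ↔ a < b := by
  refine ⟨fun h => ?_, fun h => ENNReal.rpow_lt_rpow_of_exponent_lt (by simp) (by simp) h⟩
  by_contra h2
  exact absurd h (not_lt.2 (e2_mono (not_lt.1 h2)))
lemma e2_zero : e2 0 = 1 := by simp [e2]
lemma e2_one : e2 1 = 2 := by simp [e2]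
lemma e2_ofReal (a : ℝ) : e2 a = ENNReal.ofReal (2 ^ a) := by
  rw [← ENNReal.ofReal_rpow_of_pos two_pos]; simp [e2]
lemma exists_level {X : ℝ≥0∞} (h0 : X ≠ 0) (h1 : X ≠ ∞) : ∃ k : ℤ, e2 k < X ∧ X ≤ e2 (k + 1) := by
  obtain ⟨k, hk⟩ := ENNReal.exists_mem_Ioc_zpow h0 h1 (by simp : (1 : ℝ≥0∞) < 2) (by simp)
  refine ⟨k, ?_, ?_⟩
  · simpa [e2, ENNReal.rpow_intCast] using hk.1
  · have := hk.2
    rw [← ENNReal.rpow_intCast] at this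
    simpa [e2] using this

/-- geometric series constant -/
def gs (a : ℝ) : ℝ≥0∞ := (1 - e2 (-a))⁻¹
lemma gs_ne_top {a : ℝ} (ha : 0 < a) : gs a ≠ ∞ := by
  unfold gs
  rw [Ne, ENNReal.inv_eq_top, tsub_eq_zero_iff_le, not_le, ← e2_zero, e2_lt_iff]
  linarith
lemma tsum_geom (a : ℝ) : ∑' j : ℕ, e2 (-(j * a)) = gs a := by
  unfold gs
  rw [← ENNReal.tsum_geometric]
  refine tsum_congr fun j => ?_
  rw [show -(j * a) = -a * j by ring, e2_mul, ENNReal.rpow_natCast]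

lemma tsum_below (a : ℝ) (k0 : ℤ) :
    ∑' k : ℤ, (if k ≤ k0 then e2 (k * a) else 0) = e2 (k0 * a) * gs a := by
  have hinj : Function.Injective fun j : ℕ => k0 - (j : ℤ) := fun i j h => by simpa using h
  rw [← hinj.tsum_eq, ← tsum_geom, ← ENNReal.tsum_mul_left]
  · refine tsum_congr fun j => ?_
    rw [if_pos (by omega), ← e2_add]
    push_cast; ring_nf
  · intro k hk
    simp only [Function.mem_support, ne_eq, ite_eq_right_iff, Classical.not_imp] at hk
    exact ⟨(k0 - k).toNat, by simp; omega⟩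
lemma tsum_above (a : ℝ) (k0 : ℤ) :
    ∑' k : ℤ, (if k0 ≤ k then e2 (-(k * a)) else 0) = e2 (-(k0 * a)) * gs a := by
  have := tsum_below a (-k0)
  rw [← (Equiv.neg ℤ).tsum_eq] at this
  simp only [Equiv.neg_apply, neg_le_neg_iff] at this
  push_cast at this
  simpa [neg_mul] using this

lemma tsum_lt_le {a : ℝ} (ha : 0 < a) (G : ℝ≥0∞) :
    ∑' k : ℤ, (if e2 k < G then e2 (k * a) else 0) ≤ gs a * G ^ a := by
  rcases eq_or_ne G 0 with rfl | h0
  · simp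
  rcases eq_or_ne G ∞ with rfl | h1
  · rw [ENNReal.top_rpow_of_pos ha, ENNReal.mul_top (by simp [gs])]; exact le_top
  obtain ⟨k0, h2, h3⟩ := exists_level h0 h1
  calc _ ≤ ∑' k : ℤ, (if k ≤ k0 then e2 (k * a) else 0) := by
        refine ENNReal.tsum_le_tsum fun k => ?_
        split_ifs with h4 h5
        · exact le_rfl
        · exfalso; apply h5
          have := e2_lt_iff.1 (h4.trans_le h3)
          exact_mod_cast Int.lt_add_one_iff.1 (by exact_mod_cast this)
        · exact zero_le
        · exact le_rfl
    _ = e2 (k0 * a) * gs a := tsum_below a k0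
    _ ≤ gs a * G ^ a := by
        rw [mul_comm, e2_mul]; gcongr
lemma rpow_le_tsum {p : ℝ} (hp : 0 < p) (X : ℝ≥0∞) :
    X ^ p ≤ ∑' k : ℤ, (if e2 k < X then e2 ((k + 1) * p) else 0) := by
  rcases eq_or_ne X 0 with rfl | h0
  · simp [hp]
  rcases eq_or_ne X ∞ with rfl | h1
  · have : ∀ k : ℤ, e2 ((k + 1) * p) ≤ ∑' k : ℤ, (if e2 k < ∞ then e2 ((k + 1) * p) else 0) := by
      intro k
      refine le_trans ?_ (ENNReal.le_tsum k)
      rw [if_pos (e2_ne_top k).lt_top]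
    refine le_of_eq_of_le (b := (∞ : ℝ≥0∞)) (by simp [hp]) ?_
    refine ENNReal.le_of_forall_nnreal_lt fun r _ => ?_
    obtain ⟨n, hn⟩ := exists_nat_gt (r : ℝ≥0∞).toReal
    obtain ⟨k, hk⟩ := exists_nat_gt (n / p)
    refine le_trans ?_ (this k)
    have h2 : (n : ℝ) ≤ (((k : ℤ) : ℝ) + 1) * p := by
      rw [div_lt_iff₀ hp] at hk; push_cast; nlinarith
    refine le_trans ?_ (e2_mono h2)
    rw [e2, ENNReal.rpow_natCast]
    have h3 : (r : ℝ≥0∞) ≤ n := by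
      have : (r : ℝ) < n := by simpa using hn
      have h4 : r ≤ n := by exact_mod_cast this.le
      exact_mod_cast h4
    refine h3.trans ?_
    exact_mod_cast (Nat.lt_two_pow_self (n := n)).le
  obtain ⟨k, h2, h3⟩ := exists_level h0 h1
  refine le_trans ?_ (ENNReal.le_tsum k)
  rw [if_pos h2, e2_mul]
  gcongr

lemma Mx_add_const {g g1 : ℝ → ℝ≥0∞} {c : ℝ≥0∞} (h : ∀ x, g x ≤ g1 x + c) (x : ℝ) :
    Mx g x ≤ Mx g1 x + c := by
  refine iSup_le fun a => iSup_le fun r => iSup_le fun hx => ?_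
  have hr : 0 < r := Metric.pos_of_mem_ball hx
  have hr2 : ENNReal.ofReal (2 * r) ≠ 0 := by simpa using hr
  calc _ ≤ (∫⁻ y in Metric.ball a r, (g1 y + c)) / ENNReal.ofReal (2 * r) := by
        gcongr with y; exact h y
    _ = (∫⁻ y in Metric.ball a r, g1 y) / ENNReal.ofReal (2 * r) + c := by
        rw [lintegral_add_right _ measurable_const, lintegral_const, Measure.restrict_apply_univ,
          Real.volume_ball, ENNReal.add_div, ENNReal.mul_div_cancel_right hr2 ENNReal.ofReal_ne_top]
    _ ≤ _ := by gcongr; exact Mx_ge g1 hx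

lemma Mx_strong {p : ℝ} (hp : 1 < p) {g : ℝ → ℝ≥0∞} (hg : Measurable g) :
    ∫⁻ x, Mx g x ^ p ≤ (8 * e2 p * e2 (p - 1) * gs (p - 1)) * ∫⁻ x, g x ^ p := by
  have hlev : ∀ k : ℤ, volume {x | e2 k < Mx g x} ≤
      ∫⁻ y, 8 * e2 (-k) * (if e2 (k - 1) < g y then g y else 0) := by
    intro k
    have h1 : {x | e2 k < Mx g x} ⊆
        {x | e2 (k - 1) < Mx (fun y => if e2 (k - 1) < g y then g y else 0) x} := by
      intro x hx
      have h2 : Mx g x ≤ Mx (fun y => if e2 (k - 1) < g y then g y else 0) x + e2 (k - 1) :=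
        Mx_add_const (fun y => by split_ifs with h; · simp
                                  · simpa using h) x
      by_contra h3
      simp only [mem_ofPred_eq, not_lt] at h3 hx
      have h4 : e2 (k : ℝ) = e2 (k - 1) + e2 (k - 1) := by
        rw [← two_mul, ← e2_one, ← e2_add]; congr 1; ring
      exact absurd (hx.trans_le (h2.trans (by rw [h4]; gcongr))) (lt_irrefl _)
    have h5 := Mx_weak (fun y => if e2 (k - 1) < g y then g y else 0) (e2 (k - 1))
    have h6 : e2 (-k) * 2 * e2 (k - 1) = 1 := by
      rw [← e2_one, ← e2_add, ← e2_add, ← e2_zero]; congr 1; ring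
    rw [lintegral_const_mul _ (by
      refine Measurable.ite (measurableSet_lt measurable_const hg) hg measurable_const)]
    calc volume {x | e2 k < Mx g x} ≤ e2 (-k) * 2 * (e2 (k - 1) *
          volume {x | e2 (k - 1) < Mx (fun y => if e2 (k - 1) < g y then g y else 0) x}) := by
          rw [← mul_assoc, h6, one_mul]; exact measure_mono h1
      _ ≤ e2 (-k) * 2 * (4 * ∫⁻ y, (if e2 (k - 1) < g y then g y else 0)) := by gcongr
      _ = _ := by ring
  have hmM : ∀ k : ℤ, MeasurableSet {x | e2 k < Mx g x} := fun k =>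
    measurableSet_lt measurable_const (Mx_meas g)
  calc ∫⁻ x, Mx g x ^ p ≤ ∫⁻ x, ∑' k : ℤ, (if e2 k < Mx g x then e2 ((k + 1) * p) else 0) :=
        lintegral_mono fun x => rpow_le_tsum (by linarith) _
    _ = ∑' k : ℤ, ∫⁻ x, (if e2 k < Mx g x then e2 ((k + 1) * p) else 0) :=
        lintegral_tsum fun k => (Measurable.ite (hmM k) measurable_const measurable_const).aemeasurable
    _ = ∑' k : ℤ, e2 ((k + 1) * p) * volume {x | e2 k < Mx g x} := by
        refine tsum_congr fun k => ?_
        rw [← lintegral_indicator_const (hmM k)]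
        refine lintegral_congr fun x => ?_
        simp [indicator_apply]
    _ ≤ ∑' k : ℤ, e2 ((k + 1) * p) * ∫⁻ y, 8 * e2 (-k) * (if e2 (k - 1) < g y then g y else 0) := by
        gcongr with k; exact hlev k
    _ = ∫⁻ y, ∑' k : ℤ, e2 ((k + 1) * p) * (8 * e2 (-k) * (if e2 (k - 1) < g y then g y else 0)) := by
        have hm : ∀ k : ℤ, Measurable fun y => 8 * e2 (-k) * (if e2 (k - 1) < g y then g y else 0) :=
          fun k => (Measurable.ite (measurableSet_lt measurable_const hg) hg measurable_const).const_mul _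
        rw [lintegral_tsum fun k => ((hm k).const_mul _).aemeasurable]
        exact tsum_congr fun k => (lintegral_const_mul _ (hm k)).symm
    _ ≤ ∫⁻ y, (8 * e2 p * e2 (p - 1) * gs (p - 1)) * g y ^ p := by
        refine lintegral_mono fun y => ?_
        calc _ = 8 * e2 p * g y * ∑' k : ℤ, (if e2 k < 2 * g y then e2 (k * (p - 1)) else 0) := by
              rw [← ENNReal.tsum_mul_left]
              refine tsum_congr fun k => ?_
              have : e2 (k - 1) < g y ↔ e2 k < 2 * g y := by
                rw [show (k : ℝ) = 1 + (k - 1) by ring, e2_add, e2_one]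
                rw [ENNReal.mul_lt_mul_iff_right (by simp) (by simp)]; ring_nf
              by_cases h : e2 k < 2 * g y
              · rw [if_pos h, if_pos (this.2 h),
                  show ((k : ℝ) + 1) * p = p + k + k * (p - 1) by ring, e2_add, e2_add]
                have h6 : e2 k * e2 (-k) = 1 := by
                  rw [← e2_add, ← e2_zero]; congr 1; ring
                calc _ = (e2 k * e2 (-k)) * (8 * e2 p * g y * e2 (k * (p - 1))) := by ring
                  _ = _ := by rw [h6, one_mul]
              · rw [if_neg h, if_neg (this.not.2 h)]; simp
          _ ≤ 8 * e2 p * g y * (gs (p - 1) * (2 * g y) ^ (p - 1)) := by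
              gcongr; exact tsum_lt_le (by linarith) _
          _ = _ := by
              rw [ENNReal.mul_rpow_of_nonneg _ _ (by linarith)]
              have : g y ^ p = g y * g y ^ (p - 1) := by
                conv_rhs => enter [1]; rw [← ENNReal.rpow_one (g y)]
                rw [← ENNReal.rpow_add_of_nonneg _ _ (by norm_num) (by linarith)]; congr 1; ring
              rw [this]; simp only [e2]; ring
    _ = _ := lintegral_const_mul _ (hg.pow_const p)

/-- averages against w are bounded by the maximal function -/
lemma w_le_Mx {g : ℝ → ℝ≥0∞} (hg : Measurable g) {t : ℝ} (ht : 0 < t) {x x' : ℝ} (h : |x - x'| ≤ t) :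
    ∫⁻ y, g y * ENNReal.ofReal (w ((x - y) / t)) ≤ ENNReal.ofReal (64 * t) * Mx g x' := by
  have key : ∀ u : ℝ, ENNReal.ofReal (w u) ≤
      ∑' j : ℕ, (if |u| < 2 ^ j then ENNReal.ofReal (4 * (1 / 4) ^ j) else 0) := by
    intro u
    obtain ⟨j, hj1, hj2⟩ : ∃ j : ℕ, |u| < 2 ^ j ∧ w u ≤ 4 * (1 / 4) ^ j := by
      have hex : ∃ j : ℕ, |u| < 2 ^ j := pow_unbounded_of_one_lt _ one_lt_two
      classical
      refine ⟨Nat.find hex, Nat.find_spec hex, ?_⟩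
      rcases h0 : Nat.find hex with _ | j
      · have := w_le_one u; simp; linarith
      · have h1 := Nat.find_min hex (m := j) (by omega)
        rw [not_lt] at h1
        have h2 : w u ≤ ((2 ^ j) ^ 2)⁻¹ := by
          unfold w
          apply inv_anti₀ (by positivity)
          rw [← sq_abs u]
          have := pow_le_pow_left₀ (by positivity) h1 2
          linarith
        refine h2.trans (le_of_eq ?_)
        rw [← pow_mul, mul_comm j 2, pow_mul, pow_succ, one_div, inv_pow]
        norm_num; ring
    refine le_trans ?_ (ENNReal.le_tsum j)
    rw [if_pos hj1]
    exact ENNReal.ofReal_le_ofReal hj2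
  calc _ ≤ ∫⁻ y, ∑' j : ℕ, g y * (if |(x - y) / t| < 2 ^ j then ENNReal.ofReal (4 * (1 / 4) ^ j) else 0) := by
        refine lintegral_mono fun y => ?_
        simp only
        rw [ENNReal.tsum_mul_left]
        gcongr; exact key _
    _ = ∑' j : ℕ, ∫⁻ y, g y * (if |(x - y) / t| < 2 ^ j then ENNReal.ofReal (4 * (1 / 4) ^ j) else 0) := by
        refine lintegral_tsum fun j => ?_
        refine (hg.mul (Measurable.ite ?_ measurable_const measurable_const)).aemeasurable
        exact measurableSet_lt (by fun_prop) measurable_const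
    _ ≤ ∑' j : ℕ, ENNReal.ofReal (16 * t * (1 / 2) ^ j) * Mx g x' := by
        gcongr with j
        have h1 : ∀ y, g y * (if |(x - y) / t| < 2 ^ j then ENNReal.ofReal (4 * (1 / 4) ^ j) else 0) ≤
            (Metric.ball x' (2 * 2 ^ j * t)).indicator (fun y => ENNReal.ofReal (4 * (1 / 4) ^ j) * g y) y := by
          intro y
          split_ifs with hy
          · rw [indicator_of_mem]
            · rw [mul_comm]
            · rw [abs_div, abs_of_pos ht, div_lt_iff₀ ht, abs_lt] at hy
              rw [Metric.mem_ball, Real.dist_eq, abs_lt]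
              have h2 : (1 : ℝ) ≤ 2 ^ j := one_le_pow₀ one_le_two
              rw [abs_le] at h
              constructor <;> nlinarith
          · simp
        refine (lintegral_mono h1).trans ?_
        rw [lintegral_indicator measurableSet_ball, lintegral_const_mul _ hg]
        have h3 := Mx_ge g (Metric.mem_ball_self (x := x') (ε := 2 * 2 ^ j * t) (by positivity))
        rw [ENNReal.div_le_iff (by simp only [ne_eq, ENNReal.ofReal_eq_zero, not_le]; positivity)
          ENNReal.ofReal_ne_top] at h3
        refine (mul_le_mul_right h3 _).trans (le_of_eq ?_)
        rw [mul_comm (Mx g x'), ← mul_assoc, ← ENNReal.ofReal_mul (by positivity)]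
        congr 2
        have : (1 / 4 : ℝ) ^ j * 2 ^ j = (1 / 2) ^ j := by rw [← mul_pow]; norm_num
        rw [← this]; ring
    _ = ENNReal.ofReal (32 * t) * Mx g x' := by
        rw [ENNReal.tsum_mul_right, ← ENNReal.ofReal_tsum_of_nonneg (fun j => by positivity)
          ((summable_geometric_two).mul_left _), tsum_mul_left, tsum_geometric_two]
        congr 2; ring
    _ ≤ _ := by gcongr; linarith
end
end Car

namespace Car
noncomputable section

lemma iterate_aux {h : ℝ → ℝ≥0∞} {K M : ℝ≥0∞} {a : ℝ} (ha : a ≤ 1) (hM : ∀ x, h x ≤ M)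
    (H : ∀ E : Set ℝ, MeasurableSet E → volume E ≠ ∞ → ∃ E' ⊆ E, MeasurableSet E' ∧
      volume E ≤ 2 * volume E' ∧ ∫⁻ x in E', h x ≤ K * volume E ^ (1 - a)) (n : ℕ) :
    ∀ E : Set ℝ, MeasurableSet E → volume E ≠ ∞ → ∫⁻ x in E, h x ≤
      (∑ j ∈ Finset.range n, e2 (-(j * (1 - a)))) * K * volume E ^ (1 - a) + M * e2 (-n) * volume E := by
  induction n with
  | zero =>
    intro E _ _
    simp only [Finset.range_zero, Finset.sum_empty, zero_mul, Nat.cast_zero, neg_zero, e2_zero,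
      mul_one, zero_add]
    refine (setLIntegral_mono' ‹_› fun x _ => hM x).trans ?_
    simp
  | succ n ih =>
    intro E hE hf
    obtain ⟨E', hs, hE', h1, h2⟩ := H E hE hf
    have h3 := ih (E \ E') (hE.diff hE') (measure_ne_top_of_subset sdiff_subset hf)
    have hf' : volume E' ≠ ∞ := measure_ne_top_of_subset hs hf
    have h4 : volume (E \ E') ≤ e2 (-1) * volume E := by
      have h5 : e2 (-1) * volume E ≤ volume E' := by
        refine (mul_le_mul_right h1 _).trans (le_of_eq ?_)
        rw [← mul_assoc, ← e2_one, ← e2_add]; simp [e2_zero]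
      have h6 : e2 (-1) * volume E + e2 (-1) * volume E = volume E := by
        rw [← two_mul, ← mul_assoc, ← e2_one, ← e2_add]; simp [e2_zero]
      rw [measure_sdiff hs hE'.nullMeasurableSet hf', tsub_le_iff_right]
      conv_lhs => rw [← h6]
      gcongr
    rw [← inter_union_sdiff E E', inter_eq_self_of_subset_right hs,
      lintegral_union (hE.diff hE') disjoint_sdiff_right,
      union_sdiff_cancel hs]
    calc _ ≤ K * volume E ^ (1 - a) + ((∑ j ∈ Finset.range n, e2 (-(j * (1 - a)))) * K *
          (e2 (-1) * volume E) ^ (1 - a) + M * e2 (-n) * (e2 (-1) * volume E)) := by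
          refine add_le_add h2 (h3.trans ?_)
          gcongr
      _ = _ := by
          rw [Finset.sum_range_succ', ENNReal.mul_rpow_of_nonneg _ _ (by linarith), ← e2_mul]
          have : ∀ j : ℕ, e2 (-(((j + 1 : ℕ) : ℝ) * (1 - a))) = e2 (-(j * (1 - a))) * e2 (-1 * (1 - a)) := by
            intro j; rw [← e2_add]; congr 1; push_cast; ring
          simp_rw [this]
          rw [← Finset.sum_mul]
          have h7 : e2 (-((n + 1 : ℕ) : ℝ)) = e2 (-n) * e2 (-1) := by
            rw [← e2_add]; congr 1; push_cast; ring
          rw [h7]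
          simp only [Nat.cast_zero, zero_mul, neg_zero, e2_zero]
          ring

lemma iterate {h : ℝ → ℝ≥0∞} {K M : ℝ≥0∞} {a : ℝ} (ha : a ≤ 1) (hM : ∀ x, h x ≤ M) (hM' : M ≠ ∞)
    (H : ∀ E : Set ℝ, MeasurableSet E → volume E ≠ ∞ → ∃ E' ⊆ E, MeasurableSet E' ∧
      volume E ≤ 2 * volume E' ∧ ∫⁻ x in E', h x ≤ K * volume E ^ (1 - a))
    (E : Set ℝ) (hE : MeasurableSet E) (hf : volume E ≠ ∞) :
    ∫⁻ x in E, h x ≤ gs (1 - a) * K * volume E ^ (1 - a) := by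
  have h1 : ∀ n : ℕ, ∫⁻ x in E, h x ≤ gs (1 - a) * K * volume E ^ (1 - a) + M * e2 (-n) * volume E := by
    intro n
    refine (iterate_aux ha hM H n E hE hf).trans ?_
    gcongr
    rw [← tsum_geom]
    exact ENNReal.sum_le_tsum _
  have h2 : Tendsto (fun n : ℕ => gs (1 - a) * K * volume E ^ (1 - a) + M * e2 (-n) * volume E) atTop
      (𝓝 (gs (1 - a) * K * volume E ^ (1 - a) + M * 0 * volume E)) := by
    refine tendsto_const_nhds.add (ENNReal.Tendsto.mul_const (ENNReal.Tendsto.const_mul ?_ (Or.inr hM')) (Or.inr hf))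
    have : ∀ n : ℕ, e2 (-(n : ℝ)) = (2⁻¹ : ℝ≥0∞) ^ n := by
      intro n; rw [e2, ENNReal.rpow_neg, ENNReal.rpow_natCast, ENNReal.inv_pow]
    simp_rw [this]
    exact ENNReal.tendsto_pow_atTop_nhds_zero_of_lt_one (by simp)
  simp only [mul_zero, zero_mul, add_zero] at h2
  exact ge_of_tendsto' h2 h1

lemma tsum_abs (θ : ℝ) (k : ℤ) : ∑' j : ℤ, e2 (-(|(k : ℝ) - j| * θ)) ≤ 2 * gs θ := by
  calc _ ≤ ∑' j : ℤ, ((e2 (-(k * θ)) * if j ≤ k then e2 (j * θ) else 0) +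
        (e2 (k * θ) * if k ≤ j then e2 (-(j * θ)) else 0)) := by
        refine ENNReal.tsum_le_tsum fun j => ?_
        rcases le_total j k with h | h
        · refine le_trans (le_of_eq ?_) (le_add_of_nonneg_right zero_le)
          have : (j : ℝ) ≤ k := by exact_mod_cast h
          rw [if_pos h, ← e2_add, abs_of_nonneg (by linarith)]; ring_nf
        · refine le_trans (le_of_eq ?_) (le_add_of_nonneg_left zero_le)
          have : (k : ℝ) ≤ j := by exact_mod_cast h
          rw [if_pos h, ← e2_add, abs_of_nonpos (by linarith)]; ring_nf
    _ = _ := by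
        rw [ENNReal.tsum_add, ENNReal.tsum_mul_left, ENNReal.tsum_mul_left, tsum_below, tsum_above,
          ← mul_assoc, ← mul_assoc, ← e2_add, ← e2_add]
        simp [e2_zero, two_mul]

lemma young_aux {κ X Y : ℝ≥0∞} {a a0 : ℝ} (hκ0 : κ ≠ 0) (hκ : κ ≤ 1) (ha0 : a0 ≤ a) (h0 : 0 < a0)
    (h1 : a < 1) : X ^ (1 - a) * Y ^ a ≤ κ ^ a0 * X + κ⁻¹ * Y := by
  have hκt : κ ≠ ∞ := ne_top_of_le_ne_top (by simp) hκ
  have hpow : ∀ Z : ℝ≥0∞, Z ^ (1 - a) * Z ^ a = Z := by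
    intro Z
    rw [← ENNReal.rpow_add_of_nonneg _ _ (by linarith) (by linarith)]; simp
  rcases le_total Y (κ * X) with h | h
  · refine le_trans ?_ (le_add_of_nonneg_right zero_le)
    calc X ^ (1 - a) * Y ^ a ≤ X ^ (1 - a) * (κ * X) ^ a := by gcongr; linarith
      _ = κ ^ a * (X ^ (1 - a) * X ^ a) := by
          rw [ENNReal.mul_rpow_of_nonneg _ _ (by linarith)]; ring
      _ ≤ κ ^ a0 * X := by
          rw [hpow]; exact mul_le_mul' (ENNReal.rpow_le_rpow_of_exponent_ge hκ ha0) le_rfl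
  · refine le_trans ?_ (le_add_of_nonneg_left zero_le)
    have h2 : X ≤ κ⁻¹ * Y := by
      rw [mul_comm, ← div_eq_mul_inv, ENNReal.le_div_iff_mul_le (Or.inl hκ0) (Or.inl hκt), mul_comm]
      exact h
    calc X ^ (1 - a) * Y ^ a ≤ (κ⁻¹ * Y) ^ (1 - a) * (κ⁻¹ * Y) ^ a := by
          have h3 : Y ≤ κ⁻¹ * Y := le_mul_of_one_le_left' (by simpa using hκ)
          gcongr
          linarith
      _ = _ := hpow _

lemma interp_term {p a : ℝ} (ha0 : 0 < a) (ha1 : a < 1) {k j : ℤ} {V F : ℝ≥0∞} :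
    e2 (k * (p - 1)) * (e2 j * (V ^ (1 - a) * F ^ a)) =
      e2 ((k - j) * (p * a - 1)) * ((e2 (k * p) * V) ^ (1 - a) * (e2 (j * p) * F) ^ a) := by
  rw [ENNReal.mul_rpow_of_nonneg _ _ (by linarith), ENNReal.mul_rpow_of_nonneg _ _ ha0.le,
    ← e2_mul, ← e2_mul]
  have h1 : e2 (k * (p - 1)) * e2 j = e2 ((k - j) * (p * a - 1)) * (e2 (k * p * (1 - a)) * e2 (j * p * a)) := by
    rw [← e2_add, ← e2_add, ← e2_add]; congr 1; ring
  calc _ = (e2 (k * (p - 1)) * e2 j) * (V ^ (1 - a) * F ^ a) := by ring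
    _ = _ := by rw [h1]; ring

lemma interp {p δ : ℝ} (hp : 1 < p) (hδ : 0 < δ) (h1 : 0 < 1 / p - δ) (h2 : 1 / p + δ < 1) :
    ∃ C : ℝ≥0∞, C ≠ ∞ ∧ ∀ (B M : ℝ≥0∞) (h : ℝ → ℝ≥0∞) (S : Set ℝ) (J : Finset ℤ) (F : ℤ → ℝ≥0∞)
      (hj : ℤ → ℝ → ℝ≥0∞), B ≤ 1 → M ≠ ∞ → Measurable h → (∀ x ∈ S, h x ≤ M) → MeasurableSet S →
      volume S ≠ ∞ → (∀ j, Measurable (hj j)) → (∀ x ∈ S, h x ≤ ∑ j ∈ J, e2 j * hj j x) →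
      (∀ j ∈ J, ∀ E ⊆ S, MeasurableSet E → ∀ a ∈ ({1 / p - δ, 1 / p + δ} : Set ℝ),
        ∫⁻ x in E, hj j x ≤ B * (volume E ^ (1 - a) * F j ^ a)) →
      ∫⁻ x in S, h x ^ p ≤ C * B * ∑ j ∈ J, e2 (j * p) * F j := by
  have hp0 : 0 < p := by linarith
  have hθ : 0 < p * δ := by positivity
  set Cg : ℝ≥0∞ := 2 * gs (p * δ) with hCg
  have hCgt : Cg ≠ ∞ := ENNReal.mul_ne_top (by simp) (gs_ne_top hθ)
  have hCg0 : Cg ≠ 0 := by simp [Cg, gs]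
  set a0 := 1 / p - δ with ha0
  set κ : ℝ≥0∞ := min 1 ((2 * Cg)⁻¹ ^ (1 / a0)) with hκ
  have hκ1 : κ ≤ 1 := min_le_left _ _
  have hκ0 : κ ≠ 0 := by
    have : (2 * Cg)⁻¹ ^ (1 / a0) ≠ 0 := by
      have h3 : (2 * Cg)⁻¹ ≠ 0 := by simp [ENNReal.mul_eq_top, hCgt]
      have h4 : (2 * Cg)⁻¹ ≠ ∞ := by simp [hCg0]
      exact (ENNReal.rpow_pos (pos_iff_ne_zero.2 h3) h4).ne'
    exact (lt_min one_pos (pos_iff_ne_zero.2 this)).ne'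
  have hκa : κ ^ a0 * Cg ≤ 2⁻¹ := by
    have : κ ^ a0 ≤ (2 * Cg)⁻¹ := by
      calc κ ^ a0 ≤ ((2 * Cg)⁻¹ ^ (1 / a0)) ^ a0 := by gcongr; exact min_le_right _ _
        _ = _ := by rw [← ENNReal.rpow_mul, one_div, inv_mul_cancel₀ h1.ne', ENNReal.rpow_one]
    calc _ ≤ (2 * Cg)⁻¹ * Cg := by gcongr
      _ = 2⁻¹ := by
        rw [ENNReal.mul_inv (by simp) (by simp), mul_assoc, ENNReal.inv_mul_cancel hCg0 hCgt, mul_one]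
  refine ⟨e2 p * (2 * (κ⁻¹ * Cg)), ?_, ?_⟩
  · exact ENNReal.mul_ne_top (e2_ne_top _) (ENNReal.mul_ne_top (by simp) (ENNReal.mul_ne_top (by simpa) hCgt))
  intro B M h S J F hj hB hM hh hhM hS hSf hjm hle hE
  let E : ℤ → Set ℝ := fun k => S ∩ {x | e2 k < h x ∧ h x ≤ e2 (k + 1)}
  have hEm : ∀ k, MeasurableSet (E k) := fun k =>
    hS.inter ((measurableSet_lt measurable_const hh).inter (measurableSet_le hh measurable_const))
  let X : ℤ → ℝ≥0∞ := fun k => e2 (k * p) * volume (E k)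
  have hEmem : ∀ {k x}, x ∈ E k → x ∈ S ∧ e2 k < h x ∧ h x ≤ e2 (k + 1) := fun h => h
  have hEdisj : Pairwise (Function.onFun Disjoint E) := by
    intro k l hkl
    refine Set.disjoint_left.2 fun x hx hx' => hkl ?_
    obtain ⟨-, h3, h4⟩ := hEmem hx
    obtain ⟨-, h5, h6⟩ := hEmem hx'
    have h7 := e2_lt_iff.1 (h3.trans_le h6)
    have h8 := e2_lt_iff.1 (h5.trans_le h4)
    have h7' : k < l + 1 := by exact_mod_cast h7
    have h8' : l < k + 1 := by exact_mod_cast h8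
    omega
  have hXfin : ∑' k, X k ≠ ∞ := by
    have : ∑' k, X k ≤ ∫⁻ x in S, M ^ p := by
      calc ∑' k, X k ≤ ∑' k, ∫⁻ x in E k, M ^ p := by
            refine ENNReal.tsum_le_tsum fun k => ?_
            rw [setLIntegral_const]
            change e2 (k * p) * volume (E k) ≤ _
            rcases (E k).eq_empty_or_nonempty with he | ⟨x, hx⟩
            · simp [he]
            · gcongr
              rw [e2_mul]
              gcongr
              exact (hEmem hx).2.1.le.trans (hhM x (hEmem hx).1)
        _ = ∫⁻ x in ⋃ k, E k, M ^ p := (lintegral_iUnion hEm hEdisj _).symm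
        _ ≤ _ := lintegral_mono_set (iUnion_subset fun k => inter_subset_left)
    refine ne_top_of_le_ne_top ?_ this
    rw [setLIntegral_const]
    exact ENNReal.mul_ne_top (ENNReal.rpow_ne_top_of_nonneg hp0.le hM) hSf
  have hmain : ∀ k, X k ≤ ∑ j ∈ J, B * (e2 (-(|(k : ℝ) - j| * (p * δ))) *
      (κ ^ a0 * X k + κ⁻¹ * (e2 (j * p) * F j))) := by
    intro k
    calc X k = e2 (k * (p - 1)) * ∫⁻ x in E k, e2 k := by
          rw [setLIntegral_const, ← mul_assoc, ← e2_add]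
          change e2 (k * p) * volume (E k) = _
          congr 2; ring
      _ ≤ e2 (k * (p - 1)) * ∫⁻ x in E k, ∑ j ∈ J, e2 j * hj j x := by
          gcongr 1
          refine setLIntegral_mono' (hEm k) fun x hx => ?_
          exact (hEmem hx).2.1.le.trans (hle x (hEmem hx).1)
      _ = ∑ j ∈ J, e2 (k * (p - 1)) * (e2 j * ∫⁻ x in E k, hj j x) := by
          rw [lintegral_finsetSum _ (fun j _ => (hjm j).const_mul _), Finset.mul_sum]
          exact Finset.sum_congr rfl fun j _ => by rw [lintegral_const_mul _ (hjm j)]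
      _ ≤ _ := by
          refine Finset.sum_le_sum fun j hjJ => ?_
          obtain ⟨a, ha, ha1, ha2, ha3, ha4⟩ : ∃ a ∈ ({1 / p - δ, 1 / p + δ} : Set ℝ), 0 < a ∧ a < 1 ∧
              a0 ≤ a ∧ ((k : ℝ) - j) * (p * a - 1) = -(|(k : ℝ) - j| * (p * δ)) := by
            rcases le_total (0 : ℝ) ((k : ℝ) - j) with h3 | h3
            · refine ⟨1 / p - δ, by simp, h1, by linarith, le_rfl, ?_⟩
              rw [abs_of_nonneg h3]; field_simp; ring
            · refine ⟨1 / p + δ, by simp, by linarith, h2, by rw [ha0]; linarith, ?_⟩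
              rw [abs_of_nonpos h3]; field_simp; ring
          calc _ ≤ e2 (k * (p - 1)) * (e2 j * (B * (volume (E k) ^ (1 - a) * F j ^ a))) := by
                gcongr; exact hE j hjJ (E k) inter_subset_left (hEm k) a ha
            _ = B * (e2 (k * (p - 1)) * (e2 j * (volume (E k) ^ (1 - a) * F j ^ a))) := by ring
            _ = B * (e2 (-(|(k : ℝ) - j| * (p * δ))) * (X k ^ (1 - a) * (e2 (j * p) * F j) ^ a)) := by
                rw [interp_term ha1 ha2, ha4]
            _ ≤ _ := by gcongr; exact young_aux hκ0 hκ1 ha3 h1 ha2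
  have hsum : ∑' k, X k ≤ 2⁻¹ * ∑' k, X k + B * (κ⁻¹ * Cg) * ∑ j ∈ J, e2 (j * p) * F j := by
    calc ∑' k, X k ≤ ∑' k, ((κ ^ a0 * Cg) * X k + ∑ j ∈ J, B * κ⁻¹ * (e2 (j * p) * F j) *
            e2 (-(|(k : ℝ) - j| * (p * δ)))) := by
          refine ENNReal.tsum_le_tsum fun k => (hmain k).trans ?_
          have : ∀ j ∈ J, B * (e2 (-(|(k : ℝ) - j| * (p * δ))) *
              (κ ^ a0 * X k + κ⁻¹ * (e2 (j * p) * F j))) ≤ (κ ^ a0 * X k) * e2 (-(|(k : ℝ) - j| * (p * δ)))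
              + B * κ⁻¹ * (e2 (j * p) * F j) * e2 (-(|(k : ℝ) - j| * (p * δ))) := by
            intro j _
            calc _ = B * ((κ ^ a0 * X k) * e2 (-(|(k : ℝ) - j| * (p * δ))))
                + B * κ⁻¹ * (e2 (j * p) * F j) * e2 (-(|(k : ℝ) - j| * (p * δ))) := by ring
              _ ≤ 1 * ((κ ^ a0 * X k) * e2 (-(|(k : ℝ) - j| * (p * δ)))) + _ := by gcongr
              _ = _ := by rw [one_mul]
          refine (Finset.sum_le_sum this).trans ?_
          rw [Finset.sum_add_distrib, ← Finset.mul_sum]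
          refine add_le_add ?_ le_rfl
          calc _ ≤ κ ^ a0 * X k * Cg := by
                refine mul_le_mul' le_rfl ?_
                exact (ENNReal.sum_le_tsum J).trans (tsum_abs (p * δ) k)
            _ = _ := by ring
      _ ≤ _ := by
          rw [ENNReal.tsum_add, ENNReal.tsum_mul_left, Summable.tsum_finsetSum (fun _ _ => ENNReal.summable)]
          gcongr ?_ * _ + ?_
          rw [Finset.mul_sum]
          refine Finset.sum_le_sum fun j _ => ?_
          rw [ENNReal.tsum_mul_left]
          calc _ ≤ B * κ⁻¹ * (e2 (j * p) * F j) * Cg := by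
                gcongr
                refine le_trans (le_of_eq (tsum_congr fun k => ?_)) (tsum_abs (p * δ) j)
                rw [abs_sub_comm]
            _ = _ := by ring
  have hX : ∑' k, X k ≤ 2 * (B * (κ⁻¹ * Cg) * ∑ j ∈ J, e2 (j * p) * F j) := by
    have h3 : ∑' k, X k = 2⁻¹ * ∑' k, X k + 2⁻¹ * ∑' k, X k := by
      rw [← add_mul, ENNReal.inv_two_add_inv_two, one_mul]
    have h4 : 2⁻¹ * ∑' k, X k ≤ B * (κ⁻¹ * Cg) * ∑ j ∈ J, e2 (j * p) * F j := by
      have h5 : 2⁻¹ * ∑' k, X k ≠ ∞ := ENNReal.mul_ne_top (by simp) hXfin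
      rw [← ENNReal.add_le_add_iff_left h5, ← h3]
      exact hsum
    calc ∑' k, X k = 2 * (2⁻¹ * ∑' k, X k) := by
          rw [← mul_assoc, ENNReal.mul_inv_cancel (by simp) (by simp), one_mul]
      _ ≤ _ := by gcongr
  calc ∫⁻ x in S, h x ^ p ≤ ∫⁻ x in S, ∑' k, (E k).indicator (fun _ => e2 ((k + 1) * p)) x := by
        refine setLIntegral_mono' hS fun x hx => ?_
        rcases eq_or_ne (h x) 0 with h0 | h0
        · rw [h0, ENNReal.zero_rpow_of_pos hp0]; exact zero_le
        · obtain ⟨k, hk1, hk2⟩ := exists_level h0 (ne_top_of_le_ne_top hM (hhM x hx))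
          refine le_trans ?_ (ENNReal.le_tsum k)
          rw [indicator_of_mem (show x ∈ E k from ⟨hx, hk1, hk2⟩), e2_mul]
          gcongr
    _ ≤ ∫⁻ x, ∑' k, (E k).indicator (fun _ => e2 ((k + 1) * p)) x := setLIntegral_le_lintegral _ _
    _ = ∑' k, e2 p * X k := by
        rw [lintegral_tsum fun k => (measurable_const.indicator (hEm k)).aemeasurable]
        refine tsum_congr fun k => ?_
        rw [lintegral_indicator_const (hEm k)]
        change _ = e2 p * (e2 (k * p) * volume (E k))
        rw [← mul_assoc, ← e2_add]; congr 2; ring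
    _ ≤ e2 p * (2 * (B * (κ⁻¹ * Cg) * ∑ j ∈ J, e2 (j * p) * F j)) := by
        rw [ENNReal.tsum_mul_left]; gcongr
    _ = _ := by ring
end
end Car

namespace Car
noncomputable section
open FourierTransform ComplexConjugate

def ee (t : ℝ) : ℂ := Complex.exp ((2 * Real.pi * t : ℝ) * Complex.I)
lemma ee_add (a b : ℝ) : ee (a + b) = ee a * ee b := by
  unfold ee; rw [← Complex.exp_add]; congr 1; push_cast; ring
lemma ee_zero : ee 0 = 1 := by simp [ee]
lemma ee_norm (t : ℝ) : ‖ee t‖ = 1 := Complex.norm_exp_ofReal_mul_I _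
lemma ee_ne (t : ℝ) : ee t ≠ 0 := Complex.exp_ne_zero _
lemma ee_conj (t : ℝ) : conj (ee t) = ee (-t) := by
  unfold ee; rw [← Complex.exp_conj]; congr 1; simp [Complex.conj_ofNat]
@[fun_prop] lemma ee_cont {f : ℝ → ℝ} (hf : Continuous f) : Continuous fun x => ee (f x) := by
  unfold ee; fun_prop
lemma ee_cont0 : Continuous ee := ee_cont continuous_id
@[fun_prop] lemma ee_meas {α : Type*} [MeasurableSpace α] {f : α → ℝ} (hf : Measurable f) :
    Measurable fun x => ee (f x) := ee_cont0.measurable.comp hf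
lemma ee_one_sub (t : ℝ) : ‖ee t - 1‖ ≤ 7 * |t| := by
  have h := Real.norm_exp_I_mul_ofReal_sub_one_le (x := 2 * Real.pi * t)
  unfold ee; rw [mul_comm]; refine h.trans ?_
  rw [Real.norm_eq_abs, abs_mul, abs_of_pos (by positivity : (0:ℝ) < 2 * Real.pi)]
  nlinarith [abs_nonneg t, Real.pi_lt_d2]
lemma ee_sub (a b : ℝ) : ‖ee a - ee b‖ ≤ 7 * |a - b| := by
  have : ee a - ee b = ee b * (ee (a - b) - 1) := by
    rw [mul_sub, ← ee_add]; simp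
  rw [this, norm_mul, ee_norm, one_mul]; exact ee_one_sub _

lemma F_eq (h : ℝ → ℂ) (ζ : ℝ) : 𝓕 h ζ = ∫ y, ee (-(y * ζ)) * h y := by
  rw [Real.fourier_real_eq_integral_exp_smul]
  refine integral_congr_ae (ae_of_all _ fun y => ?_)
  simp only [smul_eq_mul, ee]; congr 3; push_cast; ring
lemma Finv_eq (h : ℝ → ℂ) (x : ℝ) : 𝓕⁻ h x = ∫ η, ee (η * x) * h η := by
  rw [Real.fourierInv_eq_fourier_neg, F_eq]; simp

def Band (h : ℝ → ℂ) (a b : ℝ) : Prop := Continuous h ∧ Integrable h ∧ ∀ ζ, ζ ∉ Ioo a b → 𝓕 h ζ = 0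

namespace Band
variable {h g : ℝ → ℂ} {a b c d : ℝ}
lemma F_cont (hi : Integrable h) : Continuous (𝓕 h) :=
  VectorFourier.fourierIntegral_continuous Real.continuous_fourierChar
    (by simp; fun_prop) hi
lemma F_int (H : Band h a b) : Integrable (𝓕 h) := by
  refine ((F_cont H.2.1).integrable_of_hasCompactSupport ?_)
  refine HasCompactSupport.intro isCompact_Icc (K := Icc a b) fun x hx => H.2.2 x fun h => hx ⟨h.1.le, h.2.le⟩
lemma inv (H : Band h a b) (x : ℝ) : h x = ∫ η, ee (η * x) * 𝓕 h η := by
  rw [← Finv_eq, H.1.fourierInv_fourier_eq H.2.1 H.F_int]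
lemma bdd (H : Band h a b) : ∃ C, ∀ x, ‖h x‖ ≤ C := ⟨∫ η, ‖𝓕 h η‖, fun x => by
  rw [H.inv x]; refine (norm_integral_le_integral_norm _).trans (le_of_eq ?_)
  simp [ee_norm]⟩
lemma mono (H : Band h a b) (h1 : c ≤ a) (h2 : b ≤ d) : Band h c d :=
  ⟨H.1, H.2.1, fun ζ hζ => H.2.2 ζ fun h => hζ ⟨h1.trans_lt h.1, h.2.trans_le h2⟩⟩
lemma integrand (hi : Integrable h) (ζ : ℝ) : Integrable fun y => ee (-(y * ζ)) * h y := by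
  refine hi.bdd_mul (c := 1) (by fun_prop) (ae_of_all _ fun y => (ee_norm _).le)
lemma add (H : Band h a b) (G : Band g a b) : Band (fun x => h x + g x) a b := by
  refine ⟨H.1.add G.1, H.2.1.add G.2.1, fun ζ hζ => ?_⟩
  have h1 := H.2.2 ζ hζ; have h2 := G.2.2 ζ hζ
  rw [F_eq] at h1 h2 ⊢
  simp only [mul_add]; rw [integral_add (integrand H.2.1 ζ) (integrand G.2.1 ζ), h1, h2, add_zero]
lemma zero : Band (fun _ => 0) a b :=
  ⟨continuous_const, integrable_zero _ _ _, fun ζ _ => by rw [F_eq]; simp⟩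
lemma smul (H : Band h a b) (k : ℂ) : Band (fun x => k * h x) a b := by
  refine ⟨continuous_const.mul H.1, H.2.1.const_mul k, fun ζ hζ => ?_⟩
  have h1 := H.2.2 ζ hζ; rw [F_eq] at h1 ⊢
  simp only [mul_left_comm _ k]; rw [integral_const_mul, h1, mul_zero]
lemma sub (H : Band h a b) (G : Band g a b) : Band (fun x => h x - g x) a b := by
  have := H.add (G.smul (-1)); simpa [sub_eq_add_neg] using this
lemma sum {ι : Type*} (S : Finset ι) {f : ι → ℝ → ℂ} (H : ∀ i ∈ S, Band (f i) a b) :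
    Band (fun x => ∑ i ∈ S, f i x) a b := by
  classical
  induction S using Finset.induction_on with
  | empty => simpa using zero
  | insert i S hi ih =>
    simp only [Finset.sum_insert hi]
    exact (H i (by simp)).add (ih fun j hj => H j (by simp [hj]))
lemma cj (H : Band h a b) : Band (fun x => conj (h x)) (-b) (-a) := by
  refine ⟨Complex.continuous_conj.comp H.1, ?_, fun ζ hζ => ?_⟩
  · exact (Complex.conjLIE.toContinuousLinearEquiv.toContinuousLinearMap.integrable_comp H.2.1)
  · have h1 := H.2.2 (-ζ) fun h => hζ ⟨by linarith [h.2], by linarith [h.1]⟩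
    rw [F_eq] at h1 ⊢
    have : ∫ y, ee (-(y * ζ)) * conj (h y) = conj (∫ y, ee (-(y * (-ζ))) * h y) := by
      rw [← integral_conj]; congr 1; ext y; simp [ee_conj]
    rw [this, h1, map_zero]
lemma mul (H : Band h a b) (G : Band g c d) : Band (fun x => h x * g x) (a + c) (b + d) := by
  obtain ⟨C, hC⟩ := H.bdd
  refine ⟨H.1.mul G.1, G.2.1.bdd_mul H.1.aestronglyMeasurable (ae_of_all _ hC), fun ζ hζ => ?_⟩
  rw [F_eq]
  have e1 : ∀ y, ee (-(y * ζ)) * (h y * g y) = ∫ η, 𝓕 h η * (ee (-(y * (ζ - η))) * g y) := fun y => by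
    conv_lhs => rw [H.inv y, mul_comm _ (g y), ← mul_assoc, ← integral_const_mul]
    congr 1; ext η
    rw [show -(y * (ζ - η)) = -(y * ζ) + η * y by ring, ee_add]; ring
  simp only [e1]
  rw [integral_integral_swap]
  · have : ∀ η, ∫ y, 𝓕 h η * (ee (-(y * (ζ - η))) * g y) = 0 := fun η => by
      rw [integral_const_mul, ← F_eq]
      by_cases h1 : η ∈ Ioo a b
      · rw [G.2.2, mul_zero]
        intro h2; exact hζ ⟨by linarith [h1.1, h2.1], by linarith [h1.2, h2.2]⟩
      · rw [H.2.2 η h1, zero_mul]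
    simp [this]
  · have h1 : Integrable (fun q : ℝ × ℝ => 𝓕 h q.2 * g q.1) (volume.prod volume) := by
      have := (G.2.1.mul_prod H.F_int); simpa [mul_comm] using this
    have := h1.bdd_mul (c := 1) (f := fun q : ℝ × ℝ => ee (-(q.1 * (ζ - q.2))))
      (by
        have : Measurable fun q : ℝ × ℝ => ee (-(q.1 * (ζ - q.2))) := by fun_prop
        exact this.aestronglyMeasurable) (ae_of_all _ fun y => (ee_norm _).le)
    refine this.congr (ae_of_all _ fun q => ?_)
    simp [Function.uncurry]; ring
lemma orth (H : Band h a b) (G : Band g c d) (hh : b ≤ c ∨ d ≤ a) :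
    ∫ x, h x * (starRingEnd ℂ) (g x) = 0 := by
  have := (H.mul G.cj).2.2 0 (by
    rintro ⟨h1, h2⟩; rcases hh with hh | hh <;> linarith)
  rw [F_eq] at this; simpa [ee_zero] using this
lemma conv_eq (f : ℝ → ℂ) (K : ℝ → ℂ) : (fun x => ∫ y, f y * K (x - y)) =
    convolution f K (ContinuousLinearMap.mul ℂ ℂ) volume := by
  ext x; simp [convolution]
lemma conv_int {f : ℝ → ℂ} (hf : Integrable f) (hg : Integrable g) :
    Integrable fun x => ∫ y, f y * g (x - y) := by
  rw [conv_eq]; exact hf.integrable_convolution (ContinuousLinearMap.mul ℂ ℂ) hg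
lemma conv_F {f : ℝ → ℂ} (hf : Integrable f) (hg : Integrable g) (ζ : ℝ) :
    𝓕 (fun x => ∫ y, f y * g (x - y)) ζ = 𝓕 f ζ * 𝓕 g ζ := by
  rw [conv_eq]; exact Real.fourier_mul_convolution_eq hf hg ζ
lemma conv_cont {f : ℝ → ℂ} (hf : Integrable f) (hg : Continuous g) {C : ℝ} (hC : ∀ x, ‖g x‖ ≤ C) :
    Continuous fun x => ∫ y, f y * g (x - y) := by
  rw [conv_eq]
  exact BddAbove.continuous_convolution_right_of_integrable _ ⟨C, by rintro _ ⟨x, rfl⟩; exact hC x⟩ hf hg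
lemma conv {f : ℝ → ℂ} (hf : Integrable f) (H : Band g a b) :
    Band (fun x => ∫ y, f y * g (x - y)) a b := by
  obtain ⟨C, hC⟩ := H.bdd
  exact ⟨conv_cont hf H.1 hC, conv_int hf H.2.1, fun ζ hζ => by rw [conv_F hf H.2.1, H.2.2 ζ hζ, mul_zero]⟩
lemma eq_zero (H : Band h a a) (x : ℝ) : h x = 0 := by
  rw [H.inv]
  have : ∀ η, 𝓕 h η = 0 := fun η => H.2.2 η (by simp)
  simp [this]
lemma repr (H : Band h a b) {Φ : ℝ → ℂ} (hi : Integrable Φ) {κ : ℂ} (hκ : ∀ ζ ∈ Ioo a b, 𝓕 Φ ζ = κ) (x : ℝ) :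
    ∫ y, h y * Φ (x - y) = κ * h x := by
  obtain ⟨C, hC⟩ := H.bdd
  have e : (fun x => ∫ y, h y * Φ (x - y)) = fun x => ∫ y, Φ y * h (x - y) := by
    ext x
    have := integral_sub_left_eq_self (fun y => h y * Φ (x - y)) volume x
    rw [← this]; congr 1; ext y; simp [mul_comm]
  have hc : Continuous (fun x => ∫ y, h y * Φ (x - y)) := by rw [e]; exact conv_cont hi H.1 hC
  have B : Band (fun x => (∫ y, h y * Φ (x - y)) - κ * h x) 0 0 := by
    refine ⟨hc.sub (continuous_const.mul H.1), (conv_int H.2.1 hi).sub (H.2.1.const_mul κ), fun ζ _ => ?_⟩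
    rw [F_eq]; simp only [mul_sub]
    rw [integral_sub (integrand (conv_int H.2.1 hi) ζ) (integrand (H.2.1.const_mul κ) ζ), ← F_eq, conv_F H.2.1 hi]
    simp only [mul_left_comm _ κ]; rw [integral_const_mul, ← F_eq]
    by_cases h1 : ζ ∈ Ioo a b
    · rw [hκ ζ h1]; ring
    · rw [H.2.2 ζ h1]; ring
  exact sub_eq_zero.1 (B.eq_zero x)
lemma modul (H : Band h a b) (M : ℝ) : Band (fun x => ee (M * x) * h x) (M + a) (M + b) := by
  refine ⟨(by fun_prop : Continuous fun x => ee (M * x)).mul H.1, ?_, fun ζ hζ => ?_⟩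
  · exact H.2.1.bdd_mul (c := 1) (by fun_prop) (ae_of_all _ fun y => (ee_norm _).le)
  · have := H.2.2 (ζ - M) fun h => hζ ⟨by linarith [h.1], by linarith [h.2]⟩
    rw [F_eq] at this ⊢; rw [← this]; congr 1; ext y
    rw [← mul_assoc, ← ee_add]; congr 2; ring
lemma trans (H : Band h a b) (c : ℝ) : Band (fun x => h (x - c)) a b := by
  refine ⟨H.1.comp (continuous_id.sub continuous_const), H.2.1.comp_sub_right c, fun ζ hζ => ?_⟩
  have h1 := H.2.2 ζ hζ
  rw [F_eq] at h1 ⊢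
  rw [← integral_add_right_eq_self _ c]
  have : ∀ y, ee (-((y + c) * ζ)) * h (y + c - c) = ee (-(c * ζ)) * (ee (-(y * ζ)) * h y) := fun y => by
    rw [← mul_assoc, ← ee_add]; congr 2 <;> ring
  simp only [this]; rw [integral_const_mul, h1, mul_zero]
lemma dil (H : Band h a b) {t : ℝ} (ht : 0 < t) : Band (fun x => h (x / t)) (a / t) (b / t) := by
  refine ⟨H.1.comp (continuous_id.div_const t), H.2.1.comp_div ht.ne', fun ζ hζ => ?_⟩
  have h1 := H.2.2 (t * ζ) fun h => hζ ⟨by rw [div_lt_iff₀ ht]; linarith [h.1],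
    by rw [lt_div_iff₀ ht]; linarith [h.2]⟩
  rw [F_eq] at h1 ⊢
  have := Measure.integral_comp_div (fun y => ee (-(y * (t * ζ))) * h y) t
  rw [h1, smul_zero] at this; rw [← this]; congr 1; ext y; congr 2; field_simp
end Band
end
end Car

namespace Car
noncomputable section
open FourierTransform ComplexConjugate

lemma Band.rc {h : ℝ → ℂ} {a b : ℝ} (H : Band h a b) (x : ℝ) : Band (fun y => conj (h (x - y))) a b := by
  have h1 : Band (fun y => h (-y)) (-b) (-a) := by
    refine ⟨H.1.comp continuous_neg, H.2.1.comp_neg, fun ζ hζ => ?_⟩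
    have h1 := H.2.2 (-ζ) fun h => hζ ⟨by linarith [h.2], by linarith [h.1]⟩
    rw [F_eq] at h1 ⊢
    rw [← h1, ← integral_neg_eq_self]; simp
  have := (h1.trans x).cj
  simpa using this

/-- decay and Lipschitz decay profile -/
def Prof (g : ℝ → ℂ) (C : ℝ) : Prop := 0 < C ∧ (∀ u, ‖g u‖ ≤ C * w u ^ 3) ∧
  ∀ u v, ‖g u - g v‖ ≤ C * |u - v| * (w u ^ 3 + w v ^ 3)

lemma schw_decay (ψ : SchwartzMap ℝ ℂ) (k : ℕ) : ∃ C, 0 < C ∧ ∀ x, ‖ψ x‖ ≤ C * w x ^ k := by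
  have h := SchwartzMap.one_add_le_sup_seminorm_apply (𝕜 := ℝ) (m := (2 * k, 0)) (k := 2 * k) (n := 0)
    le_rfl le_rfl ψ
  refine ⟨2 ^ (2 * k) * ((Finset.Iic (2 * k, 0)).sup fun m => SchwartzMap.seminorm ℝ m.1 m.2) ψ + 1,
    by positivity, fun x => ?_⟩
  have h := h x
  rw [norm_iteratedFDeriv_zero, Real.norm_eq_abs] at h
  set A := 2 ^ (2 * k) * ((Finset.Iic (2 * k, 0)).sup fun m => SchwartzMap.seminorm ℝ m.1 m.2) ψ
  have h2 : (1 + x ^ 2) ^ k ≤ (1 + |x|) ^ (2 * k) := by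
    rw [pow_mul]; gcongr; nlinarith [abs_nonneg x, sq_abs x]
  have h3 : w x ^ k = ((1 + x ^ 2) ^ k)⁻¹ := by simp [w]
  rw [h3, ← div_eq_mul_inv, le_div_iff₀ (by positivity)]
  nlinarith [norm_nonneg (ψ x), mul_le_mul_of_nonneg_right h2 (norm_nonneg (ψ x))]

lemma w_near' {u v : ℝ} (k : ℕ) (h : |u - v| ≤ 1) : w u ^ k ≤ 4 ^ k * w v ^ k := by
  rw [← mul_pow]; exact pow_le_pow_left₀ (w_nn _) (w_near h) k

lemma schw_lip (ψ : SchwartzMap ℝ ℂ) (k : ℕ) : ∃ C, 0 < C ∧ (∀ x, ‖ψ x‖ ≤ C * w x ^ k) ∧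
    ∀ u v, ‖ψ u - ψ v‖ ≤ C * |u - v| * (w u ^ k + w v ^ k) := by
  obtain ⟨C1, h1, h1'⟩ := schw_decay ψ k
  obtain ⟨C2, h2, h2'⟩ := schw_decay (SchwartzMap.derivCLM ℝ ℂ ψ) k
  refine ⟨C1 + C2 * 4 ^ k, by positivity, fun x => (h1' x).trans ?_, fun u v => ?_⟩
  · have := w_nn x; gcongr; linarith [show 0 < C2 * 4 ^ k by positivity]
  have hu := pow_nonneg (w_nn u) k
  have hv := pow_nonneg (w_nn v) k
  rcases le_total |u - v| 1 with h | h
  · have := (convex_segment v u).norm_image_sub_le_of_norm_deriv_le (f := ψ) (C := C2 * (4 ^ k * w v ^ k))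
      (fun x _ => ψ.differentiable.differentiableAt) (fun x hx => ?_) (left_mem_segment ℝ v u)
      (right_mem_segment ℝ v u)
    · refine this.trans ?_
      rw [Real.norm_eq_abs]
      have a1 : 0 ≤ |u - v| * w u ^ k := by positivity
      have a2 : 0 ≤ |u - v| * w v ^ k := by positivity
      nlinarith [mul_nonneg h1.le a1, mul_nonneg h1.le a2, mul_nonneg (by positivity : 0 ≤ C2 * 4 ^ k) a1]
    · refine (h2' x).trans ?_
      gcongr
      refine w_near' k (le_trans ?_ h)
      rw [segment_eq_uIcc] at hx
      exact (abs_sub_left_of_mem_uIcc hx)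
  · refine (norm_sub_le _ _).trans ((add_le_add (h1' u) (h1' v)).trans ?_)
    have : 0 ≤ C2 * 4 ^ k := by positivity
    rw [← mul_add]; gcongr
    nlinarith

lemma prof_mul {ψ : SchwartzMap ℝ ℂ} : ∃ C, 0 < C ∧ ∀ (g : ℝ → ℂ), (∀ u, ‖g u‖ ≤ 1 + |u|) →
    (∀ u v, ‖g u - g v‖ ≤ |u - v| * (1 + |v|)) → Prof (fun u => ψ u * g u) C := by
  obtain ⟨C, hC, h1, h2⟩ := schw_lip ψ 4
  have key : ∀ u, (1 + |u|) * w u ^ 4 ≤ 2 * w u ^ 3 := fun u => by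
    have : (1 + |u|) * w u ≤ 2 := by
      unfold w; rw [← div_eq_mul_inv, div_le_iff₀ (by positivity)]; nlinarith [sq_abs u, sq_nonneg (|u| - 1)]
    calc _ = (1 + |u|) * w u * w u ^ 3 := by ring
      _ ≤ _ := by have := w_nn u; gcongr
  refine ⟨8 * C, by positivity, fun g g1 g2 => ⟨by positivity, fun u => ?_, fun u v => ?_⟩⟩
  · rw [norm_mul]
    have a := mul_le_mul (h1 u) (g1 u) (norm_nonneg _) (by have := w_nn u; positivity)
    have := key u
    have b : 0 ≤ C * w u ^ 3 := by have := w_nn u; positivity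
    nlinarith
  · have e : ψ u * g u - ψ v * g v = (ψ u - ψ v) * g u + ψ v * (g u - g v) := by ring
    have e' : ψ u * g u - ψ v * g v = (ψ u - ψ v) * g v + ψ u * (g u - g v) := by ring
    have wu := w_nn u
    have wv := w_nn v
    have ab := abs_nonneg (u - v)
    have A : ∀ u v, |u| ≤ |v| ∨ |u - v| ≤ 1 → ‖ψ u - ψ v‖ * ‖g u‖ + ‖ψ v‖ * ‖g u - g v‖ ≤ 8 * C * |u - v| * (w u ^ 3 + w v ^ 3) := fun u v huv => by
      have wu := w_nn u
      have wv := w_nn v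
      have ab := abs_nonneg (u - v)
      have k1 := key u
      have k2 := key v
      have a1 := mul_le_mul (h2 u v) (g1 u) (norm_nonneg _) (by positivity)
      have a2 := mul_le_mul (h1 v) (g2 u v) (norm_nonneg _) (by positivity)
      have k3 : (1 + |u|) * w v ^ 4 ≤ 4 * w v ^ 3 := by
        have : 1 + |u| ≤ 2 * (1 + |v|) := by
          rcases huv with h | h
          · linarith [abs_nonneg v]
          · have := abs_sub_abs_le_abs_sub u v; linarith [abs_nonneg v]
        have := mul_le_mul_of_nonneg_right this (pow_nonneg wv 4)
        linarith
      have t : 0 ≤ C * |u - v| := by positivity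
      have b1 := mul_le_mul_of_nonneg_left k1 t
      have b2 := mul_le_mul_of_nonneg_left k2 t
      have b3 := mul_le_mul_of_nonneg_left k3 t
      have b4 : 0 ≤ C * |u - v| * w u ^ 3 := by positivity
      have b5 : 0 ≤ C * |u - v| * w v ^ 3 := by positivity
      nlinarith
    rcases le_total |u| |v| with h | h
    · rw [e]
      refine (norm_add_le _ _).trans ?_
      rw [norm_mul, norm_mul]
      exact A u v (.inl h)
    · rw [e']
      refine (norm_add_le _ _).trans ?_
      rw [norm_mul, norm_mul]
      have := A v u (.inl h)
      rw [norm_sub_rev (ψ u), norm_sub_rev (g u), abs_sub_comm, add_comm (w u ^ 3)]; exact this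

/-- Packets. -/
def W (P : Tile) (φ : ℝ → ℂ) : Prop :=
  Band φ (2 * P.m * z (-P.s - 1)) ((2 * P.m + 1) * z (-P.s - 1)) ∧
  (∀ y, ‖φ y‖ ≤ (z P.s)⁻¹ * w ((y - P.c) / z P.s) ^ 3) ∧
  ∀ y y', ‖ee (-(P.m / z P.s * y)) * φ y - ee (-(P.m / z P.s * y')) * φ y'‖ ≤
    (z P.s)⁻¹ * (|y - y'| / z P.s) * (w ((y - P.c) / z P.s) ^ 3 + w ((y' - P.c) / z P.s) ^ 3)

lemma W_zero (P : Tile) : W P fun _ => 0 :=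
  ⟨Band.zero, fun y => by have := z_pos P.s; have := w_nn ((y - P.c) / z P.s); simp; positivity, fun y y' => by
    have := z_pos P.s; have := w_nn ((y - P.c) / z P.s); have := w_nn ((y' - P.c) / z P.s); simp; positivity⟩
lemma W.phase {P : Tile} {φ : ℝ → ℂ} (H : W P φ) {k : ℂ} (hk : ‖k‖ = 1) : W P fun y => k * φ y := by
  refine ⟨H.1.smul k, fun y => by rw [norm_mul, hk, one_mul]; exact H.2.1 y, fun y y' => ?_⟩
  rw [mul_left_comm, mul_left_comm _ k, ← mul_sub, norm_mul, hk, one_mul]; exact H.2.2 y y'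

def cP (f : ℝ → ℂ) (P : Tile) : ℝ := sSup {r | ∃ φ, W P φ ∧ r = ‖∫ y, f y * conj (φ y)‖}

lemma W.le {P : Tile} {φ f : ℝ → ℂ} (hf : Integrable f) (H : W P φ) :
    ‖∫ y, f y * conj (φ y)‖ ≤ cP f P := by
  refine le_csSup ⟨(∫ y, ‖f y‖) * (z P.s)⁻¹, ?_⟩ ⟨φ, H, rfl⟩
  rintro _ ⟨φ, H, rfl⟩
  rw [← integral_mul_const]
  refine norm_integral_le_of_norm_le (hf.norm.mul_const _) (ae_of_all _ fun y => ?_)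
  rw [norm_mul, RCLike.norm_conj]
  gcongr
  refine (H.2.1 y).trans ?_
  have := z_pos P.s
  exact mul_le_of_le_one_right (by positivity) (pow_le_one₀ (w_nn _) (w_le_one _))
lemma cP_nn (f : ℝ → ℂ) (P : Tile) : 0 ≤ cP f P := Real.sSup_nonneg (by rintro _ ⟨φ, H, rfl⟩; positivity)
lemma cP_ex (f : ℝ → ℂ) (P : Tile) : ∃ φ, W P φ ∧ ∃ r : ℝ, ∫ y, f y * conj (φ y) = r ∧ cP f P ≤ 2 * r := by
  rcases (cP_nn f P).eq_or_lt with h | h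
  · exact ⟨_, W_zero P, 0, by simp, by simp [← h]⟩
  have h0 : cP f P / 2 < cP f P := by linarith
  obtain ⟨_, ⟨φ, H, rfl⟩, h2⟩ := exists_lt_of_lt_csSup (show Set.Nonempty {r | ∃ φ, W P φ ∧ r = ‖∫ y, f y * conj (φ y)‖} from ⟨_, _, W_zero P, rfl⟩) h0
  set I := ∫ y, f y * conj (φ y) with hI
  have hn : 0 < ‖I‖ := by linarith
  refine ⟨fun y => (I / ‖I‖) * φ y, H.phase (by rw [norm_div, Complex.norm_real, norm_norm, div_self hn.ne']), ‖I‖, ?_, by linarith⟩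
  have : ∀ y, f y * conj ((I / ‖I‖) * φ y) = conj (I / ‖I‖) * (f y * conj (φ y)) := fun y => by
    rw [map_mul]; ring
  simp only [this]
  rw [integral_const_mul, ← hI, map_div₀, Complex.conj_ofReal, div_mul_eq_mul_div, ← Complex.normSq_eq_conj_mul_self,
    Complex.normSq_eq_norm_sq]
  have : (‖I‖ : ℂ) ≠ 0 := by exact_mod_cast hn.ne'
  push_cast; field_simp

lemma W_prof {g : ℝ → ℂ} {C : ℝ} (hg : Prof g C) (hB : Band g 0 (1/2)) (P : Tile) (x : ℝ) :
    W P fun y => ((8 * C)⁻¹ * w ((x - P.c) / z P.s) ^ 3 : ℝ) *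
      conj ((fun t => ee (P.m / z P.s * t) * ((z P.s)⁻¹ * g (t / z P.s))) (x - y)) := by
  obtain ⟨hC, g1, g2⟩ := hg
  have hz := z_pos P.s
  have key : ∀ y, w ((x - P.c) / z P.s) ^ 3 * w ((x - y) / z P.s) ^ 3 ≤ 8 * w ((y - P.c) / z P.s) ^ 3 := fun y => by
    have := w_peetre ((x - P.c) / z P.s) (-((x - y) / z P.s))
    rw [w_neg] at this
    calc _ = (w ((x - P.c) / z P.s) * w ((x - y) / z P.s)) ^ 3 := by ring
      _ ≤ (2 * w ((x - P.c) / z P.s + -((x - y) / z P.s))) ^ 3 :=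
        pow_le_pow_left₀ (mul_nonneg (w_nn _) (w_nn _)) this 3
      _ = _ := by rw [mul_pow]; norm_num; congr 1; ring
  have wx := w_nn ((x - P.c) / z P.s)
  refine ⟨?_, fun y => ?_, fun y y' => ?_⟩
  · have h1 := ((hB.dil hz).smul ((z P.s)⁻¹ : ℝ)).modul (P.m / z P.s)
    refine ((h1.rc x).smul _).mono (le_of_eq ?_) (le_of_eq ?_) <;> rw [z_sub, z_neg, z_one] <;> field_simp <;> ring
  · have wy := w_nn ((x - y) / z P.s)
    rw [norm_mul, RCLike.norm_conj, norm_mul, ee_norm, norm_mul, one_mul, Complex.norm_real, Complex.norm_real, Real.norm_of_nonneg (by positivity), Real.norm_of_nonneg (by positivity)]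
    calc _ ≤ (8 * C)⁻¹ * w ((x - P.c) / z P.s) ^ 3 * ((z P.s)⁻¹ * (C * w ((x - y) / z P.s) ^ 3)) := by gcongr; exact g1 _
      _ = 8⁻¹ * (z P.s)⁻¹ * (w ((x - P.c) / z P.s) ^ 3 * w ((x - y) / z P.s) ^ 3) := by field_simp
      _ ≤ 8⁻¹ * (z P.s)⁻¹ * (8 * w ((y - P.c) / z P.s) ^ 3) := mul_le_mul_of_nonneg_left (key y) (by positivity)
      _ = _ := by ring
  · have wy := w_nn ((x - y) / z P.s)
    have wy' := w_nn ((x - y') / z P.s)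
    have e1 : ∀ y, ee (-(P.m / z P.s * y)) * (((8 * C)⁻¹ * w ((x - P.c) / z P.s) ^ 3 : ℝ) *
      conj (ee (P.m / z P.s * (x - y)) * ((z P.s)⁻¹ * g ((x - y) / z P.s)))) =
      ee (-(P.m / z P.s * x)) * ((z P.s)⁻¹ * ((8 * C)⁻¹ * w ((x - P.c) / z P.s) ^ 3 : ℝ)) * conj (g ((x - y) / z P.s)) := fun y => by
      rw [show -(P.m / z P.s * x) = -(P.m / z P.s * y) + -(P.m / z P.s * (x - y)) by ring, ee_add]
      simp only [map_mul, ee_conj, Complex.conj_ofReal]; ring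
    rw [e1, e1, ← mul_sub, ← map_sub]
    rw [norm_mul, RCLike.norm_conj, norm_mul, ee_norm, norm_mul, one_mul, Complex.norm_real, Complex.norm_real, Real.norm_of_nonneg (by positivity), Real.norm_of_nonneg (by positivity)]
    have e2 : |(x - y) / z P.s - (x - y') / z P.s| = |y - y'| / z P.s := by
      rw [← sub_div, abs_div, abs_of_pos hz, abs_sub_comm]; congr 2; ring
    have g3 := g2 ((x - y) / z P.s) ((x - y') / z P.s)
    rw [e2] at g3
    calc _ ≤ (z P.s)⁻¹ * ((8 * C)⁻¹ * w ((x - P.c) / z P.s) ^ 3) * (C * (|y - y'| / z P.s) * (w ((x - y) / z P.s) ^ 3 + w ((x - y') / z P.s) ^ 3)) := by gcongr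
      _ = 8⁻¹ * (z P.s)⁻¹ * (|y - y'| / z P.s) * (w ((x - P.c) / z P.s) ^ 3 * w ((x - y) / z P.s) ^ 3 + w ((x - P.c) / z P.s) ^ 3 * w ((x - y') / z P.s) ^ 3) := by field_simp
      _ ≤ 8⁻¹ * (z P.s)⁻¹ * (|y - y'| / z P.s) * (8 * w ((y - P.c) / z P.s) ^ 3 + 8 * w ((y' - P.c) / z P.s) ^ 3) :=
          mul_le_mul_of_nonneg_left (add_le_add (key y) (key y')) (by positivity)
      _ = _ := by ring

/-- The scale-`s` piece. -/
def aa (ψ : ℝ → ℂ) (f : ℝ → ℂ) (s : ℤ) (M x : ℝ) : ℂ :=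
  ∫ y, f y * (ee (M * (x - y)) * ((z s)⁻¹ * ψ ((x - y) / z s)))

lemma prof_le {g f : ℝ → ℂ} {C : ℝ} (hf : Integrable f) (hg : Prof g C) (hB : Band g 0 (1/2)) (P : Tile) (x : ℝ) :
    ‖aa g f P.s (P.m / z P.s) x‖ ≤ 8 * C * cP f P * (w ((x - P.c) / z P.s) ^ 3)⁻¹ := by
  have h := (W_prof hg hB P x).le hf
  have hC := hg.1
  have hw := w_pos ((x - P.c) / z P.s)
  have e : ∀ y, f y * conj (((8 * C)⁻¹ * w ((x - P.c) / z P.s) ^ 3 : ℝ) *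
      conj ((fun t => ee (P.m / z P.s * t) * ((z P.s)⁻¹ * g (t / z P.s))) (x - y)))
      = ((8 * C)⁻¹ * w ((x - P.c) / z P.s) ^ 3 : ℝ) * (f y * (ee (P.m / z P.s * (x - y)) * ((z P.s)⁻¹ * g ((x - y) / z P.s)))) := fun y => by
    simp only [map_mul (starRingEnd ℂ), Complex.conj_conj, Complex.conj_ofReal]; ring
  simp only [e] at h
  rw [integral_const_mul, norm_mul, Complex.norm_real, Real.norm_of_nonneg (by positivity)] at h
  rw [← div_eq_mul_inv, le_div_iff₀ (by positivity)]
  have : aa g f P.s (P.m / z P.s) x = ∫ y, f y * (ee (P.m / z P.s * (x - y)) * ((z P.s)⁻¹ * g ((x - y) / z P.s))) := rfl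
  rw [this]; generalize (∫ y, f y * (ee (P.m / z P.s * (x - y)) * ((z P.s)⁻¹ * g ((x - y) / z P.s)))) = J at h ⊢
  calc _ = 8 * C * ((8 * C)⁻¹ * w ((x - P.c) / z P.s) ^ 3 * ‖J‖) := by field_simp
    _ ≤ _ := by gcongr

lemma mem_om2 {P : Tile} {M : ℝ} (h : M ∈ P.om2) : 1 / 2 ≤ M * z P.s - P.m ∧ M * z P.s - P.m ≤ 9 / 16 := by
  have hz := z_pos P.s
  obtain ⟨h1, h2⟩ := h
  have e : z (-P.s - 4) = (z P.s)⁻¹ / 16 := by rw [z_sub, z_neg, show (4:ℤ) = (4:ℕ) by rfl, z_nat]; norm_num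
  rw [e] at h1 h2; push_cast at h1 h2
  have h2 := h2.le
  rw [div_eq_inv_mul, mul_left_comm, ← div_eq_inv_mul, ← div_eq_mul_inv] at h1 h2
  field_simp at h1 h2
  constructor <;> linarith

lemma aa_shift (ψ f : ℝ → ℂ) (P : Tile) (M x : ℝ) : aa ψ f P.s M x =
    aa (fun u => ψ u * ee ((M * z P.s - P.m) * u)) f P.s (P.m / z P.s) x := by
  unfold aa; congr 1; ext y
  have hz := z_pos P.s
  rw [show M * (x - y) = P.m / z P.s * (x - y) + (M * z P.s - P.m) * ((x - y) / z P.s) by field_simp; ring, ee_add]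
  ring

lemma aa_int {ψ f : ℝ → ℂ} (hf : Integrable f) (hc : Continuous ψ) {C : ℝ} (hC : ∀ u, ‖ψ u‖ ≤ C) (s : ℤ) (M x : ℝ) :
    Integrable fun y => f y * (ee (M * (x - y)) * ((z s)⁻¹ * ψ ((x - y) / z s))) := by
  refine hf.mul_bdd (c := (z s)⁻¹ * C) (by fun_prop) (ae_of_all _ fun y => ?_)
  have hz := z_pos s
  rw [norm_mul, ee_norm, one_mul, norm_mul, Complex.norm_real, Real.norm_of_nonneg (by positivity)]
  gcongr; exact hC _

lemma aa_le {ψ : SchwartzMap ℝ ℂ} (hψ : Band ψ (-(7/16)) (-(1/16))) : ∃ C, 0 < C ∧ ∀ f : ℝ → ℂ, Integrable f →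
    ∀ (P : Tile) (M x : ℝ), M ∈ P.om2 → ‖aa ψ f P.s M x‖ ≤ C * cP f P * (w ((x - P.c) / z P.s) ^ 3)⁻¹ ∧
    ∀ M' ∈ P.om2, ‖aa ψ f P.s M x - aa ψ f P.s M' x‖ ≤ C * cP f P * (w ((x - P.c) / z P.s) ^ 3)⁻¹ * (z P.s * |M - M'|) := by
  obtain ⟨C, hC, H⟩ := prof_mul (ψ := ψ)
  refine ⟨224 * C, by positivity, fun f hf P M x hM => ?_⟩
  have hz := z_pos P.s
  have wx := w_pos ((x - P.c) / z P.s)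
  have cc := cP_nn f P
  have bnd : ∀ M, M ∈ P.om2 → Band (fun u => ψ u * ee ((M * z P.s - P.m) * u)) 0 (1/2) := fun M hM => by
    have := hψ.modul (M * z P.s - P.m)
    simp only [mul_comm (ψ _)]
    have := mem_om2 hM
    exact (hψ.modul _).mono (by linarith) (by linarith)
  constructor
  · rw [aa_shift]
    refine (prof_le (g := fun u => ψ u * ee ((M * z P.s - P.m) * u)) (C := 28 * C) hf ?_ (bnd M hM) P x).trans (le_of_eq (by ring))
    have h7 := H (fun u => (1/28 : ℝ) * ee ((M * z P.s - P.m) * u)) (fun u => ?_) (fun u v => ?_)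
    · refine ⟨by positivity, fun u => ?_, fun u v => ?_⟩
      · have := h7.2.1 u
        beta_reduce at this
        rw [mul_left_comm, norm_mul, Complex.norm_real] at this; norm_num at this ⊢
        linarith
      · have := h7.2.2 u v
        beta_reduce at this ⊢
        rw [mul_left_comm, mul_left_comm (ψ v), ← mul_sub, norm_mul, Complex.norm_real] at this; norm_num at this ⊢
        linarith
    · rw [norm_mul, ee_norm, Complex.norm_real]; norm_num; linarith [abs_nonneg u]
    · rw [← mul_sub, norm_mul, Complex.norm_real]
      have := ee_sub ((M * z P.s - P.m) * u) ((M * z P.s - P.m) * v)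
      rw [← mul_sub, abs_mul] at this
      have h2 := mem_om2 hM
      have h3 : |M * z P.s - P.m| ≤ 1 := abs_le.2 ⟨by linarith, by linarith⟩
      norm_num
      have h4 := mul_le_mul_of_nonneg_right h3 (abs_nonneg (u - v))
      nlinarith [mul_nonneg (abs_nonneg (u - v)) (abs_nonneg v), abs_nonneg (u - v)]
  · intro M' hM'
    by_cases hne : M = M'
    · simp [hne]
    set a := M * z P.s - P.m with ha
    set b := M' * z P.s - P.m with hb
    have hab : a - b = z P.s * (M - M') := by rw [ha, hb]; ring
    have hab0 : a - b ≠ 0 := by rw [hab]; exact mul_ne_zero hz.ne' (sub_ne_zero.2 hne)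
    set q : ℝ → ℂ := fun u => ψ u * ((28 * (a - b) : ℝ)⁻¹ * (ee (a * u) - ee (b * u))) with hq
    obtain ⟨hm1, hm2⟩ := mem_om2 hM
    obtain ⟨hn1, hn2⟩ := mem_om2 hM'
    rw [← ha] at hm1 hm2; rw [← hb] at hn1 hn2
    have e : aa ψ f P.s M x - aa ψ f P.s M' x = (28 * (a - b) : ℝ) * aa q f P.s (P.m / z P.s) x := by
      rw [aa_shift, aa_shift ψ f P M', ← ha, ← hb]
      unfold aa
      rw [← integral_const_mul, ← integral_sub]
      · congr 1; ext y
        have : ((28 * (a - b) : ℝ) : ℂ) ≠ 0 := by exact_mod_cast (mul_ne_zero (by norm_num) hab0)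
        simp only [hq, Complex.ofReal_inv]
        generalize ee (a * _) = A; generalize ee (b * _) = B
        field_simp
      · obtain ⟨K, hK⟩ := (bnd M hM).bdd
        exact aa_int hf (bnd M hM).1 hK _ _ _
      · obtain ⟨K, hK⟩ := (bnd M' hM').bdd
        exact aa_int hf (bnd M' hM').1 hK _ _ _
    have hP : Prof q C := by
      have lin : ∀ u, ‖ee (a * u) - ee (b * u)‖ ≤ 7 * |a - b| * |u| := fun u => by
        have := ee_sub (a * u) (b * u); rwa [← sub_mul, abs_mul, ← mul_assoc] at this
      have hp : 0 < |a - b| := abs_pos.2 hab0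
      refine H _ (fun u => ?_) (fun u v => ?_)
      · rw [norm_mul, Complex.norm_real, Real.norm_eq_abs, abs_inv, abs_mul, abs_of_pos (by norm_num : (0:ℝ) < 28), inv_mul_le_iff₀ (by positivity)]
        nlinarith [lin u, abs_nonneg u, mul_nonneg hp.le (abs_nonneg u)]
      · have e3 : ee (a * u) - ee (b * u) - (ee (a * v) - ee (b * v)) =
            ee (b * u) * (ee ((a - b) * u) - ee ((a - b) * v)) + (ee (b * u) - ee (b * v)) * (ee ((a - b) * v) - 1) := by
          have h1 : ee (a * u) = ee (b * u) * ee ((a - b) * u) := by rw [← ee_add]; congr 1; ring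
          have h2 : ee (a * v) = ee (b * v) * ee ((a - b) * v) := by rw [← ee_add]; congr 1; ring
          rw [h1, h2]; ring
        rw [← mul_sub, e3, norm_mul, Complex.norm_real, Real.norm_eq_abs, abs_inv, abs_mul, abs_of_pos (by norm_num : (0:ℝ) < 28), inv_mul_le_iff₀ (by positivity)]
        refine (norm_add_le _ _).trans ?_
        rw [norm_mul, ee_norm, one_mul, norm_mul]
        have q1 := ee_sub ((a - b) * u) ((a - b) * v)
        have q2 := ee_one_sub ((a - b) * v)
        rw [← mul_sub, abs_mul] at q1; rw [abs_mul] at q2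
        have q3 : ‖ee (b * u) - ee (b * v)‖ ≤ 2 := (norm_sub_le _ _).trans (by simp [ee_norm]; norm_num)
        have q3' := ee_sub (b * u) (b * v)
        rw [← mul_sub, abs_mul, abs_of_pos (by linarith : (0:ℝ) < b)] at q3'
        have q2' : ‖ee ((a - b) * v) - 1‖ ≤ |a - b| * 7 * |v| := by linarith
        have q4 := mul_le_mul q3' q2' (norm_nonneg _) (by have := hn1; positivity)
        have q5 : 0 ≤ |a - b| * |u - v| := by positivity
        have q6 : 0 ≤ |a - b| * |u - v| * |v| := by positivity
        have q7 := mul_le_mul_of_nonneg_right hn2 q6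
        linarith
    rw [e, norm_mul, Complex.norm_real, Real.norm_eq_abs]
    have hBq : Band q 0 (1/2) := by
      have := ((bnd M hM).sub (bnd M' hM')).smul ((28 * (a - b) : ℝ)⁻¹)
      convert this using 2 with u; simp only [hq, ← ha, ← hb, Complex.ofReal_inv]; ring
    have := prof_le hf hP hBq P x
    rw [hab, abs_mul, abs_mul, abs_of_pos hz, abs_of_pos (by norm_num : (0:ℝ) < 28)]
    calc _ ≤ 28 * (z P.s * |M - M'|) * (8 * C * cP f P * (w ((x - P.c) / z P.s) ^ 3)⁻¹) := by gcongr
      _ = _ := by ring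
end
end Car

namespace Car
noncomputable section
open FourierTransform ComplexConjugate

lemma tile_sum (𝒬 : Finset Tile) {s m : ℤ} (x : ℝ) (h : ∀ P ∈ 𝒬, P.s = s ∧ P.m = m) :
    ∑ P ∈ 𝒬, w ((x - P.c) / z P.s) ≤ 13 := by
  classical
  have e : ∑ P ∈ 𝒬, w ((x - P.c) / z P.s) = ∑ n ∈ 𝒬.image Tile.n, w ((x - ctr s n) / z s) := by
    rw [Finset.sum_image]
    · refine Finset.sum_congr rfl fun P hP => ?_
      rw [Tile.c, (h P hP).1]
    · intro P hP Q hQ hn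
      exact Tile.ext ((h P hP).1.trans (h Q hQ).1.symm) hn ((h P hP).2.trans (h Q hQ).2.symm)
  rw [e]; exact w_sum_ctr _ _ _

lemma w_sq_le (u : ℝ) : w u ^ 2 ≤ w u := by nlinarith [w_nn u, w_le_one u]

lemma W_corr {P Q : Tile} {φ χ : ℝ → ℂ} (hφ : W P φ) (hχ : W Q χ) (hs : Q.s ≤ P.s) :
    ‖∫ y, φ y * conj (χ y)‖ ≤ 13 * (z P.s)⁻¹ * w ((P.c - Q.c) / z P.s) ^ 2 := by
  have hz := z_pos P.s
  have hz' := z_pos Q.s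
  have hw := w_nn ((P.c - Q.c) / z P.s)
  have : ∀ y, ‖φ y * conj (χ y)‖ ≤ 4 * (z P.s)⁻¹ * w ((P.c - Q.c) / z P.s) ^ 2 * (z Q.s)⁻¹ * w ((y - Q.c) / z Q.s) := fun y => by
    rw [norm_mul, RCLike.norm_conj]
    have w1 := w_nn ((y - P.c) / z P.s)
    have w2 := w_nn ((y - Q.c) / z Q.s)
    have w3 : w ((y - Q.c) / z Q.s) ≤ w ((y - Q.c) / z P.s) := by
      apply w_anti; rw [abs_div, abs_div, abs_of_pos hz, abs_of_pos hz']
      have := z_mono hs; gcongr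
    have w4 := w_peetre (-((y - P.c) / z P.s)) ((y - Q.c) / z P.s)
    rw [w_neg, show -((y - P.c) / z P.s) + (y - Q.c) / z P.s = (P.c - Q.c) / z P.s by ring] at w4
    have w5 : w ((y - P.c) / z P.s) ^ 3 ≤ w ((y - P.c) / z P.s) ^ 2 :=
      pow_le_pow_of_le_one w1 (w_le_one _) (by norm_num)
    calc _ ≤ ((z P.s)⁻¹ * w ((y - P.c) / z P.s) ^ 3) * ((z Q.s)⁻¹ * w ((y - Q.c) / z Q.s) ^ 3) := by
          have := hφ.2.1 y; have := hχ.2.1 y; gcongr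
      _ ≤ ((z P.s)⁻¹ * w ((y - P.c) / z P.s) ^ 2) * ((z Q.s)⁻¹ * (w ((y - Q.c) / z P.s) ^ 2 * w ((y - Q.c) / z Q.s))) := by
          rw [pow_succ (w ((y - Q.c) / z Q.s)) 2]; gcongr
      _ = (w ((y - P.c) / z P.s) * w ((y - Q.c) / z P.s)) ^ 2 * ((z P.s)⁻¹ * (z Q.s)⁻¹ * w ((y - Q.c) / z Q.s)) := by ring
      _ ≤ (2 * w ((P.c - Q.c) / z P.s)) ^ 2 * ((z P.s)⁻¹ * (z Q.s)⁻¹ * w ((y - Q.c) / z Q.s)) := by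
          gcongr; exact mul_nonneg w1 (w_nn _)
      _ = _ := by ring
  refine (norm_integral_le_of_norm_le ((w_int' hz' Q.c).const_mul _) (ae_of_all _ this)).trans ?_
  rw [integral_const_mul, w_integral hz']
  have h1 : 4 * (z P.s)⁻¹ * w ((P.c - Q.c) / z P.s) ^ 2 * (z Q.s)⁻¹ * (z Q.s * Real.pi) = (4 * Real.pi) * ((z P.s)⁻¹ * w ((P.c - Q.c) / z P.s) ^ 2) := by
    field_simp
  rw [h1, mul_assoc 13]
  have := Real.pi_lt_d2
  gcongr; linarith

/-- off-diagonal relation -/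
def Off (P Q : Tile) : Prop := Q.s < P.s ∧ P.om ⊆ Q.om1

lemma W_orth {P Q : Tile} {φ χ : ℝ → ℂ} (hφ : W P φ) (hχ : W Q χ)
    (h : ¬ (P.om1 ∩ Q.om1).Nonempty) : ∫ y, φ y * conj (χ y) = 0 := by
  refine Band.orth hφ.1 hχ.1 ?_
  by_contra! hh
  obtain ⟨h1, h2⟩ := hh
  apply h
  refine ⟨max (2 * P.m * z (-P.s - 1)) (2 * Q.m * z (-Q.s - 1)), ?_, ?_⟩ <;>
  simp only [Tile.om1, D, mem_Ico] <;> push_cast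
  · exact ⟨le_max_left _ _, max_lt (by have := z_pos (-P.s - 1); nlinarith) h1⟩
  · exact ⟨le_max_right _ _, max_lt h2 (by have := z_pos (-Q.s - 1); nlinarith)⟩

lemma gram (𝒬 : Finset Tile) (φ : Tile → ℝ → ℂ) (hφ : ∀ P ∈ 𝒬, W P (φ P)) (c : Tile → ℝ) (hc : ∀ P, 0 ≤ c P) :
    open Classical in Integrable (fun y => ‖∑ P ∈ 𝒬, (z P.s * c P : ℝ) * φ P y‖ ^ 2) ∧ ∫ y, ‖∑ P ∈ 𝒬, (z P.s * c P : ℝ) * φ P y‖ ^ 2 ≤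
      169 * ∑ P ∈ 𝒬, z P.s * c P ^ 2 + 26 * ∑ P ∈ 𝒬, ∑ Q ∈ 𝒬 with Off P Q, z Q.s * c P * c Q * w ((P.c - Q.c) / z P.s) ^ 2 := by
  classical
  set a : Tile → ℝ := fun P => z P.s * c P with ha
  have a0 : ∀ P, 0 ≤ a P := fun P => mul_nonneg (z_nn _) (hc P)
  set G : ℝ → ℂ := fun y => ∑ P ∈ 𝒬, (a P : ℂ) * φ P y with hG
  set K : Tile → Tile → ℝ := fun P Q => 13 * (z P.s)⁻¹ * w ((P.c - Q.c) / z P.s) ^ 2 with hK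
  have K0 : ∀ P Q, 0 ≤ K P Q := fun P Q => by
    have := z_pos P.s; have := w_nn ((P.c - Q.c) / z P.s); positivity
  have int : ∀ P ∈ 𝒬, ∀ Q ∈ 𝒬, Integrable fun y => φ P y * conj (φ Q y) := fun P hP Q hQ =>
    ((hφ P hP).1.mul (hφ Q hQ).1.cj).2.1
  have e0 : ∀ y, ((‖G y‖ ^ 2 : ℝ) : ℂ) = ∑ P ∈ 𝒬, ∑ Q ∈ 𝒬, ((a P * a Q : ℝ) : ℂ) * (φ P y * conj (φ Q y)) := fun y => by
    rw [← Complex.normSq_eq_norm_sq, ← Complex.mul_conj, hG, map_sum, Finset.sum_mul_sum]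
    refine Finset.sum_congr rfl fun P _ => Finset.sum_congr rfl fun Q _ => ?_
    rw [map_mul, Complex.conj_ofReal]; push_cast; ring
  have iG : Integrable fun y => ((‖G y‖ ^ 2 : ℝ) : ℂ) := by
    simp only [e0]
    exact integrable_finsetSum _ fun P hP => integrable_finsetSum _ fun Q hQ => (int P hP Q hQ).const_mul _
  refine ⟨by have h9 : Integrable (fun y => ‖G y‖ ^ 2) := iG.re
             exact h9, ?_⟩
  have e1 : ((∫ y, ‖G y‖ ^ 2 : ℝ) : ℂ) = ∑ P ∈ 𝒬, ∑ Q ∈ 𝒬, ((a P * a Q : ℝ) : ℂ) * ∫ y, φ P y * conj (φ Q y) := by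
    rw [← integral_complex_ofReal]; simp only [e0]
    rw [integral_finsetSum _ fun P hP => integrable_finsetSum _ fun Q hQ => (int P hP Q hQ).const_mul _]
    refine Finset.sum_congr rfl fun P hP => ?_
    rw [integral_finsetSum _ fun Q hQ => (int P hP Q hQ).const_mul _]
    exact Finset.sum_congr rfl fun Q hQ => integral_const_mul _ _
  have e2 : ∫ y, ‖G y‖ ^ 2 ≤ ∑ P ∈ 𝒬, ∑ Q ∈ 𝒬, a P * a Q * ((if Off P Q then K P Q else 0) +
      (if Off Q P then K Q P else 0) + if P.s = Q.s ∧ P.m = Q.m then K P Q else 0) := by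
    have : ∫ y, ‖G y‖ ^ 2 ≤ ‖((∫ y, ‖G y‖ ^ 2 : ℝ) : ℂ)‖ := by
      rw [Complex.norm_real]; exact Real.le_norm_self _
    refine this.trans ?_
    rw [e1]
    refine (norm_sum_le _ _).trans (Finset.sum_le_sum fun P hP => (norm_sum_le _ _).trans (Finset.sum_le_sum fun Q hQ => ?_))
    rw [norm_mul, Complex.norm_real, Real.norm_of_nonneg (mul_nonneg (a0 P) (a0 Q))]
    refine mul_le_mul_of_nonneg_left ?_ (mul_nonneg (a0 P) (a0 Q))
    have p1 : 0 ≤ (if Off P Q then K P Q else 0) := by split_ifs; exacts [K0 _ _, le_rfl]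
    have p2 : 0 ≤ (if Off Q P then K Q P else 0) := by split_ifs; exacts [K0 _ _, le_rfl]
    have p3 : 0 ≤ (if P.s = Q.s ∧ P.m = Q.m then K P Q else 0) := by split_ifs; exacts [K0 _ _, le_rfl]
    by_cases hne : (P.om1 ∩ Q.om1).Nonempty
    · obtain ⟨x, hx, hx'⟩ := hne
      rcases lt_trichotomy P.s Q.s with h | h | h
      · have h1 : Off Q P := ⟨h, om_sub_om1 h (om1_sub _ hx') hx⟩
        rw [if_pos h1]
        have := W_corr (hφ Q hQ) (hφ P hP) h.le
        have e : ‖∫ y, φ P y * conj (φ Q y)‖ = ‖∫ y, φ Q y * conj (φ P y)‖ := by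
          rw [← RCLike.norm_conj, ← integral_conj]; simp [mul_comm]
        rw [e]; linarith
      · have h1 : P.m = Q.m := by
          have h1 := mem_D.1 (om1_sub _ hx)
          have h2 := mem_D.1 (om1_sub _ hx'); rw [h] at h1; omega
        rw [if_pos (⟨h, h1⟩ : P.s = Q.s ∧ P.m = Q.m)]
        linarith [W_corr (hφ P hP) (hφ Q hQ) h.ge]
      · have h1 : Off P Q := ⟨h, om_sub_om1 h (om1_sub _ hx) hx'⟩
        rw [if_pos h1]
        linarith [W_corr (hφ P hP) (hφ Q hQ) h.le]
    · rw [W_orth (hφ P hP) (hφ Q hQ) hne, norm_zero]; linarith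
  refine e2.trans ?_
  simp only [mul_add, Finset.sum_add_distrib]
  have s2 : ∑ P ∈ 𝒬, ∑ Q ∈ 𝒬, a P * a Q * (if Off Q P then K Q P else 0) = ∑ P ∈ 𝒬, ∑ Q ∈ 𝒬, a P * a Q * (if Off P Q then K P Q else 0) := by
    rw [Finset.sum_comm]
    exact Finset.sum_congr rfl fun P _ => Finset.sum_congr rfl fun Q _ => by rw [mul_comm (a Q)]
  have s1 : ∑ P ∈ 𝒬, ∑ Q ∈ 𝒬, a P * a Q * (if Off P Q then K P Q else 0) =
      13 * ∑ P ∈ 𝒬, ∑ Q ∈ 𝒬 with Off P Q, z Q.s * c P * c Q * w ((P.c - Q.c) / z P.s) ^ 2 := by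
    simp only [Finset.mul_sum, Finset.sum_filter]
    refine Finset.sum_congr rfl fun P _ => Finset.sum_congr rfl fun Q _ => ?_
    have := z_ne P.s
    split_ifs
    · simp only [ha, hK]; field_simp
    · simp
  have s3 : ∑ P ∈ 𝒬, ∑ Q ∈ 𝒬, a P * a Q * (if P.s = Q.s ∧ P.m = Q.m then K P Q else 0) ≤ 169 * ∑ P ∈ 𝒬, z P.s * c P ^ 2 := by
    set Dg : Tile → Tile → ℝ := fun P Q => if P.s = Q.s ∧ P.m = Q.m then K P Q else 0 with hD
    have D0 : ∀ P Q, 0 ≤ Dg P Q := fun P Q => by simp only [hD]; split_ifs; exacts [K0 _ _, le_rfl]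
    have Ds : ∀ P Q, Dg P Q = Dg Q P := fun P Q => by
      simp only [hD, hK]
      by_cases h : P.s = Q.s ∧ P.m = Q.m
      · rw [if_pos h, if_pos ⟨h.1.symm, h.2.symm⟩, h.1, ← w_neg]; congr 3; ring
      · rw [if_neg h, if_neg fun h' => h ⟨h'.1.symm, h'.2.symm⟩]
    have b1 : ∑ P ∈ 𝒬, ∑ Q ∈ 𝒬, a P * a Q * Dg P Q ≤ ∑ P ∈ 𝒬, ∑ Q ∈ 𝒬, a P ^ 2 * Dg P Q := by
      have b2 : ∑ P ∈ 𝒬, ∑ Q ∈ 𝒬, a Q ^ 2 * Dg P Q = ∑ P ∈ 𝒬, ∑ Q ∈ 𝒬, a P ^ 2 * Dg P Q := by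
        rw [Finset.sum_comm]
        exact Finset.sum_congr rfl fun P _ => Finset.sum_congr rfl fun Q _ => by rw [Ds Q P]
      have b3 : 2 * ∑ P ∈ 𝒬, ∑ Q ∈ 𝒬, a P * a Q * Dg P Q ≤ ∑ P ∈ 𝒬, ∑ Q ∈ 𝒬, a P ^ 2 * Dg P Q + ∑ P ∈ 𝒬, ∑ Q ∈ 𝒬, a Q ^ 2 * Dg P Q := by
        simp only [Finset.mul_sum, ← Finset.sum_add_distrib]
        refine Finset.sum_le_sum fun P _ => Finset.sum_le_sum fun Q _ => ?_
        nlinarith [mul_nonneg (sq_nonneg (a P - a Q)) (D0 P Q)]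
      linarith
    refine b1.trans ?_
    rw [Finset.mul_sum]
    refine Finset.sum_le_sum fun P _ => ?_
    rw [← Finset.mul_sum, ← Finset.sum_filter]
    have hz := z_pos P.s
    have t1 : ∑ Q ∈ 𝒬 with P.s = Q.s ∧ P.m = Q.m, K P Q ≤ 13 * (z P.s)⁻¹ * 13 := by
      refine le_trans (Finset.sum_le_sum (g := fun Q => 13 * (z P.s)⁻¹ * w ((P.c - Q.c) / z Q.s)) fun Q hQ => ?_) ?_
      · rw [Finset.mem_filter] at hQ
        simp only [hK]; rw [← hQ.2.1]; gcongr; exact w_sq_le _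
      · rw [← Finset.mul_sum]; gcongr
        exact tile_sum _ (s := P.s) (m := P.m) _ fun Q hQ => by
          rw [Finset.mem_filter] at hQ; exact ⟨hQ.2.1.symm, hQ.2.2.symm⟩
    calc _ ≤ a P ^ 2 * (13 * (z P.s)⁻¹ * 13) := by gcongr
      _ = _ := by simp only [ha]; field_simp; ring
  rw [s2, s1]; linarith
end
end Car

namespace Car
noncomputable section
open FourierTransform ComplexConjugate
open scoped Classical

lemma z_sum (S : Finset ℤ) {t : ℤ} (h : ∀ s ∈ S, s ≤ t) : ∑ s ∈ S, z s ≤ 2 * z t := by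
  have key : ∀ k : ℕ, ∑ i ∈ Finset.range k, z (t - i) ≤ 2 * z t - z (t - k + 1) := by
    intro k
    induction k with
    | zero => simp [z_succ]
    | succ k ih =>
      rw [Finset.sum_range_succ]
      have := z_succ (t - k); push_cast
      rw [show t - (k + 1 : ℤ) + 1 = t - k by ring]; linarith
  obtain ⟨k, hk⟩ : ∃ k : ℕ, ∀ s ∈ S, t - k < s := by
    refine ⟨∑ s ∈ S, (t - s).toNat + 1, fun s hs => ?_⟩
    have := Finset.single_le_sum (f := fun s => (t - s).toNat) (fun _ _ => Nat.zero_le _) hs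
    have := h s hs; push_cast [-Nat.cast_sum] at *; omega
  refine le_trans ?_ ((key k).trans (by linarith [z_pos (t - k + 1)]))
  rw [← Finset.sum_image (f := z) (g := fun i : ℕ => t - i) (by intro a _ b _ h; simpa using h)]
  refine Finset.sum_le_sum_of_subset_of_nonneg (fun s hs => ?_) fun _ _ _ => z_nn _
  rw [Finset.mem_image]
  exact ⟨(t - s).toNat, by rw [Finset.mem_range]; have := hk s hs; have := h s hs; omega, by have := h s hs; omega⟩

/-- tops of trees -/
structure Top where
  s : ℤ
  n : ℤ
  ξ : ℝ

def Top.J (t : Top) : Set ℝ := D t.s t.n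
def Down (t : Top) (P : Tile) : Prop := P.I ⊆ t.J ∧ t.ξ ∈ P.om
def EQ (E : Set ℝ) (N : ℝ → ℝ) (Q : Tile) : Set ℝ := {x | x ∈ E ∧ x ∈ Q.I ∧ N x ∈ Q.om}
def Mass (E : Set ℝ) (N : ℝ → ℝ) (P : Tile) (μ : ℝ) : Prop :=
  ∀ Q, P.le Q → volume (EQ E N Q) ≤ ENNReal.ofReal (μ * z Q.s)

lemma Tile.le_trans' {P Q R : Tile} (h : P.le Q) (h' : Q.le R) : P.le R := ⟨h.1.trans h'.1, h'.2.trans h.2⟩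
lemma Tile.le_of {P Q : Tile} {x ξ : ℝ} (h : P.s ≤ Q.s) (h1 : x ∈ P.I) (h2 : x ∈ Q.I) (h3 : ξ ∈ P.om) (h4 : ξ ∈ Q.om) :
    P.le Q := ⟨D_sub h h1 h2, D_sub (by omega) h4 h3⟩
lemma Tile.eq_of {P Q : Tile} {x ξ : ℝ} (h : P.s = Q.s) (h1 : x ∈ P.I) (h2 : x ∈ Q.I) (h3 : ξ ∈ P.om) (h4 : ξ ∈ Q.om) :
    P = Q := by
  have a1 := mem_D.1 h1; have a2 := mem_D.1 h2; have a3 := mem_D.1 h3; have a4 := mem_D.1 h4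
  rw [h] at a1 a3
  exact Tile.ext h (a1.symm.trans a2) (a3.symm.trans a4)
lemma EQ_meas {E : Set ℝ} {N : ℝ → ℝ} (hE : MeasurableSet E) (hN : Measurable N) (Q : Tile) : MeasurableSet (EQ E N Q) :=
  hE.inter ((I_meas Q).inter (hN (D_meas _ _)))

lemma mass_lemma {E : Set ℝ} {N : ℝ → ℝ} (hE : MeasurableSet E) (hN : Measurable N) (𝒜 : Finset Tile) {μ : ℝ} (hμ : 0 < μ) :
    ∃ 𝒯 : Finset Top, ENNReal.ofReal μ * ∑ t ∈ 𝒯, ENNReal.ofReal (z t.s) ≤ 4 * volume E ∧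
      ∀ P ∈ 𝒜, (∀ t ∈ 𝒯, ¬ Down t P) → Mass E N P (μ / 4) := by
  have : ∀ P, ∃ Q : Tile, ¬ Mass E N P (μ / 4) → P.le Q ∧ ENNReal.ofReal (μ / 4 * z Q.s) < volume (EQ E N Q) := fun P => by
    by_cases h : Mass E N P (μ / 4)
    · exact ⟨P, fun h' => (h' h).elim⟩
    · simp only [Mass, not_forall, not_le] at h
      obtain ⟨Q, h1, h2⟩ := h; exact ⟨Q, fun _ => ⟨h1, h2⟩⟩
  choose q hq using this
  set 𝒬 := (𝒜.filter fun P => ¬ Mass E N P (μ / 4)).image q with h𝒬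
  set ℳ := 𝒬.filter fun Q => ∀ Q' ∈ 𝒬, Q.le Q' → Q' = Q with hℳ
  have hv : ∀ Q ∈ 𝒬, ENNReal.ofReal (μ / 4 * z Q.s) ≤ volume (EQ E N Q) := fun Q hQ => by
    simp only [h𝒬, Finset.mem_image, Finset.mem_filter] at hQ
    obtain ⟨P, hP, rfl⟩ := hQ; exact (hq P hP.2).2.le
  have hmax : ∀ Q ∈ 𝒬, ∃ Q' ∈ ℳ, Q.le Q' := fun Q hQ => by
    obtain ⟨R, hR, hR'⟩ := Finset.exists_max_image (𝒬.filter fun Q' => Q.le Q') Tile.s ⟨Q, Finset.mem_filter.2 ⟨hQ, subset_rfl, subset_rfl⟩⟩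
    simp only [Finset.mem_filter] at hR hR'
    refine ⟨R, Finset.mem_filter.2 ⟨hR.1, fun R' h1 h2 => ?_⟩, hR.2⟩
    have a := hR' R' ⟨h1, Tile.le_trans' hR.2 h2⟩
    have b := D_le h2.1
    exact (Tile.eq_of (le_antisymm b a) (D_left R.s R.n) (h2.1 (D_left R.s R.n)) (h2.2 (D_left _ R'.m)) (D_left _ R'.m)).symm
  set tp : Tile → Top := fun Q => ⟨Q.s, Q.n, Q.m * z (-Q.s)⟩
  refine ⟨ℳ.image tp, ?_, fun P hP h => ?_⟩
  · rw [Finset.sum_image (by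
      intro Q _ Q' _ h; simp only [tp, Top.mk.injEq] at h
      obtain ⟨h1, h2, h3⟩ := h
      rw [h1] at h3
      exact Tile.ext h1 h2 (by exact_mod_cast mul_right_cancel₀ (z_ne _) h3))]
    have hd : (ℳ : Set Tile).PairwiseDisjoint (EQ E N) := fun Q hQ Q' hQ' hne => by
      rw [Function.onFun, Set.disjoint_left]
      rintro x ⟨_, h1, h2⟩ ⟨_, h3, h4⟩
      simp only [hℳ, Finset.coe_filter, Set.mem_ofPred_eq] at hQ hQ'
      rcases le_total Q.s Q'.s with h | h
      · exact hne (hQ.2 _ hQ'.1 (Tile.le_of h h1 h3 h2 h4)).symm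
      · exact hne (hQ'.2 _ hQ.1 (Tile.le_of h h3 h1 h4 h2))
    have h1 : ∑ Q ∈ ℳ, volume (EQ E N Q) ≤ volume E := by
      rw [← measure_biUnion_finset hd fun Q _ => EQ_meas hE hN Q]
      exact measure_mono (Set.iUnion₂_subset fun Q _ x hx => hx.1)
    refine le_trans ?_ (mul_le_mul_right h1 4)
    rw [Finset.mul_sum, Finset.mul_sum]
    refine Finset.sum_le_sum fun Q hQ => ?_
    refine le_trans (le_of_eq ?_) (mul_le_mul_right (hv Q (Finset.mem_filter.1 hQ).1) 4)
    rw [← ENNReal.ofReal_mul hμ.le, show (4 : ℝ≥0∞) = ENNReal.ofReal 4 by simp, ← ENNReal.ofReal_mul (by norm_num)]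
    congr 1; simp only [tp]; ring
  · by_contra hb
    obtain ⟨R, hR, hR'⟩ := hmax (q P) (Finset.mem_image_of_mem _ (Finset.mem_filter.2 ⟨hP, hb⟩))
    have := Tile.le_trans' (hq P hb).1 hR'
    exact h (tp R) (Finset.mem_image_of_mem _ hR) ⟨this.1, this.2 (D_left _ _)⟩

/-- energy (squared) bounded by κ -/
def En (𝒜 : Finset Tile) (c : Tile → ℝ) (κ : ℝ) : Prop :=
  ∀ t : Top, ∑ P ∈ 𝒜 with P.I ⊆ t.J ∧ t.ξ ∈ P.om2, z P.s * c P ^ 2 ≤ κ * z t.s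

lemma En.mono {𝒜 𝒜' : Finset Tile} {c : Tile → ℝ} {κ : ℝ} (h : En 𝒜 c κ) (h' : 𝒜' ⊆ 𝒜) : En 𝒜' c κ := fun t =>
  (Finset.sum_le_sum_of_subset_of_nonneg (Finset.filter_subset_filter _ h')
    fun _ _ _ => mul_nonneg (z_nn _) (sq_nonneg _)).trans (h t)
lemma En.c_le {𝒜 : Finset Tile} {c : Tile → ℝ} {κ : ℝ} (h : En 𝒜 c κ) {P : Tile} (hP : P ∈ 𝒜) : c P ^ 2 ≤ κ := by
  have h1 := h ⟨P.s, P.n, (16 * P.m + 8 : ℤ) * z (-P.s - 4)⟩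
  have := (Finset.single_le_sum (f := fun P : Tile => z P.s * c P ^ 2) (fun _ _ => mul_nonneg (z_nn _) (sq_nonneg _))
    (Finset.mem_filter.2 ⟨hP, subset_rfl, D_left _ _⟩)).trans h1
  simp only at this
  exact le_of_mul_le_mul_left (by linarith) (z_pos P.s)

lemma select (c : Tile → ℝ) {κ : ℝ} (hκ : 0 < κ) (k : ℕ) : ∀ 𝒜 : Finset Tile, 𝒜.card ≤ k →
    ∃ (𝒯 : Finset Top) (𝒬 : Finset Tile) (τ : Tile → Top), 𝒬 ⊆ 𝒜 ∧
      (∀ P ∈ 𝒬, τ P ∈ 𝒯 ∧ P.I ⊆ (τ P).J ∧ (τ P).ξ ∈ P.om2) ∧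
      (∀ t ∈ 𝒯, κ * z t.s < ∑ P ∈ 𝒬 with τ P = t, z P.s * c P ^ 2) ∧
      (∀ P ∈ 𝒬, ∀ P' ∈ 𝒬, Off P P' → Disjoint P'.I (τ P).J) ∧
      En (𝒜.filter fun P => ∀ t ∈ 𝒯, ¬ Down t P) c κ := by
  have z0 : ∀ P : Tile, 0 ≤ z P.s * c P ^ 2 := fun P => mul_nonneg (z_nn _) (sq_nonneg _)
  induction k with
  | zero =>
    intro 𝒜 h
    have : 𝒜 = ∅ := by simpa using h
    subst this
    exact ⟨∅, ∅, fun _ => ⟨0, 0, 0⟩, by simp, by simp, by simp, by simp, fun t => by simpa using mul_nonneg hκ.le (z_nn _)⟩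
  | succ k ih =>
    intro 𝒜 hk
    set V : Top → Prop := fun t => κ * z t.s < ∑ P ∈ 𝒜 with P.I ⊆ t.J ∧ t.ξ ∈ P.om2, z P.s * c P ^ 2 with hV
    by_cases hE : ∀ t, ¬ V t
    · exact ⟨∅, ∅, fun _ => ⟨0, 0, 0⟩, by simp, by simp, by simp, by simp, fun t => by simpa [V] using hE t⟩
    push Not at hE
    set l : Tile → ℝ := fun P => (16 * P.m + 8 : ℤ) * z (-P.s - 4) with hl
    have hcan : ∀ t, V t → ∃ ξ ∈ 𝒜.image l, ξ ≤ t.ξ ∧ V ⟨t.s, t.n, ξ⟩ := fun t ht => by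
      have hne : (𝒜.filter fun P => P.I ⊆ t.J ∧ t.ξ ∈ P.om2).Nonempty := by
        by_contra h0
        rw [Finset.not_nonempty_iff_eq_empty] at h0
        simp only [hV] at ht; rw [h0, Finset.sum_empty] at ht
        linarith [mul_nonneg hκ.le (z_nn t.s)]
      obtain ⟨R, hR, hR'⟩ := Finset.exists_max_image _ l hne
      simp only [Finset.mem_filter] at hR hR'
      refine ⟨l R, Finset.mem_image_of_mem _ hR.1, hR.2.2.1, lt_of_lt_of_le ht ?_⟩
      refine Finset.sum_le_sum_of_subset_of_nonneg (fun P hP => ?_) fun P _ _ => z0 P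
      simp only [Finset.mem_filter] at hP ⊢
      exact ⟨hP.1, hP.2.1, hR' P hP, lt_of_le_of_lt hR.2.2.1 hP.2.2.2⟩
    obtain ⟨t1, ht1⟩ := hE
    obtain ⟨ξ1, hξ1, _, hv1⟩ := hcan t1 ht1
    obtain ⟨ξ0, hξ0, hmin⟩ := Finset.exists_min_image ((𝒜.image l).filter fun ξ => ∃ s n, V ⟨s, n, ξ⟩) id
      ⟨ξ1, Finset.mem_filter.2 ⟨hξ1, _, _, hv1⟩⟩
    obtain ⟨_, s0, n0, hv0⟩ := Finset.mem_filter.1 hξ0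
    set t0 : Top := ⟨s0, n0, ξ0⟩ with ht0
    have hmin' : ∀ t, V t → ξ0 ≤ t.ξ := fun t ht => by
      obtain ⟨ξ, h1, h2, h3⟩ := hcan t ht
      exact (hmin ξ (Finset.mem_filter.2 ⟨h1, _, _, h3⟩)).trans h2
    set T0 := 𝒜.filter fun P => P.I ⊆ t0.J ∧ t0.ξ ∈ P.om2 with hT0
    set 𝒜' := 𝒜.filter fun P => ¬ Down t0 P with h𝒜'
    have hT0d : ∀ P ∈ T0, Down t0 P := fun P hP => by
      have := (Finset.mem_filter.1 hP).2; exact ⟨this.1, om2_sub _ this.2⟩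
    have hcard : 𝒜'.card ≤ k := by
      have hne : T0.Nonempty := by
        by_contra h0
        rw [Finset.not_nonempty_iff_eq_empty] at h0
        simp only [hV] at hv0
        rw [show (𝒜.filter fun P => P.I ⊆ t0.J ∧ t0.ξ ∈ P.om2) = ∅ from h0, Finset.sum_empty] at hv0
        linarith [mul_nonneg hκ.le (z_nn t0.s)]
      obtain ⟨R, hR⟩ := hne
      have : 𝒜'.card < 𝒜.card := Finset.card_lt_card (Finset.filter_ssubset.2 ⟨R, (Finset.mem_filter.1 hR).1, not_not.2 (hT0d R hR)⟩)
      omega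
    obtain ⟨𝒯, 𝒬, τ, i0, i1, i2, i3, i4⟩ := ih 𝒜' hcard
    have hQT : ∀ P ∈ 𝒬, P ∉ T0 := fun P hP h => (Finset.mem_filter.1 (i0 hP)).2 (hT0d P h)
    refine ⟨insert t0 𝒯, 𝒬 ∪ T0, fun P => if P ∈ T0 then t0 else τ P, ?_, ?_, ?_, ?_, ?_⟩
    · exact Finset.union_subset (i0.trans (Finset.filter_subset _ _)) (Finset.filter_subset _ _)
    · intro P hP
      by_cases h : P ∈ T0
      · simp only [h, if_true]; exact ⟨Finset.mem_insert_self _ _, (Finset.mem_filter.1 h).2⟩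
      · have := i1 P ((Finset.mem_union.1 hP).resolve_right h)
        simp only [h, if_false]; exact ⟨Finset.mem_insert_of_mem this.1, this.2⟩
    · intro t ht
      rcases Finset.mem_insert.1 ht with rfl | ht
      · refine lt_of_lt_of_le hv0 (Finset.sum_le_sum_of_subset_of_nonneg (fun P hP => ?_) fun P _ _ => z0 P)
        have hP : P ∈ T0 := hP
        exact Finset.mem_filter.2 ⟨Finset.mem_union_right _ hP, by simp [hP]⟩
      · refine lt_of_lt_of_le (i2 t ht) (Finset.sum_le_sum_of_subset_of_nonneg (fun P hP => ?_) fun P _ _ => z0 P)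
        obtain ⟨h1, h2⟩ := Finset.mem_filter.1 hP
        exact Finset.mem_filter.2 ⟨Finset.mem_union_left _ h1, by simp [hQT P h1, h2]⟩
    · intro P hP P' hP' hO
      by_cases h : P ∈ T0
      · have hx : ξ0 ∈ P'.om1 := hO.2 (hT0d P h).2
        simp only [h, if_true]
        by_cases h' : P' ∈ T0
        · exact absurd (om12_lt hx (Finset.mem_filter.1 h').2.2) (lt_irrefl _)
        · have h1 := (Finset.mem_filter.1 (i0 ((Finset.mem_union.1 hP').resolve_right h'))).2
          refine (D_cases ?_).resolve_left fun h2 => h1 ⟨h2, om1_sub _ hx⟩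
          exact hO.1.le.trans (D_le (hT0d P h).1)
      · have hQ := (Finset.mem_union.1 hP).resolve_right h
        simp only [h, if_false]
        by_cases h' : P' ∈ T0
        · have hx : (τ P).ξ ∈ P'.om1 := hO.2 (om2_sub _ (i1 P hQ).2.2)
          have h1 := om12_lt hx (Finset.mem_filter.1 h').2.2
          refine absurd (hmin' (τ P) (lt_of_lt_of_le (i2 _ (i1 P hQ).1) ?_)) (not_le.2 h1)
          refine Finset.sum_le_sum_of_subset_of_nonneg (fun R hR => ?_) fun P _ _ => z0 P
          obtain ⟨h2, h3⟩ := Finset.mem_filter.1 hR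
          exact Finset.mem_filter.2 ⟨(Finset.mem_filter.1 (i0 h2)).1, by rw [← h3]; exact (i1 R h2).2⟩
        · exact i3 P hQ P' ((Finset.mem_union.1 hP').resolve_right h') hO
    · refine i4.mono fun P hP => ?_
      obtain ⟨h1, h2⟩ := Finset.mem_filter.1 hP
      exact Finset.mem_filter.2 ⟨Finset.mem_filter.2 ⟨h1, h2 t0 (Finset.mem_insert_self _ _)⟩, fun t ht => h2 t (Finset.mem_insert_of_mem ht)⟩

lemma gram2 (𝒬 : Finset Tile) {f : ℝ → ℂ} (hf : Integrable f) (hf2 : Integrable fun y => ‖f y‖ ^ 2) {l : ℝ} (hl : 0 < l) :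
    ∑ P ∈ 𝒬, z P.s * cP f P ^ 2 ≤ l * (∫ y, ‖f y‖ ^ 2) + l⁻¹ * (169 * ∑ P ∈ 𝒬, z P.s * cP f P ^ 2 +
      26 * ∑ P ∈ 𝒬, ∑ Q ∈ 𝒬 with Off P Q, z Q.s * cP f P * cP f Q * w ((P.c - Q.c) / z P.s) ^ 2) := by
  choose φ hφ r hr hr' using cP_ex f
  obtain ⟨g1, g2⟩ := gram 𝒬 φ (fun P _ => hφ P) (cP f) (cP_nn f)
  set G : ℝ → ℂ := fun y => ∑ P ∈ 𝒬, (z P.s * cP f P : ℝ) * φ P y with hG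
  have hi : ∀ P, Integrable fun y => f y * conj (φ P y) := fun P => by
    refine hf.mul_bdd (c := (z P.s)⁻¹) (Complex.continuous_conj.comp (hφ P).1.1).aestronglyMeasurable (ae_of_all _ fun y => ?_)
    rw [RCLike.norm_conj]
    refine ((hφ P).2.1 y).trans (mul_le_of_le_one_right (inv_nonneg.2 (z_nn _)) (pow_le_one₀ (w_nn _) (w_le_one _)))
  have e1 : ∫ y, f y * conj (G y) = ((∑ P ∈ 𝒬, z P.s * cP f P * r P : ℝ) : ℂ) := by
    have : ∀ y, f y * conj (G y) = ∑ P ∈ 𝒬, ((z P.s * cP f P : ℝ) : ℂ) * (f y * conj (φ P y)) := fun y => by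
      rw [hG, map_sum, Finset.mul_sum]
      refine Finset.sum_congr rfl fun P _ => ?_
      rw [map_mul, Complex.conj_ofReal]; ring
    simp only [this]
    rw [integral_finsetSum _ fun P _ => (hi P).const_mul _]
    rw [Complex.ofReal_sum]
    refine Finset.sum_congr rfl fun P _ => ?_
    rw [integral_const_mul, hr, ← Complex.ofReal_mul]
  have e2 : ∑ P ∈ 𝒬, z P.s * cP f P ^ 2 ≤ 2 * ‖∫ y, f y * conj (G y)‖ := by
    rw [e1, Complex.norm_real]
    refine le_trans ?_ (mul_le_mul_of_nonneg_left (Real.le_norm_self _) zero_le_two)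
    rw [Finset.mul_sum]
    refine Finset.sum_le_sum fun P _ => ?_
    have := mul_le_mul_of_nonneg_left (hr' P) (mul_nonneg (z_nn P.s) (cP_nn f P))
    nlinarith
  have e3 : 2 * ‖∫ y, f y * conj (G y)‖ ≤ ∫ y, (l * ‖f y‖ ^ 2 + l⁻¹ * ‖G y‖ ^ 2) := by
    have : ‖∫ y, f y * conj (G y)‖ ≤ ∫ y, (1 / 2) * (l * ‖f y‖ ^ 2 + l⁻¹ * ‖G y‖ ^ 2) := by
      refine norm_integral_le_of_norm_le (((hf2.const_mul _).add (g1.const_mul _)).const_mul _) (ae_of_all _ fun y => ?_)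
      rw [norm_mul, RCLike.norm_conj]
      have h2 : l * ‖f y‖ ^ 2 + l⁻¹ * ‖G y‖ ^ 2 - 2 * (‖f y‖ * ‖G y‖) = l⁻¹ * (l * ‖f y‖ - ‖G y‖) ^ 2 := by field_simp; ring
      have h3 : 0 ≤ l⁻¹ * (l * ‖f y‖ - ‖G y‖) ^ 2 := by positivity
      linarith
    rw [integral_const_mul] at this; linarith
  rw [integral_add (hf2.const_mul _) (g1.const_mul _), integral_const_mul, integral_const_mul] at e3
  have := mul_le_mul_of_nonneg_left g2 (inv_nonneg.2 hl.le)
  linarith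

lemma energy_lemma {f : ℝ → ℂ} (hf : Integrable f) (hf2 : Integrable fun y => ‖f y‖ ^ 2) (𝒜 : Finset Tile)
    {κ : ℝ} (hκ : 0 < κ) (hE : En 𝒜 (cP f) (4 * κ)) : ∃ 𝒯 : Finset Top, κ * ∑ t ∈ 𝒯, z t.s ≤ 2 ^ 21 * ∫ y, ‖f y‖ ^ 2 ∧
      En (𝒜.filter fun P => ∀ t ∈ 𝒯, ¬ Down t P) (cP f) κ := by
  obtain ⟨𝒯, 𝒬, τ, i0, i1, i2, i3, i4⟩ := select (cP f) hκ _ 𝒜 le_rfl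
  refine ⟨𝒯, ?_, i4⟩
  set A := ∑ P ∈ 𝒬, z P.s * cP f P ^ 2 with hA
  set S := ∑ t ∈ 𝒯, z t.s with hS
  have fib : ∀ g : Tile → ℝ, ∑ P ∈ 𝒬, g P = ∑ t ∈ 𝒯, ∑ P ∈ 𝒬 with τ P = t, g P := fun g =>
    (Finset.sum_fiberwise_of_maps_to (fun P hP => (i1 P hP).1) g).symm
  have hA1 : κ * S ≤ A := by
    rw [hA, fib, hS, Finset.mul_sum]; exact Finset.sum_le_sum fun t ht => (i2 t ht).le
  have hA2 : A ≤ 4 * κ * S := by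
    rw [hA, fib, hS, Finset.mul_sum]
    refine Finset.sum_le_sum fun t ht => le_trans ?_ (hE t)
    refine Finset.sum_le_sum_of_subset_of_nonneg (fun P hP => ?_) fun P _ _ => mul_nonneg (z_nn _) (sq_nonneg _)
    obtain ⟨h1, h2⟩ := Finset.mem_filter.1 hP
    exact Finset.mem_filter.2 ⟨i0 h1, by rw [← h2]; exact (i1 P h1).2⟩
  have hc : ∀ P ∈ 𝒬, ∀ Q ∈ 𝒬, cP f P * cP f Q ≤ 4 * κ := fun P hP Q hQ => by
    nlinarith [hE.c_le (i0 hP), hE.c_le (i0 hQ), sq_nonneg (cP f P - cP f Q)]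
  have wi : ∀ P : Tile, Integrable fun y => w ((y - P.c) / z P.s) ^ 2 := fun P =>
    (w_int' (z_pos P.s) P.c).mono' ((w_meas (by fun_prop)).pow_const 2).aestronglyMeasurable (ae_of_all _ fun y => by
      rw [Real.norm_of_nonneg (sq_nonneg _)]; exact w_sq_le _)
  have o1 : ∀ P ∈ 𝒬, ∑ Q ∈ 𝒬 with Off P Q, z Q.s * w ((P.c - Q.c) / z P.s) ^ 2 ≤
      16 * ∫ y in (τ P).Jᶜ, w ((y - P.c) / z P.s) ^ 2 := fun P hP => by
    have h1 : ∀ Q ∈ 𝒬.filter fun Q => Off P Q, z Q.s * w ((P.c - Q.c) / z P.s) ^ 2 ≤ 16 * ∫ y in Q.I, w ((y - P.c) / z P.s) ^ 2 := fun Q hQ => by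
      obtain ⟨hQ, hO⟩ := Finset.mem_filter.1 hQ
      have : ∫ y in Q.I, w ((P.c - Q.c) / z P.s) ^ 2 ≤ ∫ y in Q.I, 16 * w ((y - P.c) / z P.s) ^ 2 := by
        refine setIntegral_mono_on (by simp [I_vol]) ((wi P).const_mul _).integrableOn (I_meas _) fun y hy => ?_
        have := w_D' (ctr_mem Q.s Q.n) hy P.c hO.1.le
        rw [show (16 : ℝ) = 4 ^ 2 by norm_num, ← mul_pow, ← w_neg ((P.c - Q.c) / _), ← neg_div, neg_sub]
        exact pow_le_pow_left₀ (w_nn _) this 2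
      rw [integral_const_mul] at this
      refine le_trans (le_of_eq ?_) this
      simp [Measure.real, I_vol, ENNReal.toReal_ofReal (z_nn _)]
    refine (Finset.sum_le_sum h1).trans ?_
    rw [← Finset.mul_sum]; gcongr
    rw [← integral_biUnion_finset _ (fun Q _ => I_meas Q) ?_ fun Q _ => (wi P).integrableOn]
    · refine setIntegral_mono_set (wi P).integrableOn (ae_of_all _ fun y => sq_nonneg _) (LE.le.eventuallyLE ?_)
      refine Set.iUnion₂_subset fun Q hQ => ?_
      obtain ⟨hQ, hO⟩ := Finset.mem_filter.1 hQ
      exact (i3 P hP Q hQ hO).subset_compl_right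
    · have key : ∀ Q ∈ 𝒬, ∀ Q' ∈ 𝒬, Off P Q → Off P Q' → Q.s < Q'.s → Disjoint Q.I Q'.I := fun Q hQ Q' hQ' h h' hs => by
        have hx := D_left (-P.s) P.m
        have hO : Off Q' Q := ⟨hs, om_sub_om1 hs (om1_sub _ (h'.2 hx)) (h.2 hx)⟩
        exact (i3 Q' hQ' Q hQ hO).mono_right (i1 Q' hQ').2.1
      intro Q hQ Q' hQ' hne
      obtain ⟨hQ, hO⟩ := Finset.mem_filter.1 hQ
      obtain ⟨hQ', hO'⟩ := Finset.mem_filter.1 hQ'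
      rcases lt_trichotomy Q.s Q'.s with h | h | h
      · exact key Q hQ Q' hQ' hO hO' h
      · rw [Function.onFun, Set.disjoint_left]
        intro x h1 h2
        have hx := D_left (-P.s) P.m
        exact hne (Tile.eq_of h h1 h2 (om1_sub _ (hO.2 hx)) (om1_sub _ (hO'.2 hx)))
      · exact (key Q' hQ' Q hQ hO' hO h).symm
  have o2 : ∀ t ∈ 𝒯, ∑ P ∈ 𝒬 with τ P = t, ∫ y in (τ P).Jᶜ, w ((y - P.c) / z P.s) ^ 2 ≤ 13 * (4 * Real.pi * z t.s) := fun t ht => by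
    set T := 𝒬.filter fun P => τ P = t with hT
    have hT' : ∀ P ∈ T, P.I ⊆ t.J ∧ t.ξ ∈ P.om2 ∧ τ P = t := fun P hP => by
      obtain ⟨h1, h2⟩ := Finset.mem_filter.1 hP
      have := i1 P h1; rw [h2] at this; exact ⟨this.2.1, this.2.2, h2⟩
    set a := t.n * z t.s; set b := (t.n + 1) * z t.s
    set g : ℤ → ℝ → ℝ := fun s y => w ((y - a) / z s) + w ((y - b) / z s) with hg
    have gi : ∀ s, Integrable (g s) := fun s => (w_int' (z_pos s) a).add (w_int' (z_pos s) b)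
    have g0 : ∀ s y, 0 ≤ g s y := fun s y => add_nonneg (w_nn _) (w_nn _)
    have p1 : ∀ y ∈ t.Jᶜ, ∑ P ∈ T, w ((y - P.c) / z P.s) ^ 2 ≤ ∑ s ∈ T.image Tile.s, 13 * g s y := fun y hy => by
      rw [← Finset.sum_fiberwise_of_maps_to (fun P hP => Finset.mem_image_of_mem Tile.s hP)]
      refine Finset.sum_le_sum fun s _ => ?_
      refine le_trans (Finset.sum_le_sum (g := fun P => w ((y - P.c) / z P.s) * g s y) fun P hP => ?_) ?_
      · obtain ⟨h1, h2⟩ := Finset.mem_filter.1 hP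
        rw [sq]; refine mul_le_mul_of_nonneg_left ?_ (w_nn _)
        have hc := (hT' P h1).1 (ctr_mem P.s P.n)
        rw [← h2]; exact w_bdry (z_pos _) hc.1 hc.2.le hy
      · rw [← Finset.sum_mul]
        refine mul_le_mul_of_nonneg_right (tile_sum _ (s := s) (m := idx (-s) t.ξ) y fun P hP => ?_) (g0 _ _)
        obtain ⟨h1, h2⟩ := Finset.mem_filter.1 hP
        exact ⟨h2, by rw [← h2]; exact (mem_D.1 (om2_sub _ (hT' P h1).2.1)).symm⟩
    rw [Finset.sum_congr rfl fun P hP => by rw [(hT' P hP).2.2]]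
    rw [← integral_finsetSum _ fun P _ => (wi P).integrableOn]
    refine (setIntegral_mono_on (integrable_finsetSum _ fun P _ => (wi P).integrableOn)
      (integrable_finsetSum _ fun s _ => ((gi s).const_mul 13).integrableOn) (D_meas _ _).compl p1).trans ?_
    refine (setIntegral_le_integral (integrable_finsetSum _ fun s _ => ((gi s).const_mul 13))
      (ae_of_all _ fun y => Finset.sum_nonneg fun s _ => mul_nonneg (by norm_num) (g0 s y))).trans ?_
    rw [integral_finsetSum _ fun s _ => ((gi s).const_mul 13)]
    have : ∀ s, ∫ y, 13 * g s y = 26 * Real.pi * z s := fun s => by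
      rw [integral_const_mul, hg, integral_add (w_int' (z_pos s) a) (w_int' (z_pos s) b), w_integral (z_pos s), w_integral (z_pos s)]; ring
    simp only [this]
    rw [← Finset.mul_sum]
    have := z_sum (T.image Tile.s) (t := t.s) fun s hs => by
      obtain ⟨P, hP, rfl⟩ := Finset.mem_image.1 hs; exact D_le (hT' P hP).1
    nlinarith [Real.pi_pos]
  have o3 : ∑ P ∈ 𝒬, ∑ Q ∈ 𝒬 with Off P Q, z Q.s * cP f P * cP f Q * w ((P.c - Q.c) / z P.s) ^ 2 ≤ 10600 * κ * S := by
    calc _ ≤ ∑ P ∈ 𝒬, 4 * κ * (16 * ∫ y in (τ P).Jᶜ, w ((y - P.c) / z P.s) ^ 2) := by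
          refine Finset.sum_le_sum fun P hP => le_trans ?_ (mul_le_mul_of_nonneg_left (o1 P hP) (by positivity))
          rw [Finset.mul_sum]
          refine Finset.sum_le_sum fun Q hQ => ?_
          have := mul_le_mul_of_nonneg_right (hc P hP Q (Finset.mem_filter.1 hQ).1)
            (mul_nonneg (z_nn Q.s) (sq_nonneg (w ((P.c - Q.c) / z P.s))))
          linarith
      _ = 64 * κ * ∑ t ∈ 𝒯, ∑ P ∈ 𝒬 with τ P = t, ∫ y in (τ P).Jᶜ, w ((y - P.c) / z P.s) ^ 2 := by
          rw [← fib, Finset.mul_sum]; exact Finset.sum_congr rfl fun _ _ => by ring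
      _ ≤ 64 * κ * ∑ t ∈ 𝒯, 13 * (4 * Real.pi * z t.s) := by
          gcongr with t ht; exact o2 t ht
      _ = 64 * 52 * Real.pi * κ * S := by
          rw [hS, Finset.mul_sum, Finset.mul_sum]; exact Finset.sum_congr rfl fun _ _ => by ring
      _ ≤ _ := by
          have := Real.pi_lt_d2
          have hS0 : 0 ≤ S := Finset.sum_nonneg fun t _ => z_nn _
          have : 0 ≤ κ * S := by positivity
          nlinarith
  have := gram2 𝒬 hf hf2 (l := 2 ^ 20) (by norm_num)
  rw [← hA] at this
  nlinarith
end
end Car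

namespace Car
noncomputable section
open FourierTransform ComplexConjugate
open scoped Classical

lemma bump_ex {r R : ℝ} (hr : 0 < r) (hR : r < R) : ∃ Φ : SchwartzMap ℝ ℂ, (∀ ζ, |ζ| ≤ r → 𝓕 (Φ : ℝ → ℂ) ζ = 1) ∧
    Band Φ (-R) R := by
  let f : ContDiffBump (0 : ℝ) := ⟨r, R, hr, hR⟩
  have h1 : ContDiff ℝ ((⊤ : ℕ∞) : WithTop ℕ∞) (fun x => ((f x : ℝ) : ℂ)) := Complex.ofRealCLM.contDiff.comp f.contDiff
  have h2 : HasCompactSupport (fun x => ((f x : ℝ) : ℂ)) := f.hasCompactSupport.comp_left (g := fun x : ℝ => (x : ℂ)) (by simp)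
  set g : SchwartzMap ℝ ℂ := h2.toSchwartzMap h1
  have e : ∀ ζ, 𝓕 ((𝓕⁻ g : SchwartzMap ℝ ℂ) : ℝ → ℂ) ζ = ((f ζ : ℝ) : ℂ) := fun ζ => by
    rw [← SchwartzMap.fourier_coe, FourierTransform.fourier_fourierInv_eq]; rfl
  refine ⟨𝓕⁻ g, fun ζ hζ => ?_, SchwartzMap.continuous _, SchwartzMap.integrable _, fun ζ hζ => ?_⟩
  · rw [e, f.one_of_mem_closedBall (by simpa using hζ)]; simp
  · rw [e, f.zero_of_le_dist]; · simp
    by_contra! h; apply hζ; rw [Real.dist_eq, sub_zero, abs_lt] at h; exact h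

lemma orth_sum (S : Finset ℤ) (F : ℤ → ℝ → ℂ) (a b : ℤ → ℝ) (hF : ∀ s ∈ S, Band (F s) (a s) (b s))
    (ho : ∀ s ∈ S, ∀ t ∈ S, s ≠ t → b s ≤ a t ∨ b t ≤ a s) :
    Integrable (fun y => ‖∑ s ∈ S, F s y‖ ^ 2) ∧ ∫ y, ‖∑ s ∈ S, F s y‖ ^ 2 = ∑ s ∈ S, ∫ y, ‖F s y‖ ^ 2 := by
  have sq : ∀ u : ℂ, ((‖u‖ ^ 2 : ℝ) : ℂ) = u * conj u := fun u => by rw [← Complex.normSq_eq_norm_sq, ← Complex.mul_conj]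
  have int : ∀ s ∈ S, ∀ t ∈ S, Integrable fun y => F s y * conj (F t y) := fun s hs t ht => ((hF s hs).mul (hF t ht).cj).2.1
  have e0 : ∀ y, ((‖∑ s ∈ S, F s y‖ ^ 2 : ℝ) : ℂ) = ∑ s ∈ S, ∑ t ∈ S, F s y * conj (F t y) := fun y => by
    rw [sq, map_sum, Finset.sum_mul_sum]
  have iG : Integrable fun y => ((‖∑ s ∈ S, F s y‖ ^ 2 : ℝ) : ℂ) := by
    simp only [e0]; exact integrable_finsetSum _ fun P hP => integrable_finsetSum _ fun Q hQ => int P hP Q hQ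
  refine ⟨iG.re, ?_⟩
  apply Complex.ofReal_injective
  rw [← integral_complex_ofReal]; simp only [e0]
  rw [integral_finsetSum _ fun P hP => integrable_finsetSum _ fun Q hQ => int P hP Q hQ, Complex.ofReal_sum]
  refine Finset.sum_congr rfl fun s hs => ?_
  rw [integral_finsetSum _ fun Q hQ => int s hs Q hQ, Finset.sum_eq_single_of_mem s hs fun t ht hst => (hF s hs).orth (hF t ht) (ho s hs t ht hst.symm)]
  rw [← integral_complex_ofReal]; simp only [sq]

lemma cover_lemma (𝒥 : Set (ℤ × ℤ)) (hd : 𝒥.PairwiseDisjoint fun J => D J.1 J.2) {A : Set ℝ} (hA : MeasurableSet A)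
    (hc : A ⊆ ⋃ J ∈ 𝒥, D J.1 J.2) {m : ℝ≥0∞} (hm : ∀ J ∈ 𝒥, volume (A ∩ D J.1 J.2) ≤ m * volume (D J.1 J.2))
    {g h : ℝ → ℝ≥0∞} (hg : ∀ J ∈ 𝒥, ∀ x ∈ A ∩ D J.1 J.2, ∀ y ∈ D J.1 J.2, g x ≤ h y) : ∫⁻ x in A, g x ≤ m * ∫⁻ x, h x := by
  have hco := Set.to_countable 𝒥
  calc ∫⁻ x in A, g x ≤ ∫⁻ x in ⋃ J ∈ 𝒥, (A ∩ D J.1 J.2), g x := by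
        refine lintegral_mono_set fun x hx => ?_
        obtain ⟨J, hJ, hx'⟩ := Set.mem_iUnion₂.1 (hc hx)
        exact Set.mem_iUnion₂.2 ⟨J, hJ, hx, hx'⟩
    _ ≤ ∑' J : 𝒥, ∫⁻ x in A ∩ D J.1.1 J.1.2, g x := by
        rw [Set.biUnion_eq_iUnion]; exact lintegral_iUnion_le _ _
    _ ≤ ∑' J : 𝒥, m * ∫⁻ x in D J.1.1 J.1.2, h x := by
        refine ENNReal.tsum_le_tsum fun J => ?_
        obtain ⟨J, hJ⟩ := J
        obtain ⟨k, hk1, hk2⟩ : ∃ k, (∀ y ∈ D J.1 J.2, k ≤ h y) ∧ ∀ x ∈ A ∩ D J.1 J.2, g x ≤ k :=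
          ⟨⨅ y ∈ D J.1 J.2, h y, fun y hy => iInf₂_le y hy, fun x hx => le_iInf₂ fun y hy => hg J hJ x hx y hy⟩
        calc ∫⁻ x in A ∩ D J.1 J.2, g x ≤ ∫⁻ x in A ∩ D J.1 J.2, k :=
              setLIntegral_mono' (hA.inter (D_meas _ _)) hk2
          _ = k * volume (A ∩ D J.1 J.2) := setLIntegral_const _ _
          _ ≤ k * (m * volume (D J.1 J.2)) := mul_le_mul_right (hm J hJ) _
          _ = m * ∫⁻ x in D J.1 J.2, k := by rw [setLIntegral_const]; ring
          _ ≤ _ := mul_le_mul_right (setLIntegral_mono' (D_meas _ _) hk1) _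
    _ ≤ _ := by
        rw [ENNReal.tsum_mul_left]
        gcongr
        have : Countable 𝒥 := hco
        have hd' : Pairwise (Function.onFun Disjoint fun J : 𝒥 => D J.1.1 J.1.2) :=
          fun J J' hne => hd J.2 J'.2 fun h => hne (Subtype.ext h)
        rw [← lintegral_iUnion (fun J : 𝒥 => D_meas J.1.1 J.1.2) hd' h]
        exact setLIntegral_le_lintegral _ _

/-- boundary counting -/
lemma bdry_count (𝓑 : Finset (ℤ × ℤ × ℤ)) {t a : ℤ} (h1 : ∀ B ∈ 𝓑, B.2.2 = B.2.1 ∨ B.2.2 = B.2.1 + 1)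
    (h2 : ∀ B ∈ 𝓑, D B.1 B.2.1 ⊆ Ico ((a - 1) * z t) ((a + 2) * z t))
    (h3 : ∀ B ∈ 𝓑, ∀ B' ∈ 𝓑, B.1 < B'.1 → D B.1 B.2.1 ⊆ D B'.1 B'.2.1 →
      B.2.2 * z B.1 = B'.2.1 * z B'.1 ∨ B.2.2 * z B.1 = (B'.2.1 + 1) * z B'.1) :
    ∑ B ∈ 𝓑, z B.1 ≤ 12 * z t := by
  set R : ℤ × ℤ × ℤ → Set ℝ := fun B => if B.2.2 = B.2.1 then Ico ((B.2.1 + 1 / 4) * z B.1) ((B.2.1 + 1 / 2) * z B.1)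
    else Ico ((B.2.1 + 1 / 2) * z B.1) ((B.2.1 + 3 / 4) * z B.1) with hR
  have Rv : ∀ B, volume (R B) = ENNReal.ofReal (z B.1 / 4) := fun B => by
    simp only [hR]; split_ifs <;> rw [Real.volume_Ico] <;> congr 1 <;> ring
  have Rm : ∀ B, MeasurableSet (R B) := fun B => by
    simp only [hR]; split_ifs <;> exact measurableSet_Ico
  have Rs : ∀ B, R B ⊆ D B.1 B.2.1 := fun B x hx => by
    have := z_pos B.1
    simp only [hR, D] at hx ⊢; split_ifs at hx <;> constructor <;> nlinarith [hx.1, hx.2]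
  have key : ∀ B ∈ 𝓑, ∀ B' ∈ 𝓑, B.1 < B'.1 → Disjoint (R B) (R B') := fun B hB B' hB' hs => by
    rw [Set.disjoint_left]; intro x hx hx'
    have hsub := D_sub hs.le (Rs B hx) (Rs B' hx')
    have hz := z_pos B.1
    have hz' := z_mono (show B.1 + 1 ≤ B'.1 by omega)
    rw [z_succ] at hz'
    have h3 := h3 B hB B' hB' hs hsub
    have hl := hsub (D_left _ _)
    have hr := hsub (show (B.2.1 + 3 / 4) * z B.1 ∈ D B.1 B.2.1 by constructor <;> nlinarith)
    rcases h1 B hB with e | e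
    · rw [e] at h3
      simp only [hR, e, if_true] at hx hx'
      have h3 := h3.resolve_right fun h => absurd hl.2 (by rw [h]; exact lt_irrefl _)
      split_ifs at hx' <;> nlinarith [hx.1, hx.2, hx'.1, hx'.2]
    · have ne : B.2.2 ≠ B.2.1 := by omega
      rw [e] at h3; push_cast at h3
      simp only [hR, ne, if_false] at hx hx'
      have h3 := h3.resolve_left fun h => absurd hl.1 (by nlinarith)
      split_ifs at hx' <;> nlinarith [hx.1, hx.2, hx'.1, hx'.2]
  have hd : (𝓑 : Set _).PairwiseDisjoint R := fun B hB B' hB' hne => by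
    rcases lt_trichotomy B.1 B'.1 with h | h | h
    · exact key B hB B' hB' h
    · by_cases hn : B.2.1 = B'.2.1
      · have a1 := h1 B hB; have a2 := h1 B' hB'
        have : B.2.2 ≠ B'.2.2 := fun h' => hne (Prod.ext h (Prod.ext hn h'))
        rw [Function.onFun, Set.disjoint_left]; intro x hx hx'
        simp only [hR] at hx hx'
        rw [← hn, ← h] at hx'
        split_ifs at hx hx' <;> first | omega | (have a3 := hx.2; have a4 := hx'.1; have a5 := hx.1; have a6 := hx'.2; linarith)
      · refine Disjoint.mono (Rs B) (Rs B') ?_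
        rw [h]; exact D_disj hn
    · exact (key B' hB' B hB h).symm
  have h4 : ∑ B ∈ 𝓑, ENNReal.ofReal (z B.1 / 4) ≤ ENNReal.ofReal (3 * z t) := by
    rw [← Finset.sum_congr rfl fun B _ => Rv B, ← measure_biUnion_finset hd fun B _ => Rm B]
    refine (measure_mono (Set.iUnion₂_subset fun B hB => (Rs B).trans (h2 B hB))).trans (le_of_eq ?_)
    rw [Real.volume_Ico]; congr 1; ring
  rw [← ENNReal.ofReal_sum_of_nonneg fun B _ => by have := z_pos B.1; positivity,
    ENNReal.ofReal_le_ofReal_iff (by have := z_pos t; positivity), ← Finset.sum_div] at h4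
  linarith

lemma sep {P Q : Tile} {ξ : ℝ} (hP : ξ ∈ P.om2) (hQ : ξ ∈ Q.om2) (h : P.s < Q.s) : P.s + 4 ≤ Q.s := by
  by_contra! hh
  have h1 := mem_D.1 (D_sixteen _ _ hQ)
  have h2 := mem_D.1 hP
  have e := idx_coarse (s := -P.s - 4) (t := -Q.s - 1) (by omega) ξ
  rw [h1, h2] at e
  have : Q.s - P.s = 1 ∨ Q.s - P.s = 2 ∨ Q.s - P.s = 3 := by omega
  rcases this with h | h | h
  all_goals
    rw [show -Q.s - 1 - (-P.s - 4) = 3 - (Q.s - P.s) by ring, h] at e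
    norm_num [show Int.toNat 2 = 2 from rfl] at e; omega

lemma switch (K : Finset ℤ) {p q : ℤ} (hp : p ∈ K) (hq : q ∉ K) :
    ∃ k ∈ K, (k + 1 ∉ K ∧ p ≤ k ∧ k < q) ∨ (k - 1 ∉ K ∧ q < k ∧ k ≤ p) := by
  rcases lt_or_ge p q with h | h
  · obtain ⟨k, hk, hm⟩ := (K.filter fun k => p ≤ k ∧ k < q).exists_max_image id ⟨p, by simp [hp, h]⟩
    simp only [Finset.mem_filter, id] at hk hm
    refine ⟨k, hk.1, Or.inl ⟨fun h' => ?_, hk.2⟩⟩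
    have : k + 1 ≠ q := fun h => hq (h ▸ h')
    have := hm (k + 1) ⟨h', by omega, by omega⟩; omega
  · have h : q < p := lt_of_le_of_ne h fun h => hq (h ▸ hp)
    obtain ⟨k, hk, hm⟩ := (K.filter fun k => q < k ∧ k ≤ p).exists_min_image id ⟨p, by simp [hp, h]⟩
    simp only [Finset.mem_filter, id] at hk hm
    refine ⟨k, hk.1, Or.inr ⟨fun h' => ?_, hk.2⟩⟩
    have : k - 1 ≠ q := fun h => hq (h ▸ h')
    have := hm (k - 1) ⟨h', by omega, by omega⟩; omega
end
end Car

namespace Car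
noncomputable section
open FourierTransform ComplexConjugate
open scoped Classical

def us (K : Finset ℤ) (s : ℤ) (x : ℝ) : ℂ := if idx s x ∈ K then 1 else 0
def chi (η : ℝ → ℂ) (K : Finset ℤ) (s : ℤ) (x : ℝ) : ℂ := ∫ y, us K s y * ((z s)⁻¹ * η ((x - y) / z s))
def bd (K : Finset ℤ) : Finset (ℤ × ℤ) :=
  (K ×ˢ (K ∪ K.image (· + 1))).filter fun b => (b.2 = b.1 ∨ b.2 = b.1 + 1) ∧ 2 * b.2 - 1 - b.1 ∉ K

lemma idx_bd (s : ℤ) (x : ℝ) : idx s x * z s ≤ x ∧ x < (idx s x + 1) * z s := mem_D_idx s x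

lemma bd_between {K : Finset ℤ} {s : ℤ} {x y : ℝ} (hx : idx s x ∈ K) (hy : idx s y ∉ K) :
    ∃ b ∈ bd K, (x ≤ b.2 * z s ∧ b.2 * z s ≤ y) ∨ (y ≤ b.2 * z s ∧ b.2 * z s ≤ x) := by
  obtain ⟨k, hk, ⟨h1, h2, h3⟩ | ⟨h1, h2, h3⟩⟩ := switch K hx hy
  · refine ⟨(k, k + 1), ?_, Or.inl ⟨(idx_bd s x).2.le.trans ?_, le_trans ?_ (idx_bd s y).1⟩⟩
    · simp only [bd, Finset.mem_filter, Finset.mem_product, Finset.mem_union, Finset.mem_image]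
      exact ⟨⟨hk, Or.inr ⟨k, hk, rfl⟩⟩, Or.inr trivial, by rwa [show 2 * (k + 1) - 1 - k = k + 1 by ring]⟩
    · have : (idx s x : ℝ) ≤ k := by exact_mod_cast h2
      have := z_pos s; push_cast; nlinarith
    · have : (k + 1 : ℝ) ≤ idx s y := by exact_mod_cast h3
      have := z_pos s; push_cast; nlinarith
  · refine ⟨(k, k), ?_, Or.inr ⟨(idx_bd s y).2.le.trans ?_, le_trans ?_ (idx_bd s x).1⟩⟩
    · simp only [bd, Finset.mem_filter, Finset.mem_product, Finset.mem_union, Finset.mem_image]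
      exact ⟨⟨hk, Or.inl hk⟩, Or.inl trivial, by rwa [show 2 * k - 1 - k = k - 1 by ring]⟩
    · have : (idx s y + 1 : ℝ) ≤ k := by exact_mod_cast h2
      have := z_pos s; nlinarith
    · have : (k : ℝ) ≤ idx s x := by exact_mod_cast h3
      have := z_pos s; nlinarith

lemma us_meas (K : Finset ℤ) (s : ℤ) : Measurable (us K s) := by
  have : Measurable (idx s) := by unfold idx; fun_prop
  exact Measurable.ite (this (MeasurableSet.of_discrete (s := (K : Set ℤ)))) measurable_const measurable_const
lemma us_le (K : Finset ℤ) (s : ℤ) (x : ℝ) : ‖us K s x‖ ≤ 1 := by unfold us; split_ifs <;> simp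

lemma trunc {η : ℝ → ℂ} (hc : Continuous η) {C : ℝ} (hC : ∀ u, ‖η u‖ ≤ C * w u ^ 5) (h1 : ∫ u, η u = 1) {K : Finset ℤ} {s : ℤ} {x B : ℝ} {a : ℂ}
    (ha : ∀ n ∈ K, ‖a‖ ≤ B * (w ((x - ctr s n) / z s) ^ 3)⁻¹) (hB : 0 ≤ B) :
    ‖us K s x * a - chi η K s x * a‖ ≤ 256 * C * B * ∑ b ∈ bd K, w ((x - b.2 * z s) / z s) := by
  have hz := z_pos s
  have key : ∀ y, ‖(us K s x - us K s y) * a‖ * w ((x - y) / z s) ^ 4 ≤ 64 * B * ∑ b ∈ bd K, w ((x - b.2 * z s) / z s) := by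
    intro y
    have hmain : ∀ x' y', ((x' = x ∧ y' = y) ∨ (x' = y ∧ y' = x)) → idx s x' ∈ K → idx s y' ∉ K → ‖a‖ * w ((x - y) / z s) ^ 4 ≤ 64 * B * ∑ b ∈ bd K, w ((x - b.2 * z s) / z s) := by
      intro x' y' h hx hy
      obtain ⟨b, hb, hb'⟩ := bd_between hx hy
      have hw : w ((x - y) / z s) ≤ w ((x - b.2 * z s) / z s) := w_anti (by
        rw [abs_div, abs_div]; refine div_le_div_of_nonneg_right ?_ (abs_nonneg _)
        rcases h with ⟨rfl, rfl⟩ | ⟨rfl, rfl⟩ <;> rcases hb' with h | h <;> rw [abs_le] <;> constructor <;>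
          first | (cases abs_cases (x' - y') <;> linarith [h.1, h.2]) | (cases abs_cases (y' - x') <;> linarith [h.1, h.2]))
      have hs : w ((x - b.2 * z s) / z s) ≤ ∑ b ∈ bd K, w ((x - b.2 * z s) / z s) :=
        Finset.single_le_sum (f := fun b : ℤ × ℤ => w ((x - b.2 * z s) / z s)) (fun _ _ => w_nn _) hb
      have h4 : w ((x - y) / z s) ≤ 4 * w ((x - ctr s (idx s x')) / z s) := by
        rcases h with ⟨rfl, rfl⟩ | ⟨rfl, rfl⟩
        · refine (w_le_one _).trans ?_
          have := w_near (u := 0) (v := (x' - ctr s (idx s x')) / z s) (by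
            rw [zero_sub, abs_neg]; exact D_dist (mem_D_idx s x') (ctr_mem s _))
          simpa [w] using this
        · exact w_D (mem_D_idx s x') (ctr_mem s _) _ le_rfl
      set A := w ((x - y) / z s)
      set G := w ((x - ctr s (idx s x')) / z s)
      have hA : 0 < A := w_pos _
      have hG : 0 < G := w_pos _
      calc ‖a‖ * A ^ 4 ≤ (B * (G ^ 3)⁻¹) * ((4 * G) ^ 3 * A) := by
            rw [pow_succ A 3]; have := ha _ hx; gcongr ?_ * (?_ ^ 3 * A)
        _ = 64 * B * A := by field_simp; ring
        _ ≤ _ := by gcongr; exact hw.trans hs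
    have hs0 : 0 ≤ ∑ b ∈ bd K, w ((x - b.2 * z s) / z s) := Finset.sum_nonneg fun _ _ => w_nn _
    by_cases hx : idx s x ∈ K <;> by_cases hy : idx s y ∈ K
    · simp only [us, hx, hy]; simp; positivity
    · simp only [us, hx, hy]; simpa using hmain x y (by tauto) hx hy
    · simp only [us, hx, hy]; simpa using hmain y x (by tauto) hy hx
    · simp only [us, hx, hy]; simp; positivity
  have hη : Integrable fun y => (((z s)⁻¹ : ℝ) : ℂ) * η ((x - y) / z s) := by
    refine Integrable.const_mul ?_ _
    refine Integrable.mono' ((w_int' hz x).const_mul C) (by fun_prop) (ae_of_all _ fun y => (hC _).trans ?_)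
    have := w_nn ((x-y)/z s)
    have hC0 : 0 ≤ C := by have := (norm_nonneg _).trans (hC 0); simpa [w] using this
    rw [show (y - x) / z s = -((x-y)/z s) by ring, w_neg]
    gcongr; exact pow_le_of_le_one this (w_le_one _) (by norm_num)
  have hC0 : 0 ≤ C := by have := (norm_nonneg _).trans (hC 0); simpa [w] using this
  have e1 : ∫ y, (((z s)⁻¹ : ℝ) : ℂ) * η ((x - y) / z s) = 1 := by
    rw [integral_const_mul, integral_sub_left_eq_self (fun y => η (y / z s)) volume x, Measure.integral_comp_div, h1, abs_of_pos hz]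
    simp [hz.ne']
  have hU : Integrable fun y => us K s y * ((((z s)⁻¹ : ℝ) : ℂ) * η ((x - y) / z s)) :=
    hη.bdd_mul (us_meas K s).aestronglyMeasurable (ae_of_all _ (us_le K s))
  have e2 : us K s x * a - chi η K s x * a = ∫ y, ((us K s x - us K s y) * a) * ((((z s)⁻¹ : ℝ) : ℂ) * η ((x - y) / z s)) := by
    have : ∀ y, ((us K s x - us K s y) * a) * ((((z s)⁻¹ : ℝ) : ℂ) * η ((x - y) / z s)) = (us K s x * a) * ((((z s)⁻¹ : ℝ) : ℂ) * η ((x - y) / z s)) - us K s y * ((((z s)⁻¹ : ℝ) : ℂ) * η ((x - y) / z s)) * a := fun y => by ring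
    simp only [this]
    rw [integral_sub (hη.const_mul _) (hU.mul_const _), integral_const_mul, integral_mul_const, e1, mul_one]; rfl
  rw [e2]
  set Sg := ∑ b ∈ bd K, w ((x - b.2 * z s) / z s)
  have hs0 : 0 ≤ Sg := Finset.sum_nonneg fun _ _ => w_nn _
  calc _ ≤ ∫ y, (64 * C * B * Sg * (z s)⁻¹) * w ((y - x) / z s) := by
        refine norm_integral_le_of_norm_le ((w_int' hz x).const_mul _) (ae_of_all _ fun y => ?_)
        rw [norm_mul, norm_mul (((z s)⁻¹ : ℝ) : ℂ), Complex.norm_real, Real.norm_of_nonneg (inv_nonneg.2 hz.le), show (y - x) / z s = -((x-y)/z s) by ring, w_neg]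
        have k := key y
        have := w_nn ((x-y)/z s)
        calc _ ≤ ‖(us K s x - us K s y) * a‖ * ((z s)⁻¹ * (C * w ((x-y)/z s) ^ 5)) := by gcongr; exact hC _
          _ = (‖(us K s x - us K s y) * a‖ * w ((x-y)/z s) ^ 4) * ((z s)⁻¹ * C * w ((x-y)/z s)) := by ring
          _ ≤ (64 * B * Sg) * ((z s)⁻¹ * C * w ((x-y)/z s)) := by gcongr
          _ = _ := by ring
    _ = 64 * C * B * Sg * Real.pi := by rw [integral_const_mul, w_integral hz]; field_simp
    _ ≤ 64 * C * B * Sg * 4 := by gcongr; exact Real.pi_le_four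
    _ = _ := by ring

lemma chi_le {η : ℝ → ℂ} {C : ℝ} (hC : ∀ u, ‖η u‖ ≤ C * w u ^ 5) {K : Finset ℤ} {s : ℤ} (x : ℝ) :
    ‖chi η K s x‖ ≤ 4 ^ 5 * C * ∑ n ∈ K, w ((x - ctr s n) / z s) ^ 5 := by
  have hz := z_pos s
  have hC0 : 0 ≤ C := by have := (norm_nonneg _).trans (hC 0); simpa [w] using this
  have hi : ∀ n, Integrable fun y => (D s n).indicator (fun _ => (4 ^ 5 * C * w ((x - ctr s n) / z s) ^ 5) * (z s)⁻¹) y := fun n =>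
    (integrable_indicator_iff (D_meas s n)).2 (integrableOn_const (by rw [D_vol]; simp))
  calc _ ≤ ∫ y, ∑ n ∈ K, (D s n).indicator (fun _ => (4 ^ 5 * C * w ((x - ctr s n) / z s) ^ 5) * (z s)⁻¹) y := by
        refine norm_integral_le_of_norm_le (integrable_finsetSum _ fun n _ => hi n) (ae_of_all _ fun y => ?_)
        have hnn : ∀ n ∈ K, 0 ≤ (D s n).indicator (fun _ => (4 ^ 5 * C * w ((x - ctr s n) / z s) ^ 5) * (z s)⁻¹) y := fun n _ =>
          indicator_nonneg (fun _ _ => by have := w_nn ((x - ctr s n) / z s); positivity) _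
        unfold us; split_ifs with h
        · refine le_trans ?_ (Finset.single_le_sum hnn h)
          rw [indicator_of_mem (mem_D_idx s y), one_mul, norm_mul, Complex.norm_real, Real.norm_of_nonneg (inv_nonneg.2 hz.le), mul_comm]
          gcongr
          refine (hC _).trans ?_
          have := w_near' (u := (x - y) / z s) (v := (x - ctr s (idx s y)) / z s) 5 (by
            rw [show (x - y) / z s - (x - ctr s (idx s y)) / z s = (ctr s (idx s y) - y) / z s by ring]
            exact D_dist (ctr_mem s _) (mem_D_idx s y))
          calc _ ≤ C * (4 ^ 5 * w ((x - ctr s (idx s y)) / z s) ^ 5) := by gcongr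
            _ = _ := by ring
        · simpa using Finset.sum_nonneg hnn
    _ = _ := by
        rw [integral_finsetSum _ fun n _ => hi n, Finset.mul_sum]
        refine Finset.sum_congr rfl fun n _ => ?_
        rw [integral_indicator (D_meas s n), setIntegral_const, measureReal_def, D_vol, ENNReal.toReal_ofReal hz.le, smul_eq_mul]
        field_simp
end
end Car

namespace Car
noncomputable section
open FourierTransform ComplexConjugate
open scoped Classical

lemma adj {s n s' n' k : ℤ} (hk : k = n ∨ k = n + 1) (h : D s n ⊆ D s' n') (h' : ¬ D s (2 * k - 1 - n) ⊆ D s' n') :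
    (k * z s : ℝ) = n' * z s' ∨ (k * z s : ℝ) = (n' + 1) * z s' := by
  have hs := D_le h
  have hz := z_pos s
  have e : z s' = ((2 ^ (s' - s).toNat : ℕ) : ℝ) * z s := by
    nth_rw 1 [show s' = s + ((s' - s).toNat : ℤ) by omega]; rw [z_add, z_nat]; push_cast; ring
  set M : ℤ := ((2 ^ (s' - s).toNat : ℕ) : ℤ)
  have e : z s' = (M : ℝ) * z s := by rw [e]; simp [M]
  have sub : ∀ j, D s j ⊆ D s' n' ↔ n' * M ≤ j ∧ j < (n' + 1) * M := by
    intro j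
    have : D s j ⊆ D s' n' ↔ (j * z s : ℝ) ∈ D s' n' := ⟨fun h => h (D_left s j), fun h => D_sub hs (D_left s j) h⟩
    rw [this, D, mem_Ico, e, ← mul_assoc, ← mul_assoc, mul_le_mul_iff_left₀ hz, mul_lt_mul_iff_left₀ hz]
    norm_cast
  rw [sub] at h h'
  have : k = n' * M ∨ k = (n' + 1) * M := by rcases hk with rfl | rfl <;> [left; right] <;> omega
  rw [e]; rcases this with h | h <;> [left; right] <;> rw [h] <;> push_cast <;> ring

def Cvx (T : Finset Tile) : Prop := ∀ P ∈ T, ∀ R ∈ T, ∀ Q : Tile, P.le Q → Q.le R → Q ∈ T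
/-- lacunary positions at scale s -/
def KK (T : Finset Tile) (ξ : ℝ) (s : ℤ) : Finset ℤ := (T.filter fun P => ξ ∈ P.om2 ∧ P.s = s).image Tile.n
def SS (T : Finset Tile) (ξ : ℝ) : Finset ℤ := (T.filter fun P => ξ ∈ P.om2).image Tile.s

lemma om2_iff {P Q : Tile} {ξ : ℝ} (h : P.s = Q.s) (h1 : ξ ∈ P.om) (h2 : ξ ∈ Q.om) (h3 : ξ ∈ P.om2) : ξ ∈ Q.om2 := by
  rw [Tile.om, mem_D] at h1 h2
  rw [h] at h1
  have : P.m = Q.m := by rw [← h1, ← h2]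
  rwa [Tile.om2, ← h, ← this]

lemma mem_KK {T : Finset Tile} {ξ : ℝ} {s n : ℤ} (hT : ∀ P ∈ T, ξ ∈ P.om) : n ∈ KK T ξ s ↔
    (⟨s, n, idx (-s) ξ⟩ : Tile) ∈ T ∧ ξ ∈ (⟨s, n, idx (-s) ξ⟩ : Tile).om2 := by
  simp only [KK, Finset.mem_image, Finset.mem_filter]
  constructor
  · rintro ⟨P, ⟨h1, h2, rfl⟩, rfl⟩
    have := hT P h1; rw [Tile.om, mem_D] at this; rw [this]; exact ⟨h1, h2⟩
  · intro h; exact ⟨_, ⟨h.1, h.2, rfl⟩, rfl⟩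

lemma bcount {T : Finset Tile} {t : Top} (hT : ∀ P ∈ T, Down t P) (hC : Cvx T) :
    ∑ s ∈ SS T t.ξ, ∑ _b ∈ bd (KK T t.ξ s), z s ≤ 24 * z t.s := by
  have hm : ∀ s n, n ∈ KK T t.ξ s ↔ _ := fun s n => mem_KK fun P hP => (hT P hP).2
  set 𝓑 : Finset (ℤ × ℤ × ℤ) := (SS T t.ξ).biUnion fun s => (bd (KK T t.ξ s)).image fun b => (s, b)
  have e : ∑ s ∈ SS T t.ξ, ∑ _b ∈ bd (KK T t.ξ s), z s = ∑ B ∈ 𝓑, z B.1 := by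
    rw [Finset.sum_biUnion]
    · refine Finset.sum_congr rfl fun s _ => ?_
      rw [Finset.sum_image fun a _ b _ h => (Prod.ext_iff.1 h).2]
    · intro s _ s' _ h
      rw [Function.onFun, Finset.disjoint_left]; intro a ha hb
      simp only [Finset.mem_image] at ha hb
      obtain ⟨_, _, rfl⟩ := ha; obtain ⟨_, _, h'⟩ := hb; exact h (Prod.ext_iff.1 h').1.symm
  have hB : ∀ B ∈ 𝓑, (B.2.2 = B.2.1 ∨ B.2.2 = B.2.1 + 1) ∧ B.2.1 ∈ KK T t.ξ B.1 ∧ 2 * B.2.2 - 1 - B.2.1 ∉ KK T t.ξ B.1 := by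
    intro B hB
    simp only [𝓑, Finset.mem_biUnion, Finset.mem_image, bd, Finset.mem_filter, Finset.mem_product] at hB
    obtain ⟨s, _, b, ⟨⟨h1, _⟩, h2, h3⟩, rfl⟩ := hB; exact ⟨h2, h1, h3⟩
  have hJ : ∀ B ∈ 𝓑, D B.1 B.2.1 ⊆ D t.s t.n := fun B h => (hT _ ((hm _ _).1 (hB B h).2.1).1).1
  have big : D t.s t.n ⊆ Ico ((t.n - 1) * z t.s : ℝ) ((t.n + 2) * z t.s) := by
    have := z_pos t.s; apply Ico_subset_Ico <;> nlinarith
  let p : ℤ × ℤ × ℤ → Prop := fun B => ∃ P ∈ T, P.I ⊆ D B.1 (2 * B.2.2 - 1 - B.2.1)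
  let g : ℤ × ℤ × ℤ → ℤ × ℤ × ℤ := fun B => (B.1, 2 * B.2.2 - 1 - B.2.1, B.2.2)
  have gg : ∀ B, g (g B) = B := fun B => by ext <;> simp [g]
  have c1 : ∑ B ∈ 𝓑.filter p, z B.1 ≤ 12 * z t.s := by
    refine bdry_count _ (fun B h => (hB B (Finset.mem_filter.1 h).1).1) (a := t.n) (fun B h => (hJ B (Finset.mem_filter.1 h).1).trans big) ?_
    intro B h B' h' hs hsub
    rw [Finset.mem_filter] at h h'
    refine adj (hB B h.1).1 hsub fun hsub' => (hB B h.1).2.2 ?_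
    obtain ⟨P, hP, hPI⟩ := h.2
    have h1 := (hm _ _).1 (hB B h.1).2.1
    have h2 := (hm _ _).1 (hB B' h'.1).2.1
    rw [hm]
    have mm : ∀ n, t.ξ ∈ (⟨B.1, n, idx (-B.1) t.ξ⟩ : Tile).om := fun n => mem_D_idx _ _
    refine ⟨hC P hP _ h2.1 _ ?_ ?_, h1.2⟩
    · exact Tile.le_of (D_le hPI) (ctr_mem P.s P.n) (hPI (ctr_mem P.s P.n)) (hT P hP).2 (mm _)
    · exact Tile.le_of hs.le (ctr_mem _ _) (hsub' (ctr_mem _ _)) (mm _) (mem_D_idx _ _)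
  have c2 : ∑ B ∈ 𝓑.filter (¬ p ·), z B.1 ≤ 12 * z t.s := by
    rw [show ∑ B ∈ 𝓑.filter (¬ p ·), z B.1 = ∑ B ∈ (𝓑.filter (¬ p ·)).image g, z B.1 by
      rw [Finset.sum_image fun a _ b _ h => by rw [← gg a, h, gg]]]
    have hi : ∀ B, B ∈ (𝓑.filter (¬ p ·)).image g ↔ g B ∈ 𝓑 ∧ ¬ p (g B) := fun B => by
      rw [Finset.mem_image]; constructor
      · rintro ⟨A, h, rfl⟩; rw [gg]; exact Finset.mem_filter.1 h
      · intro h; exact ⟨g B, Finset.mem_filter.2 h, gg B⟩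
    refine bdry_count _ (fun B h => ?_) (a := t.n) (fun B h => ?_) ?_
    · have := (hB _ ((hi B).1 h).1).1; simp only [g] at this; omega
    · have h1 := hJ _ ((hi B).1 h).1
      have hs := D_le h1
      have h2 := (hB _ ((hi B).1 h).1).1
      simp only [g] at h1 h2 hs
      have hz := z_pos B.1
      have hz' := z_mono hs
      obtain ⟨l1, hr⟩ := (Ico_subset_Ico_iff (by linarith)).1 h1
      have e1 : (B.2.2 = 2 * B.2.2 - 1 - B.2.1) ∨ (B.2.2 = B.2.1) := by omega
      have g1 : ((t.n : ℝ) - 1) * z t.s ≤ B.2.1 * z B.1 ∧ (B.2.1 + 1 : ℝ) * z B.1 ≤ (t.n + 2) * z t.s := by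
        rcases e1 with e1 | e1
        · have : (B.2.1 : ℝ) = (2 * B.2.2 - 1 - B.2.1 : ℤ) - 1 := by exact_mod_cast (by omega : B.2.1 = 2 * B.2.2 - 1 - B.2.1 - 1)
          rw [this]; constructor <;> nlinarith
        · have : (B.2.1 : ℝ) = (2 * B.2.2 - 1 - B.2.1 : ℤ) + 1 := by rw [e1]; push_cast; ring
          rw [this]; constructor <;> nlinarith
      exact Ico_subset_Ico g1.1 g1.2
    · intro B h B' h' hs hsub
      have h1 := hB _ ((hi B).1 h).1
      simp only [g] at h1
      refine adj (by omega) hsub fun hsub' => ((hi B').1 h').2 ⟨_, ((hm _ _).1 h1.2.1).1, ?_⟩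
      simp only [g, Tile.I]; convert hsub' using 2; ring
  rw [e, ← Finset.sum_filter_add_sum_filter_not 𝓑 p]; linarith
end
end Car

namespace Car
noncomputable section
open FourierTransform ComplexConjugate
open scoped Classical

lemma F_md (h : ℝ → ℂ) {t : ℝ} (ht : 0 < t) (ξ ζ : ℝ) :
    𝓕 (fun x => ee (ξ * x) * (((t⁻¹ : ℝ) : ℂ) * h (x / t))) ζ = 𝓕 h (t * (ζ - ξ)) := by
  rw [F_eq, F_eq]
  have : ∀ y, ee (-(y * ζ)) * (ee (ξ * y) * (((t⁻¹ : ℝ) : ℂ) * h (y / t))) = ((t⁻¹ : ℝ) : ℂ) * (fun v => ee (-(v * (t * (ζ - ξ)))) * h v) (y / t) := fun y => by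
    have : ee (-(y / t * (t * (ζ - ξ)))) = ee (-(y * ζ)) * ee (ξ * y) := by rw [← ee_add]; congr 1; field_simp; ring
    simp only [this]; ring
  simp only [this]
  rw [integral_const_mul, Measure.integral_comp_div (fun v => ee (-(v * (t * (ζ - ξ)))) * h v) t, abs_of_pos ht, Complex.real_smul, ← mul_assoc, ← Complex.ofReal_mul, inv_mul_cancel₀ ht.ne', Complex.ofReal_one, one_mul]

lemma sum_KK {T : Finset Tile} {ξ : ℝ} (hT : ∀ P ∈ T, ξ ∈ P.om) (g : Tile → ℝ) :
    ∑ s ∈ SS T ξ, ∑ n ∈ KK T ξ s, g ⟨s, n, idx (-s) ξ⟩ = ∑ P ∈ T with ξ ∈ P.om2, g P := by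
  rw [← Finset.sum_fiberwise_of_maps_to (t := SS T ξ) (g := Tile.s) (fun P hP => Finset.mem_image_of_mem _ hP)]
  refine Finset.sum_congr rfl fun s _ => ?_
  have e : ∀ P ∈ T, (⟨P.s, P.n, idx (-P.s) ξ⟩ : Tile) = P := fun P hP => by
    have := hT P hP; rw [Tile.om, mem_D] at this; rw [this]
  rw [KK, Finset.filter_filter, Finset.sum_image]
  · refine Finset.sum_congr rfl fun P hP => ?_
    rw [Finset.mem_filter] at hP; rw [← hP.2.2, e P hP.1]
  · intro P hP Q hQ h
    simp only [Finset.coe_filter, mem_ofPred_eq] at hP hQ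
    rw [← e P hP.1, ← e Q hQ.1, h, hP.2.2, hQ.2.2]

lemma sq_int {K : Finset ℤ} {s : ℤ} (c : ℤ → ℝ) {h : ℝ → ℂ} {B : ℝ}
    (hh : ∀ x, ‖h x‖ ≤ B * ∑ n ∈ K, c n * w ((x - ctr s n) / z s) ^ 2) :
    ∫ x, ‖h x‖ ^ 2 ≤ 52 * B ^ 2 * ∑ n ∈ K, z s * c n ^ 2 := by
  have hz := z_pos s
  have hi : Integrable fun x => ∑ n ∈ K, B ^ 2 * 13 * c n ^ 2 * w ((x - ctr s n) / z s) :=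
    integrable_finsetSum _ fun n _ => (w_int' hz _).const_mul _
  calc _ ≤ ∫ x, ∑ n ∈ K, B ^ 2 * 13 * c n ^ 2 * w ((x - ctr s n) / z s) := by
        refine integral_mono_of_nonneg (ae_of_all _ fun x => by positivity) hi (ae_of_all _ fun x => ?_)
        have h1 : ‖h x‖ ^ 2 ≤ (B * ∑ n ∈ K, c n * w ((x - ctr s n) / z s) ^ 2) ^ 2 := by gcongr; exact hh x
        have h2 := Finset.sum_mul_sq_le_sq_mul_sq K (fun n => c n * w ((x - ctr s n) / z s)) (fun n => w ((x - ctr s n) / z s))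
        have h3 : ∑ n ∈ K, w ((x - ctr s n) / z s) ^ 2 ≤ 13 := by
          refine le_trans (Finset.sum_le_sum fun n _ => ?_) (w_sum_ctr K s x)
          exact pow_le_of_le_one (w_nn _) (w_le_one _) two_ne_zero
        have h4 : ∑ n ∈ K, (c n * w ((x - ctr s n) / z s)) ^ 2 ≤ ∑ n ∈ K, c n ^ 2 * w ((x - ctr s n) / z s) :=
          Finset.sum_le_sum fun n _ => by
            rw [mul_pow]; gcongr; exact pow_le_of_le_one (w_nn _) (w_le_one _) two_ne_zero
        have h5 : 0 ≤ ∑ n ∈ K, c n ^ 2 * w ((x - ctr s n) / z s) := Finset.sum_nonneg fun n _ => mul_nonneg (sq_nonneg _) (w_nn _)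
        have e : ∑ n ∈ K, B ^ 2 * 13 * c n ^ 2 * w ((x - ctr s n) / z s) = B ^ 2 * ((∑ n ∈ K, c n ^ 2 * w ((x - ctr s n) / z s)) * 13) := by
          rw [Finset.sum_mul, Finset.mul_sum]; exact Finset.sum_congr rfl fun _ _ => by ring
        simp only [e]
        refine h1.trans ?_
        rw [mul_pow]; gcongr
        simp only [mul_assoc, ← pow_two] at h2 ⊢
        refine h2.trans (mul_le_mul h4 h3 (Finset.sum_nonneg fun _ _ => sq_nonneg _) h5)
    _ = 13 * Real.pi * B ^ 2 * ∑ n ∈ K, z s * c n ^ 2 := by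
        rw [integral_finsetSum _ fun n _ => (w_int' hz _).const_mul _, Finset.mul_sum]
        refine Finset.sum_congr rfl fun n _ => ?_
        rw [integral_const_mul, w_integral hz]; ring
    _ ≤ _ := by
        have : 0 ≤ ∑ n ∈ K, z s * c n ^ 2 := Finset.sum_nonneg fun n _ => by positivity
        gcongr; linarith [Real.pi_le_four]

lemma lac {ψ : SchwartzMap ℝ ℂ} (hψ : Band ψ (-(7/16)) (-(1/16))) : ∃ C, 0 < C ∧ ∀ f : ℝ → ℂ, Integrable f →
    ∀ (T : Finset Tile) (ξ : ℝ), (∀ P ∈ T, ξ ∈ P.om) → ∃ F : ℤ → ℝ → ℂ, (Continuous fun y => ∑ s ∈ SS T ξ, F s y) ∧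
      (∫⁻ y, ‖∑ s ∈ SS T ξ, F s y‖ₑ ^ (2 : ℝ) ≤ ENNReal.ofReal (C * ∑ P ∈ T with ξ ∈ P.om2, z P.s * cP f P ^ 2)) ∧
      (∀ σ ∈ SS T ξ, ∀ x x', |x - x'| ≤ z σ → ‖∑ s ∈ SS T ξ with σ ≤ s, F s x‖ₑ ≤
        ENNReal.ofReal C * Mx (fun y => ‖∑ s ∈ SS T ξ, F s y‖ₑ) x') ∧
      ∀ e, (∀ P ∈ T, cP f P ≤ e) → ∀ s ∈ SS T ξ, ∀ x, ‖us (KK T ξ s) s x * aa ψ f s ξ x - F s x‖ ≤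
        C * e * ∑ b ∈ bd (KK T ξ s), w ((x - b.2 * z s) / z s) := by
  obtain ⟨Ca, hCa, Ha⟩ := aa_le hψ
  obtain ⟨η, hη1, hηB⟩ := bump_ex (r := 1/64) (R := 1/32) (by norm_num) (by norm_num)
  obtain ⟨Φ, hΦ1, hΦB⟩ := bump_ex (r := 15/32) (R := 1/2) (by norm_num) (by norm_num)
  obtain ⟨Ce, hCe, He⟩ := schw_decay η 5
  obtain ⟨Cp, hCp, Hp⟩ := schw_decay Φ 1
  set C := 256 * Ce * Ca + 52 * (4 ^ 5 * Ce * Ca) ^ 2 + 64 * Cp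
  refine ⟨C, by positivity, fun f hf T ξ hT => ?_⟩
  have hm : ∀ s n, n ∈ KK T ξ s ↔ _ := fun s n => mem_KK hT
  have ha : ∀ s, ∀ n ∈ KK T ξ s, ∀ x, ‖aa ψ f s ξ x‖ ≤ Ca * cP f ⟨s, n, idx (-s) ξ⟩ * (w ((x - ctr s n) / z s) ^ 3)⁻¹ := fun s n hn x =>
    (Ha f hf ⟨s, n, idx (-s) ξ⟩ ξ x ((hm s n).1 hn).2).1
  set F : ℤ → ℝ → ℂ := fun s x => chi η (KK T ξ s) s x * aa ψ f s ξ x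
  have hF : ∀ s x, ‖F s x‖ ≤ (4 ^ 5 * Ce * Ca) * ∑ n ∈ KK T ξ s, cP f ⟨s, n, idx (-s) ξ⟩ * w ((x - ctr s n) / z s) ^ 2 := by
    intro s x
    simp only [F]; rw [norm_mul]
    refine (mul_le_mul_of_nonneg_right (chi_le He x) (norm_nonneg _)).trans ?_
    rw [mul_assoc, Finset.sum_mul, mul_assoc (4 ^ 5 * Ce), Finset.mul_sum _ _ Ca]
    refine mul_le_mul_of_nonneg_left (Finset.sum_le_sum fun n hn => ?_) (by positivity)
    have hw := w_pos ((x - ctr s n) / z s)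
    calc _ ≤ w ((x - ctr s n) / z s) ^ 5 * (Ca * cP f ⟨s, n, idx (-s) ξ⟩ * (w ((x - ctr s n) / z s) ^ 3)⁻¹) := by gcongr; exact ha s n hn x
      _ = _ := by field_simp
  have hB : ∀ s, Band (F s) (ξ - 15/32 * z (-s)) (ξ - 1/32 * z (-s)) := by
    intro s
    have hz := z_pos s
    have hus : Integrable (us (KK T ξ s) s) := by
      have : Integrable fun y => ∑ n ∈ KK T ξ s, (D s n).indicator (fun _ => (1:ℝ)) y :=
        integrable_finsetSum _ fun n _ => (integrable_indicator_iff (D_meas s n)).2 (integrableOn_const (by rw [D_vol]; simp))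
      refine this.mono' (us_meas _ _).aestronglyMeasurable (ae_of_all _ fun y => ?_)
      have hnn : ∀ n ∈ KK T ξ s, 0 ≤ (D s n).indicator (fun _ => (1:ℝ)) y := fun n _ => indicator_nonneg (fun _ _ => zero_le_one) _
      unfold us; split_ifs with h
      · refine le_trans ?_ (Finset.single_le_sum hnn h); rw [indicator_of_mem (mem_D_idx s y)]; simp
      · simpa using Finset.sum_nonneg hnn
    have b1 := Band.conv hus ((hηB.dil hz).smul (((z s)⁻¹ : ℝ) : ℂ))
    have b2 := Band.conv hf (((hψ.dil hz).smul (((z s)⁻¹ : ℝ) : ℂ)).modul ξ)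
    have b3 := b1.mul b2
    refine Band.mono b3 ?_ ?_ <;> rw [z_neg] <;> ring_nf <;> rfl
  have hsep : ∀ s ∈ SS T ξ, ∀ t ∈ SS T ξ, s < t → s + 4 ≤ t := by
    intro s hs t ht h
    simp only [SS, Finset.mem_image, Finset.mem_filter] at hs ht
    obtain ⟨P, ⟨_, hP⟩, rfl⟩ := hs; obtain ⟨Q, ⟨_, hQ⟩, rfl⟩ := ht
    exact sep hP hQ h
  have z4 : ∀ {s t : ℤ}, s + 4 ≤ t → 16 * z (-t) ≤ z (-s) := fun {s t} h => by
    have := z_mono (show -t + 4 ≤ -s by omega)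
    rw [z_add] at this; simpa [z, mul_comm, show (2:ℝ) ^ (4:ℤ) = 16 by norm_num] using this
  have ho : ∀ s ∈ SS T ξ, ∀ t ∈ SS T ξ, s ≠ t → (ξ - 1/32 * z (-s)) ≤ (ξ - 15/32 * z (-t)) ∨ (ξ - 1/32 * z (-t)) ≤ (ξ - 15/32 * z (-s)) := by
    intro s hs t ht hst
    rcases lt_or_gt_of_ne hst with h | h
    · left; linarith [z4 (hsep s hs t ht h), z_pos (-t)]
    · right; linarith [z4 (hsep t ht s hs h), z_pos (-s)]
  have hcont : Continuous fun y => ∑ s ∈ SS T ξ, F s y := continuous_finsetSum _ fun s _ => (hB s).1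
  refine ⟨F, hcont, ?_, ?_, ?_⟩
  · obtain ⟨i, o⟩ := orth_sum (SS T ξ) F _ _ (fun s _ => hB s) ho
    have : ∀ y, ‖∑ s ∈ SS T ξ, F s y‖ₑ ^ (2 : ℝ) = ENNReal.ofReal (‖∑ s ∈ SS T ξ, F s y‖ ^ 2) := fun y => by
      rw [← ofReal_norm, ENNReal.ofReal_pow (norm_nonneg _)]; exact_mod_cast rfl
    simp only [this]
    rw [← ofReal_integral_eq_lintegral_ofReal i (ae_of_all _ fun _ => by positivity), o]
    refine ENNReal.ofReal_le_ofReal ?_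
    calc _ ≤ ∑ s ∈ SS T ξ, 52 * (4 ^ 5 * Ce * Ca) ^ 2 * ∑ n ∈ KK T ξ s, z s * cP f ⟨s, n, idx (-s) ξ⟩ ^ 2 :=
          Finset.sum_le_sum fun s _ => sq_int _ (hF s)
      _ = 52 * (4 ^ 5 * Ce * Ca) ^ 2 * ∑ P ∈ T with ξ ∈ P.om2, z P.s * cP f P ^ 2 := by
          rw [← Finset.mul_sum, sum_KK hT fun P => z P.s * cP f P ^ 2]
      _ ≤ _ := by
          refine mul_le_mul_of_nonneg_right ?_ (Finset.sum_nonneg fun P _ => mul_nonneg (z_nn _) (sq_nonneg _))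
          have : 0 < 256 * Ce * Ca := by positivity
          simp only [C]; linarith
  · intro σ hσ x x' hx
    have hz := z_pos σ
    set Ψ : ℝ → ℂ := fun u => ee (ξ * u) * ((((z σ)⁻¹ : ℝ) : ℂ) * Φ (u / z σ))
    have hΨ : Band Ψ _ _ := ((hΦB.dil hz).smul (((z σ)⁻¹ : ℝ) : ℂ)).modul ξ
    obtain ⟨cb, hcb⟩ := hΨ.bdd
    have hint : ∀ s, Integrable fun y => F s y * Ψ (x - y) := fun s =>
      (hB s).2.1.mul_bdd (c := cb) (hΨ.1.comp (continuous_const.sub continuous_id)).aestronglyMeasurable (ae_of_all _ fun y => hcb _)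
    have e : ∑ s ∈ SS T ξ with σ ≤ s, F s x = ∫ y, (∑ s ∈ SS T ξ, F s y) * Ψ (x - y) := by
      simp only [Finset.sum_mul]
      rw [integral_finsetSum _ fun s _ => hint s, Finset.sum_filter]
      refine Finset.sum_congr rfl fun s hs => ?_
      split_ifs with h
      · rw [(hB s).repr hΨ.2.1 (κ := 1), one_mul]
        intro ζ hζ
        rw [F_md _ hz, hΦ1]
        have h1 := z_mono (show -s ≤ -σ by omega)
        rw [abs_mul, abs_of_pos hz]
        calc z σ * |ζ - ξ| ≤ z σ * (15/32 * z (-σ)) := by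
              gcongr; rw [abs_le]; have := z_pos (-s); constructor <;> linarith [hζ.1, hζ.2]
          _ = 15/32 := by rw [z_neg]; field_simp
      · rw [(hB s).repr hΨ.2.1 (κ := 0), zero_mul]
        intro ζ hζ
        rw [F_md _ hz]
        refine hΦB.2.2 _ fun h' => ?_
        have h1 := z4 (hsep s hs σ hσ (not_le.1 h))
        have h2 := h'.1
        have : z σ * (ζ - ξ) ≤ z σ * (-(1/2) * z (-σ)) := by gcongr; linarith [hζ.2]
        rw [z_neg] at this; field_simp at this; linarith
    rw [e]
    refine (enorm_integral_le_lintegral_enorm _).trans ?_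
    calc _ ≤ ∫⁻ y, ENNReal.ofReal ((z σ)⁻¹ * Cp) * (‖∑ s ∈ SS T ξ, F s y‖ₑ * ENNReal.ofReal (w ((x - y) / z σ))) := by
          refine lintegral_mono fun y => ?_
          rw [enorm_mul, mul_left_comm, ← ENNReal.ofReal_mul (by positivity), ← ofReal_norm (Ψ _)]
          gcongr
          simp only [Ψ]
          rw [norm_mul, ee_norm, one_mul, norm_mul, Complex.norm_real, Real.norm_of_nonneg (by positivity), mul_assoc]
          gcongr; simpa using Hp ((x - y) / z σ)
      _ = ENNReal.ofReal ((z σ)⁻¹ * Cp) * ∫⁻ y, ‖∑ s ∈ SS T ξ, F s y‖ₑ * ENNReal.ofReal (w ((x - y) / z σ)) :=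
          lintegral_const_mul' _ _ ENNReal.ofReal_ne_top
      _ ≤ ENNReal.ofReal ((z σ)⁻¹ * Cp) * (ENNReal.ofReal (64 * z σ) * Mx (fun y => ‖∑ s ∈ SS T ξ, F s y‖ₑ) x') := by
          gcongr; exact w_le_Mx hcont.enorm.measurable hz hx
      _ = ENNReal.ofReal (64 * Cp) * Mx (fun y => ‖∑ s ∈ SS T ξ, F s y‖ₑ) x' := by
          rw [← mul_assoc, ← ENNReal.ofReal_mul (by positivity)]; congr 2; field_simp
      _ ≤ _ := by
          gcongr
          have : 0 < 256 * Ce * Ca := by positivity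
          have : 0 < 52 * (4 ^ 5 * Ce * Ca) ^ 2 := by positivity
          simp only [C]; linarith
  · intro e he s hs x
    have he0 : 0 ≤ e := by
      obtain ⟨P, hP, _⟩ := Finset.mem_image.1 hs
      exact (cP_nn f P).trans (he P (Finset.mem_filter.1 hP).1)
    refine (trunc (B := Ca * e) η.continuous He ?_ (fun n hn => (ha s n hn x).trans ?_) (by positivity)).trans ?_
    · have := hη1 0 (by norm_num); rw [F_eq] at this; simpa [ee_zero] using this
    · have := he _ ((hm s n).1 hn).1
      have := w_pos ((x - ctr s n) / z s)
      gcongr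
    · have h0 : 0 ≤ ∑ b ∈ bd (KK T ξ s), w ((x - b.2 * z s) / z s) := Finset.sum_nonneg fun _ _ => w_nn _
      have : 0 < 52 * (4 ^ 5 * Ce * Ca) ^ 2 := by positivity
      calc _ = (256 * Ce * Ca) * e * ∑ b ∈ bd (KK T ξ s), w ((x - b.2 * z s) / z s) := by ring
        _ ≤ _ := by gcongr; simp only [C]; linarith
end
end Car

namespace Car
noncomputable section
open FourierTransform ComplexConjugate
open scoped Classical

def TS (ψ f : ℝ → ℂ) (N : ℝ → ℝ) (T : Finset Tile) (x : ℝ) : ℂ :=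
  ∑ P ∈ T, if x ∈ P.I ∧ N x ∈ P.om2 then aa ψ f P.s (N x) x else 0

lemma tree_pt {ψ : SchwartzMap ℝ ℂ} (hψ : Band ψ (-(7/16)) (-(1/16))) : ∃ C, 0 < C ∧ ∀ f : ℝ → ℂ, Integrable f →
    ∀ (T : Finset Tile) (ξ : ℝ), (∀ P ∈ T, ξ ∈ P.om) → ∃ G : ℝ → ℂ, Continuous G ∧
      (∫⁻ y, ‖G y‖ₑ ^ (2 : ℝ) ≤ ENNReal.ofReal (C * ∑ P ∈ T with ξ ∈ P.om2, z P.s * cP f P ^ 2)) ∧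
      ∀ (N : ℝ → ℝ) (e : ℝ), 0 < e → (∀ P ∈ T, cP f P ≤ e) → ∀ j n x y, x ∈ D j n → y ∈ D j n → (∀ P ∈ T, ¬ P.I ⊆ D j n) →
      ‖TS ψ f N T x‖ₑ ≤ ENNReal.ofReal (C * e) + (ENNReal.ofReal (C * e * ∑ s ∈ SS T ξ, ∑ b ∈ bd (KK T ξ s), w ((y - b.2 * z s) / z s)) +
        ENNReal.ofReal C * Mx (fun y => ‖G y‖ₑ) y) := by
  obtain ⟨Ca, hCa, Ha⟩ := aa_le hψ
  obtain ⟨C1, hC1, H1⟩ := lac hψ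
  refine ⟨48 * Ca + 4 * C1, by positivity, fun f hf T ξ hT => ?_⟩
  obtain ⟨F, hc, hI, hHi, hEr⟩ := H1 f hf T ξ hT
  refine ⟨_, hc, hI.trans (ENNReal.ofReal_le_ofReal ?_), fun N e he0 he j n x y hx hy hJ => ?_⟩
  · refine mul_le_mul_of_nonneg_right (by linarith) (Finset.sum_nonneg fun P _ => mul_nonneg (z_nn _) (sq_nonneg _))
  have hm : ∀ s n, n ∈ KK T ξ s ↔ _ := fun s n => mem_KK hT
  have hw : ∀ P : Tile, x ∈ P.I → (w ((x - P.c) / z P.s) ^ 3)⁻¹ ≤ 8 := fun P h => by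
    rw [← inv_pow]
    have h1 : (w ((x - P.c) / z P.s))⁻¹ ≤ 2 := by
      have : ((x - P.c) / z P.s) ^ 2 ≤ 1 := by rw [sq_le_one_iff_abs_le_one]; exact D_dist h (ctr_mem _ _)
      rw [w, inv_inv]; linarith
    calc _ ≤ (2:ℝ) ^ 3 := by gcongr; exact inv_nonneg.2 (w_nn _)
      _ = 8 := by norm_num
  have hsc : ∀ P ∈ T, x ∈ P.I → j < P.s := fun P hP h => by
    by_contra h'; exact hJ P hP (D_sub (not_lt.1 h') h hx)
  have inj : ∀ P ∈ T, ∀ Q ∈ T, x ∈ P.I → x ∈ Q.I → P.s = Q.s → P = Q := fun P hP Q hQ h1 h2 h =>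
    Tile.eq_of h h1 h2 (hT P hP) (hT Q hQ)
  set X := T.filter fun P => x ∈ P.I ∧ N x ∈ P.om2
  have hX : ∀ {P}, P ∈ X → P ∈ T ∧ x ∈ P.I ∧ N x ∈ P.om2 := fun h => Finset.mem_filter.1 h
  have e0 : TS ψ f N T x = ∑ P ∈ X with ξ ∈ P.om2, aa ψ f P.s (N x) x + ∑ P ∈ X with ¬ ξ ∈ P.om2, aa ψ f P.s (N x) x := by
    rw [Finset.sum_filter_add_sum_filter_not, TS, Finset.sum_filter]
  have hcw : ∀ P ∈ X, Ca * cP f P * (w ((x - P.c) / z P.s) ^ 3)⁻¹ ≤ 8 * Ca * e := fun P hP => by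
    have h1 := hw P (hX hP).2.1
    have h2 := he P (hX hP).1
    have h3 := cP_nn f P
    calc _ ≤ Ca * e * 8 := by gcongr; exact inv_nonneg.2 (pow_nonneg (w_nn _) _)
      _ = _ := by ring
  -- nonlacunary
  have b1 : ‖∑ P ∈ X with ¬ ξ ∈ P.om2, aa ψ f P.s (N x) x‖ ≤ 32 * Ca * e := by
    set X' := X.filter fun P => ¬ ξ ∈ P.om2
    have card : X'.card ≤ 4 := by
      rcases X'.eq_empty_or_nonempty with h | h
      · simp [h]
      obtain ⟨P0, hP0, hmin⟩ := X'.exists_min_image Tile.s h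
      have : X'.card ≤ (Finset.Icc P0.s (P0.s + 3)).card := by
        refine Finset.card_le_card_of_injOn Tile.s (fun Q hQ => ?_) fun P hP Q hQ h => ?_
        · rw [Finset.mem_coe, Finset.mem_Icc]
          refine ⟨hmin Q hQ, ?_⟩
          by_contra h'
          obtain ⟨hQ1, hQ2⟩ := Finset.mem_filter.1 hQ
          obtain ⟨hp1, hp2⟩ := Finset.mem_filter.1 hP0
          exact hp2 (D_sub (by omega : -Q.s ≤ -P0.s - 4) (om2_sub Q (hX hQ1).2.2) (hX hp1).2.2 (hT Q (hX hQ1).1))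
        · have hP := (Finset.mem_filter.1 hP).1
          have hQ := (Finset.mem_filter.1 hQ).1
          exact inj P (hX hP).1 Q (hX hQ).1 (hX hP).2.1 (hX hQ).2.1 h
      rw [Int.card_Icc] at this; omega
    calc _ ≤ ∑ P ∈ X', 8 * Ca * e := norm_sum_le_of_le _ fun P hP => by
          have hP := (Finset.mem_filter.1 hP).1
          exact ((Ha f hf P _ x (hX hP).2.2).1).trans (hcw P hP)
      _ ≤ 4 * (8 * Ca * e) := by
          rw [Finset.sum_const, nsmul_eq_mul]; gcongr; exact_mod_cast card
      _ = _ := by ring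
  set L := X.filter fun P => ξ ∈ P.om2
  have hL : ∀ {P}, P ∈ L → P ∈ X ∧ ξ ∈ P.om2 := fun h => Finset.mem_filter.1 h
  set G : ℝ → ℂ := fun y => ∑ s ∈ SS T ξ, F s y
  set Sg := ∑ s ∈ SS T ξ, ∑ b ∈ bd (KK T ξ s), w ((y - b.2 * z s) / z s)
  have hSg : 0 ≤ Sg := Finset.sum_nonneg fun _ _ => Finset.sum_nonneg fun _ _ => w_nn _
  have b2 : ‖∑ P ∈ L, aa ψ f P.s (N x) x‖ₑ ≤ ENNReal.ofReal (16 * Ca * e) + (ENNReal.ofReal (4 * C1 * e * Sg) + ENNReal.ofReal (2 * C1) * Mx (fun y => ‖G y‖ₑ) y) := by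
    rcases L.eq_empty_or_nonempty with h | h
    · simp [h]
    obtain ⟨P0, hP0, hmax⟩ := L.exists_max_image Tile.s h
    set σ := P0.s
    obtain ⟨hp1, hp2⟩ := hL hP0
    have hNx : |N x - ξ| ≤ z (-σ) := (D_dist_lt (hX hp1).2.2 hp2).le.trans (z_mono (by omega))
    have c1 : ‖∑ P ∈ L, aa ψ f P.s (N x) x - ∑ P ∈ L, aa ψ f P.s ξ x‖ ≤ 16 * Ca * e := by
      rw [← Finset.sum_sub_distrib]
      calc _ ≤ ∑ P ∈ L, (8 * Ca * e * z (-σ)) * z P.s := norm_sum_le_of_le _ fun P hP => by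
            refine ((Ha f hf P _ x (hX (hL hP).1).2.2).2 ξ (hL hP).2).trans ?_
            refine (mul_le_mul (hcw P (hL hP).1) (mul_le_mul_of_nonneg_left hNx (z_nn _)) (by have := z_nn P.s; positivity) (by positivity)).trans (le_of_eq ?_)
            ring
        _ = (8 * Ca * e * z (-σ)) * ∑ s ∈ L.image Tile.s, z s := by
            rw [Finset.mul_sum, Finset.sum_image]
            intro P hP Q hQ h
            exact inj P (hX (hL hP).1).1 Q (hX (hL hQ).1).1 (hX (hL hP).1).2.1 (hX (hL hQ).1).2.1 h
        _ ≤ (8 * Ca * e * z (-σ)) * (2 * z σ) := by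
            have := z_nn (-σ)
            gcongr; exact z_sum _ fun s hs => by obtain ⟨P, hP, rfl⟩ := Finset.mem_image.1 hs; exact hmax P hP
        _ = _ := by rw [z_neg]; have := z_ne σ; field_simp; norm_num
    have c2 : ∑ P ∈ L, aa ψ f P.s ξ x = ∑ s ∈ SS T ξ with j < s ∧ s ≤ σ, us (KK T ξ s) s x * aa ψ f s ξ x := by
      have inL : ∀ P ∈ L, idx P.s x ∈ KK T ξ P.s := fun P hP => by
        rw [mem_D.1 (hX (hL hP).1).2.1]
        exact Finset.mem_image.2 ⟨P, Finset.mem_filter.2 ⟨(hX (hL hP).1).1, (hL hP).2, rfl⟩, rfl⟩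
      have : ∑ P ∈ L, aa ψ f P.s ξ x = ∑ s ∈ L.image Tile.s, us (KK T ξ s) s x * aa ψ f s ξ x := by
        rw [Finset.sum_image]
        · refine Finset.sum_congr rfl fun P hP => ?_
          rw [us, if_pos (inL P hP), one_mul]
        · intro P hP Q hQ h
          exact inj P (hX (hL hP).1).1 Q (hX (hL hQ).1).1 (hX (hL hP).1).2.1 (hX (hL hQ).1).2.1 h
      rw [this]
      refine Finset.sum_subset (fun s hs => ?_) fun s hs hs' => ?_
      · obtain ⟨P, hP, rfl⟩ := Finset.mem_image.1 hs
        exact Finset.mem_filter.2 ⟨Finset.mem_image.2 ⟨P, Finset.mem_filter.2 ⟨(hX (hL hP).1).1, (hL hP).2⟩, rfl⟩, hsc P (hX (hL hP).1).1 (hX (hL hP).1).2.1, hmax P hP⟩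
      · rw [us, if_neg, zero_mul]
        intro hk
        obtain ⟨h1, h2⟩ := (hm _ _).1 hk
        refine hs' (Finset.mem_image.2 ⟨_, Finset.mem_filter.2 ⟨Finset.mem_filter.2 ⟨h1, mem_D_idx s x, ?_⟩, h2⟩, rfl⟩)
        have := (Finset.mem_filter.1 hs).2.2
        exact D_sub (by simp only []; omega) hp2 h2 (hX hp1).2.2
    have c3 : ∀ k, j ≤ k → ‖∑ s ∈ SS T ξ with k < s, F s x‖ₑ ≤ ENNReal.ofReal C1 * Mx (fun y => ‖G y‖ₑ) y := by
      intro k hk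
      rcases ((SS T ξ).filter fun s => k < s).eq_empty_or_nonempty with h | h
      · simp [h]
      obtain ⟨s0, hs0, hmin⟩ := Finset.exists_min_image _ id h
      rw [Finset.mem_filter] at hs0
      have : (SS T ξ).filter (fun s => k < s) = (SS T ξ).filter fun s => s0 ≤ s := Finset.filter_congr fun s hs =>
        ⟨fun h' => hmin s (Finset.mem_filter.2 ⟨hs, h'⟩), fun h' => hs0.2.trans_le h'⟩
      rw [this]
      exact hHi s0 hs0.1 x y ((D_dist_lt hx hy).le.trans (z_mono (by omega)))
    have c4 : ∑ s ∈ SS T ξ with j < s ∧ s ≤ σ, F s x = ∑ s ∈ SS T ξ with j < s, F s x - ∑ s ∈ SS T ξ with σ < s, F s x := by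
      have hj : j < σ := hsc P0 (hX hp1).1 (hX hp1).2.1
      rw [eq_sub_iff_add_eq, ← Finset.sum_union]
      · refine Finset.sum_congr ?_ fun _ _ => rfl
        ext s; simp only [Finset.mem_union, Finset.mem_filter]; constructor
        · rintro (h | h) <;> exact ⟨h.1, by omega⟩
        · intro h; rcases le_or_gt s σ with h' | h'
          · exact Or.inl ⟨h.1, h.2, h'⟩
          · exact Or.inr ⟨h.1, h'⟩
      · rw [Finset.disjoint_filter]; intro s _ h; omega
    have c5 : ‖∑ s ∈ SS T ξ with j < s ∧ s ≤ σ, us (KK T ξ s) s x * aa ψ f s ξ x - ∑ s ∈ SS T ξ with j < s ∧ s ≤ σ, F s x‖ ≤ 4 * C1 * e * Sg := by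
      rw [← Finset.sum_sub_distrib]
      calc _ ≤ ∑ s ∈ SS T ξ with j < s ∧ s ≤ σ, 4 * C1 * e * ∑ b ∈ bd (KK T ξ s), w ((y - b.2 * z s) / z s) := norm_sum_le_of_le _ fun s hs => by
            rw [Finset.mem_filter] at hs
            refine (hEr e he s hs.1 x).trans ?_
            have : ∑ b ∈ bd (KK T ξ s), w ((x - b.2 * z s) / z s) ≤ 4 * ∑ b ∈ bd (KK T ξ s), w ((y - b.2 * z s) / z s) := by
              rw [Finset.mul_sum]; exact Finset.sum_le_sum fun b _ => w_D' hx hy _ hs.2.1.le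
            calc _ ≤ C1 * e * (4 * ∑ b ∈ bd (KK T ξ s), w ((y - b.2 * z s) / z s)) := by gcongr
              _ = _ := by ring
        _ ≤ ∑ s ∈ SS T ξ, 4 * C1 * e * ∑ b ∈ bd (KK T ξ s), w ((y - b.2 * z s) / z s) :=
            Finset.sum_le_sum_of_subset_of_nonneg (Finset.filter_subset _ _) fun s _ _ =>
              mul_nonneg (by positivity) (Finset.sum_nonneg fun _ _ => w_nn _)
        _ = _ := by rw [← Finset.mul_sum]
    set a := ∑ P ∈ L, aa ψ f P.s (N x) x
    set b := ∑ s ∈ SS T ξ with j < s ∧ s ≤ σ, us (KK T ξ s) s x * aa ψ f s ξ x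
    set c := ∑ s ∈ SS T ξ with j < s ∧ s ≤ σ, F s x
    rw [c2] at c1
    rw [show a = (a - b) + ((b - c) + c) by ring]
    refine (enorm_add_le _ _).trans (add_le_add ?_ ((enorm_add_le _ _).trans (add_le_add ?_ ?_)))
    · rw [← ofReal_norm]; exact ENNReal.ofReal_le_ofReal c1
    · rw [← ofReal_norm]; exact ENNReal.ofReal_le_ofReal c5
    · rw [c4, ENNReal.ofReal_mul two_pos.le, ENNReal.ofReal_ofNat, mul_assoc, two_mul]
      exact enorm_sub_le.trans (add_le_add (c3 j le_rfl) (c3 σ (hsc P0 (hX hp1).1 (hX hp1).2.1).le))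
  have b1' := ENNReal.ofReal_le_ofReal b1
  rw [ofReal_norm] at b1'
  rw [e0]
  refine (enorm_add_le _ _).trans ((add_le_add b2 b1').trans ?_)
  rw [add_right_comm, ← ENNReal.ofReal_add (by positivity) (by positivity)]
  gcongr <;> nlinarith [mul_pos hCa he0, mul_pos hC1 he0]
end
end Car

namespace Car
noncomputable section
open FourierTransform ComplexConjugate
open scoped Classical

lemma tree_lemma {ψ : SchwartzMap ℝ ℂ} (hψ : Band ψ (-(7/16)) (-(1/16))) : ∃ C : ℝ≥0∞, C ≠ ∞ ∧ ∀ f : ℝ → ℂ, Integrable f →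
    ∀ (T : Finset Tile) (t : Top) (N : ℝ → ℝ) (E : Set ℝ) (e μ : ℝ), (∀ P ∈ T, Down t P) → Cvx T → Measurable N → MeasurableSet E →
    0 < e → (∀ P ∈ T, cP f P ≤ e) → ∑ P ∈ T with t.ξ ∈ P.om2, z P.s * cP f P ^ 2 ≤ e ^ 2 * z t.s → (∀ P ∈ T, Mass E N P μ) →
    ∫⁻ x in E, ‖TS ψ f N T x‖ₑ ≤ C * ENNReal.ofReal (e * μ * z t.s) := by
  obtain ⟨C, hC, H⟩ := tree_pt hψ
  set CM : ℝ≥0∞ := 8 * e2 2 * e2 (2 - 1) * gs (2 - 1)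
  have hCM : CM ≠ ∞ := by
    have := gs_ne_top (a := 2 - 1) (by norm_num)
    simp only [CM, e2]; finiteness
  refine ⟨2 * (ENNReal.ofReal (98 * C) + ENNReal.ofReal C * (CM * ENNReal.ofReal C)), by finiteness, ?_⟩
  intro f hf T t N E e μ hT hcv hN hE he hce hS hmass
  have hT' : ∀ P ∈ T, t.ξ ∈ P.om := fun P hP => (hT P hP).2
  rcases T.eq_empty_or_nonempty with h0 | ⟨P1, hP1⟩
  · simp [h0, TS]
  have hzt := z_pos t.s
  obtain ⟨G, hGc, hG2, hG⟩ := H f hf T t.ξ hT'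
  set Sg : ℝ → ℝ := fun y => ∑ s ∈ SS T t.ξ, ∑ b ∈ bd (KK T t.ξ s), w ((y - b.2 * z s) / z s)
  set A : Set ℝ := E ∩ ⋃ P ∈ T, {x | x ∈ P.I ∧ N x ∈ P.om2}
  have hA : MeasurableSet A := hE.inter (Finset.measurableSet_biUnion _ fun P _ => (D_meas _ _).inter (hN (D_meas _ _)))
  have hAP : ∀ x ∈ A, x ∈ E ∧ ∃ P ∈ T, x ∈ P.I ∧ N x ∈ P.om2 := fun x hx => ⟨hx.1, by obtain ⟨P, hP, h⟩ := mem_iUnion₂.1 hx.2; exact ⟨P, hP, h⟩⟩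
  have r1 : ∫⁻ x in E, ‖TS ψ f N T x‖ₑ ≤ ∫⁻ x in A, ‖TS ψ f N T x‖ₑ := by
    rw [← lintegral_indicator hE, ← lintegral_indicator hA]
    refine lintegral_mono fun x => ?_
    by_cases hx : x ∈ A
    · rw [indicator_of_mem hx]; exact indicator_le_self _ _ _
    · by_cases hxE : x ∈ E
      · rw [indicator_of_mem hxE, TS, Finset.sum_eq_zero]; · simp
        intro P hP; rw [if_neg]; intro h; exact hx ⟨hxE, mem_iUnion₂.2 ⟨P, hP, h⟩⟩
      · rw [indicator_of_notMem hxE]; exact zero_le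
  set 𝒥 : Set (ℤ × ℤ) := {J | (∀ P ∈ T, ¬ P.I ⊆ D J.1 J.2) ∧ ∃ x ∈ D J.1 J.2, ∃ P ∈ T, P.I ⊆ D (J.1 + 1) (idx (J.1 + 1) x)}
  have hd : 𝒥.PairwiseDisjoint fun J => D J.1 J.2 := by
    have key : ∀ J ∈ 𝒥, ∀ J' ∈ 𝒥, J.1 < J'.1 → Disjoint (D J.1 J.2) (D J'.1 J'.2) := by
      rintro J ⟨_, x, hx, P, hP, hPI⟩ J' ⟨h', _⟩ h
      rcases D_cases (n := J.2) (m := J'.2) h.le with h1 | h1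
      · exact absurd (hPI.trans (D_sub (by omega) (mem_D_idx _ x) (h1 hx))) (h' P hP)
      · exact h1
    intro J hJ J' hJ' hne
    rcases lt_trichotomy J.1 J'.1 with h | h | h
    · exact key J hJ J' hJ' h
    · simp only [Function.onFun, h]; exact D_disj fun h' => hne (Prod.ext h h')
    · exact (key J' hJ' J hJ h).symm
  have hcov : A ⊆ ⋃ J ∈ 𝒥, D J.1 J.2 := by
    intro x hx
    obtain ⟨_, P, hP, hxP, _⟩ := hAP x hx
    obtain ⟨P2, hP2, hmin⟩ := T.exists_min_image Tile.s ⟨P1, hP1⟩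
    obtain ⟨j, hj, hj'⟩ : ∃ j : ℤ, (∃ P ∈ T, P.I ⊆ D j (idx j x)) ∧ ∀ k, (∃ P ∈ T, P.I ⊆ D k (idx k x)) → j ≤ k :=
      Int.exists_least_of_bdd (P := fun k => ∃ P ∈ T, P.I ⊆ D k (idx k x)) ⟨P2.s, fun k ⟨Q, hQ, hs⟩ => (hmin Q hQ).trans (D_le hs)⟩
        ⟨P.s, P, hP, by rw [mem_D.1 hxP]; exact le_rfl⟩
    refine mem_iUnion₂.2 ⟨(j - 1, idx (j - 1) x), ⟨fun Q hQ hs => ?_, x, mem_D_idx _ _, ?_⟩, mem_D_idx _ _⟩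
    · have := hj' (j - 1) ⟨Q, hQ, hs⟩; omega
    · simpa using hj
  have hin : ∀ J ∈ 𝒥, ∀ x ∈ A ∩ D J.1 J.2, ∃ P ∈ T, J.1 < P.s ∧ x ∈ P.I ∧ N x ∈ P.om2 := by
    rintro J ⟨hJ, _⟩ x ⟨hx, hxJ⟩
    obtain ⟨_, P, hP, h1, h2⟩ := hAP x hx
    refine ⟨P, hP, ?_, h1, h2⟩
    by_contra h; exact hJ P hP (D_sub (not_lt.1 h) h1 hxJ)
  have hm : ∀ J ∈ 𝒥, volume (A ∩ D J.1 J.2) ≤ ENNReal.ofReal (2 * μ) * volume (D J.1 J.2) := by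
    rintro J hJ
    obtain ⟨x0, hx0, P0, hP0, hPI⟩ := hJ.2
    set Q : Tile := ⟨J.1 + 1, idx (J.1 + 1) x0, idx (-(J.1 + 1)) t.ξ⟩
    have hle : P0.le Q := Tile.le_of (D_le hPI) (ctr_mem _ _) (hPI (ctr_mem P0.s P0.n)) (hT' P0 hP0) (mem_D_idx _ _)
    have h1 := hmass P0 hP0 Q hle
    refine (measure_mono fun x hx => ?_).trans (h1.trans (le_of_eq ?_))
    · obtain ⟨P, hP, h2, h3, h4⟩ := hin J hJ x hx
      refine ⟨hx.1.1, D_sub (by omega) hx0 (mem_D_idx (J.1 + 1) x0) hx.2, D_sub (s := -P.s) (n := P.m) (by simp only [Q]; omega) (hT' P hP) (mem_D_idx _ _) (om2_sub P h4)⟩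
    · rw [D_vol, ← ENNReal.ofReal_mul' (z_nn _), z_succ]; congr 1; ring
  set h : ℝ → ℝ≥0∞ := fun y => (t.J).indicator (fun _ => ENNReal.ofReal (2 * C * e)) y + (ENNReal.ofReal (C * e * Sg y) +
    ENNReal.ofReal C * (ENNReal.ofReal e⁻¹ * Mx (fun y => ‖G y‖ₑ) y ^ (2:ℝ)))
  have hg : ∀ J ∈ 𝒥, ∀ x ∈ A ∩ D J.1 J.2, ∀ y ∈ D J.1 J.2, ‖TS ψ f N T x‖ₑ ≤ h y := by
    intro J hJ x hx y hy
    obtain ⟨P, hP, h2, h3, h4⟩ := hin J hJ x hx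
    have hyt : y ∈ t.J := (hT P hP).1 (D_sub h2.le hx.2 h3 hy)
    refine (hG N e he hce J.1 J.2 x y hx.2 hy hJ.1).trans ?_
    simp only [h]; rw [indicator_of_mem hyt]
    set M := Mx (fun y => ‖G y‖ₑ) y
    have hM : M ≤ ENNReal.ofReal e + ENNReal.ofReal e⁻¹ * M ^ (2:ℝ) := by
      rcases le_total M (ENNReal.ofReal e) with h | h
      · exact h.trans le_self_add
      · refine le_trans ?_ le_add_self
        calc M = ENNReal.ofReal e⁻¹ * (ENNReal.ofReal e * M) := by
              rw [← mul_assoc, ← ENNReal.ofReal_mul (by positivity), inv_mul_cancel₀ he.ne', ENNReal.ofReal_one, one_mul]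
          _ ≤ ENNReal.ofReal e⁻¹ * (M * M) := by gcongr
          _ = _ := by rw [show (2:ℝ) = ((2:ℕ):ℝ) by norm_num, ENNReal.rpow_natCast, pow_two]
    calc _ ≤ ENNReal.ofReal (C * e) + (ENNReal.ofReal (C * e * Sg y) + ENNReal.ofReal C * (ENNReal.ofReal e + ENNReal.ofReal e⁻¹ * M ^ (2:ℝ))) := by gcongr
      _ = _ := by
        rw [mul_assoc 2 C e, two_mul, ENNReal.ofReal_add (by positivity) (by positivity), ENNReal.ofReal_mul (p := C) (q := e) hC.le]; ring
  have hSgi : Integrable Sg := integrable_finsetSum _ fun s _ => integrable_finsetSum _ fun b _ => w_int' (z_pos s) _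
  have hSg0 : ∀ y, 0 ≤ Sg y := fun y => Finset.sum_nonneg fun _ _ => Finset.sum_nonneg fun _ _ => w_nn _
  have i2 : ∫⁻ y, ENNReal.ofReal (C * e * Sg y) ≤ ENNReal.ofReal (96 * C * e * z t.s) := by
    rw [← ofReal_integral_eq_lintegral_ofReal (hSgi.const_mul _) (ae_of_all _ fun y => by have := hSg0 y; positivity), integral_const_mul]
    refine ENNReal.ofReal_le_ofReal ?_
    have : ∫ y, Sg y = Real.pi * ∑ s ∈ SS T t.ξ, ∑ _b ∈ bd (KK T t.ξ s), z s := by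
      simp only [Sg]
      rw [integral_finsetSum _ fun s _ => integrable_finsetSum _ fun b _ => w_int' (z_pos s) _, Finset.mul_sum]
      refine Finset.sum_congr rfl fun s _ => ?_
      rw [integral_finsetSum _ fun b _ => w_int' (z_pos s) _, Finset.mul_sum]
      refine Finset.sum_congr rfl fun b _ => ?_
      rw [w_integral (z_pos s), mul_comm]
    rw [this]
    calc _ ≤ C * e * (4 * (24 * z t.s)) := by gcongr; exacts [Finset.sum_nonneg fun _ _ => Finset.sum_nonneg fun _ _ => z_nn _, Real.pi_le_four, bcount hT hcv]
      _ = _ := by ring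
  have i3 : ∫⁻ y, Mx (fun y => ‖G y‖ₑ) y ^ (2:ℝ) ≤ CM * ENNReal.ofReal (C * (e ^ 2 * z t.s)) := by
    refine (Mx_strong (by norm_num) hGc.enorm.measurable).trans ?_
    gcongr
    refine hG2.trans (ENNReal.ofReal_le_ofReal ?_); gcongr
  have i1 : ∫⁻ y, (t.J).indicator (fun _ => ENNReal.ofReal (2 * C * e)) y = ENNReal.ofReal (2 * C) * ENNReal.ofReal (e * z t.s) := by
    rw [lintegral_indicator (show MeasurableSet t.J from D_meas _ _), setLIntegral_const, Top.J, D_vol, ← ENNReal.ofReal_mul (by positivity), ← ENNReal.ofReal_mul (by positivity)]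
    congr 1; ring
  have hh : ∫⁻ y, h y ≤ (ENNReal.ofReal (98 * C) + ENNReal.ofReal C * (CM * ENNReal.ofReal C)) * ENNReal.ofReal (e * z t.s) := by
    simp only [h]
    rw [lintegral_add_left (measurable_const.indicator (show MeasurableSet t.J from D_meas _ _)), lintegral_add_left (by exact (ENNReal.measurable_ofReal.comp (by simp only [Sg]; fun_prop))), i1,
      lintegral_const_mul' _ _ ENNReal.ofReal_ne_top, lintegral_const_mul' _ _ ENNReal.ofReal_ne_top]
    calc _ ≤ ENNReal.ofReal (2 * C) * ENNReal.ofReal (e * z t.s) + (ENNReal.ofReal (96 * C * e * z t.s) + ENNReal.ofReal C * (ENNReal.ofReal e⁻¹ * (CM * ENNReal.ofReal (C * (e ^ 2 * z t.s))))) := by gcongr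
      _ = _ := by
        rw [show 96 * C * e * z t.s = (96 * C) * (e * z t.s) by ring, show 98 * C = 2 * C + 96 * C by ring, ENNReal.ofReal_mul (p := 96 * C) (by positivity),
          ENNReal.ofReal_mul (p := C) (q := e ^ 2 * z t.s) hC.le, show e ^ 2 * z t.s = e * (e * z t.s) by ring, ENNReal.ofReal_mul (p := e) (q := e * z t.s) he.le, ENNReal.ofReal_add (by positivity) (by positivity)]
        have : ENNReal.ofReal e⁻¹ * ENNReal.ofReal e = 1 := by rw [← ENNReal.ofReal_mul (by positivity), inv_mul_cancel₀ he.ne', ENNReal.ofReal_one]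
        calc _ = ENNReal.ofReal (2 * C) * ENNReal.ofReal (e * z t.s) + (ENNReal.ofReal (96 * C) * ENNReal.ofReal (e * z t.s) + ENNReal.ofReal C * (CM * (ENNReal.ofReal C * ((ENNReal.ofReal e⁻¹ * ENNReal.ofReal e) * ENNReal.ofReal (e * z t.s))))) := by ring
          _ = _ := by rw [this]; ring
  refine r1.trans ((cover_lemma 𝒥 hd hA hcov hm hg).trans ((mul_le_mul_right hh _).trans ?_))
  rcases le_total 0 μ with hμ | hμ
  · rw [show e * μ * z t.s = μ * (e * z t.s) by ring, ENNReal.ofReal_mul hμ, ENNReal.ofReal_mul two_pos.le, ENNReal.ofReal_ofNat]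
    calc _ = 2 * (ENNReal.ofReal (98 * C) + ENNReal.ofReal C * (CM * ENNReal.ofReal C)) * (ENNReal.ofReal μ * ENNReal.ofReal (e * z t.s)) := by ring
      _ ≤ _ := le_rfl
  · rw [ENNReal.ofReal_of_nonpos (p := 2 * μ) (by linarith)]; simp
end
end Car

namespace Car
noncomputable section
open FourierTransform ComplexConjugate
open scoped Classical

lemma z_abs_sum (S : Finset ℤ) (k : ℤ) : ∑ s ∈ S, z (-|s - k|) ≤ 4 := by
  rw [← Finset.sum_filter_add_sum_filter_not S (fun s => s ≤ k)]
  have h1 : ∑ s ∈ S with s ≤ k, z (-|s - k|) ≤ 2 := by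
    have := z_sum ({s ∈ S | s ≤ k}.image fun s => s - k) (t := 0) (by intro s hs; simp only [Finset.mem_image, Finset.mem_filter] at hs; omega)
    rw [Finset.sum_image (fun _ _ _ _ h => by have : _ - _ = _ - _ := h; omega), z_zero] at this
    refine le_trans (le_of_eq (Finset.sum_congr rfl fun s hs => ?_)) (this.trans (by norm_num))
    congr 1; have := (Finset.mem_filter.1 hs).2; rw [abs_of_nonpos] <;> omega
  have h2 : ∑ s ∈ S with ¬ s ≤ k, z (-|s - k|) ≤ 2 := by
    have := z_sum ({s ∈ S | ¬ s ≤ k}.image fun s => k - s) (t := 0) (by intro s hs; simp only [Finset.mem_image, Finset.mem_filter] at hs; omega)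
    rw [Finset.sum_image (fun _ _ _ _ h => by have : _ - _ = _ - _ := h; omega), z_zero] at this
    refine le_trans (le_of_eq (Finset.sum_congr rfl fun s hs => ?_)) (this.trans (by norm_num))
    congr 1; have := (Finset.mem_filter.1 hs).2; rw [abs_of_nonneg] <;> omega
  linarith

lemma lac_sum {T : Finset Tile} {ξ : ℝ} (hT : ∀ P ∈ T, ξ ∈ P.om2) (y : ℝ) (k : ℤ) :
    ∑ P ∈ T, z (-|P.s - k|) * w ((y - P.c) / z P.s) ≤ 52 := by
  rw [← Finset.sum_fiberwise_of_maps_to (g := Tile.s) (t := T.image Tile.s) (fun P hP => Finset.mem_image_of_mem _ hP)]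
  calc _ ≤ ∑ s ∈ T.image Tile.s, z (-|s - k|) * 13 := by
        refine Finset.sum_le_sum fun s _ => ?_
        calc _ = z (-|s - k|) * ∑ P ∈ T with P.s = s, w ((y - P.c) / z P.s) := by
              rw [Finset.mul_sum]; refine Finset.sum_congr rfl fun P hP => ?_
              rw [(Finset.mem_filter.1 hP).2]
          _ ≤ _ := mul_le_mul_of_nonneg_left (tile_sum _ (s := s) (m := idx (-s) ξ) y fun P hP => by
              rw [Finset.mem_filter] at hP
              refine ⟨hP.2, ?_⟩
              have := mem_D.1 (om2_sub P (hT P hP.1)); rw [hP.2] at this; exact this.symm) (z_nn _)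
    _ ≤ _ := by rw [← Finset.sum_mul]; linarith [z_abs_sum (T.image Tile.s) k]

lemma bad_sum {T : Finset Tile} {t : Top} (hT : ∀ P ∈ T, P.I ⊆ t.J ∧ t.ξ ∈ P.om2) {ν : ℝ → ℝ≥0∞} (hν : Measurable ν)
    {σ : ℝ → ℤ} {l K : ℝ} (hl : 0 ≤ l) (hK : 0 ≤ K) (hx : ∀ P ∈ T, ∃ x ∈ P.I, Mx ν x ≤ ENNReal.ofReal l)
    (hσ : Measurable σ) {d : Tile → ℝ} (hd0 : ∀ P, 0 ≤ d P)
    (hd : ∀ P ∈ T, ENNReal.ofReal (d P) ≤ ∫⁻ y, ν y * ENNReal.ofReal (K * ((z P.s)⁻¹ * z (-|P.s - σ y|) * w ((y - P.c) / z P.s) ^ 2))) :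
    ∑ P ∈ T, z P.s * d P ^ 2 ≤ 2 ^ 20 * K ^ 2 * l ^ 2 * z t.s := by
  have h1 : ∀ P ∈ T, d P ≤ 64 * K * l := by
    intro P hP
    have hz := z_pos P.s
    obtain ⟨x, hxP, hxl⟩ := hx P hP
    rw [← ENNReal.ofReal_le_ofReal_iff (by positivity)]
    calc _ ≤ ∫⁻ y, ENNReal.ofReal (K * (z P.s)⁻¹) * (ν y * ENNReal.ofReal (w ((P.c - y) / z P.s))) := by
          refine (hd P hP).trans (lintegral_mono fun y => ?_)
          rw [mul_left_comm (ENNReal.ofReal _), ← ENNReal.ofReal_mul (by positivity)]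
          refine mul_le_mul_right (ENNReal.ofReal_le_ofReal ?_) _
          have w0 := w_nn ((y - P.c) / z P.s)
          have e : w ((P.c - y) / z P.s) = w ((y - P.c) / z P.s) := by rw [← w_neg]; congr 1; ring
          have h1 : z (-|P.s - σ y|) ≤ 1 := by rw [← z_zero]; exact z_mono (by simp)
          rw [e, mul_assoc K, mul_assoc (z P.s)⁻¹]
          refine mul_le_mul_of_nonneg_left (mul_le_mul_of_nonneg_left ?_ (inv_pos.2 hz).le) hK
          nlinarith [w_sq_le ((y - P.c) / z P.s), z_pos (-|P.s - σ y|)]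
      _ ≤ ENNReal.ofReal (K * (z P.s)⁻¹) * (ENNReal.ofReal (64 * z P.s) * ENNReal.ofReal l) := by
          rw [lintegral_const_mul' _ _ ENNReal.ofReal_ne_top]
          gcongr
          refine (w_le_Mx hν hz (x' := x) ?_).trans (by gcongr)
          have := D_dist (ctr_mem P.s P.n) hxP
          rwa [abs_div, abs_of_pos hz, div_le_one hz] at this
      _ = _ := by
          rw [← ENNReal.ofReal_mul (by positivity), ← ENNReal.ofReal_mul (by positivity)]
          congr 1; field_simp
  rcases T.eq_empty_or_nonempty with h0 | ⟨P0, hP0⟩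
  · rw [h0, Finset.sum_empty]; have := z_pos t.s; positivity
  have hzt := z_pos t.s
  set c := ctr t.s t.n
  have hwm : ∀ P : Tile, Measurable fun y => ν y * ENNReal.ofReal (K * (z (-|P.s - σ y|) * w ((y - P.c) / z P.s) ^ 2)) := fun P => by
    have : Measurable fun y => z (-|P.s - σ y|) := (measurable_from_top (f := fun k : ℤ => z (-|P.s - k|))).comp hσ
    fun_prop
  have h2 : ∑ P ∈ T, z P.s * d P ≤ 13312 * K * l * z t.s := by
    rw [← ENNReal.ofReal_le_ofReal_iff (by positivity), ENNReal.ofReal_sum_of_nonneg fun P _ => mul_nonneg (z_nn _) (hd0 P)]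
    calc _ ≤ ∑ P ∈ T, ∫⁻ y, ν y * ENNReal.ofReal (K * (z (-|P.s - σ y|) * w ((y - P.c) / z P.s) ^ 2)) := by
          refine Finset.sum_le_sum fun P hP => ?_
          rw [ENNReal.ofReal_mul (z_nn _)]
          refine (mul_le_mul_right (hd P hP) _).trans ?_
          rw [← lintegral_const_mul' _ _ ENNReal.ofReal_ne_top]
          refine lintegral_mono fun y => le_of_eq ?_
          rw [mul_left_comm, ← ENNReal.ofReal_mul (z_nn _)]
          congr 2; have := z_ne P.s; field_simp
      _ = ∫⁻ y, ∑ P ∈ T, ν y * ENNReal.ofReal (K * (z (-|P.s - σ y|) * w ((y - P.c) / z P.s) ^ 2)) :=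
          (lintegral_finsetSum _ fun P _ => hwm P).symm
      _ ≤ ∫⁻ y, ENNReal.ofReal (208 * K) * (ν y * ENNReal.ofReal (w ((c - y) / z t.s))) := by
          refine lintegral_mono fun y => ?_
          rw [← Finset.mul_sum, mul_left_comm, ← ENNReal.ofReal_mul (by positivity), ← ENNReal.ofReal_sum_of_nonneg fun P _ => by
            have := z_pos (-|P.s - σ y|); positivity]
          gcongr
          have e : w ((c - y) / z t.s) = w ((y - c) / z t.s) := by rw [← w_neg]; congr 1; ring
          have w0 := w_nn ((y - c) / z t.s)
          rw [e, ← Finset.mul_sum, mul_comm 208 K, mul_assoc]; gcongr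
          calc _ ≤ ∑ P ∈ T, z (-|P.s - σ y|) * w ((y - P.c) / z P.s) * (4 * w ((y - c) / z t.s)) := by
                refine Finset.sum_le_sum fun P hP => ?_
                have w1 := w_nn ((y - P.c) / z P.s)
                have hz := z_pos P.s
                rw [pow_two, ← mul_assoc]
                refine mul_le_mul_of_nonneg_left ?_ (mul_nonneg (z_nn _) w1)
                refine le_trans (w_anti ?_) (w_D ((hT P hP).1 (ctr_mem P.s P.n)) (ctr_mem t.s t.n) y le_rfl)
                · rw [abs_div, abs_div, abs_of_pos hz, abs_of_pos hzt]; exact div_le_div_of_nonneg_left (abs_nonneg _) hz (z_mono (D_le (hT P hP).1))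
            _ ≤ _ := by
                rw [← Finset.sum_mul]
                have := lac_sum (fun P hP => (hT P hP).2) y (σ y)
                nlinarith
      _ ≤ ENNReal.ofReal (208 * K) * (ENNReal.ofReal (64 * z t.s) * ENNReal.ofReal l) := by
          rw [lintegral_const_mul' _ _ ENNReal.ofReal_ne_top]
          gcongr
          obtain ⟨x, hxP, hxl⟩ := hx P0 hP0
          refine (w_le_Mx hν hzt (x' := x) ?_).trans (by gcongr)
          have := D_dist (ctr_mem t.s t.n) ((hT P0 hP0).1 hxP)
          rwa [abs_div, abs_of_pos hzt, div_le_one hzt] at this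
      _ = _ := by
          rw [← ENNReal.ofReal_mul (by positivity), ← ENNReal.ofReal_mul (by positivity)]
          congr 1; ring
  calc _ ≤ ∑ P ∈ T, (64 * K * l) * (z P.s * d P) := Finset.sum_le_sum fun P hP => by
        have := h1 P hP; have := mul_nonneg (z_nn P.s) (hd0 P); nlinarith
    _ ≤ (64 * K * l) * (13312 * K * l * z t.s) := by rw [← Finset.mul_sum]; gcongr
    _ ≤ _ := by have : 0 ≤ K ^ 2 * l ^ 2 * z t.s := by positivity
                nlinarith

lemma cP_add {f g : ℝ → ℂ} (hf : Integrable f) (hg : Integrable g) (P : Tile) : cP (fun y => f y + g y) P ≤ cP f P + cP g P := by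
  refine csSup_le ⟨_, _, W_zero P, rfl⟩ ?_
  rintro _ ⟨φ, H, rfl⟩
  have hb : ∀ {f : ℝ → ℂ}, Integrable f → Integrable fun y => f y * conj (φ y) := fun hf =>
    hf.mul_bdd (c := (z P.s)⁻¹) (Complex.continuous_conj.comp H.1.1).aestronglyMeasurable (ae_of_all _ fun y => by
      rw [RCLike.norm_conj]; refine (H.2.1 y).trans ?_
      have := z_pos P.s; have := pow_le_one₀ (n := 3) (w_nn ((y - P.c) / z P.s)) (w_le_one _)
      nlinarith [inv_pos.2 (z_pos P.s)])
  simp only [add_mul]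
  rw [integral_add (hb hf) (hb hg)]
  exact (norm_add_le _ _).trans (add_le_add (H.le hf) (H.le hg))

lemma cP_sq {f g : ℝ → ℂ} (hf : Integrable f) (hg : Integrable g) (T : Finset Tile) :
    ∑ P ∈ T, z P.s * cP (fun y => f y + g y) P ^ 2 ≤ 2 * ∑ P ∈ T, z P.s * cP f P ^ 2 + 2 * ∑ P ∈ T, z P.s * cP g P ^ 2 := by
  rw [Finset.mul_sum, Finset.mul_sum, ← Finset.sum_add_distrib]
  refine Finset.sum_le_sum fun P _ => ?_
  have h1 := cP_add hf hg P
  have h2 := cP_nn (fun y => f y + g y) P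
  have h3 : cP (fun y => f y + g y) P ^ 2 ≤ 2 * cP f P ^ 2 + 2 * cP g P ^ 2 := by
    nlinarith [cP_nn f P, cP_nn g P, sq_nonneg (cP f P - cP g P)]
  nlinarith [z_pos P.s]

lemma Mx_const (a : ℝ≥0∞) (x : ℝ) : Mx (fun _ => a) x ≤ a := by
  refine iSup_le fun c => iSup_le fun r => iSup_le fun hx => ?_
  rw [setLIntegral_const, Real.volume_ball]
  exact ENNReal.div_le_of_le_mul le_rfl

lemma size_a {f : ℝ → ℂ} (hf : Integrable f) {A : ℝ} (hA : ∀ y, ‖f y‖ ≤ A) {T : Finset Tile} {t : Top}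
    (hT : ∀ P ∈ T, P.I ⊆ t.J ∧ t.ξ ∈ P.om2) : ∑ P ∈ T, z P.s * cP f P ^ 2 ≤ 2 ^ 24 * A ^ 2 * z t.s := by
  have hA0 : 0 ≤ A := (norm_nonneg _).trans (hA 0)
  have hzt := z_pos t.s
  set c := ctr t.s t.n
  set B := Icc (c - 2 * z t.s) (c + 2 * z t.s)
  have hB : MeasurableSet B := measurableSet_Icc
  have hBv : volume B = ENNReal.ofReal (4 * z t.s) := by rw [Real.volume_Icc]; congr 1; ring
  have i1 := hf.indicator hB
  have i2 := hf.indicator hB.compl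
  have e : f = fun y => B.indicator f y + Bᶜ.indicator f y := by
    funext y; by_cases h : y ∈ B <;> simp [h]
  have j1 : Integrable fun y => B.indicator (fun _ => A ^ 2) y := (integrable_indicator_iff hB).2 (integrableOn_const (by rw [hBv]; exact ENNReal.ofReal_ne_top))
  have hle : ∀ y, ‖B.indicator f y‖ ^ 2 ≤ B.indicator (fun _ => A ^ 2) y := fun y => by
    by_cases h : y ∈ B
    · simp only [indicator_of_mem h]; gcongr; exact hA y
    · simp [h]
  have j2 : Integrable fun y => ‖B.indicator f y‖ ^ 2 := j1.mono' (i1.aestronglyMeasurable.norm.pow 2) (ae_of_all _ fun y => by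
    rw [Real.norm_of_nonneg (by positivity)]; exact hle y)
  have n1 : ∑ P ∈ T, z P.s * cP (B.indicator f) P ^ 2 ≤ 676 * (A ^ 2 * (4 * z t.s)) := by
    have g := gram2 T i1 j2 (l := 338) (by norm_num)
    have hoff : ∑ P ∈ T, ∑ Q ∈ T with Off P Q, z Q.s * cP (B.indicator f) P * cP (B.indicator f) Q * w ((P.c - Q.c) / z P.s) ^ 2 = 0 := by
      refine Finset.sum_eq_zero fun P hP => ?_
      rw [Finset.filter_false_of_mem, Finset.sum_empty]
      intro Q hQ h
      exact (om12_lt (P := Q) (h.2 (om2_sub P (hT P hP).2)) (hT Q hQ).2).false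
    have hi : ∫ y, ‖B.indicator f y‖ ^ 2 ≤ A ^ 2 * (4 * z t.s) := by
      refine (integral_mono j2 j1 hle).trans (le_of_eq ?_)
      rw [integral_indicator_const _ hB, Measure.real, hBv, ENNReal.toReal_ofReal (by positivity), smul_eq_mul, mul_comm]
    rw [hoff] at g
    linarith
  have n2 : ∑ P ∈ T, z P.s * cP (Bᶜ.indicator f) P ^ 2 ≤ 2 ^ 20 * 2 ^ 2 * A ^ 2 * z t.s := by
    refine bad_sum hT (ν := fun _ => ENNReal.ofReal A) (σ := fun _ => t.s) measurable_const hA0 (by norm_num)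
      (fun P _ => ⟨_, ctr_mem P.s P.n, Mx_const _ _⟩) measurable_const (cP_nn _) fun P hP => ?_
    obtain ⟨φ, hφ, r, hr, hcr⟩ := cP_ex (Bᶜ.indicator f) P
    have hz := z_pos P.s
    calc _ ≤ 2 * ‖∫ y, Bᶜ.indicator f y * conj (φ y)‖ₑ := by
          rw [hr, ← ofReal_norm, ← ENNReal.ofReal_ofNat, ← ENNReal.ofReal_mul (by norm_num), Complex.norm_real]
          exact ENNReal.ofReal_le_ofReal (hcr.trans (by gcongr; exact le_abs_self r))
      _ ≤ 2 * ∫⁻ y, ‖Bᶜ.indicator f y * conj (φ y)‖ₑ := by gcongr; exact enorm_integral_le_lintegral_enorm _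
      _ = ∫⁻ y, 2 * ‖Bᶜ.indicator f y * conj (φ y)‖ₑ := (lintegral_const_mul' _ _ (by simp)).symm
      _ ≤ _ := by
          refine lintegral_mono fun y => ?_
          rw [← ofReal_norm, ← ENNReal.ofReal_ofNat, ← ENNReal.ofReal_mul (by norm_num), ← ENNReal.ofReal_mul hA0]
          refine ENNReal.ofReal_le_ofReal ?_
          have w0 := w_nn ((y - P.c) / z P.s)
          have := z_pos (-|P.s - t.s|)
          by_cases hy : y ∈ B
          · simp only [indicator_of_notMem (show y ∉ Bᶜ by simpa using hy)]; simp; positivity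
          · rw [indicator_of_mem (show y ∈ Bᶜ from hy), norm_mul, RCLike.norm_conj]
            have hs := D_le (hT P hP).1
            have hc := D_dist (ctr_mem t.s t.n) ((hT P hP).1 (ctr_mem P.s P.n))
            rw [abs_div, abs_of_pos hzt, div_le_one hzt] at hc
            have hy' : z t.s ≤ |y - P.c| := by
              have : 2 * z t.s ≤ |y - c| := by
                by_contra! h; rw [abs_lt] at h; exact hy ⟨by linarith, by linarith⟩
              have h2 := abs_sub_le y P.c c
              rw [abs_sub_comm P.c c] at h2
              change |c - P.c| ≤ _ at hc; linarith
            have hw : w ((y - P.c) / z P.s) ≤ z (-|P.s - t.s|) := by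
              rw [abs_of_nonpos (by omega), neg_neg, z_sub]
              have hu : z t.s / z P.s ≤ |(y - P.c) / z P.s| := by rw [abs_div, abs_of_pos hz]; gcongr
              have h0 : 0 < z t.s / z P.s := by positivity
              unfold w
              rw [← inv_div (z t.s)]
              gcongr
              nlinarith [sq_abs ((y - P.c) / z P.s), abs_nonneg ((y - P.c) / z P.s)]
            calc _ ≤ 2 * (A * ((z P.s)⁻¹ * w ((y - P.c) / z P.s) ^ 3)) := by gcongr; exacts [hA y, hφ.2.1 y]
              _ = A * (2 * ((z P.s)⁻¹ * w ((y - P.c) / z P.s) * w ((y - P.c) / z P.s) ^ 2)) := by ring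
              _ ≤ _ := by gcongr
  rw [e]
  refine (cP_sq i1 i2 T).trans ?_
  have : 0 ≤ A ^ 2 * z t.s := by positivity
  nlinarith
end
end Car

namespace Car
noncomputable section
open FourierTransform ComplexConjugate
open scoped Classical

lemma idx_meas {σ : ℝ → ℤ} (hσ : Measurable σ) : Measurable fun y => idx (σ y) y :=
  Int.measurable_floor.comp (measurable_id.div ((measurable_from_top (f := z)).comp hσ))

lemma z_small {r : ℝ} (hr : 0 < r) : ∃ k : ℤ, z k < r := by
  obtain ⟨n, hn⟩ := exists_pow_lt_of_lt_one hr (y := (1/2:ℝ)) (by norm_num)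
  exact ⟨-n, by simpa [z] using hn⟩
lemma z_large (r : ℝ) : ∃ k : ℤ, r < z k := by
  obtain ⟨n, hn⟩ := pow_unbounded_of_one_lt r (show (1:ℝ) < 2 by norm_num)
  exact ⟨n, by simpa [z] using hn⟩

lemma whitney {O : Set ℝ} (hO : IsOpen O) {x0 : ℝ} (hx0 : x0 ∉ O) : ∃ σ : ℝ → ℤ, Measurable σ ∧
    ∀ y ∈ O, (∀ v ∈ D (σ y) (idx (σ y) y), v ∈ O ∧ σ v = σ y) ∧ (∀ x ∉ O, z (σ y) ≤ |x - y|) ∧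
      ∃ x ∉ O, ∀ v ∈ D (σ y) (idx (σ y) y), |x - v| < 4 * z (σ y) := by
  set Gd : ℤ → ℤ → Prop := fun k n => ∀ v ∈ D k n, ∀ x ∉ O, z k ≤ |x - v|
  have mono : ∀ {j k : ℤ} {y : ℝ}, j ≤ k → Gd k (idx k y) → Gd j (idx j y) := fun {j k y} h H v hv x hx =>
    (z_mono h).trans (H v (D_sub h (mem_D_idx j y) (mem_D_idx k y) hv) x hx)
  have ex : ∀ y, ∃ k, y ∈ O → Gd k (idx k y) ∧ ¬ Gd (k + 1) (idx (k + 1) y) := by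
    intro y
    by_cases hy : y ∈ O
    swap; · exact ⟨0, fun h => absurd h hy⟩
    obtain ⟨r, hr, hb⟩ := Metric.isOpen_iff.1 hO y hy
    obtain ⟨k1, hk1⟩ := z_small (half_pos hr)
    obtain ⟨k2, hk2⟩ := z_large |x0 - y|
    obtain ⟨k, hk, hk'⟩ : ∃ k : ℤ, Gd k (idx k y) ∧ ∀ j, Gd j (idx j y) → j ≤ k := by
      refine Int.exists_greatest_of_bdd ⟨k2, fun j hj => ?_⟩ ⟨k1, fun v hv x hx => ?_⟩
      · by_contra! h
        exact absurd (hj y (mem_D_idx _ _) x0 hx0) (not_le.2 (hk2.trans (z_lt h)))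
      · have h1 := D_dist hv (mem_D_idx k1 y)
        rw [abs_div, abs_of_pos (z_pos k1), div_le_one (z_pos k1)] at h1
        have h2 : r ≤ |x - y| := by by_contra! h; exact hx (hb (by rwa [Metric.mem_ball, Real.dist_eq]))
        linarith [abs_sub_le x v y]
    exact ⟨k, fun _ => ⟨hk, fun h => by have := hk' _ h; omega⟩⟩
  choose σ0 hσ0 using ex
  set σ : ℝ → ℤ := fun y => if y ∈ O then σ0 y else 0
  have hσ : ∀ y ∈ O, Gd (σ y) (idx (σ y) y) ∧ ¬ Gd (σ y + 1) (idx (σ y + 1) y) := fun y hy => by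
    simp only [σ, if_pos hy]; exact hσ0 y hy
  have uniq : ∀ y ∈ O, ∀ k, Gd k (idx k y) → ¬ Gd (k + 1) (idx (k + 1) y) → σ y = k := fun y hy k h1 h2 => by
    obtain ⟨h3, h4⟩ := hσ y hy
    rcases lt_trichotomy (σ y) k with h | h | h
    · exact absurd (mono (by omega) h1) h4
    · exact h
    · exact absurd (mono (by omega) h3) h2
  refine ⟨σ, measurable_to_countable' fun k => ?_, fun y hy => ⟨fun v hv => ?_, fun x hx => (hσ y hy).1 y (mem_D_idx _ _) x hx, ?_⟩⟩
  · have hm : ∀ k, Measurable (idx k) := fun k => idx_meas (σ := fun _ => k) measurable_const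
    have e : σ ⁻¹' {k} = (O ∩ (idx k ⁻¹' {n | Gd k n} ∩ idx (k + 1) ⁻¹' {n | ¬ Gd (k + 1) n})) ∪ (Oᶜ ∩ {_y | 0 = k}) := by
      ext y
      by_cases hy : y ∈ O
      · simp only [mem_preimage, mem_singleton_iff, mem_union, mem_inter_iff, hy, mem_compl_iff, not_true, false_and, or_false, true_and]
        exact ⟨fun h => h ▸ hσ y hy, fun h => uniq y hy k h.1 h.2⟩
      · simp [σ, hy]
    rw [e]
    exact (hO.measurableSet.inter ((hm _ .of_discrete).inter (hm _ .of_discrete))).union (hO.measurableSet.compl.inter (MeasurableSet.const _))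
  · have hvO : v ∈ O := by
      by_contra h; have := (hσ y hy).1 v hv v h; simp at this; exact absurd this (not_le.2 (z_pos _))
    refine ⟨hvO, uniq v hvO _ ?_ ?_⟩
    · rw [mem_D.1 hv]; exact (hσ y hy).1
    · have : v ∈ D (σ y + 1) (idx (σ y + 1) y) := D_sub (by omega) (mem_D_idx _ y) (mem_D_idx _ y) hv
      rw [mem_D.1 this]; exact (hσ y hy).2
  · obtain ⟨h1, h2⟩ := hσ y hy
    simp only [Gd] at h2; push Not at h2
    obtain ⟨v, hv, x, hx, h⟩ := h2
    refine ⟨x, hx, fun v' hv' => ?_⟩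
    have h3 := D_dist hv (D_sub (by omega) (mem_D_idx _ y) (mem_D_idx (σ y + 1) y) hv')
    rw [abs_div, abs_of_pos (z_pos _), div_le_one (z_pos _)] at h3
    rw [z_succ] at h h3
    linarith [abs_sub_le x v v']

lemma Mx_ae {F : Set ℝ} (hF : MeasurableSet F) : ∀ᵐ x, x ∈ F → 1 / 2 ≤ Mx (F.indicator 1) x := by
  filter_upwards [Besicovitch.ae_tendsto_measure_inter_div_of_measurableSet volume hF] with x hx hxF
  simp only [indicator_of_mem hxF, Pi.one_apply] at hx
  have h2 : Tendsto (fun r => volume (F ∩ Metric.closedBall x r) / volume (Metric.closedBall x r) / 2) (𝓝[>] 0) (𝓝 (1 / 2)) :=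
    ENNReal.Tendsto.div_const hx (by simp)
  refine le_of_tendsto h2 ?_
  filter_upwards [self_mem_nhdsWithin] with r hr
  have hr : 0 < r := hr
  refine le_trans ?_ (Mx_ge _ (c := x) (r := 2 * r) (Metric.mem_ball_self (by positivity)))
  rw [lintegral_indicator hF]
  simp only [Pi.one_apply, setLIntegral_const, one_mul, Measure.restrict_restrict hF, Real.volume_closedBall]
  rw [ENNReal.div_eq_inv_mul, ENNReal.div_eq_inv_mul, ENNReal.div_eq_inv_mul, ← mul_assoc, ENNReal.ofReal_mul (p := 2) (q := 2 * r) (by norm_num), ENNReal.mul_inv (by simp) (by simp), ENNReal.ofReal_ofNat]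
  refine mul_le_mul_right ?_ _
  exact measure_mono (inter_subset_inter_right _ (Metric.closedBall_subset_ball (by linarith)))

lemma osc {P : Tile} {φ : ℝ → ℂ} (hφ : W P φ) {ξ : ℝ} (hξ : ξ ∈ P.om2) {k n : ℤ} {x y v : ℝ} (hx : x ∈ P.I)
    (hy : y ∈ D k n) (hv : v ∈ D k n) (hxy : z k ≤ |x - y|) (hxv : z k ≤ |x - v|) :
    ‖ee (-(ξ * y)) * φ y - ee (-(ξ * v)) * φ v‖ ≤ 730 * ((z P.s)⁻¹ * z (-|P.s - k|) * w ((y - P.c) / z P.s) ^ 2) := by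
  have hz := z_pos P.s
  have hk := z_pos k
  have hyv := D_dist hy hv
  rw [abs_div, abs_of_pos hk, div_le_one hk] at hyv
  have wy := w_nn ((y - P.c) / z P.s)
  have wy1 := w_le_one ((y - P.c) / z P.s)
  have wv := w_nn ((v - P.c) / z P.s)
  rcases le_or_gt k P.s with h | h
  · have hw : w ((v - P.c) / z P.s) ≤ 4 * w ((y - P.c) / z P.s) := w_D' hv hy _ h
    obtain ⟨h1, h2⟩ := mem_om2 hξ
    set δ := ξ - P.m / z P.s
    have hδ : |δ * (v - y)| ≤ z (k - P.s) := by
      have : |δ| ≤ 1 / z P.s := by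
        have e : δ = (ξ * z P.s - P.m) / z P.s := by simp only [δ]; field_simp
        rw [e, abs_div, abs_of_pos hz]; gcongr; rw [abs_of_nonneg (by linarith)]; linarith
      rw [abs_mul, z_sub, abs_sub_comm v y]
      calc _ ≤ 1 / z P.s * z k := by gcongr
        _ = _ := by ring
    have e : ∀ y, ee (-(ξ * y)) = ee (-(δ * y)) * ee (-(P.m / z P.s * y)) := fun y => by rw [← ee_add]; congr 1; simp only [δ]; ring
    rw [e, e, mul_assoc, mul_assoc, show |P.s - k| = P.s - k from abs_of_nonneg (by omega), neg_sub]
    set A := ee (-(P.m / z P.s * y)) * φ y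
    set B := ee (-(P.m / z P.s * v)) * φ v
    have hA : ‖A‖ ≤ (z P.s)⁻¹ * w ((y - P.c) / z P.s) ^ 3 := by simp only [A]; rw [norm_mul, ee_norm, one_mul]; exact hφ.2.1 y
    have hAB : ‖A - B‖ ≤ (z P.s)⁻¹ * z (k - P.s) * (65 * w ((y - P.c) / z P.s) ^ 3) := by
      refine (hφ.2.2 y v).trans ?_
      rw [z_sub]
      have : w ((v - P.c) / z P.s) ^ 3 ≤ (4 * w ((y - P.c) / z P.s)) ^ 3 := by gcongr
      gcongr; nlinarith
    have e2 : ee (-(δ * y)) * A - ee (-(δ * v)) * B = (ee (-(δ * y)) - ee (-(δ * v))) * A + ee (-(δ * v)) * (A - B) := by ring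
    rw [e2]
    have h3 : ‖ee (-(δ * y)) - ee (-(δ * v))‖ ≤ 7 * z (k - P.s) := (ee_sub _ _).trans (by
      rw [show -(δ * y) - -(δ * v) = δ * (v - y) by ring]; gcongr)
    have hzk := z_pos (k - P.s)
    calc _ ≤ 7 * z (k - P.s) * ((z P.s)⁻¹ * w ((y - P.c) / z P.s) ^ 3) + (z P.s)⁻¹ * z (k - P.s) * (65 * w ((y - P.c) / z P.s) ^ 3) := by
          refine (norm_add_le _ _).trans (add_le_add ?_ ?_)
          · rw [norm_mul]; gcongr
          · rw [norm_mul, ee_norm, one_mul]; exact hAB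
      _ = (z P.s)⁻¹ * z (k - P.s) * w ((y - P.c) / z P.s) ^ 2 * (72 * w ((y - P.c) / z P.s)) := by ring
      _ ≤ (z P.s)⁻¹ * z (k - P.s) * w ((y - P.c) / z P.s) ^ 2 * 730 := by gcongr; linarith
      _ = _ := by ring
  · have hkk : 2 * z P.s ≤ z k := by rw [← z_succ]; exact z_mono (by omega)
    have hxc := D_dist hx (ctr_mem P.s P.n)
    rw [abs_div, abs_of_pos hz, div_le_one hz] at hxc
    change |x - P.c| ≤ _ at hxc
    have y1 : z k / 2 ≤ |y - P.c| := by
      have := abs_sub_le x P.c y; rw [abs_sub_comm P.c y] at this; linarith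
    have v1 : z k / 2 ≤ |v - P.c| := by
      have := abs_sub_le x P.c v; rw [abs_sub_comm P.c v] at this; linarith
    have hw : w ((v - P.c) / z P.s) ≤ 9 * w ((y - P.c) / z P.s) := by
      have h1 : |y - P.c| ≤ 3 * |v - P.c| := by linarith [abs_sub_le y v P.c]
      have h2 : ((y - P.c) / z P.s) ^ 2 ≤ 9 * ((v - P.c) / z P.s) ^ 2 := by
        rw [div_pow, div_pow, ← sq_abs, ← sq_abs (v - P.c), ← mul_div_assoc]; gcongr
        nlinarith [abs_nonneg (y - P.c)]
      unfold w
      rw [← div_eq_mul_inv, inv_eq_one_div, div_le_div_iff₀ (by positivity) (by positivity)]; nlinarith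
    have hwz : w ((y - P.c) / z P.s) ≤ z (P.s - k) := by
      rw [z_sub, ← inv_div (z k)]
      have hu : z k / z P.s ≤ 2 * |(y - P.c) / z P.s| := by rw [abs_div, abs_of_pos hz, ← mul_div_assoc]; gcongr; linarith
      unfold w; gcongr
      nlinarith [sq_abs ((y - P.c) / z P.s), sq_nonneg (|(y - P.c) / z P.s| - 1)]
    rw [show |P.s - k| = k - P.s from by rw [abs_of_neg] <;> omega, neg_sub]
    calc _ ≤ (z P.s)⁻¹ * w ((y - P.c) / z P.s) ^ 3 + (z P.s)⁻¹ * (9 * w ((y - P.c) / z P.s)) ^ 3 := by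
          refine (norm_sub_le _ _).trans (add_le_add ?_ ?_)
          · rw [norm_mul, ee_norm, one_mul]; exact hφ.2.1 y
          · rw [norm_mul, ee_norm, one_mul]; refine (hφ.2.1 v).trans (by gcongr)
      _ = 730 * ((z P.s)⁻¹ * w ((y - P.c) / z P.s) * w ((y - P.c) / z P.s) ^ 2) := by ring
      _ ≤ _ := by gcongr

lemma size_b {f : ℝ → ℂ} (hf : Measurable f) {F : Set ℝ} (hF : MeasurableSet F) (hFv : volume F ≠ ∞) (hfF : ∀ y, ‖f y‖ₑ ≤ F.indicator 1 y)
    {l : ℝ} (hl : 0 < l) {T : Finset Tile} {t : Top}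
    (hT : ∀ P ∈ T, P.I ⊆ t.J ∧ t.ξ ∈ P.om2) (hx : ∀ P ∈ T, ∃ x ∈ P.I, Mx (F.indicator 1) x ≤ ENNReal.ofReal l) :
    ∑ P ∈ T, z P.s * cP f P ^ 2 ≤ 2 ^ 51 * l ^ 2 * z t.s := by
  have hzt := z_pos t.s
  have h1F : ∫⁻ y, F.indicator 1 y = volume F := by rw [lintegral_indicator_one hF]
  have hfi : Integrable f := ⟨hf.aestronglyMeasurable, by
    refine (lintegral_mono hfF).trans_lt ?_; rw [h1F]; exact hFv.lt_top⟩
  have hf1 : ∀ y, ‖f y‖ ≤ 1 := fun y => by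
    have : ‖f y‖ₑ ≤ 1 := (hfF y).trans (indicator_le_self' (f := 1) (fun _ _ => zero_le) y)
    rwa [← ofReal_norm, ← ENNReal.ofReal_one, ENNReal.ofReal_le_ofReal_iff (by norm_num)] at this
  rcases le_or_gt (1 / 2) l with h2l | h2l
  · refine (size_a hfi hf1 hT).trans ?_
    refine mul_le_mul_of_nonneg_right ?_ hzt.le; nlinarith
  rcases T.eq_empty_or_nonempty with h0 | ⟨P0, hP0⟩
  · rw [h0, Finset.sum_empty]; positivity
  set ν0 : ℝ → ℝ≥0∞ := F.indicator 1
  have hν0 : Measurable ν0 := measurable_const.indicator hF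
  set O := {x | ENNReal.ofReal l < Mx ν0 x}
  have hO : IsOpen O := by simp only [O]; rw [Mx_lt_eq]; exact isOpen_iUnion fun q => Metric.isOpen_ball
  have hOv : volume O ≠ ∞ := fun h => by
    have := Mx_weak ν0 (ENNReal.ofReal l)
    rw [show volume {x | ENNReal.ofReal l < Mx ν0 x} = ∞ from h, ENNReal.mul_top (by simpa using hl), h1F] at this
    exact absurd this (not_le.2 (by finiteness))
  obtain ⟨xT, hxT, hxT'⟩ := hx P0 hP0
  obtain ⟨σ, hσ, H⟩ := whitney hO (x0 := xT) (by simpa [O] using hxT')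
  set ξ := t.ξ
  set G : ℤ × ℤ → ℂ := fun J => (((z J.1)⁻¹ : ℝ) : ℂ) * ∫ y in D J.1 J.2, ee (-(ξ * y)) * f y
  set q : ℝ → ℤ × ℤ := fun y => (σ y, idx (σ y) y)
  have hq : Measurable q := hσ.prodMk (idx_meas hσ)
  set g : ℝ → ℂ := O.indicator fun y => ee (ξ * y) * G (q y)
  have hgm : Measurable g := Measurable.indicator (by
    have : Measurable fun y => G (q y) := (Measurable.of_discrete (f := G)).comp hq
    fun_prop) hO.measurableSet
  have hgl : ∀ y, ‖g y‖ ≤ 8 * l := fun y => by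
    by_cases hy : y ∈ O
    swap; · simp only [g, indicator_of_notMem hy, norm_zero]; positivity
    simp only [g, indicator_of_mem hy, G, q]
    have hz := z_pos (σ y)
    obtain ⟨_, _, x, hxO, hxv⟩ := H y hy
    rw [norm_mul, ee_norm, one_mul, norm_mul, Complex.norm_real, Real.norm_of_nonneg (by positivity), inv_mul_le_iff₀ hz,
      ← ENNReal.ofReal_le_ofReal_iff (by positivity), ofReal_norm]
    refine (enorm_integral_le_lintegral_enorm _).trans ?_
    calc _ ≤ ∫⁻ y in Metric.ball x (4 * z (σ y)), ν0 y := by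
          refine (lintegral_mono fun y => ?_).trans (lintegral_mono_set fun v hv => ?_)
          · rw [enorm_mul, ← ofReal_norm, ee_norm, ENNReal.ofReal_one, one_mul]; exact hfF y
          · rw [Metric.mem_ball, Real.dist_eq, abs_sub_comm]; exact hxv v hv
      _ ≤ ENNReal.ofReal l * ENNReal.ofReal (2 * (4 * z (σ y))) := by
          have h := (Mx_ge ν0 (Metric.mem_ball_self (x := x) (show 0 < 4 * z (σ y) by positivity))).trans (not_lt.1 hxO)
          rwa [ENNReal.div_le_iff (by simpa using hz) ENNReal.ofReal_ne_top] at h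
      _ = _ := by rw [← ENNReal.ofReal_mul hl.le]; congr 1; ring
  have hgi : Integrable g := by
    refine (integrable_indicator_iff hO.measurableSet).2 ?_
    refine Measure.integrableOn_of_bounded (M := 8 * l) hOv ?_ ?_
    · have : Measurable fun y => G (q y) := (Measurable.of_discrete (f := G)).comp hq
      fun_prop
    · filter_upwards [ae_restrict_mem hO.measurableSet] with y hy
      have := hgl y; simp only [g, indicator_of_mem hy] at this; exact this
  set b : ℝ → ℂ := fun y => f y - g y
  have hbi : Integrable b := hfi.sub hgi
  set ν : ℝ → ℝ≥0∞ := fun y => ν0 y + ENNReal.ofReal (8 * l)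
  have hbν : ∀ y, ‖b y‖ₑ ≤ ν y := fun y => enorm_sub_le.trans (add_le_add (hfF y) (by
    rw [← ofReal_norm]; exact ENNReal.ofReal_le_ofReal (hgl y)))
  have hb0 : ∀ᵐ y, y ∉ O → b y = 0 := by
    filter_upwards [Mx_ae hF] with y hy hyO
    have : y ∉ F := fun h => hyO (lt_of_lt_of_le (by
      rw [← ENNReal.ofReal_one, ← ENNReal.ofReal_ofNat, ← ENNReal.ofReal_div_of_pos (by norm_num)]
      exact (ENNReal.ofReal_lt_ofReal_iff (by norm_num)).2 h2l) (hy h))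
    have h1 := hfF y; simp only [ν0] at h1; rw [indicator_of_notMem this] at h1
    simp only [b, g, indicator_of_notMem hyO, sub_zero]; simpa using h1
  set U : ℤ × ℤ → Set ℝ := fun J => O ∩ q ⁻¹' {J}
  have hU : ∀ J, MeasurableSet (U J) := fun J => hO.measurableSet.inter (hq .of_discrete)
  have hUd : Pairwise (Function.onFun Disjoint U) := fun J J' h => Set.disjoint_left.2 fun y hy hy' => h (hy.2.symm.trans hy'.2)
  have hUO : ⋃ J, U J = O := by ext y; simp [U]
  have n2 : ∑ P ∈ T, z P.s * cP b P ^ 2 ≤ 2 ^ 20 * 1460 ^ 2 * (9 * l) ^ 2 * z t.s := by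
    refine bad_sum hT (ν := ν) (σ := σ) (by fun_prop) (by positivity) (by norm_num) (fun P hP => ?_) hσ (cP_nn _) fun P hP => ?_
    · obtain ⟨x, hx1, hx2⟩ := hx P hP
      refine ⟨x, hx1, (Mx_add_const (fun _ => le_rfl) x).trans ((add_le_add_left hx2 _).trans (le_of_eq ?_))⟩
      rw [← ENNReal.ofReal_add (by positivity) (by positivity)]; congr 1; ring
    obtain ⟨φ, hφ, r, hr, hcr⟩ := cP_ex b P
    obtain ⟨xP, hxP, hxl⟩ := hx P hP
    have hxO : xP ∉ O := not_lt.2 hxl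
    have hz := z_pos P.s
    set k : ℝ → ℝ≥0∞ := fun y => ENNReal.ofReal (730 * ((z P.s)⁻¹ * z (-|P.s - σ y|) * w ((y - P.c) / z P.s) ^ 2))
    have hφb : ∀ y, ‖conj (φ y)‖ ≤ (z P.s)⁻¹ := fun y => by
      rw [RCLike.norm_conj]; refine (hφ.2.1 y).trans ?_
      have := pow_le_one₀ (n := 3) (w_nn ((y - P.c) / z P.s)) (w_le_one _)
      nlinarith [inv_pos.2 hz]
    have hφc : Continuous fun y => conj (φ y) := Complex.continuous_conj.comp hφ.1.1
    have hbφ : Integrable fun y => b y * conj (φ y) := hbi.mul_bdd hφc.aestronglyMeasurable (ae_of_all _ hφb)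
    have cell : ∀ J, ‖∫ y in U J, b y * conj (φ y)‖ₑ ≤ ∫⁻ y in U J, ν y * k y := by
      intro J
      rcases (U J).eq_empty_or_nonempty with h | ⟨y0, hy0, hq0⟩
      · simp [h]
      have hq0 : q y0 = J := hq0
      obtain ⟨c1, c2, _⟩ := H y0 hy0
      have hJ : D (σ y0) (idx (σ y0) y0) = D J.1 J.2 := by rw [← hq0]
      have hσJ : σ y0 = J.1 := by rw [← hq0]
      have hUJ : U J = D J.1 J.2 := by
        ext y; constructor
        · rintro ⟨_, h⟩; have h : q y = J := h; rw [← h]; exact mem_D_idx _ _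
        · intro h; obtain ⟨d1, d2⟩ := c1 y (hJ ▸ h)
          refine ⟨d1, Prod.ext (d2.trans hσJ) ?_⟩
          change idx (σ y) y = _; rw [d2, hσJ]; exact mem_D.1 h
      have hin : ∀ y ∈ D J.1 J.2, y ∈ O ∧ q y = J := fun y hy => by rw [← hUJ] at hy; exact hy
      rw [hUJ]
      set v := ctr J.1 J.2
      have hv := ctr_mem J.1 J.2
      have hm := D_meas J.1 J.2
      have hvol : volume (D J.1 J.2) ≠ ∞ := by rw [D_vol]; simp
      set bt : ℝ → ℂ := fun y => ee (-(ξ * y)) * b y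
      have hzero : ∫ y in D J.1 J.2, bt y = 0 := by
        have e : ∫ y in D J.1 J.2, bt y = ∫ y in D J.1 J.2, (ee (-(ξ * y)) * f y - G J) := by
          refine setIntegral_congr_fun hm fun y hy => ?_
          obtain ⟨d1, d2⟩ := hin y hy
          simp only [bt, b, g, indicator_of_mem d1, d2]
          rw [mul_sub, ← mul_assoc, ← ee_add, neg_add_cancel, ee_zero, one_mul]
        have hi : IntegrableOn (fun y => ee (-(ξ * y)) * f y) (D J.1 J.2) :=
          (hfi.bdd_mul (c := 1) (by fun_prop : Measurable fun y => ee (-(ξ * y))).aestronglyMeasurable (ae_of_all _ fun y => by rw [ee_norm])).integrableOn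
        rw [e, integral_sub hi (integrableOn_const hvol), setIntegral_const, Measure.real, D_vol, ENNReal.toReal_ofReal (z_nn _)]
        simp only [G, Complex.real_smul]
        rw [← mul_assoc, ← Complex.ofReal_mul, mul_inv_cancel₀ (z_ne _), Complex.ofReal_one, one_mul, sub_self]
      have hbti : IntegrableOn bt (D J.1 J.2) :=
        (hbi.bdd_mul (c := 1) (by fun_prop : Measurable fun y => ee (-(ξ * y))).aestronglyMeasurable (ae_of_all _ fun y => by rw [ee_norm])).integrableOn
      have e : ∫ y in D J.1 J.2, b y * conj (φ y) = ∫ y in D J.1 J.2, bt y * conj (ee (-(ξ * y)) * φ y - ee (-(ξ * v)) * φ v) := by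
        have e1 : ∀ y, bt y * conj (ee (-(ξ * y)) * φ y - ee (-(ξ * v)) * φ v) = b y * conj (φ y) - bt y * conj (ee (-(ξ * v)) * φ v) := fun y => by
          simp only [bt, map_sub, map_mul, ee_conj, neg_neg]
          have : ee (-(ξ * y)) * ee (ξ * y) = 1 := by rw [← ee_add, neg_add_cancel, ee_zero]
          linear_combination (b y * conj (φ y)) * this
        simp only [e1]
        rw [integral_sub hbφ.integrableOn (hbti.mul_const _), integral_mul_const, hzero, zero_mul, sub_zero]
      rw [e]
      refine (enorm_integral_le_lintegral_enorm _).trans (setLIntegral_mono' hm fun y hy => ?_)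
      obtain ⟨d1, d2⟩ := hin y hy
      rw [enorm_mul]
      refine mul_le_mul' ?_ ?_
      · simp only [bt]; rw [enorm_mul, ← ofReal_norm, ee_norm, ENNReal.ofReal_one, one_mul]; exact hbν y
      · rw [← ofReal_norm, RCLike.norm_conj]
        have hs : σ y = J.1 := by rw [← d2]
        refine ENNReal.ofReal_le_ofReal ?_
        rw [hs]
        refine osc hφ (hT P hP).2 hxP hy hv ?_ ?_
        · have := (H y d1).2.1 xP hxO; rwa [hs] at this
        · obtain ⟨d3, d4⟩ := hin v hv
          have := (H v d3).2.1 xP hxO; rwa [show σ v = J.1 by rw [← d4]] at this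
    calc _ ≤ 2 * ‖∫ y, b y * conj (φ y)‖ₑ := by
          rw [hr, ← ofReal_norm, ← ENNReal.ofReal_ofNat, ← ENNReal.ofReal_mul (by norm_num), Complex.norm_real]
          exact ENNReal.ofReal_le_ofReal (hcr.trans (by gcongr; exact le_abs_self r))
      _ = 2 * ‖∑' J, ∫ y in U J, b y * conj (φ y)‖ₑ := by
          rw [← integral_iUnion hU hUd hbφ.integrableOn, hUO, setIntegral_eq_integral_of_ae_compl_eq_zero]
          filter_upwards [hb0] with y hy h; rw [hy h, zero_mul]
      _ ≤ 2 * ∑' J, ‖∫ y in U J, b y * conj (φ y)‖ₑ := by gcongr; exact enorm_tsum_le_tsum_enorm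
      _ ≤ 2 * ∑' J, ∫⁻ y in U J, ν y * k y := by gcongr with J; exact cell J
      _ ≤ 2 * ∫⁻ y, ν y * k y := by rw [← lintegral_iUnion hU hUd]; gcongr; exact Measure.restrict_le_self
      _ = ∫⁻ y, 2 * (ν y * k y) := (lintegral_const_mul' _ _ (by simp)).symm
      _ = _ := by
          refine lintegral_congr fun y => ?_
          rw [mul_left_comm, ← ENNReal.ofReal_ofNat, ← ENNReal.ofReal_mul (by norm_num)]
          congr 2; ring
  have e : f = fun y => g y + b y := by funext y; simp [b]
  have n1 := size_a hgi hgl hT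
  rw [e]
  refine (cP_sq hgi hbi T).trans ?_
  have : 0 ≤ l ^ 2 * z t.s := by positivity
  nlinarith
end
end Car

namespace Car
noncomputable section
open FourierTransform ComplexConjugate
open scoped Classical

lemma aa_meas {ψ f : ℝ → ℂ} (hf : Measurable f) (hc : Continuous ψ) {N : ℝ → ℝ} (hN : Measurable N) (s : ℤ) :
    Measurable fun x => aa ψ f s (N x) x := by
  have : Measurable (fun q : ℝ × ℝ => f q.2 * (ee (N q.1 * (q.1 - q.2)) * ((z s)⁻¹ * ψ ((q.1 - q.2) / z s)))) := by fun_prop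
  exact (this.stronglyMeasurable.integral_prod_right (ν := volume)).measurable

lemma aa_bdd {ψ f : ℝ → ℂ} (hf : Integrable f) {C : ℝ} (hC : ∀ u, ‖ψ u‖ ≤ C) (s : ℤ) (M x : ℝ) :
    ‖aa ψ f s M x‖ ≤ (z s)⁻¹ * C * ∫ y, ‖f y‖ := by
  rw [mul_comm, ← integral_mul_const]
  refine norm_integral_le_of_norm_le (hf.norm.mul_const _) (ae_of_all _ fun y => ?_)
  have hz := z_pos s
  rw [norm_mul, norm_mul, ee_norm, one_mul, norm_mul, Complex.norm_real, Real.norm_of_nonneg (by positivity)]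
  gcongr; exact hC _

lemma TS_meas {ψ f : ℝ → ℂ} (hf : Measurable f) (hc : Continuous ψ) {N : ℝ → ℝ} (hN : Measurable N) (T : Finset Tile) :
    Measurable (TS ψ f N T) :=
  Finset.measurable_sum _ fun P _ => Measurable.ite ((I_meas P).inter (hN (D_meas _ _))) (aa_meas hf hc hN P.s) measurable_const

lemma TS_split (ψ f : ℝ → ℂ) (N : ℝ → ℝ) (T : Finset Tile) (p : Tile → Prop) (x : ℝ) :
    TS ψ f N T x = TS ψ f N (T.filter fun P => ¬ p P) x + TS ψ f N (T.filter p) x := by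
  unfold TS; rw [add_comm]; exact (Finset.sum_filter_add_sum_filter_not _ _ _).symm

def TreeC (ψ : ℝ → ℂ) (C : ℝ≥0∞) : Prop := ∀ f : ℝ → ℂ, Integrable f →
    ∀ (T : Finset Tile) (t : Top) (N : ℝ → ℝ) (E : Set ℝ) (e μ : ℝ), (∀ P ∈ T, Down t P) → Cvx T → Measurable N → MeasurableSet E →
    0 < e → (∀ P ∈ T, cP f P ≤ e) → ∑ P ∈ T with t.ξ ∈ P.om2, z P.s * cP f P ^ 2 ≤ e ^ 2 * z t.s → (∀ P ∈ T, Mass E N P μ) →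
    ∫⁻ x in E, ‖TS ψ f N T x‖ₑ ≤ C * ENNReal.ofReal (e * μ * z t.s)

lemma Cvx.rem {T : Finset Tile} (h : Cvx T) (𝒯 : Finset Top) : Cvx (T.filter fun P => ∀ t ∈ 𝒯, ¬ Down t P) := by
  intro P hP R hR Q h1 h2
  rw [Finset.mem_filter] at hP hR ⊢
  exact ⟨h P hP.1 R hR.1 Q h1 h2, fun t ht hd => hP.2 t ht ⟨h1.1.trans hd.1, h1.2 hd.2⟩⟩

lemma Cvx.down {T : Finset Tile} (h : Cvx T) (t : Top) : Cvx (T.filter fun P => Down t P) := by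
  intro P hP R hR Q h1 h2
  rw [Finset.mem_filter] at hP hR ⊢
  exact ⟨h P hP.1 R hR.1 Q h1 h2, h2.1.trans hR.2.1, h2.2 hR.2.2⟩

lemma remove {ψ f : ℝ → ℂ} {C : ℝ≥0∞} (hT : TreeC ψ C) (hf : Integrable f) (hfm : Measurable f) (hc : Continuous ψ)
    {N : ℝ → ℝ} (hN : Measurable N) {E : Set ℝ} (hE : MeasurableSet E) {e μ : ℝ} (he : 0 < e) {𝒜 : Finset Tile} (hA : Cvx 𝒜)
    (h1 : En 𝒜 (cP f) (e ^ 2)) (h2 : ∀ P ∈ 𝒜, Mass E N P μ) (𝒯 : Finset Top) :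
    ∫⁻ x in E, ‖TS ψ f N 𝒜 x‖ₑ ≤ (∫⁻ x in E, ‖TS ψ f N (𝒜.filter fun P => ∀ t ∈ 𝒯, ¬ Down t P) x‖ₑ) +
      C * ∑ t ∈ 𝒯, ENNReal.ofReal (e * μ * z t.s) := by
  induction 𝒯 using Finset.induction_on with
  | empty => simp
  | insert t 𝒯 ht ih =>
    refine ih.trans ?_
    rw [Finset.sum_insert ht, mul_add, ← add_assoc]
    gcongr
    set ℬ := 𝒜.filter fun P => ∀ t ∈ 𝒯, ¬ Down t P
    have hB : Cvx ℬ := hA.rem 𝒯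
    have hBA : ℬ ⊆ 𝒜 := Finset.filter_subset _ _
    have e1 : (𝒜.filter fun P => ∀ t' ∈ insert t 𝒯, ¬ Down t' P) = ℬ.filter fun P => ¬ Down t P := by
      ext P; simp only [ℬ, Finset.mem_filter, Finset.forall_mem_insert]; tauto
    rw [e1]
    calc _ ≤ ∫⁻ x in E, (‖TS ψ f N (ℬ.filter fun P => ¬ Down t P) x‖ₑ + ‖TS ψ f N (ℬ.filter fun P => Down t P) x‖ₑ) :=
          lintegral_mono fun x => by rw [TS_split ψ f N ℬ (Down t)]; exact enorm_add_le _ _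
      _ = _ := lintegral_add_left (TS_meas hfm hc hN _).enorm _
      _ ≤ _ := by
          gcongr
          refine hT f hf _ t N E e μ (fun P hP => (Finset.mem_filter.1 hP).2) (hB.down t) hN hE he ?_ ?_ ?_
          · intro P hP
            exact abs_le_of_sq_le_sq' (h1.c_le (hBA (Finset.mem_filter.1 hP).1)) he.le |>.2
          · refine le_trans (Finset.sum_le_sum_of_subset_of_nonneg ?_ fun _ _ _ => mul_nonneg (z_nn _) (sq_nonneg _)) (h1 t)
            intro P hP; simp only [Finset.mem_filter] at hP ⊢
            exact ⟨hBA hP.1.1, hP.1.2.1, hP.2⟩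
          · exact fun P hP => h2 P (hBA (Finset.mem_filter.1 hP).1)

lemma mass_one {E : Set ℝ} {N : ℝ → ℝ} {P : Tile} {μ : ℝ} (h : 1 ≤ μ) : Mass E N P μ := fun Q _ => by
  refine (measure_mono (t := Q.I) fun x hx => hx.2.1).trans ?_
  rw [I_vol]; exact ENNReal.ofReal_le_ofReal (by nlinarith [z_pos Q.s])

lemma En.le {𝒜 : Finset Tile} {c : Tile → ℝ} {κ κ' : ℝ} (h : En 𝒜 c κ) (h' : κ ≤ κ') : En 𝒜 c κ' := fun t =>
  (h t).trans (mul_le_mul_of_nonneg_right h' (z_nn _))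

/-- one level -/
lemma level {ψ f : ℝ → ℂ} {C : ℝ≥0∞} (hT : TreeC ψ C) (hf : Integrable f) (hfm : Measurable f) (hc : Continuous ψ)
    (hf2 : Integrable fun y => ‖f y‖ ^ 2)
    {N : ℝ → ℝ} (hN : Measurable N) {E : Set ℝ} (hE : MeasurableSet E) {a b μ e : ℝ} (ha : 0 < a) (hb : 0 < b) (hEa : volume E = ENNReal.ofReal a)
    (hfb : ∫ y, ‖f y‖ ^ 2 ≤ b) (hμ : 0 < μ) (he : 0 < e) {𝒜 : Finset Tile} (hA : Cvx 𝒜)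
    (h1 : En 𝒜 (cP f) (e ^ 2)) (h1' : En 𝒜 (cP f) (μ * (b / a))) (h2 : ∀ P ∈ 𝒜, Mass E N P μ) :
    ∃ ℬ ⊆ 𝒜, Cvx ℬ ∧ En ℬ (cP f) (μ / 4 * (b / a)) ∧ (∀ P ∈ ℬ, Mass E N P (μ / 4)) ∧
    ∫⁻ x in E, ‖TS ψ f N 𝒜 x‖ₑ ≤ (∫⁻ x in E, ‖TS ψ f N ℬ x‖ₑ) + C * ENNReal.ofReal (2 ^ 24 * a * e) := by
  obtain ⟨𝒯, i1, i2⟩ := mass_lemma hE hN 𝒜 hμ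
  have hr : 0 < b / a := by positivity
  obtain ⟨𝒯', j1, j2⟩ := energy_lemma hf hf2 𝒜 (κ := μ / 4 * (b / a)) (by positivity) (h1'.le (by ring_nf; rfl))
  have k1 : μ * ∑ t ∈ 𝒯, z t.s ≤ 4 * a := by
    rw [hEa, ← ENNReal.ofReal_sum_of_nonneg fun _ _ => z_nn _, ← ENNReal.ofReal_mul hμ.le, ← ENNReal.ofReal_ofNat,
      ← ENNReal.ofReal_mul (by norm_num), ENNReal.ofReal_le_ofReal_iff (by positivity)] at i1
    exact i1
  have k2 : μ * ∑ t ∈ 𝒯', z t.s ≤ 2 ^ 23 * a := by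
    have h3 := j1.trans (mul_le_mul_of_nonneg_left hfb (by norm_num))
    have : μ * (∑ t ∈ 𝒯', z t.s) * (b / a) ≤ 2 ^ 23 * a * (b / a) := by
      rw [mul_assoc (2 ^ 23), mul_div_cancel₀ _ ha.ne']; linarith
    exact le_of_mul_le_mul_right this hr
  have r := remove hT hf hfm hc hN hE he hA h1 h2 (𝒯 ∪ 𝒯')
  have sub : ∀ {𝒯₁}, 𝒯₁ ⊆ 𝒯 ∪ 𝒯' → (𝒜.filter fun P => ∀ t ∈ 𝒯 ∪ 𝒯', ¬ Down t P) ⊆ 𝒜.filter fun P => ∀ t ∈ 𝒯₁, ¬ Down t P := by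
    intro 𝒯₁ h P hP; rw [Finset.mem_filter] at hP ⊢; exact ⟨hP.1, fun t ht => hP.2 t (h ht)⟩
  refine ⟨_, Finset.filter_subset _ _, hA.rem (𝒯 ∪ 𝒯'), j2.mono (sub Finset.subset_union_right), fun P hP => ?_, r.trans ?_⟩
  · have := sub (Finset.subset_union_left) hP
    rw [Finset.mem_filter] at this; exact i2 P this.1 this.2
  gcongr
  rw [← ENNReal.ofReal_sum_of_nonneg fun t _ => by have := z_pos t.s; positivity, ← Finset.mul_sum]
  refine ENNReal.ofReal_le_ofReal ?_
  have h3 : ∑ t ∈ 𝒯 ∪ 𝒯', z t.s ≤ ∑ t ∈ 𝒯, z t.s + ∑ t ∈ 𝒯', z t.s := by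
    rw [← Finset.sum_union_inter]; exact le_add_of_nonneg_right (Finset.sum_nonneg fun _ _ => z_nn _)
  calc _ = e * (μ * ∑ t ∈ 𝒯 ∪ 𝒯', z t.s) := by ring
    _ ≤ e * (4 * a + 2 ^ 23 * a) := by gcongr; nlinarith
    _ ≤ _ := by nlinarith

lemma levels {ψ f : ℝ → ℂ} {C : ℝ≥0∞} (hT : TreeC ψ C) (hf : Integrable f) (hfm : Measurable f) (hc : Continuous ψ)
    (hf2 : Integrable fun y => ‖f y‖ ^ 2)
    {N : ℝ → ℝ} (hN : Measurable N) {E : Set ℝ} (hE : MeasurableSet E) {a b ρ : ℝ} (ha : 0 < a) (hb : 0 < b) (hEa : volume E = ENNReal.ofReal a)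
    (hfb : ∫ y, ‖f y‖ ^ 2 ≤ b) {𝒜 : Finset Tile} (hA : Cvx 𝒜) (hρ : 0 < ρ) (hρ1 : ρ ≤ 1) (hρr : ρ ≤ b / a)
    (h1 : En 𝒜 (cP f) ((2 ^ 29 * ρ) ^ 2)) (j : ℕ) :
    ∃ ℬ ⊆ 𝒜, Cvx ℬ ∧ En ℬ (cP f) ((4 ^ 29 * (1 / 4) ^ j) * (b / a)) ∧ (∀ P ∈ ℬ, Mass E N P (4 ^ 29 * (1 / 4) ^ j)) ∧
    ∫⁻ x in E, ‖TS ψ f N 𝒜 x‖ₑ ≤ (∫⁻ x in E, ‖TS ψ f N ℬ x‖ₑ) +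
      C * ENNReal.ofReal (2 ^ 24 * a * ∑ i ∈ Finset.range j, min (2 ^ 29 * ρ) (2 ^ 29 * (1 / 2) ^ i * √(b / a))) := by
  have hr : 0 < b / a := by positivity
  induction j with
  | zero =>
    refine ⟨𝒜, subset_rfl, hA, h1.le ?_, fun P _ => mass_one (by norm_num), by simp⟩
    rw [pow_zero, mul_one, mul_pow]
    have : (2 ^ 29 : ℝ) ^ 2 = 4 ^ 29 := by norm_num
    rw [this]; gcongr; nlinarith
  | succ j ih =>
    obtain ⟨ℬ, h2, h3, h4, h5, h6⟩ := ih
    set e := min (2 ^ 29 * ρ) (2 ^ 29 * (1 / 2) ^ j * √(b / a)) with he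
    have he0 : 0 < e := lt_min (by positivity) (by positivity)
    have h7 : En ℬ (cP f) (e ^ 2) := by
      rcases min_choice (2 ^ 29 * ρ) (2 ^ 29 * (1 / 2) ^ j * √(b / a)) with h | h
      · rw [he, h]; exact h1.mono h2
      · rw [he, h, mul_pow, Real.sq_sqrt hr.le, mul_pow, ← pow_mul (1 / 2 : ℝ), mul_comm j 2, pow_mul (1 / 2 : ℝ)]
        convert h4 using 3 <;> norm_num
    obtain ⟨ℬ', k1, k2, k3, k4, k5⟩ := level hT hf hfm hc hf2 hN hE ha hb hEa hfb (by positivity) he0 h3 h7 h4 h5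
    have e4 : (4 ^ 29 * (1 / 4) ^ j : ℝ) / 4 = 4 ^ 29 * (1 / 4) ^ (j + 1) := by ring
    rw [e4] at k3 k4
    refine ⟨ℬ', k1.trans h2, k2, k3, k4, h6.trans ((add_le_add_left k5 _).trans (le_of_eq ?_))⟩
    rw [Finset.sum_range_succ, mul_add (2 ^ 24 * a), ENNReal.ofReal_add (mul_nonneg (by positivity) (Finset.sum_nonneg fun i _ => by positivity))
      (by positivity), mul_add, ← he]
    ring

lemma levels_lim {ψ f : ℝ → ℂ} {C : ℝ≥0∞} (hT : TreeC ψ C) (hCt : C ≠ ∞) (hf : Integrable f) (hfm : Measurable f) (hc : Continuous ψ)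
    (hf2 : Integrable fun y => ‖f y‖ ^ 2)
    {N : ℝ → ℝ} (hN : Measurable N) {E : Set ℝ} (hE : MeasurableSet E) {a b ρ S : ℝ} (ha : 0 < a) (hb : 0 < b) (hEa : volume E = ENNReal.ofReal a)
    (hfb : ∫ y, ‖f y‖ ^ 2 ≤ b) {𝒜 : Finset Tile} (hA : Cvx 𝒜) (hρ : 0 < ρ) (hρ1 : ρ ≤ 1) (hρr : ρ ≤ b / a)
    (h1 : En 𝒜 (cP f) ((2 ^ 29 * ρ) ^ 2))
    (hS : ∀ j : ℕ, ∑ i ∈ Finset.range j, min (2 ^ 29 * ρ) (2 ^ 29 * (1 / 2) ^ i * √(b / a)) ≤ S) :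
    ∫⁻ x in E, ‖TS ψ f N 𝒜 x‖ₑ ≤ C * ENNReal.ofReal (2 ^ 24 * a * S) := by
  have hr : 0 < b / a := by positivity
  set 𝒯 : Finset Top := 𝒜.image fun P => ⟨P.s, P.n, P.m * z (-P.s)⟩
  have key : ∀ j : ℕ, ∫⁻ x in E, ‖TS ψ f N 𝒜 x‖ₑ ≤ C * ENNReal.ofReal (2 ^ 24 * a * S) +
      C * ∑ t ∈ 𝒯, ENNReal.ofReal ((2 ^ 29 * (1 / 2) ^ j * √(b / a)) * 1 * z t.s) := fun j => by
    obtain ⟨ℬ, h2, h3, h4, h5, h6⟩ := levels hT hf hfm hc hf2 hN hE ha hb hEa hfb hA hρ hρ1 hρr h1 j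
    refine h6.trans ?_
    rw [add_comm]
    have h7 : En ℬ (cP f) ((2 ^ 29 * (1 / 2) ^ j * √(b / a)) ^ 2) := by
      rw [mul_pow, Real.sq_sqrt hr.le, mul_pow, ← pow_mul (1 / 2 : ℝ), mul_comm j 2, pow_mul (1 / 2 : ℝ)]
      convert h4 using 3 <;> norm_num
    have h8 := remove hT hf hfm hc hN hE (by positivity) h3 h7 (fun P _ => mass_one le_rfl) 𝒯
    have h9 : (ℬ.filter fun P => ∀ t ∈ 𝒯, ¬ Down t P) = ∅ := by
      refine Finset.filter_eq_empty_iff.2 fun P hP h => ?_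
      refine h ⟨P.s, P.n, P.m * z (-P.s)⟩ (Finset.mem_image_of_mem _ (h2 hP)) ⟨subset_rfl, D_left _ _⟩
    rw [h9] at h8
    simp only [TS, Finset.sum_empty, enorm_zero, lintegral_zero, zero_add] at h8
    gcongr
    · exact hS j
    · exact h8
  have hlim : Tendsto (fun j : ℕ => C * ENNReal.ofReal (2 ^ 24 * a * S) +
      C * ∑ t ∈ 𝒯, ENNReal.ofReal ((2 ^ 29 * (1 / 2) ^ j * √(b / a)) * 1 * z t.s)) atTop
      (𝓝 (C * ENNReal.ofReal (2 ^ 24 * a * S) + C * ∑ t ∈ 𝒯, ENNReal.ofReal ((2 ^ 29 * 0 * √(b / a)) * 1 * z t.s))) := by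
    refine tendsto_const_nhds.add (ENNReal.Tendsto.const_mul (tendsto_finsetSum _ fun t _ => ENNReal.tendsto_ofReal ?_) (Or.inr hCt))
    exact ((((tendsto_pow_atTop_nhds_zero_of_lt_one (by norm_num) (by norm_num)).const_mul _).mul_const _).mul_const _).mul_const _
  have := ge_of_tendsto' hlim key
  simpa using this

lemma rwt {ψ : SchwartzMap ℝ ℂ} (hψ : Band ψ (-(7/16)) (-(1/16))) {α : ℝ} (h0 : 0 < α) (h1 : α < 1) : ∃ C : ℝ≥0∞, C ≠ ∞ ∧
    ∀ (f : ℝ → ℂ) (F : Set ℝ) (N : ℝ → ℝ) (𝒜 : Finset Tile), Measurable f → MeasurableSet F → volume F ≠ ∞ →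
    (∀ y, ‖f y‖ₑ ≤ F.indicator 1 y) → Measurable N → Cvx 𝒜 → ∀ E, MeasurableSet E → volume E ≠ ∞ → ∃ E' ⊆ E, MeasurableSet E' ∧
    volume E ≤ 2 * volume E' ∧ ∫⁻ x in E', ‖TS ψ f N 𝒜 x‖ₑ ≤ C * volume F ^ α * volume E ^ (1 - α) := by
  obtain ⟨C, hC, HC⟩ := tree_lemma hψ
  set θ := 2 * (α * (1 - α)) with hθ
  have hθ0 : 0 < θ := by have : 0 < 1 - α := by linarith
                         positivity
  have hθ1 : θ ≤ 1 := by nlinarith [sq_nonneg (2 * α - 1)]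
  set q := (1 / 2 : ℝ) ^ θ with hq
  have hq0 : 0 ≤ q := by positivity
  have hq1 : q < 1 := Real.rpow_lt_one (by norm_num) (by norm_num) hθ0
  refine ⟨C * ENNReal.ofReal (2 ^ 53 * (1 - q)⁻¹), by finiteness, fun f F N 𝒜 hf hF hFv hfF hN hA E hE hEv => ?_⟩
  by_cases hE0 : volume E = 0
  · exact ⟨E, subset_rfl, hE, by simp [hE0], by rw [setLIntegral_measure_zero _ _ hE0]; exact zero_le⟩
  have hfi : Integrable f := ⟨hf.aestronglyMeasurable, by
    refine (lintegral_mono hfF).trans_lt ?_; rw [lintegral_indicator_one hF]; exact hFv.lt_top⟩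
  by_cases hF0 : volume F = 0
  · refine ⟨E, subset_rfl, hE, by rw [two_mul]; exact le_self_add, ?_⟩
    have hf0 : f =ᵐ[volume] 0 := by
      filter_upwards [measure_eq_zero_iff_ae_notMem.1 hF0] with y hy
      have := hfF y; simp only [indicator_of_notMem hy, nonpos_iff_eq_zero, enorm_eq_zero] at this; exact this
    have : ∀ x, TS ψ f N 𝒜 x = 0 := fun x => Finset.sum_eq_zero fun P _ => by
      have : aa ψ f P.s (N x) x = 0 := by
        unfold aa; rw [integral_eq_zero_of_ae]; filter_upwards [hf0] with y hy; simp [hy]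
      simp [this]
    simp [this]
  set a := (volume E).toReal
  set b := (volume F).toReal
  have ha : 0 < a := ENNReal.toReal_pos hE0 hEv
  have hb : 0 < b := ENNReal.toReal_pos hF0 hFv
  have hEa : volume E = ENNReal.ofReal a := (ENNReal.ofReal_toReal hEv).symm
  have hFb : volume F = ENNReal.ofReal b := (ENNReal.ofReal_toReal hFv).symm
  have hr : 0 < b / a := by positivity
  set Ω := {x | ENNReal.ofReal (8 * (b / a)) < Mx (F.indicator 1) x}
  have hΩ : MeasurableSet Ω := measurableSet_lt measurable_const (Mx_meas _)
  have hΩv : volume Ω ≤ ENNReal.ofReal (a / 2) := by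
    have := Mx_weak (F.indicator 1) (ENNReal.ofReal (8 * (b / a)))
    rw [lintegral_indicator_one hF, hFb, ← ENNReal.ofReal_ofNat 4, ← ENNReal.ofReal_mul (by norm_num),
      show 4 * b = 8 * (b / a) * (a / 2) by field_simp; norm_num, ENNReal.ofReal_mul (p := 8 * (b / a)) (q := a / 2) (by positivity)] at this
    exact (ENNReal.mul_le_mul_iff_right (ENNReal.ofReal_pos.2 (by positivity)).ne' ENNReal.ofReal_ne_top).1 this
  have hΩf : volume Ω ≠ ∞ := ne_top_of_le_ne_top (by simp) hΩv
  refine ⟨E \ Ω, sdiff_subset, MeasurableSet.diff hE hΩ, ?_, ?_⟩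
  · have : volume E ≤ volume (E \ Ω) + ENNReal.ofReal (a / 2) := by
      refine (measure_mono (t := (E \ Ω) ∪ Ω) (by simp)).trans ((measure_union_le _ _).trans (by gcongr))
    have fin : volume (E \ Ω) ≠ ∞ := ne_top_of_le_ne_top hEv (measure_mono sdiff_subset)
    rw [hEa, ← ENNReal.ofReal_toReal fin, ← ENNReal.ofReal_add (by positivity) (by positivity)] at this
    rw [hEa, ← ENNReal.ofReal_toReal fin, ← ENNReal.ofReal_ofNat, ← ENNReal.ofReal_mul (by norm_num)]
    rw [ENNReal.ofReal_le_ofReal_iff (by positivity)] at this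
    exact ENNReal.ofReal_le_ofReal (by linarith)
  set ℬ := 𝒜.filter fun P => ¬ P.I ⊆ Ω
  have hB : Cvx ℬ := fun P hP R hR Q i1 i2 => by
    rw [Finset.mem_filter] at hP hR ⊢
    exact ⟨hA P hP.1 R hR.1 Q i1 i2, fun h => hP.2 (i1.1.trans h)⟩
  have e1 : ∀ x ∈ E \ Ω, ‖TS ψ f N 𝒜 x‖ₑ = ‖TS ψ f N ℬ x‖ₑ := fun x hx => by
    rw [TS_split ψ f N 𝒜 (fun P => P.I ⊆ Ω)]
    have : TS ψ f N (𝒜.filter fun P => P.I ⊆ Ω) x = 0 := Finset.sum_eq_zero fun P hP => by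
      rw [if_neg]; intro h; exact hx.2 ((Finset.mem_filter.1 hP).2 h.1)
    rw [this, add_zero]
  rw [setLIntegral_congr_fun (MeasurableSet.diff hE hΩ) e1]
  refine (lintegral_mono_set sdiff_subset).trans ?_
  have hf1 : ∀ y, ‖f y‖ ≤ 1 := fun y => by
    have := (hfF y).trans (indicator_le_self' (f := fun _ => (1 : ℝ≥0∞)) (fun _ _ => zero_le) y)
    rw [← ofReal_norm, ← ENNReal.ofReal_one, ENNReal.ofReal_le_ofReal_iff (by norm_num)] at this; exact this
  have hle : ∀ y, ‖f y‖ ^ 2 ≤ F.indicator (fun _ => (1 : ℝ)) y := fun y => by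
    by_cases hy : y ∈ F
    · rw [indicator_of_mem hy]; nlinarith [hf1 y, norm_nonneg (f y)]
    · have := hfF y; simp only [indicator_of_notMem hy, nonpos_iff_eq_zero, enorm_eq_zero] at this; simp [this, hy]
  have hFi : Integrable (F.indicator fun _ => (1 : ℝ)) := (integrable_indicator_iff hF).2 (integrableOn_const hFv)
  have hf2 : Integrable fun y => ‖f y‖ ^ 2 := hFi.mono' (by fun_prop) (ae_of_all _ fun y => by
    rw [Real.norm_of_nonneg (by positivity)]; exact hle y)
  have hfb : ∫ y, ‖f y‖ ^ 2 ≤ b := by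
    refine (integral_mono hf2 hFi hle).trans (le_of_eq ?_)
    rw [integral_indicator_const _ hF]; simp [b, Measure.real]
  have hEn : En ℬ (cP f) ((2 ^ 29 * min 1 (b / a)) ^ 2) := fun t => by
    have hz := z_pos t.s
    rcases min_choice 1 (b / a) with h | h <;> rw [h]
    · refine (size_a hfi hf1 (t := t) fun P hP => (Finset.mem_filter.1 hP).2).trans ?_
      gcongr; norm_num
    · refine (size_b hf hF hFv hfF (l := 8 * (b / a)) (by positivity) (t := t) (fun P hP => (Finset.mem_filter.1 hP).2) ?_).trans ?_
      · intro P hP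
        have := (Finset.mem_filter.1 (Finset.mem_filter.1 hP).1).2
        obtain ⟨x, hx, hx'⟩ := not_subset.1 this
        exact ⟨x, hx, not_lt.1 hx'⟩
      · gcongr; rw [mul_pow, mul_pow, ← mul_assoc]; gcongr; norm_num
  have hρ : 0 < min 1 (b / a) := lt_min one_pos hr
  set ρ := min 1 (b / a) with hρd
  have hS : ∀ j : ℕ, ∑ i ∈ Finset.range j, min (2 ^ 29 * ρ) (2 ^ 29 * (1 / 2) ^ i * √(b / a)) ≤ 2 ^ 29 * (b / a) ^ α * (1 - q)⁻¹ := fun j => by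
    have h3 : ρ ^ (1 - θ) * √(b / a) ^ θ ≤ (b / a) ^ α := by
      rw [Real.sqrt_eq_rpow, ← Real.rpow_mul hr.le]
      rcases le_total (b / a) 1 with h | h
      · rw [hρd, min_eq_right h, ← Real.rpow_add hr]
        exact Real.rpow_le_rpow_of_exponent_ge hr h (by nlinarith)
      · rw [hρd, min_eq_left h, Real.one_rpow, one_mul]
        exact Real.rpow_le_rpow_of_exponent_le h (by nlinarith)
    have h2 : ∀ i : ℕ, min (2 ^ 29 * ρ) (2 ^ 29 * (1 / 2) ^ i * √(b / a)) ≤ 2 ^ 29 * (b / a) ^ α * q ^ i := fun i => by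
      set m := min (2 ^ 29 * ρ) (2 ^ 29 * (1 / 2) ^ i * √(b / a))
      have hm : 0 < m := lt_min (by positivity) (by positivity)
      calc m = m ^ (1 - θ) * m ^ θ := by rw [← Real.rpow_add hm]; simp
        _ ≤ (2 ^ 29 * ρ) ^ (1 - θ) * (2 ^ 29 * (1 / 2) ^ i * √(b / a)) ^ θ :=
            mul_le_mul (Real.rpow_le_rpow hm.le (min_le_left _ _) (by linarith)) (Real.rpow_le_rpow hm.le (min_le_right _ _) hθ0.le)
              (by positivity) (by positivity)
        _ = (2 ^ 29) ^ (1 - θ) * (2 ^ 29) ^ θ * (ρ ^ (1 - θ) * √(b / a) ^ θ) * q ^ i := by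
            rw [Real.mul_rpow (by positivity) (by positivity), Real.mul_rpow (by positivity) (by positivity), Real.mul_rpow (by positivity) (by positivity),
              show ((1 / 2 : ℝ) ^ i) ^ θ = q ^ i by
                rw [hq, ← Real.rpow_natCast, ← Real.rpow_natCast, ← Real.rpow_mul (by norm_num), ← Real.rpow_mul (by norm_num), mul_comm θ]]; ring
        _ = 2 ^ 29 * (ρ ^ (1 - θ) * √(b / a) ^ θ) * q ^ i := by rw [← Real.rpow_add (by positivity)]; simp
        _ ≤ _ := by gcongr
    refine (Finset.sum_le_sum fun i _ => h2 i).trans ?_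
    rw [← Finset.mul_sum]
    gcongr
    rw [← tsum_geometric_of_lt_one hq0 hq1]
    exact (summable_geometric_of_lt_one hq0 hq1).sum_le_tsum _ fun i _ => by positivity
  refine (levels_lim HC hC hfi hf ψ.continuous hf2 hN hE ha hb hEa hfb hB hρ (min_le_left _ _) (min_le_right _ _) hEn hS).trans (le_of_eq ?_)
  rw [hEa, hFb, ENNReal.ofReal_rpow_of_pos ha, ENNReal.ofReal_rpow_of_pos hb, mul_assoc C, mul_assoc C, ← ENNReal.ofReal_mul' (by positivity), ← ENNReal.ofReal_mul' (by positivity)]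
  congr 2
  rw [Real.div_rpow hb.le ha.le, Real.rpow_sub ha, Real.rpow_one]; ring

lemma rwt' {ψ : SchwartzMap ℝ ℂ} (hψ : Band ψ (-(7/16)) (-(1/16))) {α : ℝ} (h0 : 0 < α) (h1 : α < 1) : ∃ C : ℝ≥0∞, C ≠ ∞ ∧
    ∀ (f : ℝ → ℂ) (F : Set ℝ) (N : ℝ → ℝ) (𝒜 : Finset Tile), Measurable f → MeasurableSet F → volume F ≠ ∞ →
    (∀ y, ‖f y‖ₑ ≤ F.indicator 1 y) → Measurable N → Cvx 𝒜 → ∀ E, MeasurableSet E → volume E ≠ ∞ →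
    ∫⁻ x in E, ‖TS ψ f N 𝒜 x‖ₑ ≤ C * (volume E ^ (1 - α) * volume F ^ α) := by
  obtain ⟨C, hC, H⟩ := rwt hψ h0 h1
  obtain ⟨K, _, hK⟩ := schw_decay ψ 0
  refine ⟨gs (1 - α) * C, ENNReal.mul_ne_top (gs_ne_top (by linarith)) hC, fun f F N 𝒜 hf hF hFv hfF hN hA E hE hEv => ?_⟩
  have hfi : Integrable f := ⟨hf.aestronglyMeasurable, by
    refine (lintegral_mono hfF).trans_lt ?_; rw [lintegral_indicator_one hF]; exact hFv.lt_top⟩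
  refine (iterate (M := ∑ P ∈ 𝒜, ENNReal.ofReal ((z P.s)⁻¹ * K * ∫ y, ‖f y‖)) h1.le (fun x => ?_)
    (ENNReal.sum_ne_top.2 fun _ _ => ENNReal.ofReal_ne_top) (H f F N 𝒜 hf hF hFv hfF hN hA) E hE hEv).trans (le_of_eq (by ring))
  refine (enorm_sum_le _ _).trans (Finset.sum_le_sum fun P _ => ?_)
  split_ifs
  · rw [← ofReal_norm]; exact ENNReal.ofReal_le_ofReal (aa_bdd hfi (fun u => by simpa using hK u) _ _ _)
  · simp

end
end Car

namespace Car
noncomputable section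
open FourierTransform ComplexConjugate
open scoped Classical

lemma kint_meas {f : ℝ → ℂ} {k : ℝ → ℝ → ℂ} (hf : Measurable f) (hk : Measurable (Function.uncurry k)) :
    Measurable fun x => ∫ y, f y * k x y := by
  have : Measurable (fun q : ℝ × ℝ => f q.2 * Function.uncurry k q) := by fun_prop
  exact (this.stronglyMeasurable.integral_prod_right (ν := volume)).measurable

lemma kint {f : ℝ → ℂ} {k : ℝ → ℝ → ℂ} (hf : Integrable f) (hk : Measurable (Function.uncurry k)) {K : ℝ} (hK : ∀ x y, ‖k x y‖ ≤ K) (x : ℝ) :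
    Integrable fun y => f y * k x y :=
  hf.mul_bdd (c := K) (hk.comp measurable_prodMk_left).aestronglyMeasurable (ae_of_all _ (hK x))

lemma z_e2 (j : ℤ) : ENNReal.ofReal (z j) = e2 j := by
  rw [z, e2_ofReal, Real.rpow_intCast]

lemma strong {p δ : ℝ} (hp : 1 < p) (hδ : 0 < δ) (h1 : 0 < 1 / p - δ) (h2 : 1 / p + δ < 1) :
    ∃ C : ℝ≥0∞, C ≠ ∞ ∧ ∀ (k : ℝ → ℝ → ℂ) (K : ℝ) (B : ℝ≥0∞), Measurable (Function.uncurry k) → (∀ x y, ‖k x y‖ ≤ K) → B ≤ 1 →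
      (∀ (f : ℝ → ℂ) (F E : Set ℝ), Measurable f → MeasurableSet F → volume F ≠ ∞ → (∀ y, ‖f y‖ₑ ≤ F.indicator 1 y) →
        MeasurableSet E → volume E ≠ ∞ → ∀ a ∈ ({1 / p - δ, 1 / p + δ} : Set ℝ),
        ∫⁻ x in E, ‖∫ y, f y * k x y‖ₑ ≤ B * (volume E ^ (1 - a) * volume F ^ a)) →
      ∀ f : ℝ → ℂ, Measurable f → Integrable f → ∫⁻ x, ‖∫ y, f y * k x y‖ₑ ^ p ≤ C * B * ∫⁻ y, ‖f y‖ₑ ^ p := by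
  obtain ⟨C, hC, H⟩ := interp hp hδ h1 h2
  have hp0 : 0 < p := by linarith
  refine ⟨C * e2 p, ENNReal.mul_ne_top hC (by simp [e2]), fun k K B hk hK hB hw f hf hfi => ?_⟩
  set F : ℤ → Set ℝ := fun j => {y | z (j - 1) ≤ ‖f y‖ ∧ ‖f y‖ < z j} with hF
  have hFm : ∀ j, MeasurableSet (F j) := fun j => (measurableSet_le measurable_const hf.norm).inter (measurableSet_lt hf.norm measurable_const)
  have hFd : Pairwise (Function.onFun Disjoint F) := by
    have : ∀ i j, i < j → Disjoint (F i) (F j) := fun i j h => disjoint_left.2 fun y h1 h2 => by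
      have : z i ≤ z (j - 1) := z_mono (by omega)
      linarith [h1.2, h2.1]
    intro i j h
    rcases lt_or_gt_of_ne h with h | h
    · exact this i j h
    · exact (this j i h).symm
  have hFv : ∀ j, volume (F j) ≠ ∞ := fun j => by
    refine (lt_of_le_of_lt (measure_mono fun y hy => ?_) (hfi.norm.measure_ge_lt_top (ε := z (j - 1)) (z_pos _))).ne
    exact hy.1
  set U : ℕ → Set ℝ := fun n => ⋃ j ∈ Finset.Icc (-n : ℤ) n, F j with hU
  have hUm : ∀ n, MeasurableSet (U n) := fun n => Finset.measurableSet_biUnion _ fun j _ => hFm j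
  set g : ℕ → ℝ → ℂ := fun n => (U n).indicator f with hg
  have hgm : ∀ n, Measurable (g n) := fun n => hf.indicator (hUm n)
  have hgi : ∀ n, Integrable (g n) := fun n => hfi.indicator (hUm n)
  have hgsum : ∀ n y, g n y = ∑ j ∈ Finset.Icc (-n : ℤ) n, (F j).indicator f y := fun n y => by
    have := Finset.indicator_biUnion (Finset.Icc (-n : ℤ) n) F (f := f) fun i _ j _ h => hFd h
    simp only [hg, hU, this]
  have key : ∀ n : ℕ, ∫⁻ x in Icc (-n : ℝ) n, ‖∫ y, g n y * k x y‖ₑ ^ p ≤ C * e2 p * B * ∫⁻ y, ‖f y‖ₑ ^ p := fun n => by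
    refine (H B (ENNReal.ofReal ((∫ y, ‖g n y‖) * K)) (fun x => ‖∫ y, g n y * k x y‖ₑ) (Icc (-n : ℝ) n) (Finset.Icc (-n : ℤ) n) (fun j => volume (F j))
      (fun j x => ‖∫ y, (((z j)⁻¹ : ℝ) : ℂ) * (F j).indicator f y * k x y‖ₑ) hB (by simp) (kint_meas (hgm n) hk).enorm ?_ measurableSet_Icc
      (by simp) (fun j => (kint_meas (by have := hf.indicator (hFm j); fun_prop) hk).enorm) ?_ ?_).trans ?_
    · intro x _
      rw [← ofReal_norm]
      refine ENNReal.ofReal_le_ofReal ?_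
      rw [← integral_mul_const]
      refine norm_integral_le_of_norm_le ((hgi n).norm.mul_const _) (ae_of_all _ fun y => ?_)
      rw [norm_mul]; gcongr; exact hK _ _
    · intro x _
      have : ∫ y, g n y * k x y = ∑ j ∈ Finset.Icc (-n : ℤ) n, (z j : ℂ) * ∫ y, (((z j)⁻¹ : ℝ) : ℂ) * (F j).indicator f y * k x y := by
        simp only [hgsum, Finset.sum_mul]
        rw [integral_finsetSum _ fun j _ => kint (hfi.indicator (hFm j)) hk hK x]
        refine Finset.sum_congr rfl fun j _ => ?_
        rw [← integral_const_mul]; congr 1; ext y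
        have : (z j : ℂ) ≠ 0 := by exact_mod_cast z_ne j
        push_cast; field_simp
      rw [this]
      refine (enorm_sum_le _ _).trans (Finset.sum_le_sum fun j _ => ?_)
      rw [enorm_mul, ← ofReal_norm (z j : ℂ), Complex.norm_real, Real.norm_of_nonneg (z_nn j), z_e2]
    · intro j _ E hES hE a ha
      refine hw _ (F j) E (by have := hf.indicator (hFm j); fun_prop) (hFm j) (hFv j) (fun y => ?_) hE
        (ne_top_of_le_ne_top (by simp) (measure_mono hES)) a ha
      by_cases hy : y ∈ F j
      · rw [indicator_of_mem hy, indicator_of_mem hy, ← ofReal_norm, norm_mul, Complex.norm_real, Real.norm_of_nonneg (by have := z_pos j; positivity)]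
        simp only [Pi.one_apply]
        rw [← ENNReal.ofReal_one]
        refine ENNReal.ofReal_le_ofReal ?_
        rw [inv_mul_le_iff₀ (z_pos j), mul_one]; exact hy.2.le
      · simp [hy]
    · rw [mul_assoc C, mul_assoc C, mul_assoc C, mul_comm (e2 p) B, mul_assoc B]
      gcongr
      calc ∑ j ∈ Finset.Icc (-n : ℤ) n, e2 (j * p) * volume (F j) ≤ ∑ j ∈ Finset.Icc (-n : ℤ) n, ∫⁻ y in F j, e2 p * ‖f y‖ₑ ^ p := by
            refine Finset.sum_le_sum fun j _ => ?_
            rw [← setLIntegral_const]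
            refine setLIntegral_mono (by fun_prop) fun y hy => ?_
            rw [e2_mul, ← z_e2, show z j = 2 * z (j - 1) by rw [← z_succ, sub_add_cancel], e2, ← ENNReal.mul_rpow_of_nonneg _ _ hp0.le,
              ENNReal.ofReal_mul (by norm_num), ENNReal.ofReal_ofNat]
            gcongr
            rw [← ofReal_norm]; exact ENNReal.ofReal_le_ofReal hy.1
        _ = ∫⁻ y in U n, e2 p * ‖f y‖ₑ ^ p := (lintegral_biUnion_finset (fun i _ j _ h => hFd h) (fun j _ => hFm j) _).symm
        _ ≤ ∫⁻ y, e2 p * ‖f y‖ₑ ^ p := setLIntegral_le_lintegral _ _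
        _ = _ := lintegral_const_mul _ (by fun_prop)
  have hlim : ∀ x, Tendsto (fun n => ∫ y, g n y * k x y) atTop (𝓝 (∫ y, f y * k x y)) := fun x => by
    refine tendsto_integral_of_dominated_convergence (fun y => ‖f y‖ * K) (fun n => (kint (hgi n) hk hK x).1) (hfi.norm.mul_const _)
      (fun n => ae_of_all _ fun y => ?_) (ae_of_all _ fun y => ?_)
    · rw [norm_mul]; gcongr
      · exact norm_indicator_le_norm_self _ _
      · exact hK _ _
    · refine Tendsto.mul_const _ ?_
      by_cases hy : f y = 0
      · have : ∀ n, g n y = f y := fun n => by simp [hg, indicator, hy]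
        simp [this]
      · obtain ⟨j, hj⟩ := exists_mem_Ico_zpow (norm_pos_iff.2 hy) (one_lt_two)
        refine tendsto_const_nhds.congr' ?_
        filter_upwards [eventually_ge_atTop (j + 1).natAbs] with n hn
        rw [hg]; simp only; rw [indicator_of_mem]
        refine mem_iUnion₂.2 ⟨j + 1, Finset.mem_Icc.2 (by omega), by simpa [z] using hj.1, by simpa [z] using hj.2⟩
  have hle : ∀ x, ‖∫ y, f y * k x y‖ₑ ^ p ≤ liminf (fun n : ℕ => (Icc (-n : ℝ) n).indicator (fun x => ‖∫ y, g n y * k x y‖ₑ ^ p) x) atTop := fun x => by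
    refine le_of_eq (Tendsto.liminf_eq ?_).symm
    have : Tendsto (fun n => ‖∫ y, g n y * k x y‖ₑ ^ p) atTop (𝓝 (‖∫ y, f y * k x y‖ₑ ^ p)) :=
      ((ENNReal.continuous_rpow_const).tendsto _).comp ((continuous_enorm.tendsto _).comp (hlim x))
    refine this.congr' ?_
    filter_upwards [eventually_ge_atTop ⌈|x|⌉₊] with n hn
    rw [indicator_of_mem]
    exact abs_le.1 (Nat.ceil_le.1 hn)
  refine (lintegral_mono hle).trans ((lintegral_liminf_le fun n => ?_).trans ?_)
  · exact ((kint_meas (hgm n) hk).enorm.pow_const p).indicator measurableSet_Icc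
  · refine (liminf_le_liminf (Eventually.of_forall fun n => ?_)).trans_eq (liminf_const (C * e2 p * B * ∫⁻ y, ‖f y‖ₑ ^ p))
    rw [lintegral_indicator measurableSet_Icc]; exact key n

end
end Car

namespace Car
noncomputable section
open FourierTransform ComplexConjugate
open scoped Classical

lemma tiles_ex (S R R' : ℕ) : ∃ 𝒜 : Finset Tile, Cvx 𝒜 ∧ ∀ (ψ f : ℝ → ℂ) (N : ℝ → ℝ) (x : ℝ), |x| ≤ R → |N x| ≤ R' →
    TS ψ f N 𝒜 x = ∑ s ∈ Finset.Icc (-S : ℤ) S, if idx (-s - 4) (N x) % 16 = 8 then aa ψ f s (N x) x else 0 := by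
  set 𝒮 : Set Tile := {P | |P.s| ≤ S ∧ (∃ x ∈ P.I, |x| ≤ R) ∧ ∃ ξ ∈ P.om, |ξ| ≤ R'}
  have fin : 𝒮.Finite := by
    have bd : ∀ (s : ℤ) (x : ℝ) (R : ℕ), |s| ≤ S → |x| ≤ R → idx s x ∈ Finset.Icc (-(R * 2 ^ S + 1) : ℤ) (R * 2 ^ S + 1) := fun s x R h1 h2 => by
      have hz := z_pos s
      have h3 : |x / z s| ≤ R * 2 ^ S := by
        rw [abs_div, abs_of_pos hz, div_eq_mul_inv, ← z_neg]
        have : z (-s) ≤ 2 ^ S := by rw [← z_nat]; exact z_mono (by have := abs_le.1 h1; omega)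
        have := z_pos (-s)
        gcongr
      have h4 := abs_le.1 h3
      rw [Finset.mem_Icc]
      constructor
      · have := Int.lt_floor_add_one (x / z s)
        have : (-(R * 2 ^ S + 1) : ℝ) < (idx s x : ℝ) := by unfold idx; linarith
        exact_mod_cast this.le
      · have := Int.floor_le (x / z s)
        have : (idx s x : ℝ) ≤ (R * 2 ^ S + 1 : ℝ) := by unfold idx; linarith
        exact_mod_cast this
    refine ((Finset.finite_toSet (Finset.Icc (-S : ℤ) S ×ˢ (Finset.Icc (-(R * 2 ^ S + 1) : ℤ) (R * 2 ^ S + 1) ×ˢ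
      Finset.Icc (-(R' * 2 ^ S + 1) : ℤ) (R' * 2 ^ S + 1)))).image fun q => (⟨q.1, q.2.1, q.2.2⟩ : Tile)).subset ?_
    rintro P ⟨h1, ⟨x, hx, h2⟩, ξ, hξ, h3⟩
    refine ⟨(P.s, P.n, P.m), ?_, rfl⟩
    simp only [Finset.coe_product, mem_prod, Finset.mem_coe]
    refine ⟨Finset.mem_Icc.2 (abs_le.1 h1), ?_, ?_⟩
    · rw [← mem_D.1 hx]; exact bd _ _ _ h1 h2
    · rw [← mem_D.1 hξ]; exact bd _ _ _ (by rwa [abs_neg]) h3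
  refine ⟨fin.toFinset, fun P hP Q hQ T h1 h2 => ?_, fun ψ f N x hx hN => ?_⟩
  · rw [Finite.mem_toFinset] at *
    obtain ⟨x, hx, hx'⟩ := hP.2.1; obtain ⟨ξ, hξ, hξ'⟩ := hQ.2.2
    refine ⟨abs_le.2 ⟨(abs_le.1 hP.1).1.trans (D_le h1.1), (D_le h2.1).trans (abs_le.1 hQ.1).2⟩, ⟨x, h1.1 hx, hx'⟩, ξ, h2.2 hξ, hξ'⟩
  · unfold TS
    rw [← Finset.sum_filter, ← Finset.sum_filter]
    refine Finset.sum_nbij' Tile.s (fun s => ⟨s, idx s x, idx (-s - 4) (N x) / 16⟩) ?_ ?_ ?_ ?_ ?_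
    · intro P hP
      rw [Finset.mem_filter, Finite.mem_toFinset] at hP
      rw [Finset.mem_filter, Finset.mem_Icc]
      refine ⟨abs_le.1 hP.1.1, ?_⟩
      have := mem_D.1 hP.2.2; omega
    · intro s hs
      rw [Finset.mem_filter, Finset.mem_Icc] at hs
      have h2 : N x ∈ (⟨s, idx s x, idx (-s - 4) (N x) / 16⟩ : Tile).om2 := mem_D.2 (by simp only; omega)
      rw [Finset.mem_filter, Finite.mem_toFinset]
      exact ⟨⟨abs_le.2 hs.1, ⟨x, mem_D_idx _ _, hx⟩, N x, om2_sub _ h2, hN⟩, mem_D_idx _ _, h2⟩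
    · intro P hP
      rw [Finset.mem_filter] at hP
      have h1 := mem_D.1 hP.2.2; have h2 := mem_D.1 hP.2.1
      refine Tile.ext rfl h2 ?_; simp only; omega
    · intro s _; rfl
    · intro P _; rfl

lemma count_aux (d K : ℕ) (h : ∃ r : ℕ, K = 2 ^ d * (16 * r)) (q : ℤ) :
    16 * (∑ k ∈ Finset.range K, if ((q - k) / (2 ^ d : ℕ)) % 16 = 8 then 1 else 0) = K := by
  obtain ⟨r, hr⟩ := h
  set c : ℤ → ℤ → ℕ := fun v q => ∑ k ∈ Finset.range K, if ((q - k) / (2 ^ d : ℕ)) % 16 = v then 1 else 0 with hc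
  have hd : ((2 ^ d : ℕ) : ℤ) ≠ 0 := by positivity
  have step : ∀ v q, c v (q + 1) = c v q := fun v q => by
    have h1 := Finset.sum_range_succ (fun k : ℕ => if ((q + 1 - k) / (2 ^ d : ℕ)) % 16 = v then 1 else 0) K
    rw [Finset.sum_range_succ'] at h1
    have h2 : (q + 1 - (K : ℤ)) / (2 ^ d : ℕ) = (q + 1) / (2 ^ d : ℕ) - 16 * r := by
      rw [hr]; push_cast
      rw [Int.sub_mul_ediv_left]
      positivity
    rw [h2, Int.sub_mul_emod_self_left] at h1
    have h3 : ∀ k : ℕ, q + 1 - ((k + 1 : ℕ) : ℤ) = q - k := fun k => by push_cast; ring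
    simp only [h3] at h1
    simp only [Nat.cast_zero, sub_zero] at h1
    simp only [hc]; omega
  have const : ∀ v q, c v q = c v 0 := fun v q => by
    induction q using Int.induction_on with
    | zero => rfl
    | succ i ih => rw [step, ih]
    | pred i ih => rw [← step, sub_add_cancel, ih]
  have shift : ∀ v ∈ Finset.Ico (0 : ℤ) 16, c v q = c 8 q := fun v hv => by
    rw [Finset.mem_Ico] at hv
    rw [const 8, ← const 8 (q + (2 ^ d : ℕ) * (8 - v))]
    simp only [hc]
    refine Finset.sum_congr rfl fun k _ => ?_
    rw [show q + (2 ^ d : ℕ) * (8 - v) - (k : ℤ) = q - k + (2 ^ d : ℕ) * (8 - v) by ring, Int.add_mul_ediv_left _ _ hd]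
    congr 1; rw [eq_iff_iff]; omega
  have tot : ∑ v ∈ Finset.Ico (0 : ℤ) 16, c v q = K := by
    simp only [hc]; rw [Finset.sum_comm]
    rw [Finset.sum_congr rfl (g := fun _ => 1) fun k _ => ?_]
    · simp
    · rw [Finset.sum_ite_eq, if_pos]; rw [Finset.mem_Ico]; omega
  rw [Finset.sum_congr rfl shift, Finset.sum_const, Int.card_Ico] at tot
  exact tot

lemma count_sel (S : ℕ) {s : ℤ} (hs : s ∈ Finset.Icc (-S : ℤ) S) (M : ℝ) :
    16 * (∑ k ∈ Finset.range (2 ^ (2 * S + 4)), if idx (-s - 4) (M - k * z (-S - 4)) % 16 = 8 then 1 else 0) = 2 ^ (2 * S + 4) := by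
  rw [Finset.mem_Icc] at hs
  set d := (S - s).toNat
  have := count_aux d (2 ^ (2 * S + 4)) ⟨2 ^ (2 * S - d), by rw [show 16 = 2 ^ 4 by rfl, ← pow_add, ← pow_add]; congr 1; omega⟩ ⌊M * z (S + 4)⌋
  convert this using 6 with k
  rw [idx, ← Int.floor_sub_natCast, ← Int.floor_div_natCast]
  congr 1
  have e : ((2 ^ d : ℕ) : ℝ) = z (S - s) := by push_cast; rw [← z_nat]; congr 1; omega
  rw [e, div_eq_mul_inv, ← z_neg, div_eq_mul_inv, ← z_neg, sub_mul, sub_mul, mul_assoc, mul_assoc, ← z_add, ← z_add]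
  congr 3
  · ring_nf
  · ring

lemma aa_mod (ψ f : ℝ → ℂ) (s : ℤ) (M τ x : ℝ) :
    aa ψ f s M x = ee (τ * x) * aa ψ (fun y => f y * ee (-(τ * y))) s (M - τ) x := by
  rw [aa, aa, ← integral_const_mul]
  congr 1; ext y
  rw [show M * (x - y) = τ * x + (-(τ * y) + (M - τ) * (x - y)) by ring, ee_add, ee_add]; ring

lemma full_rwt {ψ : SchwartzMap ℝ ℂ} (hψ : Band ψ (-(7/16)) (-(1/16))) {α : ℝ} (h0 : 0 < α) (h1 : α < 1) :
    ∃ C : ℝ≥0∞, C ≠ ∞ ∧ ∀ (f : ℝ → ℂ) (F : Set ℝ) (N : ℝ → ℝ) (S R' : ℕ), Measurable f → MeasurableSet F → volume F ≠ ∞ →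
      (∀ y, ‖f y‖ₑ ≤ F.indicator 1 y) → Measurable N → (∀ x, |N x| ≤ R') → ∀ E, MeasurableSet E → volume E ≠ ∞ →
      ∫⁻ x in E, ‖∑ s ∈ Finset.Icc (-S : ℤ) S, aa ψ f s (N x) x‖ₑ ≤ C * (volume E ^ (1 - α) * volume F ^ α) := by
  obtain ⟨C, hC, H⟩ := rwt' hψ h0 h1
  refine ⟨16 * C, by finiteness, fun f F N S R' hf hF hF' hfb hN hNb E hE hE' => ?_⟩
  obtain ⟨K, hK⟩ : ∃ K, K = 2 ^ (2 * S + 4) := ⟨_, rfl⟩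
  have hK0 : (K : ℝ≥0∞) ≠ 0 := by simp [hK]
  have key : ∀ R : ℕ, ∫⁻ x in E ∩ Icc (-R : ℝ) R, ‖∑ s ∈ Finset.Icc (-S : ℤ) S, aa ψ f s (N x) x‖ₑ ≤ 16 * C * (volume E ^ (1 - α) * volume F ^ α) := fun R => by
    have hER : MeasurableSet (E ∩ Icc (-R : ℝ) R) := hE.inter measurableSet_Icc
    obtain ⟨𝒜, hA, hT⟩ := tiles_ex S R (R' + K)
    set τ : ℕ → ℝ := fun k => k * z (-S - 4)
    set fk : ℕ → ℝ → ℂ := fun k y => f y * ee (-(τ k * y))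
    have e1 : ∀ x ∈ E ∩ Icc (-R : ℝ) R, (K : ℝ≥0∞) * ‖∑ s ∈ Finset.Icc (-S : ℤ) S, aa ψ f s (N x) x‖ₑ
        ≤ 16 * ∑ k ∈ Finset.range K, ‖TS ψ (fk k) (fun x => N x - τ k) 𝒜 x‖ₑ := fun x hx => by
      have a1 : (K : ℂ) * ∑ s ∈ Finset.Icc (-S : ℤ) S, aa ψ f s (N x) x
          = 16 * ∑ k ∈ Finset.range K, ee (τ k * x) * TS ψ (fk k) (fun x => N x - τ k) 𝒜 x := by
        have b1 : ∀ k ∈ Finset.range K, ee (τ k * x) * TS ψ (fk k) (fun x => N x - τ k) 𝒜 x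
            = ∑ s ∈ Finset.Icc (-S : ℤ) S, (if idx (-s - 4) (N x - τ k) % 16 = 8 then 1 else 0) * aa ψ f s (N x) x := fun k hk => by
          have hk' : (k : ℝ) ≤ K := by exact_mod_cast (Finset.mem_range.1 hk).le
          have z1 : z (-S - 4) ≤ 1 := by rw [← z_zero]; exact z_mono (by omega)
          rw [hT ψ (fk k) (fun x => N x - τ k) x (abs_le.2 hx.2), Finset.mul_sum]
          · refine Finset.sum_congr rfl fun s _ => ?_
            rw [aa_mod ψ f s (N x) (τ k) x]
            split_ifs <;> simp [fk]
          · have := abs_sub (N x) (τ k)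
            have h2 : |τ k| ≤ K := by
              rw [abs_of_nonneg (mul_nonneg (by positivity) (z_nn _))]
              nlinarith [z_nn (-S - 4), (Nat.cast_nonneg k : (0:ℝ) ≤ k)]
            push_cast; linarith [hNb x]
        rw [Finset.sum_congr rfl b1, Finset.sum_comm, Finset.mul_sum, Finset.mul_sum]
        refine Finset.sum_congr rfl fun s hs => ?_
        rw [← Finset.sum_mul, ← mul_assoc]
        have := count_sel S hs (N x)
        rw [← hK] at this
        have t2 := congrArg (Nat.cast (R := ℂ)) this
        push_cast at t2
        rw [← t2]
      have a2 := congrArg (‖·‖ₑ) a1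
      simp only [enorm_mul] at a2
      rw [show ‖(K : ℂ)‖ₑ = K by rw [← ofReal_norm]; simp, show ‖(16 : ℂ)‖ₑ = 16 by rw [← ofReal_norm]; simp] at a2
      rw [a2]
      refine mul_le_mul_right ((enorm_sum_le _ _).trans (Finset.sum_le_sum fun k _ => ?_)) _
      rw [enorm_mul, ← ofReal_norm (ee _), ee_norm]; simp
    have fkm : ∀ k, Measurable (fk k) := fun k => hf.mul (by fun_prop)
    have e2 : ∀ k, ∫⁻ x in E ∩ Icc (-R : ℝ) R, ‖TS ψ (fk k) (fun x => N x - τ k) 𝒜 x‖ₑ ≤ C * (volume E ^ (1 - α) * volume F ^ α) := fun k => by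
      refine (H (fk k) F _ 𝒜 (fkm k) hF hF' (fun y => ?_) (hN.sub_const _) hA _ hER (measure_ne_top_of_subset inter_subset_left hE')).trans ?_
      · simp only [fk]; rw [enorm_mul, ← ofReal_norm (ee _), ee_norm]; simpa using hfb y
      · gcongr
        exact inter_subset_left
    have e3 := setLIntegral_mono' (μ := volume) hER e1
    rw [lintegral_const_mul' _ _ (by simp), lintegral_const_mul' _ _ (by simp), lintegral_finsetSum] at e3
    · refine (ENNReal.mul_le_mul_iff_right hK0 (by simp)).1 (e3.trans ?_)
      calc _ ≤ 16 * ∑ k ∈ Finset.range K, C * (volume E ^ (1 - α) * volume F ^ α) := mul_le_mul_right (Finset.sum_le_sum fun k _ => e2 k) _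
        _ = _ := by rw [Finset.sum_const, Finset.card_range, nsmul_eq_mul]; ring
    · intro k _
      exact (TS_meas (fkm k) ψ.continuous (hN.sub_const _) 𝒜).enorm
  have hU : E = ⋃ R : ℕ, E ∩ Icc (-R : ℝ) R := by
    rw [← inter_iUnion, eq_comm, inter_eq_left]
    intro x _; rw [mem_iUnion]; obtain ⟨n, hn⟩ := exists_nat_ge |x|; exact ⟨n, abs_le.1 hn⟩
  rw [hU, setLIntegral_iUnion_of_directed, ← hU]
  · exact iSup_le key
  · refine (monotone_nat_of_le_succ fun n => ?_).directed_le
    refine inter_subset_inter_right _ (Icc_subset_Icc ?_ ?_) <;> push_cast <;> linarith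

end
end Car

namespace Car
noncomputable section
open FourierTransform ComplexConjugate
open scoped Classical

def Th (η : ℝ → ℝ) (u : ℝ) : ℝ := ∫ ξ, η ξ * Real.cos (2 * Real.pi * (ξ * u))

lemma Th_neg (η : ℝ → ℝ) (u : ℝ) : Th η (-u) = Th η u := by
  simp only [Th, mul_neg, Real.cos_neg]

lemma ker_ex : ∃ (ψ : SchwartzMap ℝ ℂ) (η : ℝ → ℝ) (C : ℝ), Band ψ (-(7/16)) (-(1/16)) ∧ Continuous η ∧ Integrable η ∧ 0 < C ∧
    Continuous (Th η) ∧ Th η 0 = 1 ∧ (∀ u, |Th η u| ≤ C * w u) ∧ (∀ u, |1 - Th η u| ≤ C * |u|) ∧ ∀ u, u * (2 * (ψ u).re) = Th η u - Th η (2 * u) := by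
  set V : ℝ → ℝ := fun ξ => Real.smoothTransition (16 * ξ + 3) with hV
  have Vc : ContDiff ℝ ((⊤ : ℕ∞) : WithTop ℕ∞) V := Real.smoothTransition.contDiff.comp (by fun_prop)
  have V0 : ∀ ξ ≤ -3/16, V ξ = 0 := fun ξ h => Real.smoothTransition.zero_of_nonpos (by linarith)
  have V1 : ∀ ξ ≥ -1/8, V ξ = 1 := fun ξ h => Real.smoothTransition.one_of_one_le (by linarith)
  set η := deriv V with hη
  have ηc : ContDiff ℝ ((⊤ : ℕ∞) : WithTop ℕ∞) η := (contDiff_infty_iff_deriv.1 Vc).2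
  have Vd : ∀ ξ, HasDerivAt V (η ξ) ξ := fun ξ => (Vc.differentiable (by simp)).differentiableAt.hasDerivAt
  have ηs : ∀ ξ ∉ Icc (-3/16:ℝ) (-1/8), η ξ = 0 := fun ξ h => by
    rw [mem_Icc, not_and_or, not_le, not_le] at h
    rcases h with h | h
    · rw [hη, EventuallyEq.deriv_eq ((eventually_lt_nhds h).mono fun y hy => V0 y hy.le : V =ᶠ[𝓝 ξ] fun _ => 0), deriv_const]
    · rw [hη, EventuallyEq.deriv_eq ((eventually_gt_nhds h).mono fun y hy => V1 y hy.le : V =ᶠ[𝓝 ξ] fun _ => 1), deriv_const]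
  have ηcs : HasCompactSupport η := HasCompactSupport.intro isCompact_Icc ηs
  have ηi : Integrable η := ηc.continuous.integrable_of_hasCompactSupport ηcs
  have η1 : ∫ ξ, η ξ = 1 := by
    rw [integral_of_hasDerivAt_of_tendsto (m := 0) (n := 1) Vd ηi, sub_zero]
    · exact tendsto_const_nhds.congr' ((eventually_le_atBot (-3/16)).mono fun ξ h => (V0 ξ h).symm)
    · exact tendsto_const_nhds.congr' ((eventually_ge_atTop (-1/8)).mono fun ξ h => (V1 ξ h).symm)
  set v : ℝ → ℂ := fun ξ => -(Real.pi * Complex.I) * ((V ξ - V (ξ / 2) : ℝ) : ℂ) with hv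
  have vs : ∀ ξ ∉ Icc (-3/8:ℝ) (-1/8), v ξ = 0 := fun ξ h => by
    rw [mem_Icc, not_and_or, not_le, not_le] at h
    rcases h with h | h
    · simp [hv, V0 ξ (by linarith), V0 (ξ/2) (by linarith)]
    · simp [hv, V1 ξ (by linarith), V1 (ξ/2) (by linarith)]
  have vcs : HasCompactSupport v := HasCompactSupport.intro isCompact_Icc vs
  have vc : ContDiff ℝ ((⊤ : ℕ∞) : WithTop ℕ∞) v :=
    contDiff_const.mul (Complex.ofRealCLM.contDiff.comp (Vc.sub (Vc.comp (contDiff_id.div_const 2))))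
  set ψ : SchwartzMap ℝ ℂ := 𝓕⁻ (vcs.toSchwartzMap vc) with hψ
  have ηC : ContDiff ℝ ((⊤ : ℕ∞) : WithTop ℕ∞) (fun ξ => (η ξ : ℂ)) := Complex.ofRealCLM.contDiff.comp ηc
  have ηCs : HasCompactSupport (fun ξ => (η ξ : ℂ)) := ηcs.comp_left (g := Complex.ofReal) rfl
  set th : SchwartzMap ℝ ℂ := 𝓕⁻ (ηCs.toSchwartzMap ηC) with hth
  have thE : ∀ u, th u = ∫ ξ, ee (ξ * u) * (η ξ : ℂ) := fun u => by
    rw [hth, SchwartzMap.fourierInv_coe, Finv_eq]; rfl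
  have psE : ∀ u, ψ u = 𝓕 v (-u) := fun u => by
    rw [hψ, SchwartzMap.fourierInv_coe, Real.fourierInv_eq_fourier_neg]; rfl
  have thi : ∀ u, Integrable fun ξ => ee (ξ * u) * (η ξ : ℂ) := fun u =>
    (ηi.ofReal (𝕜 := ℂ)).bdd_mul (c := 1) (by fun_prop) (ae_of_all _ fun ξ => by rw [ee_norm])
  have thR : ∀ u, (th u).re = Th η u := fun u => by
    have e := integral_re (𝕜 := ℂ) (thi u)
    rw [thE]; refine Eq.trans e.symm ?_
    rw [Th]; congr 1; ext ξ
    simp only [RCLike.re_eq_complex_re, Complex.re_mul_ofReal, ee]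
    rw [mul_comm]; congr 1
    rw [Complex.exp_ofReal_mul_I_re]
  have Th0 : Th η 0 = 1 := by simp [Th, η1]
  obtain ⟨C, hC, h1, h2⟩ := schw_lip th 1
  refine ⟨ψ, η, 2 * C, ⟨ψ.continuous, ψ.integrable, fun ζ hζ => ?_⟩, ηc.continuous, ηi, by positivity, ?_, Th0, fun u => ?_, fun u => ?_, fun u => ?_⟩
  · rw [← SchwartzMap.fourier_coe, hψ, FourierTransform.fourier_fourierInv_eq]
    refine vs ζ fun h => hζ ?_
    rw [mem_Icc] at h; constructor <;> linarith [h.1, h.2]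
  · rw [← (funext thR : (fun u => (th u).re) = Th η)]; exact Complex.continuous_re.comp th.continuous
  · rw [← thR]; refine (Complex.abs_re_le_norm _).trans ((h1 u).trans ?_); nlinarith [w_nn u]
  · rw [← Th0, ← thR, ← thR, ← Complex.sub_re]
    refine (Complex.abs_re_le_norm _).trans ((h2 0 u).trans ?_)
    rw [zero_sub, abs_neg]; nlinarith [w_le_one u, w_le_one 0, mul_nonneg hC.le (abs_nonneg u)]
  · have vd : ∀ ξ, HasDerivAt v (-(Real.pi * Complex.I) * ((η ξ - η (ξ / 2) / 2 : ℝ) : ℂ)) ξ := fun ξ => by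
      refine HasDerivAt.const_mul _ (HasDerivAt.ofReal_comp ((Vd ξ).sub ?_))
      have := (Vd (ξ / 2)).comp ξ ((hasDerivAt_id ξ).div_const 2)
      rw [mul_one_div] at this; exact this
    have vdE : deriv v = fun ξ => -(Real.pi * Complex.I) * ((η ξ - η (ξ / 2) / 2 : ℝ) : ℂ) := funext fun ξ => (vd ξ).deriv
    have η2i : Integrable fun ξ => η (ξ / 2) := ηi.comp_div two_ne_zero
    have F := congrFun (Real.fourier_deriv (vc.continuous.integrable_of_hasCompactSupport vcs) (vc.differentiable (by simp))
      (by rw [vdE]; exact ((ηi.sub (η2i.div_const 2)).ofReal (𝕜 := ℂ)).const_mul _)) (-u)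
    rw [← psE, vdE, F_eq] at F
    have e1 : ∫ y, ee (-(y * -u)) * (-(Real.pi * Complex.I) * ((η y - η (y / 2) / 2 : ℝ) : ℂ)) = -(Real.pi * Complex.I) * (th u - th (2 * u)) := by
      rw [thE, thE]
      have e2 : ∫ ξ, ee (ξ * (2 * u)) * (η ξ : ℂ) = ∫ ξ, ee (ξ * u) * ((η (ξ / 2) / 2 : ℝ) : ℂ) := by
        have := Measure.integral_comp_div (fun ξ => ee (ξ * (2 * u)) * (η ξ : ℂ)) 2
        rw [abs_of_pos two_pos] at this
        have h3 : ∫ ξ, ee (ξ * u) * ((η (ξ / 2) / 2 : ℝ) : ℂ) = (1/2 : ℂ) * ∫ x, ee (x / 2 * (2 * u)) * (η (x / 2) : ℂ) := by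
          rw [← integral_const_mul]; congr 1; ext x
          rw [show x / 2 * (2 * u) = x * u by ring]; push_cast; ring
        rw [h3, this, Complex.real_smul]; push_cast; ring
      rw [e2, ← integral_sub (thi u), ← integral_const_mul]
      · congr 1; ext y; rw [show -(y * -u) = y * u by ring]; push_cast; ring
      · exact ((η2i.div_const 2).ofReal (𝕜 := ℂ)).bdd_mul (c := 1) (by fun_prop) (ae_of_all _ fun ξ => by rw [ee_norm])
    rw [e1, smul_eq_mul] at F
    have hpi : (Real.pi * Complex.I : ℂ) ≠ 0 := by simp [Real.pi_ne_zero]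
    have F' : th u - th (2 * u) = ((2 * u : ℝ) : ℂ) * ψ u := by
      refine mul_left_cancel₀ (neg_ne_zero.2 hpi) (F.trans ?_); push_cast; ring
    have := congrArg Complex.re F'
    rw [Complex.sub_re, thR, thR, Complex.re_ofReal_mul] at this
    rw [this]; ring

lemma strong2 {p δ : ℝ} (hp : 1 < p) (hδ : 0 < δ) (h1 : 0 < 1 / p - δ) (h2 : 1 / p + δ < 1) {D : ℝ≥0∞} (hD : D ≠ ∞) :
    ∃ C : ℝ≥0∞, C ≠ ∞ ∧ ∀ (k : ℝ → ℝ → ℂ) (K : ℝ) (B : ℝ≥0∞), Measurable (Function.uncurry k) → (∀ x y, ‖k x y‖ ≤ K) → B ≤ 1 →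
      (∀ (f : ℝ → ℂ) (F E : Set ℝ), Measurable f → MeasurableSet F → volume F ≠ ∞ → (∀ y, ‖f y‖ₑ ≤ F.indicator 1 y) →
        MeasurableSet E → volume E ≠ ∞ → ∀ a ∈ ({1 / p - δ, 1 / p + δ} : Set ℝ),
        ∫⁻ x in E, ‖∫ y, f y * k x y‖ₑ ≤ D * B * (volume E ^ (1 - a) * volume F ^ a)) →
      ∀ f : ℝ → ℂ, Measurable f → Integrable f → ∫⁻ x, ‖∫ y, f y * k x y‖ₑ ^ p ≤ C * B * ∫⁻ y, ‖f y‖ₑ ^ p := by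
  obtain ⟨C, hC, H⟩ := strong hp hδ h1 h2
  set d : ℝ≥0∞ := D + 1 with hd
  have d0 : d ≠ 0 := by simp [hd]
  have dt : d ≠ ∞ := by finiteness
  have dr : 0 < d.toReal := ENNReal.toReal_pos d0 dt
  have dn : ‖((d.toReal)⁻¹ : ℂ)‖ₑ = d⁻¹ := by
    rw [← Complex.ofReal_inv, ← ofReal_norm, Complex.norm_real, Real.norm_of_nonneg (by positivity), ENNReal.ofReal_inv_of_pos dr, ENNReal.ofReal_toReal dt]
  refine ⟨d ^ p * C, by finiteness, fun k K B hk hK hB hw f hf hfi => ?_⟩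
  have e : ∀ f : ℝ → ℂ, ∀ x, ‖∫ y, f y * (((d.toReal)⁻¹ : ℂ) * k x y)‖ₑ = d⁻¹ * ‖∫ y, f y * k x y‖ₑ := fun f x => by
    simp only [mul_left_comm (f _)]; rw [integral_const_mul, enorm_mul, dn]
  have := H (fun x y => ((d.toReal)⁻¹ : ℂ) * k x y) (‖((d.toReal)⁻¹ : ℂ)‖ * K) B (hk.const_mul _)
    (fun x y => by rw [norm_mul]; exact mul_le_mul_of_nonneg_left (hK x y) (norm_nonneg _)) hB (fun f F E a1 a2 a3 a4 a5 a6 a ha => by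
      simp only [e]
      rw [lintegral_const_mul' _ _ (by simp [d0])]
      refine (mul_le_mul_right (hw f F E a1 a2 a3 a4 a5 a6 a ha) _).trans ?_
      rw [mul_assoc D, ← mul_assoc]
      refine mul_le_of_le_one_left' ?_
      rw [mul_comm, ← div_eq_mul_inv]; exact ENNReal.div_le_of_le_mul (by simp [hd])) f hf hfi
  simp only [e] at this
  calc _ = ∫⁻ x, d ^ p * (d⁻¹ * ‖∫ y, f y * k x y‖ₑ) ^ p := by
        congr 1; ext x; rw [← ENNReal.mul_rpow_of_nonneg _ _ (by linarith), ← mul_assoc, ENNReal.mul_inv_cancel d0 dt, one_mul]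
    _ ≤ _ := by
        rw [lintegral_const_mul' _ _ (by finiteness), mul_assoc (_ * C), mul_assoc (d ^ p), ← mul_assoc C]
        exact mul_le_mul_right this _

def kap (ψ : ℝ → ℂ) (S : ℕ) (u : ℝ) : ℂ := ∑ s ∈ Finset.Icc (-S : ℤ) S, (((z s)⁻¹ : ℝ) : ℂ) * ψ (u / z s)

lemma kap_cont {ψ : ℝ → ℂ} (h : Continuous ψ) (S : ℕ) : Continuous (kap ψ S) := by unfold kap; fun_prop

lemma kap_bdd (ψ : SchwartzMap ℝ ℂ) (S : ℕ) : ∃ K, ∀ u, ‖kap ψ S u‖ ≤ K := by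
  obtain ⟨C, hC, h⟩ := schw_decay ψ 0
  refine ⟨∑ s ∈ Finset.Icc (-S : ℤ) S, (z s)⁻¹ * C, fun u => (norm_sum_le _ _).trans (Finset.sum_le_sum fun s _ => ?_)⟩
  have := z_nn s
  rw [norm_mul, Complex.norm_real, Real.norm_of_nonneg (by positivity)]
  exact mul_le_mul_of_nonneg_left (by simpa using h (u / z s)) (by positivity)

lemma kap_aa (ψ : SchwartzMap ℝ ℂ) {f : ℝ → ℂ} (hf : Integrable f) (S : ℕ) (M x : ℝ) :
    ∑ s ∈ Finset.Icc (-S : ℤ) S, aa ψ f s M x = ∫ y, f y * (ee (M * (x - y)) * kap ψ S (x - y)) := by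
  obtain ⟨C, hC, h⟩ := schw_decay ψ 0
  simp only [aa]
  rw [← integral_finsetSum]
  · congr 1; ext y; rw [kap, Finset.mul_sum, Finset.mul_sum]
  · intro s _
    exact aa_int hf ψ.continuous (fun u => by simpa using h u) s M x

lemma tele {ψ : ℝ → ℂ} {η : ℝ → ℝ} (h : ∀ u, u * (2 * (ψ u).re) = Th η u - Th η (2 * u)) (S : ℕ) (u : ℝ) :
    u * (2 * (kap ψ S u).re) = Th η (u / z S) - Th η (u / z (-S - 1)) := by
  induction S with
  | zero =>
    simp only [kap, Nat.cast_zero, neg_zero, Finset.Icc_self, Finset.sum_singleton, z_zero, div_one, inv_one, Complex.ofReal_one, one_mul]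
    rw [h, zero_sub, z_neg, z_one, div_inv_eq_mul, mul_comm u]
  | succ S ih =>
    have e : Finset.Icc (-(S + 1 : ℕ) : ℤ) (S + 1 : ℕ) = insert (-(S + 1 : ℕ) : ℤ) (insert ((S + 1 : ℕ) : ℤ) (Finset.Icc (-S : ℤ) S)) := by
      ext a; simp only [Finset.mem_insert, Finset.mem_Icc]; omega
    have g : ∀ s : ℤ, u * (2 * ((((z s)⁻¹ : ℝ) : ℂ) * ψ (u / z s)).re) = Th η (u / z s) - Th η (u / z (s - 1)) := fun s => by
      have e2 : u / z (s - 1) = 2 * (u / z s) := by rw [z_sub, z_one]; have := z_pos s; field_simp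
      rw [e2, ← h, Complex.re_ofReal_mul]; have := z_pos s; field_simp
    unfold kap at ih ⊢
    rw [e, Finset.sum_insert (by simp only [Finset.mem_insert, Finset.mem_Icc]; omega), Finset.sum_insert (by simp only [Finset.mem_Icc]; omega),
      Complex.add_re, Complex.add_re, mul_add, mul_add, mul_add, mul_add, g, g, ih]
    push_cast
    rw [show (S : ℤ) + 1 - 1 = S by ring, show -((S : ℤ) + 1) = -S - 1 by ring]; ring

end
end Car

namespace Car
noncomputable section
open FourierTransform ComplexConjugate
open scoped Classical

lemma maxsel {H : ℝ → ℝ → ℂ} {B : ℝ≥0∞} {p : ℝ} (hp : 0 < p) (hc : ∀ x, Continuous fun M => H M x) (hm : ∀ M, Measurable (H M))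
    (hb : ∀ N : ℝ → ℝ, Measurable N → (∃ R : ℕ, ∀ x, |N x| ≤ R) → ∫⁻ x, ‖H (N x) x‖ₑ ^ p ≤ B) :
    ∫⁻ x, (⨆ M, ‖H M x‖ₑ) ^ p ≤ B := by
  set q := TopologicalSpace.denseSeq ℝ
  set N : ℕ → ℝ → ℝ := fun n => Nat.rec (fun _ => q 0) (fun n Nn x => if ‖H (Nn x) x‖ₑ < ‖H (q (n + 1)) x‖ₑ then q (n + 1) else Nn x) n with hN
  have N0 : ∀ x, N 0 x = q 0 := fun x => rfl
  have N1 : ∀ n x, N (n + 1) x = if ‖H (N n x) x‖ₑ < ‖H (q (n + 1)) x‖ₑ then q (n + 1) else N n x := fun n x => rfl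
  have g1 : ∀ n x, ‖H (N (n + 1) x) x‖ₑ = max ‖H (N n x) x‖ₑ ‖H (q (n + 1)) x‖ₑ := fun n x => by
    rw [N1]; split_ifs with h
    · rw [max_eq_right h.le]
    · rw [max_eq_left (not_lt.1 h)]
  have gm : ∀ n, Measurable fun x => ‖H (N n x) x‖ₑ := fun n => by
    induction n with
    | zero => simp only [N0]; exact (hm _).enorm
    | succ n ih => simp only [g1]; exact ih.max (hm _).enorm
  have Nm : ∀ n, Measurable (N n) := fun n => by
    induction n with
    | zero => exact measurable_const
    | succ n ih => exact Measurable.ite (measurableSet_lt (gm n) (hm _).enorm) measurable_const ih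
  have Nb : ∀ n, ∃ R : ℕ, ∀ x, |N n x| ≤ R := fun n => by
    induction n with
    | zero => obtain ⟨R, hR⟩ := exists_nat_ge |q 0|; exact ⟨R, fun x => hR⟩
    | succ n ih =>
      obtain ⟨R, hR⟩ := exists_nat_ge |q (n + 1)|; obtain ⟨R', hR'⟩ := ih
      refine ⟨R + R', fun x => ?_⟩
      rw [N1]; push_cast; split_ifs
      · linarith [(Nat.cast_nonneg R' : (0:ℝ) ≤ R')]
      · linarith [hR' x, (Nat.cast_nonneg R : (0:ℝ) ≤ R)]
  have mono : ∀ x, Monotone fun n => ‖H (N n x) x‖ₑ := fun x => monotone_nat_of_le_succ fun n => by rw [g1]; exact le_max_left _ _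
  have sup : ∀ x, (⨆ M, ‖H M x‖ₑ) ^ p = ⨆ n, ‖H (N n x) x‖ₑ ^ p := fun x => by
    refine Eq.trans ?_ ((ENNReal.orderIsoRpow p hp).map_iSup fun n => ‖H (N n x) x‖ₑ)
    rw [ENNReal.orderIsoRpow_apply]; congr 1
    refine le_antisymm (iSup_le fun M => ?_) (iSup_le fun n => le_iSup (fun M => ‖H M x‖ₑ) _)
    refine (TopologicalSpace.denseRange_denseSeq ℝ).induction_on (p := fun M => ‖H M x‖ₑ ≤ ⨆ n, ‖H (N n x) x‖ₑ) M
      (isClosed_le (hc x).enorm continuous_const) fun n => ?_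
    refine le_trans ?_ (le_iSup _ n)
    cases n with
    | zero => exact le_rfl
    | succ n => rw [g1]; exact le_max_right _ _
  simp only [sup]
  rw [lintegral_iSup (fun n => (gm n).pow_const _) (fun i j h x => ENNReal.rpow_le_rpow (mono x h) hp.le)]
  exact iSup_le fun n => hb _ (Nm n) (Nb n)

lemma del {p : ℝ} (hp : 1 < p) : ∃ δ, 0 < δ ∧ 0 < 1 / p - δ ∧ 1 / p + δ < 1 := by
  have h1 : 0 < 1 / p := by positivity
  have h2 : 1 / p < 1 := by rw [div_lt_one (by linarith)]; exact hp
  refine ⟨min (1/p) (1 - 1/p) / 2, by have : 0 < min (1/p) (1 - 1/p) := lt_min h1 (by linarith)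
                                      linarith, ?_, ?_⟩
  · linarith [min_le_left (1/p) (1 - 1/p)]
  · linarith [min_le_right (1/p) (1 - 1/p)]

lemma ind_int {f : ℝ → ℂ} {F : Set ℝ} (hf : Measurable f) (hF : MeasurableSet F) (hF' : volume F ≠ ∞) (h : ∀ y, ‖f y‖ₑ ≤ F.indicator 1 y) :
    Integrable f := by
  refine ⟨hf.aestronglyMeasurable, ?_⟩
  refine (lintegral_mono h).trans_lt ?_
  rw [lintegral_indicator_one hF]; exact hF'.lt_top

lemma carl_S {p : ℝ} (hp : 1 < p) {ψ : SchwartzMap ℝ ℂ} (hψ : Band ψ (-(7/16)) (-(1/16))) :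
    ∃ C : ℝ≥0∞, C ≠ ∞ ∧ ∀ (S R' : ℕ) (N : ℝ → ℝ), Measurable N → (∀ x, |N x| ≤ R') → ∀ f : ℝ → ℂ, Measurable f → Integrable f →
      ∫⁻ x, ‖∫ y, f y * (ee (N x * (x - y)) * ((2 * (kap ψ S (x - y)).re : ℝ) : ℂ))‖ₑ ^ p ≤ C * ∫⁻ y, ‖f y‖ₑ ^ p := by
  obtain ⟨δ, d0, d1, d2⟩ := del hp
  obtain ⟨C1, hC1, H1⟩ := full_rwt hψ d1 (by linarith)
  obtain ⟨C2, hC2, H2⟩ := full_rwt hψ (α := 1 / p + δ) (by linarith) d2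
  obtain ⟨C, hC, H⟩ := strong2 hp d0 d1 d2 (D := 2 * (C1 + C2)) (by finiteness)
  refine ⟨C, hC, fun S R' N hN hNb f hf hfi => ?_⟩
  obtain ⟨K, hK⟩ := kap_bdd ψ S
  have kc := kap_cont ψ.continuous S
  have := H (fun x y => ee (N x * (x - y)) * ((2 * (kap ψ S (x - y)).re : ℝ) : ℂ)) (2 * K) 1 ?_ (fun x y => ?_) le_rfl
    (fun f F E hf hF hF' hb hE hE' a ha => ?_) f hf hfi
  · simpa using this
  · have h2 : Measurable fun v : ℝ × ℝ => ((2 * (kap ψ S (v.1 - v.2)).re : ℝ) : ℂ) := by fun_prop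
    exact Measurable.mul (by fun_prop) h2
  · rw [norm_mul, ee_norm, one_mul, Complex.norm_real, Real.norm_eq_abs, abs_mul, abs_two]
    exact mul_le_mul_of_nonneg_left ((Complex.abs_re_le_norm _).trans (hK _)) zero_le_two
  · have fi := ind_int hf hF hF' hb
    have gm : Measurable fun y => conj (f y) := by fun_prop
    have gi : Integrable fun y => conj (f y) := fi.congr' (by fun_prop) (ae_of_all _ fun y => by simp)
    have gb : ∀ y, ‖conj (f y)‖ₑ ≤ F.indicator 1 y := fun y => by
      rw [← ofReal_norm, RCLike.norm_conj, ofReal_norm]; exact hb y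
    have int1 : ∀ {g : ℝ → ℂ}, Integrable g → ∀ M x, Integrable fun y => g y * (ee (M * (x - y)) * kap ψ S (x - y)) := fun gi M x =>
      gi.mul_bdd (c := K) (by fun_prop) (ae_of_all _ fun y => by rw [norm_mul, ee_norm, one_mul]; exact hK _)
    have e : ∀ x, ‖∫ y, f y * (ee (N x * (x - y)) * ((2 * (kap ψ S (x - y)).re : ℝ) : ℂ))‖ₑ
        ≤ ‖∑ s ∈ Finset.Icc (-S : ℤ) S, aa ψ f s (N x) x‖ₑ + ‖∑ s ∈ Finset.Icc (-S : ℤ) S, aa ψ (fun y => conj (f y)) s (-N x) x‖ₑ := fun x => by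
      have : ∫ y, f y * (ee (N x * (x - y)) * ((2 * (kap ψ S (x - y)).re : ℝ) : ℂ))
          = (∫ y, f y * (ee (N x * (x - y)) * kap ψ S (x - y))) + conj (∫ y, conj (f y) * (ee (-N x * (x - y)) * kap ψ S (x - y))) := by
        rw [← integral_conj, ← integral_add (int1 fi _ _)]
        · congr 1; ext y
          have h3 : conj (ee (-N x * (x - y))) = ee (N x * (x - y)) := by rw [ee_conj]; congr 1; ring
          rw [map_mul, map_mul, h3, Complex.conj_conj, Complex.ofReal_mul, Complex.ofReal_ofNat, Complex.re_eq_add_conj]; ring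
        · refine (int1 gi (-N x) x).congr' (by fun_prop) (ae_of_all _ fun y => by rw [RCLike.norm_conj])
      rw [this, kap_aa ψ fi, kap_aa ψ gi]
      refine (enorm_add_le _ _).trans (le_of_eq ?_)
      rw [← ofReal_norm (conj _), RCLike.norm_conj, ofReal_norm]
    refine (lintegral_mono e).trans ?_
    have key : ∀ C', C' ≤ C1 + C2 → (∀ (f : ℝ → ℂ) (F : Set ℝ) (N : ℝ → ℝ) (S R' : ℕ), Measurable f → MeasurableSet F → volume F ≠ ∞ →
      (∀ y, ‖f y‖ₑ ≤ F.indicator 1 y) → Measurable N → (∀ x, |N x| ≤ R') → ∀ E, MeasurableSet E → volume E ≠ ∞ →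
      ∫⁻ x in E, ‖∑ s ∈ Finset.Icc (-S : ℤ) S, aa ψ f s (N x) x‖ₑ ≤ C' * (volume E ^ (1 - a) * volume F ^ a)) →
      ∫⁻ x in E, (‖∑ s ∈ Finset.Icc (-S : ℤ) S, aa ψ f s (N x) x‖ₑ + ‖∑ s ∈ Finset.Icc (-S : ℤ) S, aa ψ (fun y => conj (f y)) s (-N x) x‖ₑ)
        ≤ 2 * (C1 + C2) * 1 * (volume E ^ (1 - a) * volume F ^ a) := fun C' hC' H' => by
      rw [lintegral_add_left]
      · refine (add_le_add (H' f F N S R' hf hF hF' hb hN hNb E hE hE')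
          (H' _ F (fun x => -N x) S R' gm hF hF' gb hN.neg (fun x => by rw [abs_neg]; exact hNb x) E hE hE')).trans ?_
        rw [mul_one, ← two_mul, ← mul_assoc]; gcongr
      · exact (Finset.measurable_sum _ fun s _ => aa_meas hf ψ.continuous hN s).enorm
    rcases ha with rfl | rfl
    · exact key C1 le_self_add H1
    · exact key C2 le_add_self H2

end
end Car

namespace Car
noncomputable section
open FourierTransform ComplexConjugate
open scoped Classical

def Hv (G : ℝ → ℂ) : ℂ := ∫ u in Ioi (0:ℝ), (G u - G (-u)) / u

lemma odd_int {G q : ℝ → ℂ} (hq : ∀ u > 0, q (-u) = -q u) (hi : Integrable fun u => G u * q u) :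
    ∫ u, G u * q u = ∫ u in Ioi (0:ℝ), (G u - G (-u)) * q u := by
  have h2 : Integrable fun u => G (-u) * q (-u) := hi.comp_neg
  rw [← intervalIntegral.integral_Iic_add_Ioi (b := 0) hi.integrableOn hi.integrableOn]
  have e := integral_comp_neg_Ioi 0 fun u => G u * q u
  rw [neg_zero] at e
  rw [← e, ← integral_add h2.integrableOn hi.integrableOn]
  refine setIntegral_congr_fun measurableSet_Ioi fun u hu => ?_
  simp only [hq u hu]; ring

def mG (f : ℝ → ℂ) (M x u : ℝ) : ℂ := f (x - u) * ee (M * u)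

lemma mG_bound (f : SchwartzMap ℝ ℂ) : ∃ K, 0 < K ∧ ∀ M x u, 0 < u → ‖(mG f M x u - mG f M x (-u)) / u‖ ≤ K * (1 + |M|) * (w u + w (x - u) + w (x + u)) := by
  obtain ⟨C, hC, h1, h2⟩ := schw_lip f 1
  refine ⟨28 * C, by positivity, fun M x u hu => ?_⟩
  rw [norm_div, Complex.norm_real, Real.norm_of_nonneg hu.le, div_le_iff₀ hu]
  have wa := w_nn u; have wb := w_nn (x - u); have wc := w_nn (x + u)
  simp only [mG, sub_neg_eq_add, pow_one] at *
  have M0 := abs_nonneg M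
  rcases le_total u 1 with h | h
  · have hw : 1 / 2 ≤ w u := by unfold w; rw [one_div]; exact inv_anti₀ (by positivity) (by nlinarith)
    have e : f (x - u) * ee (M * u) - f (x + u) * ee (M * -u) = (f (x - u) - f (x + u)) * ee (M * u) + f (x + u) * (ee (M * -u) * (ee (2 * M * u) - 1)) := by
      rw [mul_sub (ee _), ← ee_add, mul_one, show M * -u + 2 * M * u = M * u by ring]; ring
    have a1 := h2 (x - u) (x + u)
    have a2 := ee_one_sub (2 * M * u)
    rw [show x - u - (x + u) = -(2 * u) by ring, abs_neg, abs_of_pos (by positivity : 0 < 2 * u)] at a1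
    rw [abs_mul, abs_mul, abs_two, abs_of_pos hu] at a2
    have a3 := h1 (x + u)
    rw [e]
    refine (norm_add_le _ _).trans ?_
    rw [norm_mul, norm_mul, norm_mul, ee_norm, ee_norm, mul_one, one_mul]
    have a4 : ‖f (x - u) - f (x + u)‖ ≤ 4 * C * u := a1.trans (by nlinarith [w_le_one (x - u), w_le_one (x + u), mul_pos hC hu])
    have a5 : ‖f (x + u)‖ * ‖ee (2 * M * u) - 1‖ ≤ C * (7 * (2 * |M| * u)) :=
      mul_le_mul (a3.trans (by nlinarith [w_le_one (x + u)])) a2 (norm_nonneg _) hC.le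
    have a6 : 14 * C * (1 + |M|) * u ≤ 28 * C * (1 + |M|) * (w u + w (x - u) + w (x + u)) * u := by
      have : 14 * C * (1 + |M|) * 1 ≤ 14 * C * (1 + |M|) * (2 * (w u + w (x - u) + w (x + u))) := mul_le_mul_of_nonneg_left (by linarith) (by positivity)
      nlinarith
    nlinarith [mul_pos hC hu]
  · refine (norm_sub_le _ _).trans ?_
    rw [norm_mul, norm_mul, ee_norm, ee_norm, mul_one, mul_one]
    have : C * (w (x - u) + w (x + u)) ≤ 28 * C * (1 + |M|) * (w u + w (x - u) + w (x + u)) * u := by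
      have h3 : C * 1 * (w (x - u) + w (x + u)) * 1 ≤ 28 * C * (1 + |M|) * (w u + w (x - u) + w (x + u)) * u := by
        gcongr <;> linarith
      linarith
    linarith [h1 (x - u), h1 (x + u)]

lemma wx_int (x : ℝ) : Integrable fun u => w u + w (x - u) + w (x + u) := by
  have h1 : Integrable w := w_int
  exact (h1.add (h1.comp_sub_left x)).add (h1.comp_add_left x)

lemma mG_cont (f : SchwartzMap ℝ ℂ) (M x : ℝ) : Continuous (mG f M x) := by unfold mG; have := f.continuous; fun_prop

lemma mG_meas (f : SchwartzMap ℝ ℂ) (M x : ℝ) : Measurable fun u : ℝ => (mG f M x u - mG f M x (-u)) / u := by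
  have := (mG_cont f M x).measurable; fun_prop

lemma mG_int (f : SchwartzMap ℝ ℂ) (M x : ℝ) : IntegrableOn (fun u : ℝ => (mG f M x u - mG f M x (-u)) / u) (Ioi 0) := by
  obtain ⟨K, hK, h⟩ := mG_bound f
  refine Integrable.mono' ((wx_int x).const_mul (K * (1 + |M|))).integrableOn (mG_meas f M x).aestronglyMeasurable ?_
  exact (ae_restrict_iff' measurableSet_Ioi).2 (ae_of_all _ fun u hu => h M x u hu)

lemma Hv_cont (f : SchwartzMap ℝ ℂ) (x : ℝ) : Continuous fun M => Hv (mG f M x) := by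
  obtain ⟨K, hK, h⟩ := mG_bound f
  rw [continuous_iff_continuousAt]; intro M
  refine continuousAt_of_dominated (bound := fun u => K * (1 + (|M| + 1)) * (w u + w (x - u) + w (x + u)))
    (Eventually.of_forall fun M' => (mG_meas f M' x).aestronglyMeasurable) ?_ ((wx_int x).const_mul _).integrableOn ?_
  · filter_upwards [Metric.ball_mem_nhds M one_pos] with M' hM'
    refine (ae_restrict_iff' measurableSet_Ioi).2 (ae_of_all _ fun u hu => (h M' x u hu).trans ?_)
    have : |M'| ≤ |M| + 1 := by
      rw [Metric.mem_ball, Real.dist_eq] at hM'; linarith [abs_sub_abs_le_abs_sub M' M]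
    have wa := w_nn u; have wb := w_nn (x - u); have wc := w_nn (x + u)
    gcongr
  · refine ae_of_all _ fun u => Continuous.continuousAt ?_
    unfold mG; fun_prop

lemma w_tend : Tendsto w atTop (𝓝 0) :=
  tendsto_inv_atTop_zero.comp (tendsto_atTop_add_const_left _ _ (tendsto_pow_atTop two_ne_zero))

lemma H_lim {ψ : SchwartzMap ℝ ℂ} {η : ℝ → ℝ} {C : ℝ} (hC : 0 < C) (hc : Continuous (Th η)) (h0 : Th η 0 = 1)
    (hd : ∀ u, |Th η u| ≤ C * w u) (ht : ∀ u, u * (2 * (ψ u).re) = Th η u - Th η (2 * u)) (f : SchwartzMap ℝ ℂ) (M x : ℝ) :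
    Tendsto (fun S : ℕ => ∫ y, f y * (ee (M * (x - y)) * ((2 * (kap ψ S (x - y)).re : ℝ) : ℂ))) atTop (𝓝 (Hv (mG f M x))) := by
  have e : ∀ S : ℕ, ∫ y, f y * (ee (M * (x - y)) * ((2 * (kap ψ S (x - y)).re : ℝ) : ℂ))
      = ∫ u in Ioi (0:ℝ), (mG f M x u - mG f M x (-u)) / u * ((Th η (u / z S) - Th η (u / z (-S - 1)) : ℝ) : ℂ) := fun S => by
    obtain ⟨K, hK⟩ := kap_bdd ψ S
    have e1 := integral_sub_left_eq_self (fun u => mG f M x u * ((2 * (kap ψ S u).re : ℝ) : ℂ)) volume x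
    have e2 : ∫ y, f y * (ee (M * (x - y)) * ((2 * (kap ψ S (x - y)).re : ℝ) : ℂ)) = ∫ y, mG f M x (x - y) * ((2 * (kap ψ S (x - y)).re : ℝ) : ℂ) := by
      congr 1; ext y; rw [mG, sub_sub_cancel]; ring
    have kc := kap_cont ψ.continuous S
    rw [e2, e1, odd_int]
    · refine setIntegral_congr_fun measurableSet_Ioi fun u hu => ?_
      have hu' : (u : ℂ) ≠ 0 := Complex.ofReal_ne_zero.2 (ne_of_gt hu)
      rw [← tele ht S u, Complex.ofReal_mul u]; field_simp
    · intro u hu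
      have t1 := tele ht S u
      have t2 := tele ht S (-u)
      rw [neg_div, neg_div, Th_neg, Th_neg, ← t1] at t2
      rw [← Complex.ofReal_neg]; congr 1
      have : u * (2 * (kap ψ S (-u)).re + 2 * (kap ψ S u).re) = 0 := by linarith
      rcases mul_eq_zero.1 this with h | h
      · exact absurd h hu.ne'
      · linarith
    · have : Integrable (mG f M x) := (f.integrable.comp_sub_left x).mul_bdd (c := 1) (by fun_prop) (ae_of_all _ fun y => by rw [ee_norm])
      refine this.mul_bdd (c := 2 * K) (by fun_prop) (ae_of_all _ fun u => ?_)
      rw [Complex.norm_real, Real.norm_eq_abs, abs_mul, abs_two]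
      exact mul_le_mul_of_nonneg_left ((Complex.abs_re_le_norm _).trans (hK _)) zero_le_two
  simp only [e]
  refine tendsto_integral_of_dominated_convergence (fun u => ‖(mG f M x u - mG f M x (-u)) / u‖ * (C + C)) (fun S => ?_) ((mG_int f M x).norm.mul_const _) (fun S => ?_) ?_
  · have h3 : Measurable fun u : ℝ => ((Th η (u / z S) - Th η (u / z (-S - 1)) : ℝ) : ℂ) := by have := hc.measurable; fun_prop
    exact ((mG_meas f M x).mul h3).aestronglyMeasurable
  · refine ae_of_all _ fun u => ?_
    rw [norm_mul, Complex.norm_real, Real.norm_eq_abs]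
    refine mul_le_mul_of_nonneg_left ((abs_sub _ _).trans (add_le_add ?_ ?_)) (norm_nonneg _) <;>
      exact (hd _).trans (by nlinarith [w_le_one (u / z S), w_le_one (u / z (-S - 1))])
  · refine (ae_restrict_iff' measurableSet_Ioi).2 (ae_of_all _ fun u hu => ?_)
    rw [mem_Ioi] at hu
    have hp : Tendsto (fun S : ℕ => z S) atTop atTop := by
      have : (fun S : ℕ => z S) = fun S => 2 ^ S := funext z_nat
      rw [this]; exact tendsto_pow_atTop_atTop_of_one_lt one_lt_two
    have l1 : Tendsto (fun S : ℕ => Th η (u / z S)) atTop (𝓝 1) := by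
      rw [← h0]; exact (hc.tendsto 0).comp (tendsto_const_nhds.div_atTop hp)
    have l2 : Tendsto (fun S : ℕ => Th η (u / z (-S - 1))) atTop (𝓝 0) := by
      refine squeeze_zero_norm (fun S => hd _) ?_
      rw [← mul_zero C]
      refine (w_tend.comp ?_).const_mul C
      have : ∀ S : ℕ, u / z (-S - 1) = 2 * u * z S := fun S => by
        rw [show -(S : ℤ) - 1 = -(S + 1) by ring, z_neg, z_succ, div_inv_eq_mul]; ring
      simp only [this]
      exact hp.const_mul_atTop (by positivity)
    have := ((Complex.continuous_ofReal.tendsto _).comp (l1.sub l2)).const_mul ((mG f M x u - mG f M x (-u)) / u)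
    simpa using this

theorem carl {p : ℝ} (hp : 1 < p) : ∃ C : ℝ≥0∞, C ≠ ∞ ∧ ∀ f : SchwartzMap ℝ ℂ,
    ∫⁻ x, (⨆ M, ‖Hv (mG f M x)‖ₑ) ^ p ≤ C * ∫⁻ y, ‖f y‖ₑ ^ p := by
  obtain ⟨ψ, η, C0, hψ, -, -, hC0, hc, h0, hd, -, ht⟩ := ker_ex
  obtain ⟨C, hC, H⟩ := carl_S hp hψ
  refine ⟨C, hC, fun f => ?_⟩
  have fm : Measurable f := f.continuous.measurable
  have mm : ∀ N : ℝ → ℝ, Measurable N → ∀ S, Measurable fun x => ∫ y, f y * (ee (N x * (x - y)) * ((2 * (kap ψ S (x - y)).re : ℝ) : ℂ)) := fun N hN S => by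
    have kc := (kap_cont ψ.continuous S).measurable
    have h2 : Measurable fun v : ℝ × ℝ => ((2 * (kap ψ S (v.1 - v.2)).re : ℝ) : ℂ) := by fun_prop
    have h3 : Measurable fun v : ℝ × ℝ => ee (N v.1 * (v.1 - v.2)) := by fun_prop
    exact kint_meas fm (h3.mul h2)
  have lim := H_lim hC0 hc h0 hd ht f
  have gm : ∀ N : ℝ → ℝ, Measurable N → Measurable fun x => Hv (mG f (N x) x) := fun N hN =>
    measurable_of_tendsto_metrizable (mm N hN) (tendsto_pi_nhds.2 fun x => lim (N x) x)
  refine maxsel (H := fun M x => Hv (mG f M x)) (by linarith) (Hv_cont f) (fun M => gm _ measurable_const) fun N hN ⟨R, hR⟩ => ?_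
  calc _ = ∫⁻ x, liminf (fun S : ℕ => ‖∫ y, f y * (ee (N x * (x - y)) * ((2 * (kap ψ S (x - y)).re : ℝ) : ℂ))‖ₑ ^ p) atTop := by
        congr 1; ext x
        exact (((ENNReal.continuous_rpow_const (y := p)).tendsto _).comp ((lim (N x) x).enorm)).liminf_eq.symm
    _ ≤ _ := lintegral_liminf_le fun S => (mm N hN S).enorm.pow_const _
    _ ≤ _ := liminf_le_of_le (by isBoundedDefault) fun b hb => by
        obtain ⟨S, hS⟩ := hb.exists
        exact hS.trans (H S R N hN hR f fm f.integrable)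

end
end Car

namespace Car
noncomputable section
open FourierTransform ComplexConjugate
open scoped Classical

lemma rp_bd {r : ℝ} (h1 : 1 ≤ r) (h2 : r ≤ 2) (e : ℝ) : r ^ e ≤ 2 ^ |e| ∧ (2 ^ |e|)⁻¹ ≤ r ^ e := by
  have h : ∀ e : ℝ, r ^ e ≤ 2 ^ |e| := fun e =>
    (Real.rpow_le_rpow_of_exponent_le h1 (le_abs_self e)).trans (Real.rpow_le_rpow (by linarith) h2 (abs_nonneg e))
  refine ⟨h e, ?_⟩
  have := h (-e)
  rw [abs_neg, Real.rpow_neg (by linarith)] at this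
  exact inv_le_of_inv_le₀ (Real.rpow_pos_of_pos (by linarith) _) this

lemma lin_sub {A B h : ℝ} (hB : B ≠ 0) (hh : 0 < h) : volume {r ∈ Icc (1:ℝ) 2 | |A * r - B| < h} ≤ ENNReal.ofReal (8 * h / |B|) := by
  have hB' := abs_pos.2 hB
  rcases le_total (|B| / 4) |A| with hA | hA
  · have hA' : 0 < |A| := by linarith
    have A0 : A ≠ 0 := abs_pos.1 hA'
    calc _ ≤ volume (Metric.ball (B / A) (h / |A|)) := measure_mono fun r hr => by
            rw [Metric.mem_ball, Real.dist_eq, lt_div_iff₀ hA', ← abs_mul, sub_mul, div_mul_cancel₀ _ A0, mul_comm]; exact hr.2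
      _ ≤ _ := by
        rw [Real.volume_ball]; apply ENNReal.ofReal_le_ofReal
        rw [mul_div_assoc', div_le_div_iff₀ hA' hB']; nlinarith
  · by_cases h' : |B| / 2 < h
    · calc _ ≤ volume (Icc (1:ℝ) 2) := measure_mono fun r hr => hr.1
        _ ≤ _ := by rw [Real.volume_Icc]; apply ENNReal.ofReal_le_ofReal; rw [le_div_iff₀ hB']; linarith
    · rw [show {r ∈ Icc (1:ℝ) 2 | |A * r - B| < h} = ∅ from ?_]; · simp
      rw [eq_empty_iff_forall_notMem]; rintro r ⟨⟨r1, r2⟩, hr⟩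
      have : |A * r| ≤ |B| / 2 := by rw [abs_mul, abs_of_nonneg (by linarith : 0 ≤ r)]; nlinarith [abs_nonneg A]
      have := abs_sub_abs_le_abs_sub B (A * r)
      rw [abs_sub_comm] at this; linarith

lemma osc2 {ε : ℝ} (h1 : ε ≠ 1) : ∃ C, 0 < C ∧ ∀ κ b η : ℝ, 0 < κ → κ ≤ 1 → b ≠ 0 → 0 < η →
    volume {r ∈ Icc (1:ℝ) 2 | (1 ≤ b + κ * r ∧ b + κ * r ≤ 2) ∧ |κ * (b + κ * r) ^ (ε - 1) - r ^ (ε - 1)| < η} ≤ ENNReal.ofReal (C * η / |b|) := by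
  have he : ε - 1 ≠ 0 := sub_ne_zero.2 h1
  set e := (ε - 1)⁻¹
  set q : ℝ := 2 ^ |ε - 1|
  have q1 : 1 ≤ q := Real.one_le_rpow one_le_two (abs_nonneg _)
  set L : ℝ := |e| * (2 * q) ^ |e - 1|
  have hL : 0 < L := mul_pos (abs_pos.2 (inv_ne_zero he)) (by positivity)
  refine ⟨64 * L + 16 * q + 1, by positivity, fun κ b η hk hk1 hb hη => ?_⟩
  have hb' := abs_pos.2 hb
  set Sb := {r ∈ Icc (1:ℝ) 2 | (1 ≤ b + κ * r ∧ b + κ * r ≤ 2) ∧ |κ * (b + κ * r) ^ (ε - 1) - r ^ (ε - 1)| < η}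
  rcases Sb.eq_empty_or_nonempty with h | ⟨r0, h0⟩
  · rw [h]; simp
  have b4 : |b| ≤ 4 := by obtain ⟨⟨a1, a2⟩, ⟨a3, a4⟩, a5⟩ := h0; exact abs_le.2 ⟨by nlinarith, by nlinarith⟩
  rcases le_or_gt (1 / 2) ((8 * L + 2 * q) * η) with h | h
  · calc _ ≤ volume (Icc (1:ℝ) 2) := measure_mono fun r hr => hr.1
      _ ≤ _ := by rw [Real.volume_Icc]; apply ENNReal.ofReal_le_ofReal; rw [le_div_iff₀ hb']; nlinarith
  have hq : q * η < 1 / 4 := by nlinarith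
  have hl : L * η < 1 / 16 := by nlinarith
  set μ := κ ^ e
  have hμ : 0 < μ := Real.rpow_pos_of_pos hk _
  have q0 : 0 < q := by linarith
  have iq : η < q⁻¹ / 4 := by rw [lt_div_iff₀ (by norm_num), ← one_div, lt_div_iff₀ q0]; linarith
  have key : ∀ r ∈ Sb, |μ * (b + κ * r) - r| < L * η := by
    rintro r ⟨⟨a1, a2⟩, ⟨a3, a4⟩, a5⟩
    have X := rp_bd a1 a2 (ε - 1)
    have Y := rp_bd a3 a4 (ε - 1)
    rw [abs_lt] at a5
    have Y2 : κ * (b + κ * r) ^ (ε - 1) ≤ q := (mul_le_of_le_one_left (by positivity) hk1).trans Y.1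
    have i2 : (2 * q)⁻¹ ≤ q⁻¹ / 2 := by rw [mul_inv]; linarith
    have hs : ∀ y ∈ Icc (2 * q)⁻¹ (2 * q), y ^ (e - 1) ≤ (2 * q) ^ |e - 1| := by
      rintro y ⟨y1, y2⟩
      have y0 : 0 < y := lt_of_lt_of_le (by positivity) y1
      rcases le_total 0 (e - 1) with h | h
      · rw [abs_of_nonneg h]; exact Real.rpow_le_rpow y0.le y2 h
      · rw [abs_of_nonpos h, Real.rpow_neg (by positivity), ← Real.inv_rpow (by positivity)]
        exact Real.rpow_le_rpow_of_nonpos (by positivity) y1 h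
    have := (convex_Icc (2 * q)⁻¹ (2 * q)).norm_image_sub_le_of_norm_hasDerivWithin_le (f := fun y => y ^ e) (f' := fun y => e * y ^ (e - 1)) (C := L)
      (fun y hy => (Real.hasDerivAt_rpow_const (Or.inl (lt_of_lt_of_le (by positivity) hy.1).ne')).hasDerivWithinAt)
      (fun y hy => by
        have y0 : 0 < y := lt_of_lt_of_le (by positivity) hy.1
        rw [norm_mul, Real.norm_eq_abs, Real.norm_of_nonneg (by positivity)]
        exact mul_le_mul_of_nonneg_left (hs y hy) (abs_nonneg _))
      (x := r ^ (ε - 1)) (y := κ * (b + κ * r) ^ (ε - 1)) ⟨by linarith [X.2], by linarith [X.1]⟩ ⟨by linarith [X.2], by linarith⟩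
    rw [Real.mul_rpow hk.le (by positivity), ← Real.rpow_mul (by linarith), ← Real.rpow_mul (by linarith), mul_inv_cancel₀ he, Real.rpow_one, Real.rpow_one] at this
    exact lt_of_le_of_lt this (mul_lt_mul_of_pos_left (by rw [Real.norm_eq_abs, abs_lt]; exact a5) hL)
  have m4 : 1 / 4 ≤ μ := by
    have := abs_lt.1 (key r0 h0); obtain ⟨⟨a1, a2⟩, ⟨a3, a4⟩, a5⟩ := h0; nlinarith
  calc _ ≤ volume {r ∈ Icc (1:ℝ) 2 | |(1 - μ * κ) * r - μ * b| < L * η} := measure_mono fun r hr => ⟨hr.1, by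
          have := key r hr; rw [abs_sub_comm] at this; convert this using 2; ring⟩
    _ ≤ _ := lin_sub (mul_ne_zero hμ.ne' hb) (by positivity)
    _ ≤ _ := ENNReal.ofReal_le_ofReal (by
        rw [abs_mul, abs_of_pos hμ, div_le_div_iff₀ (by positivity) hb']
        have : 8 * (L * η) ≤ (64 * L + 16 * q + 1) * η * μ := by
          have : L * η * (1/4) ≤ L * η * μ := by gcongr
          have : 0 ≤ (16 * q + 1) * η * μ := by positivity
          nlinarith
        nlinarith)

lemma ibp {Φ D D' a a' : ℝ → ℝ} {c γ C α β : ℝ} (hc : c ≠ 0) (hγ : 0 < γ) (γ1 : γ ≤ 1) (hC : 0 ≤ C) (hab : α ≤ β) (hl : β - α ≤ 1)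
    (dΦ : ∀ t ∈ Icc α β, HasDerivAt Φ (c * D t) t) (dD : ∀ t ∈ Icc α β, HasDerivAt D (D' t) t) (da : ∀ t ∈ Icc α β, HasDerivAt a (a' t) t)
    (cD : ContinuousOn D' (Icc α β)) (ca : ContinuousOn a' (Icc α β)) (bD : ∀ t ∈ Icc α β, |D' t| ≤ C) (b0 : ∀ t ∈ Icc α β, |a t| ≤ 1) (b1 : ∀ t ∈ Icc α β, |a' t| ≤ 4) :
    ‖∫ t in α..β, Complex.exp (Complex.I * Φ t) * a t‖ ≤ (C + 6) / (|c| * γ ^ 2) + ∫ t in α..β, γ ^ 2 / (D t ^ 2 + γ ^ 2) := by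
  have hpos : ∀ t, 0 < D t ^ 2 + γ ^ 2 := fun t => by positivity
  set Gd : ℝ → ℝ := fun t => D' t * a t * (γ ^ 2 - D t ^ 2) / (D t ^ 2 + γ ^ 2) ^ 2 + D t * a' t / (D t ^ 2 + γ ^ 2)
  set G : ℝ → ℝ := fun t => D t * a t / (D t ^ 2 + γ ^ 2)
  have cDD : ContinuousOn D (Icc α β) := fun t ht => (dD t ht).continuousAt.continuousWithinAt
  have cA : ContinuousOn a (Icc α β) := fun t ht => (da t ht).continuousAt.continuousWithinAt
  have cΦ : ContinuousOn Φ (Icc α β) := fun t ht => (dΦ t ht).continuousAt.continuousWithinAt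
  have cG : ContinuousOn G (Icc α β) := (cDD.mul cA).div (by fun_prop) fun t _ => (hpos t).ne'
  have cGd : ContinuousOn Gd (Icc α β) := ContinuousOn.add (((cD.mul cA).mul (by fun_prop)).div (by fun_prop) fun t _ => (pow_pos (hpos t) 2).ne') ((cDD.mul ca).div (by fun_prop) fun t _ => (hpos t).ne')
  have dG : ∀ t ∈ Icc α β, HasDerivAt G (Gd t) t := fun t ht => by
    refine (((dD t ht).mul (da t ht)).div (((dD t ht).pow 2).add_const (γ ^ 2)) (hpos t).ne').congr_deriv ?_
    simp only [Gd, Pi.mul_apply, Pi.pow_apply]; have := (hpos t).ne'; field_simp; push_cast; ring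
  set E : ℝ → ℂ := fun t => Complex.exp (Complex.I * Φ t)
  have nE : ∀ t, ‖E t‖ = 1 := fun t => by simp only [E]; rw [mul_comm, Complex.norm_exp_ofReal_mul_I]
  have cE : ContinuousOn E (Icc α β) := by fun_prop
  have dE : ∀ t ∈ Icc α β, HasDerivAt E (E t * (Complex.I * (c * D t : ℝ))) t := fun t ht => ((dΦ t ht).ofReal_comp.const_mul Complex.I).cexp
  have hh : ∀ x y : ℝ, |x| ≤ 4 → |x * y| / (y ^ 2 + γ ^ 2) ≤ 4 / γ ^ 2 := fun x y hx => by
    have : |y| * γ ^ 2 ≤ y ^ 2 + γ ^ 2 := by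
      rw [← sq_abs y]; nlinarith [abs_nonneg y, sq_nonneg (|y| - γ), mul_nonneg (abs_nonneg y) (mul_nonneg hγ.le (sub_nonneg.2 γ1))]
    rw [abs_mul, div_le_div_iff₀ (by positivity) (by positivity)]
    nlinarith [mul_le_mul hx this (by positivity) (by norm_num)]
  have bG : ∀ t ∈ Icc α β, |G t| ≤ 1 / γ ^ 2 := fun t ht => by
    have := hh (4 * a t) (D t) (by rw [abs_mul]; norm_num; linarith [b0 t ht])
    rw [mul_assoc, abs_mul, mul_comm (a t)] at this
    simp only [G]; rw [abs_div, abs_of_pos (hpos t)]; norm_num at this ⊢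
    rw [mul_div_assoc, div_eq_mul_inv (4:ℝ)] at this; linarith
  have bGd : ∀ t ∈ Icc α β, |Gd t| ≤ (C + 4) / γ ^ 2 := fun t ht => by
    refine (abs_add_le _ _).trans ?_
    rw [add_div]; refine add_le_add ?_ ?_
    · rw [abs_div, abs_mul, abs_mul, abs_of_pos (pow_pos (hpos t) 2)]
      have h1 : |γ ^ 2 - D t ^ 2| ≤ D t ^ 2 + γ ^ 2 := abs_le.2 ⟨by nlinarith [sq_nonneg γ], by nlinarith [sq_nonneg (D t)]⟩
      have h2 : |D' t| * |a t| ≤ C * 1 := mul_le_mul (bD t ht) (b0 t ht) (abs_nonneg _) hC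
      calc _ ≤ C * 1 * (D t ^ 2 + γ ^ 2) / (D t ^ 2 + γ ^ 2) ^ 2 := by have := hpos t; gcongr
        _ = C / (D t ^ 2 + γ ^ 2) := by have := (hpos t).ne'; field_simp
        _ ≤ _ := by gcongr; nlinarith [sq_nonneg (D t)]
    · rw [abs_div, abs_of_pos (hpos t), mul_comm]; exact hh _ _ (b1 t ht)
  have ii : ∀ {f : ℝ → ℂ}, ContinuousOn f (Icc α β) → IntervalIntegrable f volume α β := fun h => ContinuousOn.intervalIntegrable (by rwa [uIcc_of_le hab])
  have cI : ContinuousOn (fun t => E t * (Complex.I * (c * D t : ℝ)) * (G t : ℂ) + E t * (Gd t : ℂ)) (Icc α β) := by fun_prop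
  have c2 : ContinuousOn (fun t => γ ^ 2 / (D t ^ 2 + γ ^ 2)) (Icc α β) := continuousOn_const.div (by fun_prop) fun t _ => (hpos t).ne'
  have ftc := intervalIntegral.integral_eq_sub_of_hasDerivAt (a := α) (b := β) (f := fun t => E t * (G t : ℂ)) (fun t ht => by
    rw [uIcc_of_le hab] at ht; exact (dE t ht).mul (dG t ht).ofReal_comp) (ii cI)
  have hci : Complex.I * c ≠ 0 := mul_ne_zero Complex.I_ne_zero (by exact_mod_cast hc)
  have e1 : (∫ t in α..β, E t * a t) = (Complex.I * c)⁻¹ * ((E β * G β - E α * G α) - ∫ t in α..β, E t * Gd t) + ∫ t in α..β, E t * (a t * (γ ^ 2 / (D t ^ 2 + γ ^ 2) : ℝ)) := by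
    rw [← ftc, ← intervalIntegral.integral_sub (ii cI) (ii (by fun_prop)), ← intervalIntegral.integral_const_mul, ← intervalIntegral.integral_add (ii (by fun_prop)) (ii (by fun_prop))]
    congr 1; ext t
    have := (hpos t).ne'
    have h' : ((D t : ℂ) ^ 2 + (γ : ℂ) ^ 2) ≠ 0 := by exact_mod_cast this
    have hc' : (c : ℂ) ≠ 0 := by exact_mod_cast hc
    simp only [G]; push_cast; field_simp [Complex.I_ne_zero]; ring
  change ‖∫ t in α..β, E t * a t‖ ≤ _
  rw [e1]
  refine (norm_add_le _ _).trans (add_le_add ?_ ?_)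
  · rw [norm_mul, norm_inv, norm_mul, Complex.norm_I, one_mul, Complex.norm_real, Real.norm_eq_abs]
    have n1 : ∀ t ∈ Icc α β, ‖E t * G t‖ ≤ 1 / γ ^ 2 := fun t ht => by rw [norm_mul, nE, one_mul, Complex.norm_real]; exact bG t ht
    have n2 : ‖∫ t in α..β, E t * Gd t‖ ≤ (C + 4) / γ ^ 2 * |β - α| := intervalIntegral.norm_integral_le_of_norm_le_const fun t ht => by
      rw [uIoc_of_le hab] at ht; rw [norm_mul, nE, one_mul, Complex.norm_real]; exact bGd t ⟨ht.1.le, ht.2⟩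
    have n3 : (C + 4) / γ ^ 2 * |β - α| ≤ (C + 4) / γ ^ 2 := mul_le_of_le_one_right (by positivity) (by rw [abs_of_nonneg (by linarith)]; exact hl)
    have : ‖E β * G β - E α * G α - ∫ t in α..β, E t * Gd t‖ ≤ (C + 6) / γ ^ 2 := by
      have := norm_sub_le (E β * G β - E α * G α) (∫ t in α..β, E t * Gd t)
      have := norm_sub_le (E β * G β) (E α * G α)
      have := n1 β ⟨hab, le_rfl⟩
      have := n1 α ⟨le_rfl, hab⟩
      have : (C + 6) / γ ^ 2 = (C + 4) / γ ^ 2 + 1 / γ ^ 2 + 1 / γ ^ 2 := by ring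
      linarith
    calc _ ≤ |c|⁻¹ * ((C + 6) / γ ^ 2) := by gcongr
      _ = _ := by field_simp
  · refine intervalIntegral.norm_integral_le_of_norm_le hab (ae_of_all _ fun t ht => ?_) (ContinuousOn.intervalIntegrable (by rwa [uIcc_of_le hab]))
    rw [norm_mul, nE, one_mul, norm_mul, Complex.norm_real, Complex.norm_real, Real.norm_of_nonneg (r := γ ^ 2 / _) (by have := hpos t; positivity)]
    exact mul_le_of_le_one_left (by have := hpos t; positivity) (b0 t ⟨ht.1.le, ht.2⟩)

lemma osc0 {ε : ℝ} (h0 : ε ≠ 0) (h1 : ε ≠ 1) : ∃ C, 0 < C ∧ ∀ Λ κ b s α β : ℝ, 0 < s → s ≤ 1 → |Λ| * s ^ 12 = 1 → 0 < κ → κ ≤ 1 → b ≠ 0 →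
    1 ≤ α → α ≤ β → β ≤ 2 → (∀ t ∈ Icc α β, 1 ≤ b + κ * t ∧ b + κ * t ≤ 2) →
    ‖∫ t in α..β, Complex.exp (Complex.I * (Λ * ((b + κ * t) ^ ε - t ^ ε) : ℝ)) * ((((b + κ * t) * t)⁻¹ : ℝ) : ℂ)‖ ≤ C * (s ^ 4 + s ^ 2 / |b|) := by
  obtain ⟨C2, hC2, H2⟩ := osc2 h1
  set C1 : ℝ := |ε - 1| * (2 * 2 ^ |ε - 1 - 1|)
  have hC1 : 0 ≤ C1 := by positivity
  have he : 0 < |ε| := abs_pos.2 h0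
  refine ⟨(C1 + 6) / |ε| + 1 + C2, by positivity, fun Λ κ b s α β hs s1 hΛ hk k1 hb a1 hab b2 hz => ?_⟩
  have hb' := abs_pos.2 hb
  have hΛ0 : Λ ≠ 0 := fun h => by rw [h] at hΛ; simp at hΛ
  set z : ℝ → ℝ := fun t => b + κ * t
  set D : ℝ → ℝ := fun t => κ * z t ^ (ε - 1) - t ^ (ε - 1)
  have tp : ∀ t ∈ Icc α β, 1 ≤ t ∧ t ≤ 2 := fun t ht => ⟨a1.trans ht.1, ht.2.trans b2⟩
  have dz : ∀ t, HasDerivAt z κ t := fun t => by have := ((hasDerivAt_id t).const_mul κ).const_add b; rw [mul_one] at this; exact this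
  have dzp : ∀ t ∈ Icc α β, ∀ e : ℝ, HasDerivAt (fun t => z t ^ e) (κ * e * z t ^ (e - 1)) t := fun t ht e => (dz t).rpow_const (Or.inl (by linarith [hz t ht]))
  have dtp : ∀ t ∈ Icc α β, ∀ e : ℝ, HasDerivAt (fun t : ℝ => t ^ e) (e * t ^ (e - 1)) t := fun t ht e => Real.hasDerivAt_rpow_const (Or.inl (by linarith [tp t ht]))
  have zt : ∀ t ∈ Icc α β, 1 ≤ z t * t := fun t ht => by nlinarith [tp t ht, hz t ht]
  have czp : ∀ e : ℝ, ContinuousOn (fun t => z t ^ e) (Icc α β) := fun e t ht => (dzp t ht e).continuousAt.continuousWithinAt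
  have ctp : ∀ e : ℝ, ContinuousOn (fun t : ℝ => t ^ e) (Icc α β) := fun e t ht => (dtp t ht e).continuousAt.continuousWithinAt
  have zc : Continuous z := by fun_prop
  have main := ibp (Φ := fun t => Λ * (z t ^ ε - t ^ ε)) (D := D) (D' := fun t => κ * (κ * (ε - 1) * z t ^ (ε - 1 - 1)) - (ε - 1) * t ^ (ε - 1 - 1))
    (a := fun t => (z t * t)⁻¹) (a' := fun t => -(κ * t + z t) / (z t * t) ^ 2) (c := Λ * ε) (γ := s ^ 4) (C := C1) (α := α) (β := β)
    (mul_ne_zero hΛ0 h0) (by positivity) (pow_le_one₀ hs.le s1) hC1 hab (by linarith)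
    (fun t ht => (((dzp t ht ε).sub (dtp t ht ε)).const_mul Λ).congr_deriv (by simp only [D]; ring))
    (fun t ht => ((dzp t ht _).const_mul κ).sub (dtp t ht _))
    (fun t ht => (((dz t).mul (hasDerivAt_id t)).inv (by have := zt t ht; simp; constructor <;> rintro h <;> simp [h] at this <;> linarith)).congr_deriv (by simp))
    ((continuousOn_const.mul (continuousOn_const.mul (czp _))).sub (continuousOn_const.mul (ctp _)))
    (ContinuousOn.div (by fun_prop) (by fun_prop) fun t ht => by have := zt t ht; positivity)
    (fun t ht => by
      have A := (rp_bd (tp t ht).1 (tp t ht).2 (ε - 1 - 1)).1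
      have B := (rp_bd (hz t ht).1 (hz t ht).2 (ε - 1 - 1)).1
      have B0 : 0 ≤ z t ^ (ε - 1 - 1) := Real.rpow_nonneg (by linarith [hz t ht]) _
      have A0 : 0 ≤ t ^ (ε - 1 - 1) := Real.rpow_nonneg (by linarith [tp t ht]) _
      rw [show κ * (κ * (ε - 1) * z t ^ (ε - 1 - 1)) - (ε - 1) * t ^ (ε - 1 - 1) = (ε - 1) * (κ * κ * z t ^ (ε - 1 - 1) - t ^ (ε - 1 - 1)) by ring, abs_mul]
      refine mul_le_mul_of_nonneg_left ?_ (abs_nonneg _)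
      have : κ * κ * z t ^ (ε - 1 - 1) ≤ z t ^ (ε - 1 - 1) := mul_le_of_le_one_left B0 (by nlinarith)
      have : 0 ≤ κ * κ * z t ^ (ε - 1 - 1) := by positivity
      exact abs_le.2 ⟨by linarith, by linarith⟩)
    (fun t ht => by rw [abs_inv, abs_of_nonneg (by linarith [zt t ht])]; exact inv_le_one_of_one_le₀ (zt t ht))
    (fun t ht => by
      have := tp t ht; have := hz t ht; have := zt t ht
      rw [abs_div, abs_neg, abs_of_nonneg (by positivity : 0 ≤ (z t * t) ^ 2), abs_of_nonneg (by nlinarith), div_le_iff₀ (by positivity)]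
      nlinarith)
  refine main.trans ?_
  have t1 : (C1 + 6) / (|Λ * ε| * (s ^ 4) ^ 2) = (C1 + 6) / |ε| * s ^ 4 := by
    rw [abs_mul]; have : |Λ| ≠ 0 := abs_ne_zero.2 hΛ0
    field_simp; linear_combination -hΛ
  set S := {r ∈ Icc (1:ℝ) 2 | (1 ≤ b + κ * r ∧ b + κ * r ≤ 2) ∧ |κ * (b + κ * r) ^ (ε - 1) - r ^ (ε - 1)| < s ^ 2}
  have hS := H2 κ b (s ^ 2) hk k1 hb (by positivity)
  have mS : MeasurableSet S := by
    have m1 : MeasurableSet {r | 1 ≤ b + κ * r} := measurableSet_le (by fun_prop) (by fun_prop)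
    have m2 : MeasurableSet {r | b + κ * r ≤ 2} := measurableSet_le (by fun_prop) (by fun_prop)
    have m3 : MeasurableSet {r | |κ * (b + κ * r) ^ (ε - 1) - r ^ (ε - 1)| < s ^ 2} := measurableSet_lt (Measurable.abs (by fun_prop)) (by fun_prop)
    exact measurableSet_Icc.inter ((m1.inter m2).inter m3)
  have t2 : (∫ t in α..β, (s ^ 4) ^ 2 / (D t ^ 2 + (s ^ 4) ^ 2)) ≤ s ^ 4 + C2 * s ^ 2 / |b| := by
    have iS : IntegrableOn (S.indicator fun _ => (1:ℝ)) (Ioc α β) := (integrable_const _).indicator mS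
    rw [intervalIntegral.integral_of_le hab]
    calc _ ≤ ∫ t in Ioc α β, (s ^ 4 + S.indicator (fun _ => (1:ℝ)) t) := by
          refine setIntegral_mono_on ?_ ((integrable_const _).add iS) measurableSet_Ioc fun t ht => ?_
          · refine (ContinuousOn.integrableOn_Icc ?_).mono_set Ioc_subset_Icc_self
            exact continuousOn_const.div ((((czp _).const_smul κ).sub (ctp _)).pow 2 |>.add continuousOn_const) fun t _ => by positivity
          · by_cases hh : t ∈ S
            · rw [indicator_of_mem hh]
              have : (s ^ 4) ^ 2 / (D t ^ 2 + (s ^ 4) ^ 2) ≤ 1 := div_le_one_of_le₀ (by nlinarith [sq_nonneg (D t)]) (by positivity)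
              linarith [pow_pos hs 4]
            · rw [indicator_of_notMem hh, add_zero]
              have ht' := Ioc_subset_Icc_self ht
              have : s ^ 2 ≤ |D t| := not_lt.1 fun h => hh ⟨tp t ht', hz t ht', h⟩
              have : (s ^ 2) ^ 2 ≤ D t ^ 2 := by rw [← sq_abs (D t)]; gcongr
              rw [div_le_iff₀ (by positivity)]
              nlinarith [mul_le_mul_of_nonneg_left this (pow_pos hs 4).le, pow_pos hs 12]
      _ = (β - α) * s ^ 4 + volume.real (S ∩ Ioc α β) := by
          rw [integral_add (integrable_const _) iS, integral_indicator mS]; simp [hab, mS, measureReal_def]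
      _ ≤ _ := by
          refine add_le_add (mul_le_of_le_one_left (by positivity) (by linarith)) ?_
          exact ENNReal.toReal_le_of_le_ofReal (by positivity) ((measure_mono inter_subset_left).trans hS)
  rw [t1]
  have : 0 ≤ s ^ 2 / |b| := by positivity
  have : 0 ≤ (C1 + 6) / |ε| := by positivity
  rw [mul_div_assoc] at t2
  nlinarith [mul_nonneg hC2.le (pow_pos hs 4).le, mul_nonneg this (by assumption : 0 ≤ s ^ 2 / |b|)]

end
end Car

namespace Car
noncomputable section
open FourierTransform ComplexConjugate
open scoped Classical

def Ko (ε Λ u : ℝ) : ℂ := (Icc (1:ℝ) 2).indicator (fun u => Complex.exp (Complex.I * (Λ * u ^ ε : ℝ)) * ((u⁻¹ : ℝ) : ℂ)) u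

lemma Ko_meas (ε Λ : ℝ) : Measurable (Ko ε Λ) := Measurable.indicator (by fun_prop) measurableSet_Icc

lemma Ko_bd (ε Λ u : ℝ) : ‖Ko ε Λ u‖ ≤ (Icc (1:ℝ) 2).indicator 1 u := by
  unfold Ko; by_cases h : u ∈ Icc (1:ℝ) 2
  · rw [indicator_of_mem h, indicator_of_mem h, norm_mul, mul_comm Complex.I, Complex.norm_exp_ofReal_mul_I, one_mul, Complex.norm_real, Real.norm_of_nonneg (inv_nonneg.2 (by linarith [h.1]))]
    exact inv_le_one_of_one_le₀ h.1
  · rw [indicator_of_notMem h, indicator_of_notMem h, norm_zero]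

lemma Ko_one (ε Λ u : ℝ) : ‖Ko ε Λ u‖ ≤ 1 := (Ko_bd ε Λ u).trans (indicator_le_self' (fun _ _ => zero_le_one) u)

lemma Ko_w (ε Λ u : ℝ) : ‖Ko ε Λ u‖ ≤ 5 * w u := by
  refine (Ko_bd ε Λ u).trans ?_
  by_cases h : u ∈ Icc (1:ℝ) 2
  · rw [indicator_of_mem h]; unfold w; rw [← div_eq_mul_inv]
    rw [le_div_iff₀ (by positivity)]; simp only [Pi.one_apply]; nlinarith [h.1, h.2]
  · rw [indicator_of_notMem h]; have := w_nn u; positivity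

lemma Ko_osc {ε : ℝ} (h0 : ε ≠ 0) (h1 : ε ≠ 1) : ∃ C, 0 < C ∧ ∀ Λ s u κ : ℝ, 0 < s → s ≤ 1 → |Λ| * s ^ 12 = 1 → 0 < κ → κ ≤ 1 →
    ‖∫ t, Ko ε Λ (u + κ * t) * conj (Ko ε Λ t)‖ ≤ C * (s * w u + w (u / s)) := by
  obtain ⟨C, hC, H⟩ := osc0 h0 h1
  refine ⟨10 * C + 2, by positivity, fun Λ s u κ hs s1 hΛ hk k1 => ?_⟩
  have p1 := w_nn u; have p2 := w_nn (u / s)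
  have hrhs : 0 ≤ (10 * C + 2) * (s * w u + w (u / s)) := by positivity
  set α := max 1 ((1 - u) / κ)
  set β := min 2 ((2 - u) / κ)
  have hI : ∀ t, t ∈ Icc α β ↔ t ∈ Icc (1:ℝ) 2 ∧ u + κ * t ∈ Icc (1:ℝ) 2 := fun t => by
    simp only [α, β, mem_Icc, max_le_iff, le_min_iff, div_le_iff₀ hk, le_div_iff₀ hk]
    constructor
    · rintro ⟨⟨a, b⟩, c, d⟩; exact ⟨⟨a, c⟩, by linarith, by linarith⟩
    · rintro ⟨⟨a, c⟩, b, d⟩; exact ⟨⟨a, by linarith⟩, c, by linarith⟩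
  have e : ∀ t, Ko ε Λ (u + κ * t) * conj (Ko ε Λ t) = (Icc α β).indicator (fun t => Complex.exp (Complex.I * (Λ * ((u + κ * t) ^ ε - t ^ ε) : ℝ)) * ((((u + κ * t) * t)⁻¹ : ℝ) : ℂ)) t := fun t => by
    by_cases h : t ∈ Icc α β
    · rw [indicator_of_mem h]; rw [hI] at h
      rw [Ko, Ko, indicator_of_mem h.1, indicator_of_mem h.2, map_mul, Complex.conj_ofReal, ← Complex.exp_conj, map_mul, Complex.conj_I, Complex.conj_ofReal, mul_sub, mul_inv]
      rw [Complex.ofReal_sub, mul_sub, Complex.exp_sub, neg_mul, Complex.exp_neg, Complex.ofReal_mul ((u + κ * t)⁻¹)]; ring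
    · rw [indicator_of_notMem h]; rw [hI, not_and_or] at h
      rcases h with h | h
      · rw [Ko, Ko, indicator_of_notMem h]; simp
      · rw [Ko, indicator_of_notMem h]; simp
  rcases lt_or_ge β α with hab | hab
  · simp_rw [e, Icc_eq_empty_of_lt hab, indicator_empty]; simpa using hrhs
  have hu : |u| ≤ 2 := by
    have := (hI α).1 ⟨le_rfl, hab⟩
    obtain ⟨⟨a, b⟩, c, d⟩ := this
    exact abs_le.2 ⟨by nlinarith, by nlinarith⟩
  have hw : 1 / 5 ≤ w u := by
    unfold w; rw [← sq_abs, ← one_div]; gcongr; nlinarith [abs_nonneg u]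
  rcases lt_or_ge |u| s with hus | hus
  · have : 1 / 2 ≤ w (u / s) := by
      unfold w; rw [← one_div]; gcongr
      have : |u / s| ≤ 1 := by rw [abs_div, abs_of_pos hs]; exact div_le_one_of_le₀ hus.le hs.le
      have := (sq_le_one_iff_abs_le_one _).2 this; linarith
    have : ‖∫ t, Ko ε Λ (u + κ * t) * conj (Ko ε Λ t)‖ ≤ 1 := by
      refine (norm_integral_le_of_norm_le (g := (Icc (1:ℝ) 2).indicator 1) ?_ (ae_of_all _ fun t => ?_)).trans (le_of_eq ?_)
      · exact (integrable_indicator_iff measurableSet_Icc).2 (integrableOn_const (by simp))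
      · rw [norm_mul, RCLike.norm_conj]
        exact (mul_le_of_le_one_left (norm_nonneg _) (Ko_one _ _ _)).trans (Ko_bd _ _ _)
      · rw [integral_indicator_one measurableSet_Icc]; norm_num [measureReal_def]
    have : 0 ≤ s * w u := by positivity
    nlinarith [mul_nonneg hC.le this, mul_nonneg hC.le p2]
  · have u0 : u ≠ 0 := fun h => by rw [h, abs_zero] at hus; linarith
    simp_rw [e]
    rw [integral_indicator measurableSet_Icc, integral_Icc_eq_integral_Ioc, ← intervalIntegral.integral_of_le hab]
    refine (H Λ κ u s α β hs s1 hΛ hk k1 u0 (le_max_left _ _) hab (min_le_left _ _) fun t ht => ((hI t).1 ht).2).trans ?_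
    have a1 : s ^ 2 / |u| ≤ s := by rw [div_le_iff₀ (abs_pos.2 u0)]; nlinarith
    have a2 : s ^ 4 ≤ s := by simpa using pow_le_pow_of_le_one hs.le s1 (show 1 ≤ 4 by norm_num)
    calc _ ≤ C * (s + s) := by gcongr
      _ ≤ 10 * C * (s * w u) := by nlinarith [mul_pos hC hs]
      _ ≤ _ := by have : 0 ≤ s * w u := by positivity
                  nlinarith [mul_nonneg hC.le p2]

lemma tts {k : ℝ → ℝ → ℂ} {K : ℝ} {W : ℝ≥0∞} (hW : W ≠ ∞) (hk : Measurable (Function.uncurry k)) (hK : ∀ x y, ‖k x y‖ ≤ K) (hk1 : ∀ x, ∫⁻ y, ‖k x y‖ₑ ≤ W)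
    {g : ℝ → ℂ} {E : Set ℝ} (hg : Measurable g) (hE : MeasurableSet E) (hE' : volume E ≠ ∞) (hb : ∀ x, ‖g x‖ₑ ≤ E.indicator 1 x) :
    ∫⁻ y, ‖∫ x, g x * k x y‖ₑ ^ 2 ≤ ∫⁻ x in E, ∫⁻ x' in E, ‖∫ y, k x y * conj (k x' y)‖ₑ := by
  have gi := ind_int hg hE hE' hb
  set Hh : (ℝ × ℝ) × ℝ → ℂ := fun q => (g q.1.1 * k q.1.1 q.2) * conj (g q.1.2 * k q.1.2 q.2)
  have m1 : Measurable fun q : (ℝ × ℝ) × ℝ => k q.1.1 q.2 := hk.comp (by fun_prop : Measurable fun q : (ℝ × ℝ) × ℝ => (q.1.1, q.2))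
  have m2 : Measurable fun q : (ℝ × ℝ) × ℝ => k q.1.2 q.2 := hk.comp (by fun_prop : Measurable fun q : (ℝ × ℝ) × ℝ => (q.1.2, q.2))
  have mH : Measurable Hh := by
    have : Measurable fun q : (ℝ × ℝ) × ℝ => conj (g q.1.2 * k q.1.2 q.2) := by fun_prop
    exact Measurable.mul (by fun_prop) this
  have nc : ∀ a : ℂ, ‖conj a‖ₑ = ‖a‖ₑ := fun a => by rw [← ofReal_norm, RCLike.norm_conj, ofReal_norm]
  have iH : Integrable Hh ((volume.prod volume).prod volume) := by
    refine ⟨mH.aestronglyMeasurable, ?_⟩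
    rw [HasFiniteIntegral, lintegral_prod _ mH.enorm.aemeasurable]
    calc _ ≤ ∫⁻ p : ℝ × ℝ, E.indicator 1 p.1 * E.indicator 1 p.2 * (ENNReal.ofReal K * W) ∂(volume.prod volume) := by
          refine lintegral_mono fun p => ?_
          calc _ ≤ ∫⁻ y, E.indicator 1 p.1 * E.indicator 1 p.2 * ENNReal.ofReal K * ‖k p.1 y‖ₑ := by
                refine lintegral_mono fun y => ?_
                simp only [Hh, enorm_mul, nc]
                calc _ = ‖g p.1‖ₑ * ‖g p.2‖ₑ * ‖k p.2 y‖ₑ * ‖k p.1 y‖ₑ := by ring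
                  _ ≤ _ := by
                    gcongr
                    · exact hb _
                    · exact hb _
                    · rw [← ofReal_norm]; exact ENNReal.ofReal_le_ofReal (hK _ _)
            _ ≤ _ := by
              have mk : Measurable fun y => ‖k p.1 y‖ₑ := (hk.comp (measurable_prodMk_left (x := p.1))).enorm
              rw [lintegral_const_mul _ mk, mul_assoc (_ * _)]
              gcongr; exact hk1 _
      _ < ∞ := by
        have mi : Measurable (E.indicator (1 : ℝ → ℝ≥0∞)) := measurable_one.indicator hE
        have mii : Measurable fun p : ℝ × ℝ => E.indicator (1 : ℝ → ℝ≥0∞) p.1 * E.indicator (1 : ℝ → ℝ≥0∞) p.2 := (mi.comp measurable_fst).mul (mi.comp measurable_snd)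
        rw [lintegral_mul_const _ mii, lintegral_prod_mul mi.aemeasurable mi.aemeasurable, lintegral_indicator_one hE]
        finiteness
  have sw := integral_integral_swap (f := fun p y => Hh (p, y)) iH
  have inn : ∀ y, ∫ p : ℝ × ℝ, Hh (p, y) ∂(volume.prod volume) = (‖∫ x, g x * k x y‖ ^ 2 : ℝ) := fun y => by
    have := integral_prod_mul (μ := volume) (ν := volume) (fun x => g x * k x y) (fun x => conj (g x * k x y))
    simp only [Hh]; rw [this, integral_conj, Complex.mul_conj, Complex.normSq_eq_norm_sq]
  simp_rw [inn] at sw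
  rw [integral_complex_ofReal] at sw
  have iS : Integrable fun y => ‖∫ x, g x * k x y‖ ^ 2 := by
    have := iH.swap.integral_prod_left
    simp only [Function.comp, Prod.swap_prod_mk, inn] at this
    exact this.re
  have e1 : ∫⁻ y, ‖∫ x, g x * k x y‖ₑ ^ 2 = ENNReal.ofReal (∫ y, ‖∫ x, g x * k x y‖ ^ 2) := by
    rw [ofReal_integral_eq_lintegral_ofReal iS (ae_of_all _ fun y => by positivity)]
    congr 1; ext y; rw [ENNReal.ofReal_pow (norm_nonneg _), ofReal_norm]
  have e2 : ENNReal.ofReal (∫ y, ‖∫ x, g x * k x y‖ ^ 2) = ‖∫ p : ℝ × ℝ, ∫ y, Hh (p, y) ∂volume ∂(volume.prod volume)‖ₑ := by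
    rw [sw, ← ofReal_norm, Complex.norm_real, Real.norm_of_nonneg (integral_nonneg fun y => by positivity)]
  rw [e1, e2]
  refine (enorm_integral_le_lintegral_enorm _).trans ?_
  have mI : Measurable fun p : ℝ × ℝ => ‖∫ y, Hh (p, y)‖ₑ := (mH.stronglyMeasurable.integral_prod_right (ν := volume)).measurable.enorm
  rw [lintegral_prod _ mI.aemeasurable, ← lintegral_indicator hE]
  refine lintegral_mono fun x => ?_
  have pt : ∀ x', ‖∫ y, Hh ((x, x'), y)‖ₑ ≤ E.indicator 1 x * (E.indicator 1 x' * ‖∫ y, k x y * conj (k x' y)‖ₑ) := fun x' => by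
    have : ∫ y, Hh ((x, x'), y) = (g x * conj (g x')) * ∫ y, k x y * conj (k x' y) := by
      rw [← integral_const_mul]; congr 1; ext y; simp only [Hh, map_mul]; ring
    rw [this, enorm_mul, enorm_mul, nc, mul_assoc]
    exact mul_le_mul' (hb x) (mul_le_mul' (hb x') le_rfl)
  refine (lintegral_mono pt).trans ?_
  by_cases h : x ∈ E
  · simp only [indicator_of_mem h]
    rw [← lintegral_indicator hE]
    refine lintegral_mono fun x' => ?_
    by_cases h' : x' ∈ E <;> simp [h']
  · simp [indicator_of_notMem h]

lemma pairL {k : ℝ → ℝ → ℂ} {K : ℝ} {f : ℝ → ℂ} {F E : Set ℝ} {M : ℝ≥0∞} (hk : Measurable (Function.uncurry k)) (hK : ∀ x y, ‖k x y‖ ≤ K)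
    (hf : Measurable f) (hF : MeasurableSet F) (hF' : volume F ≠ ∞) (hb : ∀ y, ‖f y‖ₑ ≤ F.indicator 1 y) (hE : MeasurableSet E) (hE' : volume E ≠ ∞)
    (H : ∀ g : ℝ → ℂ, Measurable g → (∀ x, ‖g x‖ₑ ≤ E.indicator 1 x) → ∫⁻ y, ‖∫ x, g x * k x y‖ₑ ^ 2 ≤ M) :
    ∫⁻ x in E, ‖∫ y, f y * k x y‖ₑ ≤ volume F ^ (1/2 : ℝ) * M ^ (1/2 : ℝ) := by
  have fi := ind_int hf hF hF' hb
  set T : ℝ → ℂ := fun x => ∫ y, f y * k x y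
  have mT : Measurable T := kint_meas hf hk
  set g : ℝ → ℂ := E.indicator fun x => conj (T x) / (‖T x‖ : ℂ)
  have mg : Measurable g := Measurable.indicator (by fun_prop) hE
  have gb : ∀ x, ‖g x‖ₑ ≤ E.indicator 1 x := fun x => by
    by_cases h : x ∈ E
    · simp only [g, indicator_of_mem h]
      rw [← ofReal_norm, norm_div, RCLike.norm_conj, Complex.norm_real, norm_norm]
      exact ENNReal.ofReal_le_one.2 (div_self_le_one _)
    · simp [g, indicator_of_notMem h]
  have gi := ind_int mg hE hE' gb
  have gT : ∀ x, ‖g x * T x‖ₑ = E.indicator (fun x => ‖T x‖ₑ) x ∧ g x * T x = ((‖g x * T x‖ : ℝ) : ℂ) := fun x => by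
    by_cases h : x ∈ E
    · have : g x * T x = ((‖T x‖ : ℝ) : ℂ) := by
        simp only [g, indicator_of_mem h]
        rw [div_mul_eq_mul_div, mul_comm, Complex.mul_conj, Complex.normSq_eq_norm_sq, pow_two, Complex.ofReal_mul, mul_div_assoc]
        by_cases h0 : (‖T x‖ : ℂ) = 0
        · rw [h0]; simp
        · rw [div_self h0, mul_one]
      rw [this, indicator_of_mem h, Complex.norm_real, norm_norm, ← ofReal_norm, Complex.norm_real, norm_norm, ofReal_norm]; exact ⟨rfl, rfl⟩
    · simp [g, indicator_of_notMem h]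
  have mfk : Measurable fun q : ℝ × ℝ => (g q.1 * f q.2) * k q.1 q.2 := Measurable.mul (by fun_prop) hk
  have ii : Integrable (fun q : ℝ × ℝ => (g q.1 * f q.2) * k q.1 q.2) (volume.prod volume) :=
    (gi.mul_prod fi).mul_bdd (c := K) hk.aestronglyMeasurable (ae_of_all _ fun q => hK _ _)
  have iT : Integrable fun x => g x * T x := by
    refine ii.integral_prod_left.congr (ae_of_all _ fun x => ?_)
    simp only [T]; rw [← integral_const_mul]; congr 1; ext y; ring
  have e1 : ∫⁻ x in E, ‖T x‖ₑ = ‖∫ x, g x * T x‖ₑ := by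
    rw [← lintegral_indicator hE]; simp_rw [← fun x => (gT x).1]
    rw [← ofReal_integral_norm_eq_lintegral_enorm iT, ← ofReal_norm]; congr 1
    conv_rhs => rw [integral_congr_ae (ae_of_all _ fun x => (gT x).2), integral_complex_ofReal, Complex.norm_real]
    rw [Real.norm_of_nonneg (integral_nonneg fun x => norm_nonneg _)]
  have e2 : ∫ x, g x * T x = ∫ y, f y * ∫ x, g x * k x y := by
    have := integral_integral_swap (f := fun x y => (g x * f y) * k x y) ii
    calc _ = ∫ x, ∫ y, (g x * f y) * k x y := by
          congr 1; ext x; simp only [T]; rw [← integral_const_mul]; congr 1; ext y; ring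
      _ = _ := this
      _ = _ := by congr 1; ext y; rw [← integral_const_mul]; congr 1; ext x; ring
  rw [e1, e2]
  refine (enorm_integral_le_lintegral_enorm _).trans ?_
  simp_rw [enorm_mul]
  have mS : Measurable fun y => ∫ x, g x * k x y := kint_meas (k := fun y x => k x y) mg (hk.comp measurable_swap)
  refine (ENNReal.lintegral_mul_le_Lp_mul_Lq volume Real.HolderConjugate.two_two hf.enorm.aemeasurable mS.enorm.aemeasurable).trans ?_
  refine mul_le_mul' (ENNReal.rpow_le_rpow ?_ (by norm_num)) (ENNReal.rpow_le_rpow ?_ (by norm_num))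
  · calc _ ≤ ∫⁻ y, F.indicator 1 y := lintegral_mono fun y => by
          refine (ENNReal.rpow_le_rpow (hb y) (by norm_num)).trans ?_
          by_cases h : y ∈ F <;> simp [h]
      _ = _ := lintegral_indicator_one hF
  · simpa using H g mg gb

end
end Car

namespace Car
noncomputable section
open FourierTransform ComplexConjugate
open scoped Classical

def kT (ε Λ : ℝ) (l : ℝ → ℝ) (x y : ℝ) : ℂ := (((l x)⁻¹ : ℝ) : ℂ) * Ko ε Λ ((x - y) / l x)

lemma kT_meas {ε Λ : ℝ} {l : ℝ → ℝ} (hl : Measurable l) : Measurable (Function.uncurry (kT ε Λ l)) := by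
  have h1 : Measurable fun q : ℝ × ℝ => Ko ε Λ ((q.1 - q.2) / l q.1) := (Ko_meas ε Λ).comp (by fun_prop)
  exact Measurable.mul (by fun_prop) h1

lemma kT_cov {ε Λ : ℝ} {l : ℝ → ℝ} (hl : ∀ x, 0 < l x) (G : ℝ → ℂ) (x : ℝ) : ∫ y, G y * kT ε Λ l x y = ∫ t, G (x - l x * t) * Ko ε Λ t := by
  rw [← integral_sub_left_eq_self (fun y => G y * kT ε Λ l x y) volume x]
  have := Measure.integral_comp_mul_left (fun y => G (x - y) * kT ε Λ l x (x - y)) (l x)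
  rw [abs_of_pos (inv_pos.2 (hl x))] at this
  have h0 : ((l x : ℝ) : ℂ) ≠ 0 := by exact_mod_cast (hl x).ne'
  have h := congrArg (fun q : ℂ => (l x : ℂ) * q) this
  rw [Complex.real_smul, Complex.ofReal_inv, mul_inv_cancel_left₀ h0] at h
  rw [← h, ← integral_const_mul]
  congr 1; ext t
  rw [kT, sub_sub_cancel, mul_div_cancel_left₀ _ (hl x).ne', Complex.ofReal_inv]; field_simp

def hK (s : ℝ) (l : ℝ → ℝ) (x y : ℝ) : ℝ := (l x)⁻¹ * (s * w ((x - y) / l x) + w ((x - y) / (s * l x)))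

lemma hK_int {s : ℝ} {l : ℝ → ℝ} (hl : ∀ x, 0 < l x) (hs : 0 < s) (x : ℝ) : ∫⁻ y, ENNReal.ofReal (hK s l x y) = ENNReal.ofReal (2 * Real.pi * s) := by
  have h : ∀ t : ℝ, ∀ y, w ((x - y) / t) = w ((y - x) / t) := fun t y => by rw [← w_neg, ← neg_div, neg_sub]
  have i1 := (w_int' (hl x) x).const_mul s
  have i2 := w_int' (mul_pos hs (hl x)) x
  unfold hK; simp_rw [h]
  have i3 : Integrable fun y => (l x)⁻¹ * (s * w ((y - x) / l x) + w ((y - x) / (s * l x))) := (i1.add i2).const_mul _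
  rw [← ofReal_integral_eq_lintegral_ofReal i3 (ae_of_all _ fun y => ?_), integral_const_mul, integral_add i1 i2, integral_const_mul, w_integral (hl x), w_integral (mul_pos hs (hl x))]
  · congr 1; have := (hl x).ne'; field_simp; ring
  · have := hl x; have := w_nn ((y - x) / l x); have := w_nn ((y - x) / (s * l x)); simp only [Pi.zero_apply]; positivity

lemma kT_l2 {ε : ℝ} (h0 : ε ≠ 0) (h1 : ε ≠ 1) : ∃ D, 0 < D ∧ ∀ Λ s m : ℝ, ∀ l : ℝ → ℝ, 0 < s → s ≤ 1 → |Λ| * s ^ 12 = 1 → Measurable l → 0 < m → (∀ x, m ≤ l x) →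
    ∀ (f : ℝ → ℂ) (F E : Set ℝ), Measurable f → MeasurableSet F → volume F ≠ ∞ → (∀ y, ‖f y‖ₑ ≤ F.indicator 1 y) →
        MeasurableSet E → volume E ≠ ∞ → ∫⁻ x in E, ‖∫ y, f y * kT ε Λ l x y‖ₑ ≤ volume F ^ (1/2 : ℝ) * (ENNReal.ofReal (D * s) * volume E) ^ (1/2 : ℝ) := by
  obtain ⟨C, hC, H⟩ := Ko_osc h0 h1
  refine ⟨C * (4 * Real.pi), by positivity, fun Λ s m l hs s1 hΛ ml hm hml f F E hf hF hF' hb hE hE' => ?_⟩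
  have hl : ∀ x, 0 < l x := fun x => hm.trans_le (hml x)
  have mk : Measurable (Function.uncurry (kT ε Λ l)) := kT_meas ml
  have nk : ∀ x y, ‖kT ε Λ l x y‖ = (l x)⁻¹ * ‖Ko ε Λ ((x - y) / l x)‖ := fun x y => by
    rw [kT, norm_mul, Complex.norm_real, Real.norm_of_nonneg (inv_nonneg.2 (hl x).le)]
  have bk : ∀ x y, ‖kT ε Λ l x y‖ ≤ m⁻¹ := fun x y => by
    rw [nk]; exact (mul_le_of_le_one_right (inv_nonneg.2 (hl x).le) (Ko_one _ _ _)).trans (inv_anti₀ hm (hml x))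
  have kk0 : ∀ x x', l x' ≤ l x → ‖∫ y, kT ε Λ l x y * conj (kT ε Λ l x' y)‖ ≤ C * hK s l x x' := fun x x' hh => by
    have e : ∫ y, kT ε Λ l x y * conj (kT ε Λ l x' y) = conj (∫ t, conj (kT ε Λ l x (x' - l x' * t)) * Ko ε Λ t) := by
      rw [← kT_cov hl (fun y => conj (kT ε Λ l x y)), ← integral_conj]; congr 1; ext y; simp
    have e2 : ∫ t, conj (kT ε Λ l x (x' - l x' * t)) * Ko ε Λ t = (((l x)⁻¹ : ℝ) : ℂ) * conj (∫ t, Ko ε Λ ((x - x') / l x + l x' / l x * t) * conj (Ko ε Λ t)) := by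
      rw [← integral_conj, ← integral_const_mul]; congr 1; ext t
      rw [kT, map_mul, map_mul, Complex.conj_ofReal, Complex.conj_conj, mul_assoc]; congr 4; ring
    rw [e, e2, RCLike.norm_conj, norm_mul, RCLike.norm_conj, Complex.norm_real, Real.norm_of_nonneg (inv_nonneg.2 (hl x).le), hK, mul_left_comm]
    refine mul_le_mul_of_nonneg_left ?_ (inv_nonneg.2 (hl x).le)
    have := H Λ s ((x - x') / l x) (l x' / l x) hs s1 hΛ (div_pos (hl _) (hl _)) (div_le_one_of_le₀ hh (hl x).le)
    rwa [div_div, mul_comm (l x) s] at this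
  have p0 : ∀ x x', 0 ≤ hK s l x x' := fun x x' => by
    have := hl x; have := w_nn ((x - x') / l x); have := w_nn ((x - x') / (s * l x)); unfold hK; positivity
  have kk : ∀ x x', ‖∫ y, kT ε Λ l x y * conj (kT ε Λ l x' y)‖ₑ ≤ ENNReal.ofReal C * (ENNReal.ofReal (hK s l x x') + ENNReal.ofReal (hK s l x' x)) := fun x x' => by
    rw [← ENNReal.ofReal_add (p0 _ _) (p0 _ _), ← ENNReal.ofReal_mul hC.le, ← ofReal_norm]
    apply ENNReal.ofReal_le_ofReal
    rcases le_total (l x') (l x) with h | h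
    · exact (kk0 x x' h).trans (mul_le_mul_of_nonneg_left (by linarith [p0 x' x]) hC.le)
    · have e : ∫ y, kT ε Λ l x y * conj (kT ε Λ l x' y) = conj (∫ y, kT ε Λ l x' y * conj (kT ε Λ l x y)) := by
        rw [← integral_conj]; congr 1; ext y; simp [mul_comm]
      rw [e, RCLike.norm_conj]
      exact (kk0 x' x h).trans (mul_le_mul_of_nonneg_left (by linarith [p0 x x']) hC.le)
  have mh : Measurable (Function.uncurry (hK s l)) := by
    have a := w_cont.measurable.comp (by fun_prop : Measurable fun q : ℝ × ℝ => (q.1 - q.2) / l q.1)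
    have b := w_cont.measurable.comp (by fun_prop : Measurable fun q : ℝ × ℝ => (q.1 - q.2) / (s * l q.1))
    exact Measurable.mul (f := fun q : ℝ × ℝ => (l q.1)⁻¹) (by fun_prop) ((a.const_mul s).add b)
  have mh1 : ∀ x, Measurable fun y => ENNReal.ofReal (hK s l x y) := fun x => (mh.comp (measurable_prodMk_left (x := x))).ennreal_ofReal
  have mh2 : ∀ x, Measurable fun y => ENNReal.ofReal (hK s l y x) := fun x => (mh.comp (measurable_prodMk_right (y := x))).ennreal_ofReal
  have M1 : ∫⁻ x in E, ∫⁻ x' in E, ENNReal.ofReal (hK s l x x') ≤ ENNReal.ofReal (2 * Real.pi * s) * volume E := by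
    calc _ ≤ ∫⁻ x in E, ENNReal.ofReal (2 * Real.pi * s) := lintegral_mono fun x => (setLIntegral_le_lintegral _ _).trans (hK_int hl hs x).le
      _ = _ := by simp
  have M2 : ∫⁻ x in E, ∫⁻ x' in E, ENNReal.ofReal (hK s l x' x) ≤ ENNReal.ofReal (2 * Real.pi * s) * volume E := by
    rw [lintegral_lintegral_swap]; · exact M1
    exact (mh.comp measurable_swap).ennreal_ofReal.aemeasurable
  refine pairL mk bk hf hF hF' hb hE hE' fun g hg hgb => ?_
  refine (tts (W := ENNReal.ofReal 5 * ENNReal.ofReal (2 * Real.pi * 1)) (by finiteness) mk bk (fun x => ?_) hg hE hE' hgb).trans ?_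
  · rw [← hK_int hl one_pos x, ← lintegral_const_mul _ (by
      have : Measurable (hK 1 l x) := by
        have a := w_cont.measurable.comp (by fun_prop : Measurable fun y : ℝ => (x - y) / l x)
        have b := w_cont.measurable.comp (by fun_prop : Measurable fun y : ℝ => (x - y) / (1 * l x))
        exact ((a.const_mul 1).add b).const_mul _
      exact this.ennreal_ofReal)]
    refine lintegral_mono fun y => ?_
    rw [← ofReal_norm, nk, ← ENNReal.ofReal_mul (by norm_num)]
    apply ENNReal.ofReal_le_ofReal
    have := Ko_w ε Λ ((x - y) / l x)
    rw [hK, mul_left_comm]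
    refine mul_le_mul_of_nonneg_left ?_ (inv_nonneg.2 (hl x).le)
    linarith [w_nn ((x - y) / (1 * l x))]
  · calc _ ≤ ∫⁻ x in E, ∫⁻ x' in E, ENNReal.ofReal C * (ENNReal.ofReal (hK s l x x') + ENNReal.ofReal (hK s l x' x)) := lintegral_mono fun x => lintegral_mono fun x' => kk x x'
      _ = ENNReal.ofReal C * ((∫⁻ x in E, ∫⁻ x' in E, ENNReal.ofReal (hK s l x x')) + ∫⁻ x in E, ∫⁻ x' in E, ENNReal.ofReal (hK s l x' x)) := by
          have m3 : Measurable fun x => ∫⁻ x' in E, ENNReal.ofReal (hK s l x x') := mh.ennreal_ofReal.lintegral_prod_right' (ν := volume.restrict E)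
          rw [← lintegral_add_left m3, ← lintegral_const_mul' _ _ (by finiteness)]
          refine lintegral_congr fun x => ?_
          rw [← lintegral_add_left (mh1 x), ← lintegral_const_mul' _ _ (by finiteness)]
      _ ≤ ENNReal.ofReal C * (ENNReal.ofReal (2 * Real.pi * s) * volume E + ENNReal.ofReal (2 * Real.pi * s) * volume E) := by gcongr
      _ = _ := by
          rw [← two_mul, ← mul_assoc, ← mul_assoc]; congr 1
          rw [show (2 : ℝ≥0∞) = ENNReal.ofReal 2 by simp, ← ENNReal.ofReal_mul hC.le, ← ENNReal.ofReal_mul (by positivity)]; congr 1; ring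

end
end Car

namespace Car
noncomputable section
open FourierTransform ComplexConjugate
open scoped Classical

lemma kT_mx {ε Λ : ℝ} {l : ℝ → ℝ} (hl : ∀ x, 0 < l x) {f : ℝ → ℂ} (hf : Measurable f) (x : ℝ) :
    ‖∫ y, f y * kT ε Λ l x y‖ₑ ≤ 320 * Mx (fun y => ‖f y‖ₑ) x := by
  refine (enorm_integral_le_lintegral_enorm _).trans ?_
  calc _ ≤ ∫⁻ y, ENNReal.ofReal (5 * (l x)⁻¹) * (‖f y‖ₑ * ENNReal.ofReal (w ((x - y) / l x))) := lintegral_mono fun y => by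
        rw [enorm_mul, mul_left_comm]; refine mul_le_mul' le_rfl ?_
        rw [← ENNReal.ofReal_mul (by have := hl x; positivity), ← ofReal_norm]
        apply ENNReal.ofReal_le_ofReal
        rw [kT, norm_mul, Complex.norm_real, Real.norm_of_nonneg (inv_nonneg.2 (hl x).le), mul_comm 5, mul_assoc]
        exact mul_le_mul_of_nonneg_left (Ko_w _ _ _) (inv_nonneg.2 (hl x).le)
    _ = ENNReal.ofReal (5 * (l x)⁻¹) * ∫⁻ y, ‖f y‖ₑ * ENNReal.ofReal (w ((x - y) / l x)) := lintegral_const_mul' _ _ (by finiteness)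
    _ ≤ ENNReal.ofReal (5 * (l x)⁻¹) * (ENNReal.ofReal (64 * l x) * Mx (fun y => ‖f y‖ₑ) x) := mul_le_mul' le_rfl (w_le_Mx hf.enorm (hl x) (by simpa using (hl x).le))
    _ = _ := by
      rw [← mul_assoc, ← ENNReal.ofReal_mul (by have := hl x; positivity)]; congr 1
      rw [show 5 * (l x)⁻¹ * (64 * l x) = 320 by have := (hl x).ne'; field_simp; norm_num]; simp

lemma mx_rwt {q : ℝ} (hq : 1 < q) : ∃ C : ℝ≥0∞, C ≠ ∞ ∧ ∀ (f : ℝ → ℂ) (F E : Set ℝ), Measurable f → MeasurableSet F → (∀ y, ‖f y‖ₑ ≤ F.indicator 1 y) → MeasurableSet E →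
    ∫⁻ x in E, Mx (fun y => ‖f y‖ₑ) x ≤ C * (volume E ^ (1 - 1 / q) * volume F ^ (1 / q)) := by
  have q0 : 0 < q := by linarith
  have hg := gs_ne_top (a := q - 1) (by linarith)
  have h2 := e2_ne_top q; have h3 := e2_ne_top (q - 1)
  refine ⟨(8 * e2 q * e2 (q - 1) * gs (q - 1)) ^ (1 / q), by finiteness, fun f F E hf hF hb hE => ?_⟩
  have hm : Measurable fun y => ‖f y‖ₑ := hf.enorm
  have := ENNReal.lintegral_mul_le_Lp_mul_Lq (volume.restrict E) (Real.HolderConjugate.conjExponent hq) (Mx_meas fun y => ‖f y‖ₑ).aemeasurable (aemeasurable_const (b := (1:ℝ≥0∞)))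
  simp only [Pi.mul_apply, mul_one, ENNReal.one_rpow, lintegral_const, one_mul, Measure.restrict_apply MeasurableSet.univ, univ_inter] at this
  rw [show 1 / q.conjExponent = 1 - 1 / q by rw [Real.conjExponent]; field_simp] at this
  refine this.trans ?_
  rw [mul_comm (volume E ^ _), ← mul_assoc]
  refine mul_le_mul' ?_ le_rfl
  rw [← ENNReal.mul_rpow_of_nonneg _ _ (by positivity)]
  refine ENNReal.rpow_le_rpow ?_ (by positivity)
  refine (setLIntegral_le_lintegral _ _).trans ((Mx_strong hq hm).trans (mul_le_mul' le_rfl ?_))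
  calc _ ≤ ∫⁻ y, F.indicator 1 y := lintegral_mono fun y => by
        refine (ENNReal.rpow_le_rpow (hb y) q0.le).trans ?_
        by_cases h : y ∈ F <;> simp [h, q0]
    _ = _ := lintegral_indicator_one hF

lemma highT {ε : ℝ} (h0 : ε ≠ 0) (h1 : ε ≠ 1) {p : ℝ} (hp : 1 < p) : ∃ C : ℝ≥0∞, C ≠ ∞ ∧ ∃ c : ℝ, 0 < c ∧ ∀ Λ s m : ℝ, ∀ l : ℝ → ℝ, 0 < s → s ≤ 1 → |Λ| * s ^ 12 = 1 → Measurable l → 0 < m → (∀ x, m ≤ l x) →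
    ∀ f : ℝ → ℂ, Measurable f → Integrable f → ∫⁻ x, ‖∫ y, f y * kT ε Λ l x y‖ₑ ^ p ≤ C * ENNReal.ofReal s ^ c * ∫⁻ y, ‖f y‖ₑ ^ p := by
  obtain ⟨δ, d0, d1, d2⟩ := del hp
  obtain ⟨D, hD, HD⟩ := kT_l2 h0 h1
  set θ := min (1 / p - δ) (1 - (1 / p + δ))
  have t0 : 0 < θ := lt_min d1 (by linarith)
  have t1 : θ ≤ 1 / p - δ := min_le_left _ _
  have t2 : θ ≤ 1 - (1 / p + δ) := min_le_right _ _
  have hA : ∀ a ∈ ({1 / p - δ, 1 / p + δ} : Set ℝ), θ ≤ a ∧ a ≤ 1 - θ := by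
    rintro a (rfl | rfl) <;> constructor <;> linarith
  have hrw : ∀ a, θ ≤ a → a ≤ 1 - θ → ∃ C : ℝ≥0∞, C ≠ ∞ ∧ ∀ Λ s m : ℝ, ∀ l : ℝ → ℝ, 0 < s → s ≤ 1 → |Λ| * s ^ 12 = 1 → Measurable l → 0 < m → (∀ x, m ≤ l x) →
    ∀ (f : ℝ → ℂ) (F E : Set ℝ), Measurable f → MeasurableSet F → volume F ≠ ∞ → (∀ y, ‖f y‖ₑ ≤ F.indicator 1 y) →
        MeasurableSet E → volume E ≠ ∞ → ∫⁻ x in E, ‖∫ y, f y * kT ε Λ l x y‖ₑ ≤ C * ENNReal.ofReal s ^ (θ / 2) * (volume E ^ (1 - a) * volume F ^ a) := fun a a1 a2 => by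
    have hb1 : 0 < a - θ / 2 := by linarith
    have hb2 : 0 < 1 - θ := by linarith
    obtain ⟨C, hC, H⟩ := mx_rwt (q := (1 - θ) / (a - θ / 2)) (by rw [lt_div_iff₀ hb1]; linarith)
    refine ⟨ENNReal.ofReal D ^ (θ / 2) * (320 * C) ^ (1 - θ), by finiteness, fun Λ s m l hs s1 hΛ ml hm hml f F E hf hF hF' hb hE hE' => ?_⟩
    have X1 := HD Λ s m l hs s1 hΛ ml hm hml f F E hf hF hF' hb hE hE'
    have X2 : ∫⁻ x in E, ‖∫ y, f y * kT ε Λ l x y‖ₑ ≤ 320 * (C * _) :=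
      ((lintegral_mono fun x => kT_mx (fun x => hm.trans_le (hml x)) hf x).trans_eq (lintegral_const_mul' _ _ (by finiteness))).trans (mul_le_mul' le_rfl (H f F E hf hF hb hE))
    calc _ = (∫⁻ x in E, ‖∫ y, f y * kT ε Λ l x y‖ₑ) ^ θ * (∫⁻ x in E, ‖∫ y, f y * kT ε Λ l x y‖ₑ) ^ (1 - θ) := by
          rw [← ENNReal.rpow_add_of_nonneg _ _ t0.le hb2.le, add_sub_cancel, ENNReal.rpow_one]
      _ ≤ _ := mul_le_mul' (ENNReal.rpow_le_rpow X1 t0.le) (ENNReal.rpow_le_rpow X2 hb2.le)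
      _ = _ := by
          rw [ENNReal.ofReal_mul hD.le, ENNReal.mul_rpow_of_nonneg _ _ (show (0:ℝ) ≤ 1/2 by norm_num), ENNReal.mul_rpow_of_nonneg _ _ (show (0:ℝ) ≤ 1/2 by norm_num), ENNReal.mul_rpow_of_nonneg _ _ t0.le, ENNReal.mul_rpow_of_nonneg _ _ t0.le, ENNReal.mul_rpow_of_nonneg _ _ t0.le, ENNReal.mul_rpow_of_nonneg 320 _ hb2.le, ENNReal.mul_rpow_of_nonneg C _ hb2.le, ENNReal.mul_rpow_of_nonneg (volume E ^ _) _ hb2.le, ENNReal.mul_rpow_of_nonneg 320 _ hb2.le]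
          simp_rw [← ENNReal.rpow_mul]
          have q1 : 1 / ((1 - θ) / (a - θ / 2)) * (1 - θ) = a - θ / 2 := by field_simp
          rw [show (1 - 1 / ((1 - θ) / (a - θ / 2))) * (1 - θ) = 1 - a - θ / 2 by rw [sub_mul, q1]; ring, q1, show (1 / 2 * θ) = θ / 2 by ring]
          rw [show volume E ^ (1 - a) = volume E ^ (θ / 2) * volume E ^ (1 - a - θ / 2) by rw [← ENNReal.rpow_add_of_nonneg _ _ (by linarith) (by linarith)]; congr 1; ring,
            show volume F ^ a = volume F ^ (θ / 2) * volume F ^ (a - θ / 2) by rw [← ENNReal.rpow_add_of_nonneg _ _ (by linarith) (by linarith)]; congr 1; ring]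
          ring
  have p1 := hA _ (Or.inl rfl)
  have p2 := hA _ (Or.inr rfl)
  obtain ⟨C1, hC1, H1⟩ := hrw _ p1.1 p1.2
  obtain ⟨C2, hC2, H2⟩ := hrw _ p2.1 p2.2
  obtain ⟨C, hC, H⟩ := strong2 hp d0 d1 d2 (D := C1 + C2) (by finiteness)
  refine ⟨C, hC, θ / 2, by positivity, fun Λ s m l hs s1 hΛ ml hm hml f hf hfi => ?_⟩
  refine H (kT ε Λ l) m⁻¹ (ENNReal.ofReal s ^ (θ / 2)) (kT_meas ml) (fun x y => ?_) (ENNReal.rpow_le_one (by simpa using s1) (by positivity)) (fun f F E hf hF hF' hb hE hE' a ha => ?_) f hf hfi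
  · rw [kT, norm_mul, Complex.norm_real, Real.norm_of_nonneg (inv_nonneg.2 (hm.le.trans (hml x)))]
    exact (mul_le_of_le_one_right (inv_nonneg.2 (hm.le.trans (hml x))) (Ko_one _ _ _)).trans (inv_anti₀ hm (hml x))
  · rcases ha with rfl | rfl
    · refine (H1 Λ s m l hs s1 hΛ ml hm hml f F E hf hF hF' hb hE hE').trans ?_
      gcongr; exact le_self_add
    · refine (H2 Λ s m l hs s1 hΛ ml hm hml f F E hf hF hF' hb hE hE').trans ?_
      gcongr; exact le_add_self

end
end Car

namespace Car
noncomputable section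
open FourierTransform ComplexConjugate
open scoped Classical

def Tp (f : ℝ → ℂ) (ε Λ l x : ℝ) : ℂ := ∫ t, f (x - l * t) * Ko ε Λ t

lemma Ko_int (ε Λ : ℝ) : Integrable (Ko ε Λ) :=
  (w_int.const_mul 5).mono' (Ko_meas ε Λ).aestronglyMeasurable (ae_of_all _ fun t => Ko_w ε Λ t)

lemma Tp_cont {f : ℝ → ℂ} (hf : Continuous f) {B : ℝ} (hB : ∀ x, ‖f x‖ ≤ B) (ε Λ : ℝ) : Continuous fun q : ℝ × ℝ => Tp f ε Λ q.1 q.2 := by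
  refine continuous_of_dominated (bound := fun t => B * ‖Ko ε Λ t‖) (fun q => ?_) (fun q => ae_of_all _ fun t => ?_) ((Ko_int ε Λ).norm.const_mul B) (ae_of_all _ fun t => by fun_prop)
  · exact ((by fun_prop : Measurable fun t => f (q.2 - q.1 * t)).mul (Ko_meas ε Λ)).aestronglyMeasurable
  · rw [norm_mul]; exact mul_le_mul_of_nonneg_right (hB _) (norm_nonneg _)

lemma Tsup_meas {f : ℝ → ℂ} (hf : Continuous f) {B : ℝ} (hB : ∀ x, ‖f x‖ ≤ B) (ε Λ : ℝ) : Measurable fun x => ⨆ t : ℝ, ‖Tp f ε Λ (2 ^ t) x‖ₑ := by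
  refine (lowerSemicontinuous_iSup fun t => Continuous.lowerSemicontinuous ?_).measurable
  exact ((Tp_cont hf hB ε Λ).comp (by fun_prop : Continuous fun x : ℝ => ((2:ℝ) ^ t, x))).enorm

lemma high {ε : ℝ} (h0 : ε ≠ 0) (h1 : ε ≠ 1) {p : ℝ} (hp : 1 < p) : ∃ C : ℝ≥0∞, C ≠ ∞ ∧ ∃ c : ℝ, 0 < c ∧ ∀ Λ s : ℝ, 0 < s → s ≤ 1 → |Λ| * s ^ 12 = 1 →
    ∀ f : ℝ → ℂ, Continuous f → Integrable f → ∀ B : ℝ, (∀ x, ‖f x‖ ≤ B) →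
      ∫⁻ x, (⨆ t : ℝ, ‖Tp f ε Λ (2 ^ t) x‖ₑ) ^ p ≤ C * ENNReal.ofReal s ^ c * ∫⁻ y, ‖f y‖ₑ ^ p := by
  obtain ⟨C, hC, c, hc, H⟩ := highT h0 h1 hp
  refine ⟨C, hC, c, hc, fun Λ s hs s1 hΛ f hf fi B hB => ?_⟩
  have c2 : Continuous fun t : ℝ => (2:ℝ) ^ t := Real.continuous_const_rpow (by norm_num)
  refine maxsel (H := fun t x => Tp f ε Λ (2 ^ t) x) (by linarith) (fun x => (Tp_cont hf hB ε Λ).comp (by fun_prop : Continuous fun t : ℝ => ((2:ℝ) ^ t, x)))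
    (fun t => ((Tp_cont hf hB ε Λ).comp (by fun_prop : Continuous fun x : ℝ => ((2:ℝ) ^ t, x))).measurable) fun N hN ⟨R, hR⟩ => ?_
  have := H Λ s ((2:ℝ) ^ (-R : ℝ)) (fun x => 2 ^ N x) hs s1 hΛ (by fun_prop) (by positivity) (fun x => Real.rpow_le_rpow_of_exponent_le one_le_two (abs_le.1 (hR x)).1) f hf.measurable fi
  simp_rw [kT_cov (l := fun x => (2:ℝ) ^ N x) (fun x => by positivity)] at this
  exact this

lemma high2 {ε : ℝ} (h0 : ε ≠ 0) (h1 : ε ≠ 1) {p : ℝ} (hp : 1 < p) : ∃ C : ℝ≥0∞, C ≠ ∞ ∧ ∃ c : ℝ, 0 < c ∧ ∀ Λ s : ℝ, 0 < s → s ≤ 1 → |Λ| * s ^ 12 = 1 →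
    ∀ f : SchwartzMap ℝ ℂ, ∃ G : ℝ → ℝ≥0∞, Measurable G ∧ (∀ x l, 0 < l → ‖∫ t, (f (x - l * t) * Ko ε Λ t - f (x + l * t) * Ko ε (-Λ) t)‖ₑ ≤ G x) ∧
      ∫⁻ x, G x ^ p ≤ C * ENNReal.ofReal s ^ c * ∫⁻ y, ‖f y‖ₑ ^ p := by
  obtain ⟨C, hC, c, hc, H⟩ := high h0 h1 hp
  refine ⟨2 ^ p * (C + C), by finiteness, c, hc, fun Λ s hs s1 hΛ f => ?_⟩
  obtain ⟨B, -, hB⟩ := schw_decay f 0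
  have hB1 : ∀ x, ‖f x‖ ≤ B := fun x => by simpa using hB x
  have fc : Continuous f := f.continuous
  have fi : Integrable f := f.integrable
  have gc : Continuous fun x => f (-x) := by fun_prop
  set a : ℝ → ℝ≥0∞ := fun x => ⨆ t : ℝ, ‖Tp f ε Λ (2 ^ t) x‖ₑ
  set b : ℝ → ℝ≥0∞ := fun x => ⨆ t : ℝ, ‖Tp (fun x => f (-x)) ε (-Λ) (2 ^ t) x‖ₑ
  have ma : Measurable a := Tsup_meas fc hB1 ε Λ
  have mb : Measurable b := Tsup_meas gc (fun x => hB1 (-x)) ε (-Λ)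
  have ha := H Λ s hs s1 hΛ f fc fi B hB1
  have hb := H (-Λ) s hs s1 (by rwa [abs_neg]) _ gc fi.comp_neg B (fun x => hB1 (-x))
  rw [lintegral_neg_eq_self (fun y => ‖f y‖ₑ ^ p)] at hb
  refine ⟨fun x => a x + b (-x), ma.add (mb.comp measurable_neg), fun x l hl => ?_, ?_⟩
  · have e : l = 2 ^ (Real.logb 2 l) := (Real.rpow_logb (by norm_num) (by norm_num) hl).symm
    have ii : ∀ (g : ℝ → ℝ), Continuous g → ∀ Λ, Integrable fun t => f (g t) * Ko ε Λ t := fun g hg Λ =>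
      (Ko_int ε Λ).bdd_mul (c := B) (by fun_prop) (ae_of_all _ fun t => hB1 _)
    rw [integral_sub (ii _ (by fun_prop) _) (ii _ (by fun_prop) _)]
    refine enorm_sub_le.trans (add_le_add ?_ ?_)
    · rw [e]; exact le_iSup (fun t : ℝ => ‖Tp f ε Λ (2 ^ t) x‖ₑ) (Real.logb 2 l)
    · refine le_trans (le_of_eq ?_) (le_iSup (fun t : ℝ => ‖Tp (fun x => f (-x)) ε (-Λ) (2 ^ t) (-x)‖ₑ) (Real.logb 2 l))
      rw [← e, Tp]; congr 2; ext t; congr 2; ring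
  · calc _ ≤ ∫⁻ x, 2 ^ p * (a x ^ p + b (-x) ^ p) := lintegral_mono fun x => by
          calc _ ≤ (2 * max (a x) (b (-x))) ^ p := by
                refine ENNReal.rpow_le_rpow ?_ (by linarith)
                rw [two_mul]; exact add_le_add (le_max_left _ _) (le_max_right _ _)
            _ ≤ _ := by
                rw [ENNReal.mul_rpow_of_nonneg _ _ (by linarith)]
                refine mul_le_mul' le_rfl ?_
                rcases max_choice (a x) (b (-x)) with h | h <;> rw [h]
                · exact le_self_add
                · exact le_add_self
      _ = 2 ^ p * ((∫⁻ x, a x ^ p) + ∫⁻ x, b x ^ p) := by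
          rw [lintegral_const_mul' _ _ (by finiteness), lintegral_add_left (ma.pow_const p), lintegral_neg_eq_self (fun x => b x ^ p)]
      _ ≤ _ := by
          rw [mul_assoc, mul_assoc, add_mul, ← mul_assoc]
          rw [mul_assoc]; refine mul_le_mul' le_rfl ?_
          rw [← mul_assoc]; exact add_le_add ha hb

end
end Car

namespace Car
noncomputable section
open FourierTransform ComplexConjugate
open scoped Classical

lemma two_mx {f : ℝ → ℂ} (hf : Measurable f) {τ : ℝ} (hτ : 0 < τ) (x : ℝ) (s : Set ℝ) :
    ∫⁻ u in s, (‖f (x - u)‖ₑ + ‖f (x + u)‖ₑ) * ENNReal.ofReal (w (u / τ)) ≤ ENNReal.ofReal (128 * τ) * Mx (fun y => ‖f y‖ₑ) x := by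
  have h := w_le_Mx hf.enorm hτ (x := x) (x' := x) (by simpa using hτ.le)
  have e1 := lintegral_sub_left_eq_self (μ := volume) (fun y => ‖f y‖ₑ * ENNReal.ofReal (w ((x - y) / τ))) x
  have e2 := lintegral_add_left_eq_self (μ := volume) (fun y => ‖f y‖ₑ * ENNReal.ofReal (w ((x - y) / τ))) x
  simp only [sub_sub_cancel] at e1
  have e3 : ∀ u, w ((x - (x + u)) / τ) = w (u / τ) := fun u => by rw [← w_neg]; congr 1; ring
  simp only [e3] at e2
  refine (setLIntegral_le_lintegral _ _).trans ?_
  simp_rw [add_mul]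
  have m : Measurable fun u => ‖f (x - u)‖ₑ * ENNReal.ofReal (w (u / τ)) := by fun_prop
  rw [lintegral_add_left m, e1, e2, show 128 * τ = 64 * τ + 64 * τ by ring, ENNReal.ofReal_add (by positivity) (by positivity), add_mul]
  exact add_le_add h h

def hh (f : ℝ → ℂ) (x u : ℝ) : ℂ := (f (x - u) - f (x + u)) / u

lemma hh_eq (f : ℝ → ℂ) (x u : ℝ) : hh f x u = (mG f 0 x u - mG f 0 x (-u)) / u := by simp [hh, mG, ee_zero]

lemma hh_int (f : SchwartzMap ℝ ℂ) (x : ℝ) : IntegrableOn (hh f x) (Ioi 0) := by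
  have := mG_int f 0 x; simp_rw [← hh_eq] at this; exact this

lemma truncH : ∃ C : ℝ≥0∞, C ≠ ∞ ∧ ∀ (f : SchwartzMap ℝ ℂ) (x τ : ℝ), 0 < τ →
    ‖∫ u in Ioc 0 τ, hh f x u‖ₑ ≤ C * (Mx (fun y => ‖f y‖ₑ) x + ⨆ M, ‖Hv (mG f M x)‖ₑ) := by
  obtain ⟨-, η, C, -, hη, ηi, hC, Tc, -, T1, T2, -⟩ := ker_ex
  have ηf : ∫⁻ ξ, ‖η ξ‖ₑ ≠ ∞ := ηi.2.ne
  refine ⟨ENNReal.ofReal (256 * C) + ∫⁻ ξ, ‖η ξ‖ₑ, by finiteness, fun f x τ hτ => ?_⟩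
  set S := ⨆ M, ‖Hv (mG f M x)‖ₑ
  have fc := f.continuous
  have hi := hh_int f x
  have hm : Measurable (hh f x) := by unfold hh; fun_prop
  have Tb : ∀ u, ‖((Th η (u / τ) : ℝ) : ℂ)‖ ≤ C := fun u => by
    rw [Complex.norm_real]; exact (T1 _).trans (mul_le_of_le_one_right hC.le (w_le_one _))
  have i2 : IntegrableOn (fun u => hh f x u * ((Th η (u / τ) : ℝ) : ℂ)) (Ioi 0) := hi.mul_bdd (c := C) (by fun_prop) (ae_of_all _ Tb)
  have i1 : IntegrableOn ((Iic τ).indicator (hh f x)) (Ioi 0) := hi.indicator measurableSet_Iic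
  have e0 : ∫ u in Ioc 0 τ, hh f x u = (∫ u in Ioi 0, ((Iic τ).indicator (hh f x) u - hh f x u * ((Th η (u / τ) : ℝ) : ℂ))) + ∫ u in Ioi 0, hh f x u * ((Th η (u / τ) : ℝ) : ℂ) := by
    rw [integral_sub i1 i2, sub_add_cancel, setIntegral_indicator measurableSet_Iic, Ioi_inter_Iic]
  rw [e0, mul_add]
  refine (enorm_add_le _ _).trans ?_
  have b1 : ‖∫ u in Ioi 0, ((Iic τ).indicator (hh f x) u - hh f x u * ((Th η (u / τ) : ℝ) : ℂ))‖ₑ ≤ ENNReal.ofReal (256 * C) * Mx (fun y => ‖f y‖ₑ) x := by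
    refine (enorm_integral_le_lintegral_enorm _).trans ?_
    calc _ ≤ ∫⁻ u in Ioi 0, ENNReal.ofReal (2 * C / τ) * ((‖f (x - u)‖ₑ + ‖f (x + u)‖ₑ) * ENNReal.ofReal (w (u / τ))) := by
          refine setLIntegral_mono' measurableSet_Ioi fun u hu => ?_
          have hu : 0 < u := hu
          rw [mul_left_comm, ← ENNReal.ofReal_mul (by positivity), ← ofReal_norm, ← ofReal_norm (f _), ← ofReal_norm (f _), ← ENNReal.ofReal_add (norm_nonneg _) (norm_nonneg _), ← ENNReal.ofReal_mul (by positivity)]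
          apply ENNReal.ofReal_le_ofReal
          have hw := w_nn (u / τ)
          have key : ∀ c : ℝ, |c| ≤ 2 * C * (u / τ) * w (u / τ) → ‖hh f x u * (c : ℂ)‖ ≤ (‖f (x - u)‖ + ‖f (x + u)‖) * (2 * C / τ * w (u / τ)) := fun c hc => by
            rw [hh, norm_mul, norm_div, Complex.norm_real, Complex.norm_real, Real.norm_of_nonneg hu.le, Real.norm_eq_abs]
            calc _ ≤ (‖f (x - u)‖ + ‖f (x + u)‖) / u * (2 * C * (u / τ) * w (u / τ)) := by gcongr; exact norm_sub_le _ _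
              _ = _ := by field_simp
          by_cases h : u ∈ Iic τ
          · rw [indicator_of_mem h, show hh f x u - hh f x u * ((Th η (u / τ) : ℝ) : ℂ) = hh f x u * ((1 - Th η (u / τ) : ℝ) : ℂ) by push_cast; ring]
            refine key _ ((T2 _).trans ?_)
            have v0 : 0 ≤ u / τ := by positivity
            have v1 : u / τ ≤ 1 := div_le_one_of_le₀ h hτ.le
            have : 1 / 2 ≤ w (u / τ) := by unfold w; rw [← one_div]; gcongr; nlinarith
            rw [abs_of_nonneg v0]; nlinarith [mul_nonneg hC.le v0]
          · rw [indicator_of_notMem h, zero_sub, norm_neg]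
            refine key _ ((T1 _).trans ?_)
            have v1 : 1 ≤ u / τ := (one_le_div hτ).2 (not_le.1 h).le
            have := mul_nonneg hC.le hw
            nlinarith
      _ ≤ _ := by
          rw [lintegral_const_mul' _ _ (by finiteness)]
          refine (mul_le_mul' le_rfl (two_mx fc.measurable hτ x _)).trans (le_of_eq ?_)
          rw [← mul_assoc, ← ENNReal.ofReal_mul (by positivity)]; congr 2; field_simp; norm_num
  have b2 : ‖∫ u in Ioi 0, hh f x u * ((Th η (u / τ) : ℝ) : ℂ)‖ₑ ≤ (∫⁻ ξ, ‖η ξ‖ₑ) * S := by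
    have e1 : ∫ u in Ioi 0, hh f x u * ((Th η (u / τ) : ℝ) : ℂ) = ∫ u in Ioi 0, ∫ ξ, hh f x u * ((η ξ * Real.cos (2 * Real.pi * (ξ * (u / τ))) : ℝ) : ℂ) := by
      congr 1; ext u; rw [Th, ← integral_complex_ofReal, ← integral_const_mul]
    have ii : Integrable (fun q : ℝ × ℝ => hh f x q.1 * ((η q.2 * Real.cos (2 * Real.pi * (q.2 * (q.1 / τ))) : ℝ) : ℂ)) ((volume.restrict (Ioi 0)).prod volume) := by
      refine ((hi.mul_prod ηi.ofReal).mul_bdd (c := 1) (f := fun q : ℝ × ℝ => hh f x q.1 * ((η q.2 : ℝ) : ℂ)) (g := fun q : ℝ × ℝ => ((Real.cos (2 * Real.pi * (q.2 * (q.1 / τ))) : ℝ) : ℂ)) (by fun_prop) (ae_of_all _ fun q => ?_)).congr (ae_of_all _ fun q => ?_)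
      · rw [Complex.norm_real]; exact Real.abs_cos_le_one _
      · simp only []; push_cast; ring
    rw [e1, integral_integral_swap ii]
    refine (enorm_integral_le_lintegral_enorm _).trans ?_
    rw [← lintegral_mul_const _ hη.measurable.enorm]
    refine lintegral_mono fun ξ => ?_
    have i3 := mG_int f (ξ / τ) x
    have i4 := mG_int f (-(ξ / τ)) x
    have e2 : ∫ u in Ioi 0, hh f x u * ((η ξ * Real.cos (2 * Real.pi * (ξ * (u / τ))) : ℝ) : ℂ) = ((η ξ : ℝ) : ℂ) * (2⁻¹ * (Hv (mG f (ξ / τ) x) + Hv (mG f (-(ξ / τ)) x))) := by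
      rw [Hv, Hv, ← integral_add i3 i4, ← integral_const_mul, ← integral_const_mul]
      congr 1; ext u
      have c1 : ∀ r : ℝ, ee r = Complex.cos (2 * Real.pi * r) + Complex.sin (2 * Real.pi * r) * Complex.I := fun r => by
        rw [ee, ← Complex.exp_mul_I]; congr 1; push_cast; ring
      simp only [mG, hh, c1, sub_neg_eq_add]
      push_cast
      rw [show (2 * Real.pi * (ξ / τ * -u) : ℂ) = -(2 * Real.pi * (ξ * (u / τ))) by ring, show (2 * Real.pi * (-(ξ / τ) * u) : ℂ) = -(2 * Real.pi * (ξ * (u / τ))) by ring,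
        show (2 * Real.pi * (-(ξ / τ) * -u) : ℂ) = (2 * Real.pi * (ξ * (u / τ))) by ring, show (2 * Real.pi * ((ξ / τ) * u) : ℂ) = (2 * Real.pi * (ξ * (u / τ))) by ring, Complex.cos_neg, Complex.sin_neg]
      ring
    rw [e2, enorm_mul, ← ofReal_norm ((η ξ : ℝ) : ℂ), Complex.norm_real, ofReal_norm]
    refine mul_le_mul' le_rfl ?_
    rw [enorm_mul, ← ofReal_norm (2⁻¹ : ℂ), norm_inv, Complex.norm_ofNat, ENNReal.ofReal_inv_of_pos two_pos, ENNReal.ofReal_ofNat]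
    calc _ ≤ (2:ℝ≥0∞)⁻¹ * (S + S) := mul_le_mul' le_rfl ((enorm_add_le _ _).trans (add_le_add (le_iSup (fun M => ‖Hv (mG f M x)‖ₑ) _) (le_iSup (fun M => ‖Hv (mG f M x)‖ₑ) _)))
      _ = S := by rw [← two_mul, ← mul_assoc, ENNReal.inv_mul_cancel (by norm_num) (by norm_num), one_mul]
  calc _ ≤ _ := add_le_add b1 b2
    _ ≤ _ := by gcongr; exacts [le_self_add, le_add_self]

end
end Car

namespace Car
noncomputable section
open FourierTransform ComplexConjugate
open scoped Classical

abbrev FF : Filter (ℝ × ℝ) := 𝓝[>] (0:ℝ) ×ˢ atTop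

def qq (f : ℝ → ℂ) (ε A x u : ℝ) : ℂ :=
  (f (x - u) * Complex.exp (Complex.I * ((A * u ^ ε : ℝ) : ℂ)) - f (x + u) * Complex.exp (Complex.I * ((-A * u ^ ε : ℝ) : ℂ))) / u

lemma FF_ev : ∀ᶠ q : ℝ × ℝ in FF, 0 < q.1 ∧ q.1 ≤ 1 ∧ 1 ≤ q.2 := by
  have h1 : ∀ᶠ a : ℝ in 𝓝[>] (0:ℝ), 0 < a ∧ a ≤ 1 := (eventually_mem_nhdsWithin).and (nhdsWithin_le_nhds (Iic_mem_nhds one_pos))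
  filter_upwards [h1.prod_mk (eventually_ge_atTop (1:ℝ))] with q hq
  exact ⟨hq.1.1, hq.1.2, hq.2⟩

lemma FF_lim {F : ℝ → ℂ} (hF : IntegrableOn F (Ioi 0)) : Tendsto (fun q : ℝ × ℝ => ∫ u in q.1..q.2, F u) FF (𝓝 (∫ u in Ioi 0, F u)) := by
  have c1 : AECover (volume.restrict (Ioi (0:ℝ))) FF fun q : ℝ × ℝ => Ioi q.1 := aecover_Ioi_of_Ioi (tendsto_nhds_of_tendsto_nhdsWithin tendsto_fst)
  have c2 : AECover (volume.restrict (Ioi (0:ℝ))) FF fun q : ℝ × ℝ => Iic q.2 := aecover_Iic tendsto_snd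
  refine ((c1.inter c2).integral_tendsto_of_countably_generated hF).congr' ?_
  filter_upwards [FF_ev] with q hq
  rw [Measure.restrict_restrict (measurableSet_Ioi.inter measurableSet_Iic), intervalIntegral.integral_of_le (hq.2.1.trans hq.2.2)]
  congr 2; ext u; simp only [mem_inter_iff, mem_Ioi, mem_Iic, mem_Ioc]
  exact ⟨fun h => h.1, fun h => ⟨h, hq.1.trans h.1⟩⟩

lemma IocI {F : ℝ → ℂ} (hF : IntegrableOn F (Ioc 0 1)) : ∃ L, Tendsto (fun δ => ∫ u in δ..1, F u) (𝓝[>] (0:ℝ)) (𝓝 L) := by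
  have c : AECover (volume.restrict (Ioi (0:ℝ))) (𝓝[>] (0:ℝ)) fun q : ℝ => Ioi q := aecover_Ioi_of_Ioi (tendsto_nhds_of_tendsto_nhdsWithin tendsto_id)
  have c' := c.mono (Measure.restrict_mono (Ioc_subset_Ioi_self : Ioc (0:ℝ) 1 ⊆ _) le_rfl)
  refine ⟨_, (c'.integral_tendsto_of_countably_generated hF).congr' ?_⟩
  filter_upwards [eventually_mem_nhdsWithin, nhdsWithin_le_nhds (Iic_mem_nhds one_pos)] with q h1 h2
  rw [Measure.restrict_restrict measurableSet_Ioi, intervalIntegral.integral_of_le h2]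
  congr 2; ext u; simp only [mem_inter_iff, mem_Ioi, mem_Ioc] at *
  exact ⟨fun h => ⟨h.1, h.2.2⟩, fun h => ⟨h.1, h1.trans h.1, h.2⟩⟩

lemma rp_ii {e : ℝ} (he : -1 < e) : IntegrableOn (fun u : ℝ => u ^ e) (Ioc 0 1) :=
  (intervalIntegrable_iff_integrableOn_Ioc_of_le zero_le_one).1 (intervalIntegral.intervalIntegrable_rpow' he)

lemma sin_lim {ε A : ℝ} (hε : ε ≠ 0) : ∃ L : ℂ, Tendsto (fun δ => ∫ u in δ..1, ((Real.sin (A * u ^ ε) / u : ℝ) : ℂ)) (𝓝[>] (0:ℝ)) (𝓝 L) := by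
  rcases hε.lt_or_gt with h | h
  swap
  · refine IocI (Integrable.mono' ((rp_ii (e := ε - 1) (by linarith)).const_mul |A|) (by exact (by fun_prop : Measurable fun u : ℝ => ((Real.sin (A * u ^ ε) / u : ℝ) : ℂ)).aestronglyMeasurable) ?_)
    refine (ae_restrict_iff' measurableSet_Ioc).2 (ae_of_all _ fun u hu => ?_)
    have := hu.1
    rw [Complex.norm_real, norm_div, Real.norm_of_nonneg hu.1.le, Real.rpow_sub_one this.ne', ← mul_div_assoc]
    gcongr
    refine (Real.abs_sin_le_abs).trans ?_
    rw [abs_mul, abs_of_nonneg (a := u ^ ε) (by positivity)]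
  by_cases hA : A = 0
  · exact ⟨0, by simp [hA]⟩
  have i1 : IntegrableOn (fun u : ℝ => ((Real.cos (A * u ^ ε) * u ^ (-ε - 1) / A : ℝ) : ℂ)) (Ioc 0 1) := by
    refine Integrable.mono' ((rp_ii (e := -ε - 1) (by linarith)).const_mul |A|⁻¹) (by fun_prop) ?_
    refine (ae_restrict_iff' measurableSet_Ioc).2 (ae_of_all _ fun u hu => ?_)
    have := hu.1
    rw [Complex.norm_real, norm_div, norm_mul, Real.norm_of_nonneg (r := u ^ _) (by positivity), div_eq_inv_mul, Real.norm_eq_abs, Real.norm_eq_abs]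
    gcongr
    exact mul_le_of_le_one_left (by positivity) (Real.abs_cos_le_one _)
  obtain ⟨L, hL⟩ := IocI i1
  set H : ℝ → ℝ := fun u => -(Real.cos (A * u ^ ε) * u ^ (-ε)) / (A * ε)
  have hH : ∀ u > 0, HasDerivAt H (Real.sin (A * u ^ ε) / u + Real.cos (A * u ^ ε) * u ^ (-ε - 1) / A) u := fun u hu => by
    have d1 : HasDerivAt (fun u : ℝ => A * u ^ ε) (A * (ε * u ^ (ε - 1))) u := (Real.hasDerivAt_rpow_const (Or.inl hu.ne')).const_mul A
    have d2 : HasDerivAt (fun u : ℝ => u ^ (-ε)) (-ε * u ^ (-ε - 1)) u := Real.hasDerivAt_rpow_const (Or.inl hu.ne')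
    have d3 := ((d1.cos.mul d2).neg).div_const (A * ε)
    refine d3.congr_deriv ?_
    have e1 : u ^ (ε - 1) * u ^ (-ε) = u⁻¹ := by rw [← Real.rpow_add hu, ← Real.rpow_neg_one]; congr 1; ring
    rw [div_eq_mul_inv _ u, ← e1]; field_simp; ring
  have H0 : Tendsto (fun δ => ((H δ : ℝ) : ℂ)) (𝓝[>] (0:ℝ)) (𝓝 0) := by
    have t : Tendsto (fun δ : ℝ => δ ^ (-ε)) (𝓝[>] (0:ℝ)) (𝓝 0) := by
      have := (Real.continuousAt_rpow_const 0 (-ε) (Or.inr (by linarith))).tendsto.mono_left (nhdsWithin_le_nhds (s := Ioi 0))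
      rwa [Real.zero_rpow (by linarith)] at this
    rw [tendsto_zero_iff_norm_tendsto_zero]
    have t2 := t.mul_const |A * ε|⁻¹
    rw [zero_mul] at t2
    refine squeeze_zero' (Eventually.of_forall fun _ => norm_nonneg _) ?_ t2
    filter_upwards [eventually_mem_nhdsWithin] with u (hu : 0 < u)
    rw [Complex.norm_real, norm_div, norm_neg, norm_mul, Real.norm_of_nonneg (r := u ^ _) (by positivity), div_eq_mul_inv, Real.norm_eq_abs, Real.norm_eq_abs]
    gcongr
    exact mul_le_of_le_one_left (by positivity) (Real.abs_cos_le_one _)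
  refine ⟨((H 1 : ℝ) : ℂ) - 0 - L, ((tendsto_const_nhds.sub H0).sub hL).congr' ?_⟩
  filter_upwards [eventually_mem_nhdsWithin, nhdsWithin_le_nhds (Iic_mem_nhds one_pos)] with q h1 h2
  have h1 : 0 < q := h1
  have hs : ∀ u ∈ uIcc q 1, 0 < u := fun u hu => by rw [uIcc_of_le h2] at hu; exact h1.trans_le hu.1
  have ca : ∀ e : ℝ, ContinuousOn (fun u : ℝ => u ^ e) (uIcc q 1) := fun e => continuousOn_id.rpow_const fun u hu => Or.inl (hs u hu).ne'
  have c1 : ContinuousOn (fun u : ℝ => Real.sin (A * u ^ ε) / u) (uIcc q 1) := (Real.continuous_sin.comp_continuousOn (continuousOn_const.mul (ca ε))).div continuousOn_id fun u hu => (hs u hu).ne'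
  have c2 : ContinuousOn (fun u : ℝ => Real.cos (A * u ^ ε) * u ^ (-ε - 1) / A) (uIcc q 1) := ((Real.continuous_cos.comp_continuousOn (continuousOn_const.mul (ca ε))).mul (ca _)).div_const _
  have e := intervalIntegral.integral_eq_sub_of_hasDerivAt (fun u hu => hH u (hs u hu)) (c1.add c2).intervalIntegrable
  rw [intervalIntegral.integral_add c1.intervalIntegrable c2.intervalIntegrable] at e
  rw [intervalIntegral.integral_ofReal, intervalIntegral.integral_ofReal, ← Complex.ofReal_sub, ← e]
  push_cast; ring

lemma qq_dec (f : ℝ → ℂ) (ε A x u : ℝ) : qq f ε A x u = hh f x u * ((Real.cos (A * u ^ ε) : ℝ) : ℂ) + (f (x - u) + f (x + u)) * Complex.I * ((Real.sin (A * u ^ ε) / u : ℝ) : ℂ) := by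
  unfold qq hh
  have c : ∀ r : ℝ, Complex.exp (Complex.I * r) = ((Real.cos r : ℝ) : ℂ) + ((Real.sin r : ℝ) : ℂ) * Complex.I := fun r => by
    rw [mul_comm, Complex.exp_mul_I]; push_cast; rfl
  rw [c, c, neg_mul, Real.cos_neg, Real.sin_neg]; push_cast; ring

lemma qq_cont (f : SchwartzMap ℝ ℂ) (ε A x : ℝ) : ContinuousOn (qq f ε A x) (Ioi 0) := by
  have fc := f.continuous
  have ca : ContinuousOn (fun u : ℝ => u ^ ε) (Ioi 0) := continuousOn_id.rpow_const fun u hu => Or.inl (ne_of_gt hu)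
  have cb : ∀ B : ℝ, ContinuousOn (fun u : ℝ => Complex.exp (Complex.I * ((B * u ^ ε : ℝ) : ℂ))) (Ioi 0) := fun B =>
    (by fun_prop : Continuous fun t : ℝ => Complex.exp (Complex.I * ((B * t : ℝ) : ℂ))).comp_continuousOn ca
  refine ContinuousOn.div (((by fun_prop : Continuous fun u => f (x - u)).continuousOn.mul (cb _)).sub ((by fun_prop : Continuous fun u => f (x + u)).continuousOn.mul (cb _))) (by fun_prop) fun u hu => ?_
  exact_mod_cast ne_of_gt hu

lemma qq_ii (f : SchwartzMap ℝ ℂ) (ε A x : ℝ) {a b : ℝ} (ha : 0 < a) (hb : 0 < b) : IntervalIntegrable (qq f ε A x) volume a b :=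
  ((qq_cont f ε A x).mono fun u hu => (lt_inf_iff.2 ⟨ha, hb⟩).trans_le hu.1).intervalIntegrable

lemma pv_ex (f : SchwartzMap ℝ ℂ) {ε : ℝ} (hε : ε ≠ 0) (A x : ℝ) : ∃ L, Tendsto (fun q : ℝ × ℝ => ∫ u in q.1..q.2, qq f ε A x u) FF (𝓝 L) := by
  obtain ⟨L, hL⟩ := sin_lim (A := A) hε
  obtain ⟨C, hC, -, h2⟩ := schw_lip f 0
  have fc := f.continuous
  have fi : Integrable f := f.integrable
  set ps : ℝ → ℂ := (Ioc (0:ℝ) 1).indicator fun u => 2 * f x * Complex.I * ((Real.sin (A * u ^ ε) / u : ℝ) : ℂ)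
  have ib : IntegrableOn (fun u => qq f ε A x u - ps u) (Ioi 0) := by
    have j1 : IntegrableOn (fun u => hh f x u * ((Real.cos (A * u ^ ε) : ℝ) : ℂ)) (Ioi 0) := (hh_int f x).mul_bdd (c := 1) (by fun_prop) (ae_of_all _ fun u => by rw [Complex.norm_real]; exact Real.abs_cos_le_one _)
    have j2 : Integrable fun u => (Ioc (0:ℝ) 1).indicator (fun _ => 4 * C) u + (‖f (x - u)‖ + ‖f (x + u)‖) :=
      ((integrable_indicator_iff measurableSet_Ioc).2 (integrableOn_const (by simp))).add ((fi.comp_sub_left x).norm.add (fi.comp_add_left x).norm)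
    refine (j1.add (g := fun u => (qq f ε A x u - ps u) - hh f x u * ((Real.cos (A * u ^ ε) : ℝ) : ℂ)) (j2.integrableOn.mono' ?_ ?_)).congr (ae_of_all _ fun u => by simp)
    · have : Measurable ps := Measurable.indicator (by fun_prop) measurableSet_Ioc
      exact (by unfold qq hh; fun_prop : Measurable fun u => (qq f ε A x u - ps u) - hh f x u * ((Real.cos (A * u ^ ε) : ℝ) : ℂ)).aestronglyMeasurable
    refine (ae_restrict_iff' measurableSet_Ioi).2 (ae_of_all _ fun u hu => ?_)
    have hu : 0 < u := hu
    have sb : ∀ t : ℝ, ‖((Real.sin t / u : ℝ) : ℂ)‖ ≤ u⁻¹ := fun t => by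
      rw [Complex.norm_real, norm_div, Real.norm_of_nonneg hu.le, ← one_div]; gcongr; exact Real.abs_sin_le_one t
    rw [qq_dec]
    by_cases h1 : u ∈ Ioc (0:ℝ) 1
    · simp only [ps, indicator_of_mem h1]
      have a1 := h2 (x - u) x; have a2 := h2 (x + u) x
      simp only [pow_zero, sub_sub_cancel_left, add_sub_cancel_left, abs_neg, abs_of_pos hu] at a1 a2
      have a3 : ‖f (x - u) + f (x + u) - 2 * f x‖ ≤ 4 * C * u := by
        rw [show f (x - u) + f (x + u) - 2 * f x = (f (x - u) - f x) + (f (x + u) - f x) by ring]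
        exact (norm_add_le _ _).trans (by linarith)
      rw [show ∀ a b c d e : ℂ, a + b * Complex.I * c - 2 * d * Complex.I * c - a = (b - 2 * d) * c * Complex.I from fun a b c d e => by ring]
      · rw [norm_mul, norm_mul, Complex.norm_I, mul_one]
        have := mul_le_mul a3 (sb (A * u ^ ε)) (norm_nonneg _) (by positivity)
        rw [mul_assoc (4 * C), mul_inv_cancel₀ hu.ne', mul_one] at this
        linarith [norm_nonneg (f (x - u)), norm_nonneg (f (x + u))]
      · exact 0
    · simp only [ps, indicator_of_notMem h1, sub_zero, add_sub_cancel_left, zero_add]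
      have u1 : 1 < u := by by_contra hc; exact h1 ⟨hu, not_lt.1 hc⟩
      rw [norm_mul, norm_mul, Complex.norm_I, mul_one]
      refine (mul_le_of_le_one_right (norm_nonneg _) ((sb _).trans (inv_le_one_of_one_le₀ u1.le))).trans (norm_add_le _ _)
  refine ⟨_ , ((FF_lim ib).add ((hL.const_mul (2 * f x * Complex.I)).comp tendsto_fst)).congr' ?_⟩
  filter_upwards [FF_ev] with q hq
  have hle := hq.2.1.trans hq.2.2
  have e1 : ∫ u in q.1..q.2, ps u = 2 * f x * Complex.I * ∫ u in q.1..1, ((Real.sin (A * u ^ ε) / u : ℝ) : ℂ) := by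
    rw [← intervalIntegral.integral_const_mul, intervalIntegral.integral_of_le hle, intervalIntegral.integral_of_le hq.2.1, setIntegral_indicator measurableSet_Ioc]
    congr 2; ext u; simp only [mem_inter_iff, mem_Ioc]
    exact ⟨fun h => ⟨h.1.1, h.2.2⟩, fun h => ⟨⟨h.1, h.2.trans hq.2.2⟩, hq.1.trans h.1, h.2⟩⟩
  have i1 : IntervalIntegrable (fun u => qq f ε A x u - ps u) volume q.1 q.2 := (intervalIntegrable_iff_integrableOn_Ioc_of_le hle).2 (ib.mono_set fun u hu => hq.1.trans hu.1)
  have i2 : IntervalIntegrable ps volume q.1 q.2 := ((qq_ii f ε A x hq.1 (hq.1.trans_le hle)).sub i1).congr (fun u _ => by simp)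
  simp only [Function.comp]
  rw [← e1, ← intervalIntegral.integral_add i1 i2]; simp

lemma pv_eq (f : SchwartzMap ℝ ℂ) (ε A x : ℝ) {L : ℂ} (h : Tendsto (fun q : ℝ × ℝ => ∫ u in q.1..q.2, qq f ε A x u) FF (𝓝 L)) :
    pvIntegral (fun y => Complex.exp (Complex.I * (A : ℂ) * ((Real.sign y * |y| ^ ε : ℝ) : ℂ)) * f (x - y) / (y : ℂ)) = L := by
  set g := fun y : ℝ => Complex.exp (Complex.I * (A : ℂ) * ((Real.sign y * |y| ^ ε : ℝ) : ℂ)) * f (x - y) / (y : ℂ)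
  refine (h.congr' ?_).limUnder_eq
  filter_upwards [FF_ev] with q hq
  have hle := hq.2.1.trans hq.2.2
  have fc := f.continuous
  have ca : ContinuousOn (fun u : ℝ => u ^ ε) (Ioi 0) := continuousOn_id.rpow_const fun u hu => Or.inl (ne_of_gt hu)
  have cb : ∀ B : ℝ, ContinuousOn (fun u : ℝ => Complex.exp (Complex.I * ((B * u ^ ε : ℝ) : ℂ))) (Ioi 0) := fun B =>
    (by fun_prop : Continuous fun t : ℝ => Complex.exp (Complex.I * ((B * t : ℝ) : ℂ))).comp_continuousOn ca
  have hp : ∀ u > 0, g u = f (x - u) * Complex.exp (Complex.I * ((A * u ^ ε : ℝ) : ℂ)) / u := fun u hu => by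
    simp only [g, Real.sign_of_pos hu, abs_of_pos hu]; push_cast; ring_nf
  have hn : ∀ u > 0, g (-u) = -(f (x + u) * Complex.exp (Complex.I * ((-A * u ^ ε : ℝ) : ℂ)) / u) := fun u hu => by
    simp only [g, Real.sign_of_neg (neg_lt_zero.2 hu), abs_neg, abs_of_pos hu]; push_cast; ring_nf
  have hs : ∀ u ∈ Icc q.1 q.2, (0:ℝ) < u := fun u hu => hq.1.trans_le hu.1
  have c1 : IntegrableOn g (Icc q.1 q.2) := by
    refine ContinuousOn.integrableOn_Icc (ContinuousOn.congr (ContinuousOn.mono (s := Ioi 0) ?_ hs) fun u hu => hp u (hs u hu))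
    exact ((by fun_prop : Continuous fun u => f (x - u)).continuousOn.mul (cb _)).div (by fun_prop) fun u hu => by exact_mod_cast ne_of_gt hu
  have c2 : IntegrableOn (fun u => g (-u)) (Icc q.1 q.2) := by
    refine ContinuousOn.integrableOn_Icc (ContinuousOn.congr (ContinuousOn.mono (s := Ioi 0) ?_ hs) fun u hu => hn u (hs u hu))
    exact (((by fun_prop : Continuous fun u => f (x + u)).continuousOn.mul (cb _)).div (by fun_prop) fun u hu => by exact_mod_cast ne_of_gt hu).neg
  have c3 : IntegrableOn g (Icc (-q.2) (-q.1)) := by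
    have := c2.mono_set Ioc_subset_Icc_self
    rw [← intervalIntegrable_iff_integrableOn_Ioc_of_le hle] at this
    have := (IntervalIntegrable.iff_comp_neg (f := g) (a := -q.2) (b := -q.1)).2 (by simpa using this.symm)
    rwa [intervalIntegrable_iff_integrableOn_Ioc_of_le (by linarith), ← integrableOn_Icc_iff_integrableOn_Ioc (by finiteness)] at this
  have es : {y : ℝ | q.1 ≤ |y| ∧ |y| ≤ q.2} = Icc q.1 q.2 ∪ Icc (-q.2) (-q.1) := by
    ext y; simp only [mem_ofPred_eq, mem_union, mem_Icc]
    have := hq.1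
    rw [le_abs, abs_le]; constructor
    · rintro ⟨h | h, h2⟩
      exacts [Or.inl ⟨h, h2.2⟩, Or.inr ⟨h2.1, by linarith⟩]
    · rintro (h | h)
      exacts [⟨Or.inl h.1, by linarith, h.2⟩, ⟨Or.inr (by linarith), h.1, by linarith⟩]
  have ed : Disjoint (Icc q.1 q.2) (Icc (-q.2) (-q.1)) := by rw [disjoint_left]; intro y h1 h2; linarith [h1.1, h2.2, hq.1]
  rw [es, setIntegral_union ed measurableSet_Icc c1 c3,
    integral_Icc_eq_integral_Ioc, integral_Icc_eq_integral_Ioc, ← intervalIntegral.integral_of_le hle, ← intervalIntegral.integral_of_le (by linarith),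
    ← intervalIntegral.integral_comp_neg, ← intervalIntegral.integral_add]
  · refine intervalIntegral.integral_congr fun u hu => ?_
    rw [uIcc_of_le hle] at hu
    simp only [hp u (hs u hu), hn u (hs u hu), qq]; ring
  · exact (intervalIntegrable_iff_integrableOn_Ioc_of_le hle).2 (c1.mono_set Ioc_subset_Icc_self)
  · exact (intervalIntegrable_iff_integrableOn_Ioc_of_le hle).2 (c2.mono_set Ioc_subset_Icc_self)

end
end Car

namespace Car
noncomputable section
open FourierTransform ComplexConjugate
open scoped Classical

lemma low_ann (f : SchwartzMap ℝ ℂ) (ε A x : ℝ) {l : ℝ} (hl : 0 < l) :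
    ‖∫ u in l..2 * l, (qq f ε A x u - hh f x u)‖ₑ ≤ ENNReal.ofReal (640 * 2 ^ |ε|) * ENNReal.ofReal (|A| * l ^ ε) * Mx (fun y => ‖f y‖ₑ) x := by
  rw [intervalIntegral.integral_of_le (by linarith)]
  refine (enorm_integral_le_lintegral_enorm _).trans ?_
  calc _ ≤ ∫⁻ u in Ioc l (2 * l), ENNReal.ofReal (5 * 2 ^ |ε| * (|A| * l ^ ε) / l) * ((‖f (x - u)‖ₑ + ‖f (x + u)‖ₑ) * ENNReal.ofReal (w (u / l))) := by
        refine setLIntegral_mono' measurableSet_Ioc fun u hu => ?_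
        have hu0 : 0 < u := hl.trans hu.1
        have hw := w_nn (u / l)
        rw [mul_left_comm, ← ENNReal.ofReal_mul (by positivity), ← ofReal_norm, ← ofReal_norm (f _), ← ofReal_norm (f _), ← ENNReal.ofReal_add (norm_nonneg _) (norm_nonneg _), ← ENNReal.ofReal_mul (by positivity)]
        apply ENNReal.ofReal_le_ofReal
        have v1 : 1 ≤ u / l := (one_le_div hl).2 hu.1.le
        have v2 : u / l ≤ 2 := (div_le_iff₀ hl).2 hu.2
        have w5 : 1 ≤ 5 * w (u / l) := by unfold w; rw [← div_eq_mul_inv, one_le_div (by positivity)]; nlinarith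
        have ue : u ^ ε ≤ l ^ ε * 2 ^ |ε| := by
          calc u ^ ε = l ^ ε * (u / l) ^ ε := by rw [← Real.mul_rpow hl.le (by positivity)]; congr 1; field_simp
            _ ≤ _ := by gcongr; exact (rp_bd v1 v2 ε).1
        have eb : ∀ B : ℝ, |B| = |A| → ‖Complex.exp (Complex.I * ((B * u ^ ε : ℝ) : ℂ)) - 1‖ ≤ |A| * (l ^ ε * 2 ^ |ε|) := fun B hB => by
          refine (Real.norm_exp_I_mul_ofReal_sub_one_le).trans ?_
          rw [norm_mul, Real.norm_eq_abs, hB, Real.norm_of_nonneg (by positivity)]; gcongr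
        have e : qq f ε A x u - hh f x u = (f (x - u) * (Complex.exp (Complex.I * ((A * u ^ ε : ℝ) : ℂ)) - 1) - f (x + u) * (Complex.exp (Complex.I * ((-A * u ^ ε : ℝ) : ℂ)) - 1)) / u := by
          unfold qq hh; ring
        rw [e, norm_div, Complex.norm_real, Real.norm_of_nonneg hu0.le]
        calc _ ≤ (‖f (x - u)‖ * (|A| * (l ^ ε * 2 ^ |ε|)) + ‖f (x + u)‖ * (|A| * (l ^ ε * 2 ^ |ε|))) / l := by
              refine div_le_div₀ (by positivity) ((norm_sub_le _ _).trans ?_) hl hu.1.le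
              rw [norm_mul, norm_mul]
              gcongr
              exacts [eb _ rfl, eb _ (abs_neg _)]
          _ = (‖f (x - u)‖ + ‖f (x + u)‖) * (2 ^ |ε| * (|A| * l ^ ε) / l) * 1 := by ring
          _ ≤ (‖f (x - u)‖ + ‖f (x + u)‖) * (2 ^ |ε| * (|A| * l ^ ε) / l) * (5 * w (u / l)) := by gcongr
          _ = _ := by ring
    _ ≤ _ := by
        rw [lintegral_const_mul' _ _ (by finiteness)]
        refine (mul_le_mul' le_rfl (two_mx f.continuous.measurable hl x _)).trans (le_of_eq ?_)
        rw [← mul_assoc, ← ENNReal.ofReal_mul (by positivity), ← ENNReal.ofReal_mul (by positivity)]; congr 2; field_simp; ring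

lemma high_ann (f : SchwartzMap ℝ ℂ) (ε A x : ℝ) {l : ℝ} (hl : 0 < l) :
    ∫ u in l..2 * l, qq f ε A x u = ∫ t, (f (x - l * t) * Ko ε (A * l ^ ε) t - f (x + l * t) * Ko ε (-(A * l ^ ε)) t) := by
  have h := intervalIntegral.smul_integral_comp_mul_left (a := 1) (b := 2) (qq f ε A x) l
  rw [mul_one, mul_comm l 2] at h
  rw [← h, ← intervalIntegral.integral_smul, intervalIntegral.integral_of_le one_le_two, ← integral_Icc_eq_integral_Ioc, ← integral_indicator measurableSet_Icc]
  congr 1; ext t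
  unfold Ko
  by_cases ht : t ∈ Icc (1:ℝ) 2
  · have t0 : 0 < t := one_pos.trans_le ht.1
    simp only [indicator_of_mem ht, qq]
    rw [Real.mul_rpow hl.le t0.le, Complex.real_smul, ← neg_mul, mul_assoc A, mul_assoc (-A)]
    have : (l : ℂ) ≠ 0 := by exact_mod_cast hl.ne'
    have : (t : ℂ) ≠ 0 := by exact_mod_cast t0.ne'
    rw [Complex.ofReal_mul l t, Complex.ofReal_inv]
    field_simp
  · simp only [indicator_of_notMem ht, mul_zero, sub_zero]

lemma ch_up {F : ℝ → ℂ} (hF : ∀ a b : ℝ, 0 < a → 0 < b → IntervalIntegrable F volume a b) {μ : ℝ} (hμ : 0 < μ) (c : ℝ) (N : ℕ) :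
    ∫ u in (μ * 2 ^ c)..(μ * 2 ^ (c + N)), F u = ∑ k ∈ Finset.range N, ∫ u in (μ * 2 ^ (c + k))..(2 * (μ * 2 ^ (c + k))), F u := by
  induction N with
  | zero => simp
  | succ N ih =>
    have : 2 * (μ * (2:ℝ) ^ (c + N)) = μ * 2 ^ (c + (N + 1 : ℕ)) := by rw [Nat.cast_succ, ← add_assoc, Real.rpow_add_one two_ne_zero]; ring
    rw [Finset.sum_range_succ, ← ih, this, intervalIntegral.integral_add_adjacent_intervals] <;> exact hF _ _ (by positivity) (by positivity)

lemma ch_dn {F : ℝ → ℂ} (hF : ∀ a b : ℝ, 0 < a → 0 < b → IntervalIntegrable F volume a b) {μ : ℝ} (hμ : 0 < μ) (c : ℝ) (N : ℕ) :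
    ∫ u in (μ * 2 ^ (c - N))..(μ * 2 ^ c), F u = ∑ k ∈ Finset.range N, ∫ u in (μ * 2 ^ (c - (k + 1)))..(2 * (μ * 2 ^ (c - (k + 1)))), F u := by
  induction N with
  | zero => simp
  | succ N ih =>
    have : 2 * (μ * (2:ℝ) ^ (c - (N + 1))) = μ * 2 ^ (c - N) := by rw [show c - N = c - (N + 1) + 1 by ring, Real.rpow_add_one two_ne_zero]; ring
    rw [Finset.sum_range_succ, ← ih, this, Nat.cast_succ, add_comm (intervalIntegral _ _ _ _), intervalIntegral.integral_add_adjacent_intervals] <;> exact hF _ _ (by positivity) (by positivity)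

lemma FF_seq {μ : ℝ} (hμ : 0 < μ) (c : ℝ) : Tendsto (fun N : ℕ => (μ * (2:ℝ) ^ (c - N), μ * (2:ℝ) ^ (c + N))) atTop FF := by
  have t : Tendsto (fun N : ℕ => (2:ℝ) ^ N) atTop atTop := tendsto_pow_atTop_atTop_of_one_lt one_lt_two
  have hp : 0 < μ * (2:ℝ) ^ c := by positivity
  refine Tendsto.prodMk (tendsto_nhdsWithin_iff.2 ⟨?_, Eventually.of_forall fun N => ?_⟩) ?_
  · refine ((t.inv_tendsto_atTop.const_mul (μ * (2:ℝ) ^ c)).congr fun N => ?_).trans (by rw [mul_zero])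
    rw [Real.rpow_sub two_pos, Real.rpow_natCast, Pi.inv_apply]; ring
  · simp only [mem_Ioi]; positivity
  · refine (t.const_mul_atTop hp).congr fun N => ?_
    rw [Real.rpow_add two_pos, Real.rpow_natCast]; ring

lemma ptw {ε : ℝ} (hε : ε ≠ 0) : ∃ C : ℝ≥0∞, C ≠ ∞ ∧ ∀ (f : SchwartzMap ℝ ℂ) (x : ℝ) (G : ℝ → ℝ≥0∞),
    (∀ Λ, 1 ≤ |Λ| → ∀ l, 0 < l → ‖∫ t, (f (x - l * t) * Ko ε Λ t - f (x + l * t) * Ko ε (-Λ) t)‖ₑ ≤ G Λ) →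
    carlesonOdd ε f x ≤ C * (Mx (fun y => ‖f y‖ₑ) x + ⨆ M, ‖Hv (mG f M x)‖ₑ) + ∑' m : ℕ, (G (2 ^ (|ε| * m)) + G (-2 ^ (|ε| * m))) := by
  obtain ⟨C2, hC2, H2⟩ := truncH
  have e0 : 0 < |ε| := abs_pos.2 hε
  set g : ℝ≥0∞ := ∑' m : ℕ, ENNReal.ofReal (2 ^ (-(|ε| * (m + 1))))
  have hg : g ≠ ∞ := by
    have s : Summable fun m : ℕ => (2:ℝ) ^ (-(|ε| * (m + 1))) := by
      have r1 : (2:ℝ) ^ (-|ε|) < 1 := Real.rpow_lt_one_of_one_lt_of_neg one_lt_two (by linarith)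
      refine ((summable_geometric_of_lt_one (by positivity) r1).mul_left ((2:ℝ) ^ (-|ε|))).congr fun m => ?_
      rw [← Real.rpow_natCast, ← Real.rpow_mul two_pos.le, ← Real.rpow_add two_pos]; congr 1; ring
    exact s.tsum_ofReal_ne_top
  set C1 := ENNReal.ofReal (640 * 2 ^ |ε|)
  refine ⟨C1 * g + (C2 + C2), by finiteness, fun f x G hG => ?_⟩
  set X := Mx (fun y => ‖f y‖ₑ) x
  set S := ⨆ M, ‖Hv (mG f M x)‖ₑ
  set T := ∑' m : ℕ, (G (2 ^ (|ε| * m)) + G (-2 ^ (|ε| * m)))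
  have q0 : ∀ u, qq f ε 0 x u = hh f x u := fun u => by simp [qq, hh]
  have hi : ∀ a b : ℝ, 0 < a → 0 < b → IntervalIntegrable (hh f x) volume a b := fun a b ha hb => by
    have := qq_ii f ε 0 x ha hb
    rwa [funext q0] at this
  have hb : ∀ a b : ℝ, 0 < a → 0 < b → ‖∫ u in a..b, hh f x u‖ₑ ≤ (C2 + C2) * (X + S) := fun a b ha hb => by
    have i : ∀ t : ℝ, 0 < t → IntervalIntegrable (hh f x) volume 0 t := fun t ht => (intervalIntegrable_iff_integrableOn_Ioc_of_le ht.le).2 ((hh_int f x).mono_set Ioc_subset_Ioi_self)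
    rw [← intervalIntegral.integral_interval_sub_left (i b hb) (i a ha), intervalIntegral.integral_of_le hb.le, intervalIntegral.integral_of_le ha.le, add_mul]
    exact (enorm_sub_le).trans (add_le_add (H2 f x b hb) (H2 f x a ha))
  refine iSup_le fun A => ?_
  obtain ⟨L, hL⟩ := pv_ex f hε A x
  rw [pv_eq f ε A x hL]
  suffices ∃ μ > 0, ∃ c : ℝ, ∀ N : ℕ, ‖∫ u in (μ * 2 ^ (c - N))..(μ * 2 ^ (c + N)), qq f ε A x u‖ₑ ≤ (C1 * g + (C2 + C2)) * (X + S) + T by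
    obtain ⟨μ, hμ, c, H⟩ := this
    exact le_of_tendsto ((hL.comp (FF_seq hμ c)).enorm) (Eventually.of_forall H)
  by_cases hA : A = 0
  · refine ⟨1, one_pos, 0, fun N => ?_⟩
    rw [hA, funext q0]
    refine (hb _ _ (by positivity) (by positivity)).trans (le_add_right ?_)
    exact mul_le_mul' le_add_self le_rfl
  have A0 : 0 < |A| := abs_pos.2 hA
  set μ : ℝ := |A| ^ (-ε⁻¹)
  have hμ : 0 < μ := by positivity
  have P : ∀ e : ℝ, |A| * (μ * 2 ^ e) ^ ε = 2 ^ (e * ε) := fun e => by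
    rw [Real.mul_rpow hμ.le (by positivity), ← Real.rpow_mul A0.le, ← Real.rpow_mul two_pos.le, neg_mul, inv_mul_cancel₀ hε, Real.rpow_neg_one, mul_inv_cancel_left₀ A0.ne']
  have qi : ∀ a b : ℝ, 0 < a → 0 < b → IntervalIntegrable (qq f ε A x) volume a b := fun a b ha hb => qq_ii f ε A x ha hb
  have di : ∀ a b : ℝ, 0 < a → 0 < b → IntervalIntegrable (fun u => qq f ε A x u - hh f x u) volume a b := fun a b ha hb => (qi a b ha hb).sub (hi a b ha hb)
  have lo : ∀ (e : ℕ → ℝ) (N : ℕ), (∀ k, e k * ε = -(|ε| * (k + 1))) → ‖∑ k ∈ Finset.range N, ∫ u in (μ * 2 ^ (e k))..(2 * (μ * 2 ^ (e k))), (qq f ε A x u - hh f x u)‖ₑ ≤ C1 * g * (X + S) := fun e N he => by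
    refine (enorm_sum_le _ _).trans ((Finset.sum_le_sum fun k _ => low_ann f ε A x (by positivity)).trans ?_)
    simp_rw [P, he]
    rw [← Finset.sum_mul, ← Finset.mul_sum]
    exact mul_le_mul' (mul_le_mul' le_rfl (ENNReal.sum_le_tsum _)) le_self_add
  have hi' : ∀ (e : ℕ → ℝ) (N : ℕ), (∀ k, e k * ε = |ε| * k) → ‖∑ k ∈ Finset.range N, ∫ u in (μ * 2 ^ (e k))..(2 * (μ * 2 ^ (e k))), qq f ε A x u‖ₑ ≤ T := fun e N he => by
    refine (enorm_sum_le _ _).trans ((Finset.sum_le_sum fun k _ => ?_).trans (ENNReal.sum_le_tsum _))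
    have l0 : 0 < μ * (2:ℝ) ^ (e k) := by positivity
    have Pk := P (e k)
    rw [he] at Pk
    have o1 : 1 ≤ (2:ℝ) ^ (|ε| * k) := Real.one_le_rpow one_le_two (by positivity)
    rw [high_ann f ε A x l0]
    rcases abs_cases A with h | h <;> rw [h.1] at Pk
    · rw [Pk]; exact (hG _ (o1.trans (le_abs_self _)) _ l0).trans le_self_add
    · rw [neg_mul, neg_eq_iff_eq_neg] at Pk
      rw [Pk]; exact (hG _ (by rw [abs_neg]; exact o1.trans (le_abs_self _)) _ l0).trans le_add_self
  have sp : ∀ a b : ℝ, 0 < a → 0 < b → ∫ u in a..b, qq f ε A x u = (∫ u in a..b, (qq f ε A x u - hh f x u)) + ∫ u in a..b, hh f x u := fun a b ha hb => by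
    rw [intervalIntegral.integral_sub (qi a b ha hb) (hi a b ha hb), sub_add_cancel]
  rw [add_mul]
  rcases hε.lt_or_gt with h | h
  · refine ⟨μ, hμ, 1, fun N => ?_⟩
    rw [← intervalIntegral.integral_add_adjacent_intervals (b := μ * 2 ^ (1:ℝ)) (qi _ _ (by positivity) (by positivity)) (qi _ _ (by positivity) (by positivity)),
      sp (μ * 2 ^ (1:ℝ)) _ (by positivity) (by positivity), ch_dn qi hμ, ch_up di hμ, add_comm]
    refine (enorm_add_le _ _).trans (add_le_add ((enorm_add_le _ _).trans (add_le_add (lo (fun k => 1 + k) N fun k => ?_) (hb _ _ (by positivity) (by positivity)))) (hi' (fun k => 1 - (k + 1)) N fun k => ?_))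
    all_goals rw [abs_of_neg h]; ring
  · refine ⟨μ, hμ, 0, fun N => ?_⟩
    rw [← intervalIntegral.integral_add_adjacent_intervals (b := μ * 2 ^ (0:ℝ)) (qi _ _ (by positivity) (by positivity)) (qi _ _ (by positivity) (by positivity)),
      sp _ (μ * 2 ^ (0:ℝ)) (by positivity) (by positivity), ch_up qi hμ, ch_dn di hμ]
    refine (enorm_add_le _ _).trans (add_le_add ((enorm_add_le _ _).trans (add_le_add (lo (fun k => 0 - (k + 1)) N fun k => ?_) (hb _ _ (by positivity) (by positivity)))) (hi' (fun k => 0 + k) N fun k => ?_))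
    all_goals rw [abs_of_pos h]; ring

end
end Car

namespace Car
noncomputable section
open FourierTransform ComplexConjugate
open scoped Classical

lemma sum_p {p : ℝ} (hp : 1 < p) {β : ℝ} (hβ : 0 < β) : ∃ D : ℝ≥0∞, D ≠ ∞ ∧ ∀ (a : ℕ → ℝ → ℝ≥0∞) (E : ℝ≥0∞), (∀ m, Measurable (a m)) →
    (∀ m : ℕ, ∫⁻ x, a m x ^ p ≤ e2 (-(m * β)) * E) → ∫⁻ x, (∑' m, a m x) ^ p ≤ D * E := by
  have p0 : 0 < p := by linarith
  set γ := β / (2 * p)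
  have hγ : 0 < γ := by positivity
  have g1 := gs_ne_top hγ
  have g2 := gs_ne_top (half_pos hβ)
  refine ⟨gs γ ^ p * gs (β / 2), by finiteness, fun a E ma ha => ?_⟩
  have pw : ∀ x, (∑' m, a m x) ^ p ≤ gs γ ^ p * ∑' m : ℕ, e2 (m * (β / 2)) * a m x ^ p := fun x => by
    have h1 : ∑' m, a m x ≤ gs γ * ⨆ m : ℕ, e2 (m * γ) * a m x := by
      rw [← tsum_geom, ← ENNReal.tsum_mul_right]
      refine ENNReal.tsum_le_tsum fun m => ?_
      calc a m x = e2 (-(m * γ)) * (e2 (m * γ) * a m x) := by rw [← mul_assoc, ← e2_add, neg_add_cancel, e2_zero, one_mul]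
        _ ≤ _ := mul_le_mul' le_rfl (le_iSup (fun m : ℕ => e2 (m * γ) * a m x) m)
    refine (ENNReal.rpow_le_rpow h1 p0.le).trans ?_
    rw [ENNReal.mul_rpow_of_nonneg _ _ p0.le]
    refine mul_le_mul' le_rfl ?_
    have := (ENNReal.orderIsoRpow p p0).map_iSup fun m : ℕ => e2 (m * γ) * a m x
    simp only [ENNReal.orderIsoRpow_apply] at this
    rw [this]
    refine iSup_le fun m => ?_
    rw [ENNReal.mul_rpow_of_nonneg _ _ p0.le, ← e2_mul, show (m:ℝ) * γ * p = m * (β / 2) by simp only [γ]; field_simp]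
    exact ENNReal.le_tsum (f := fun m : ℕ => e2 (m * (β / 2)) * a m x ^ p) m
  have mm : ∀ m : ℕ, Measurable fun x => a m x ^ p := fun m => (ma m).pow_const p
  calc _ ≤ ∫⁻ x, gs γ ^ p * ∑' m : ℕ, e2 (m * (β / 2)) * a m x ^ p := lintegral_mono pw
    _ = gs γ ^ p * ∑' m : ℕ, e2 (m * (β / 2)) * ∫⁻ x, a m x ^ p := by
        rw [lintegral_const_mul' _ _ (by finiteness), lintegral_tsum fun m => ((mm m).const_mul _).aemeasurable]
        congr 2; ext m; rw [lintegral_const_mul' _ _ (e2_ne_top _)]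
    _ ≤ gs γ ^ p * ∑' m : ℕ, e2 (-(m * (β / 2))) * E := by
        refine mul_le_mul' le_rfl (ENNReal.tsum_le_tsum fun m => ?_)
        refine (mul_le_mul' le_rfl (ha m)).trans (le_of_eq ?_)
        rw [← mul_assoc, ← e2_add]; congr 2; ring
    _ = _ := by rw [ENNReal.tsum_mul_right, tsum_geom, mul_assoc]

lemma rp3 {p : ℝ} (hp : 1 < p) (a b c : ℝ≥0∞) : (a + b + c) ^ p ≤ 3 ^ p * (a ^ p + b ^ p + c ^ p) := by
  have p0 : 0 < p := by linarith
  set M := max a (max b c)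
  have h1 : a + b + c ≤ 3 * M := by
    calc _ ≤ M + M + M := add_le_add (add_le_add (le_max_left _ _) ((le_max_left _ _).trans (le_max_right _ _))) ((le_max_right _ _).trans (le_max_right _ _))
      _ = _ := by ring
  refine (ENNReal.rpow_le_rpow h1 p0.le).trans ?_
  rw [ENNReal.mul_rpow_of_nonneg _ _ p0.le]
  refine mul_le_mul' le_rfl ?_
  rcases max_choice a (max b c) with h | h
  · rw [show M = a from h]; exact le_add_right le_self_add
  · rcases max_choice b c with h' | h'
    · rw [show M = b from h.trans h']; exact le_add_right le_add_self
    · rw [show M = c from h.trans h']; exact le_add_self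

lemma main1 {p : ℝ} (hp : 1 < p) : ∃ C : ℝ≥0∞, C ≠ ∞ ∧ ∀ f : SchwartzMap ℝ ℂ, ∫⁻ x, carlesonOdd 1 f x ^ p ≤ C * ∫⁻ y, ‖f y‖ₑ ^ p := by
  obtain ⟨C, hC, H⟩ := carl hp
  refine ⟨C, hC, fun f => (lintegral_mono fun x => ENNReal.rpow_le_rpow (iSup_le fun A => ?_) (by linarith)).trans (H f)⟩
  have e : ∀ u ∈ Ioi (0:ℝ), qq f 1 A x u = (mG f (A / (2 * Real.pi)) x u - mG f (A / (2 * Real.pi)) x (-u)) / u := fun u _ => by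
    have := Real.pi_ne_zero
    have e1 : ∀ v : ℝ, ee (A / (2 * Real.pi) * v) = Complex.exp (Complex.I * ((A * v : ℝ) : ℂ)) := fun v => by
      rw [ee]; congr 1; push_cast; field_simp
    simp only [qq, mG, e1, Real.rpow_one, sub_neg_eq_add]; simp only [mul_neg, neg_mul]
  have i := (mG_int f (A / (2 * Real.pi)) x).congr_fun (fun u hu => (e u hu).symm) measurableSet_Ioi
  rw [pv_eq f 1 A x (FF_lim i), setIntegral_congr_fun measurableSet_Ioi e]
  exact le_iSup (fun M => ‖Hv (mG f M x)‖ₑ) _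

lemma main2 {ε : ℝ} (h0 : ε ≠ 0) (h1 : ε ≠ 1) {p : ℝ} (hp : 1 < p) : ∃ C : ℝ≥0∞, C ≠ ∞ ∧ ∀ f : SchwartzMap ℝ ℂ, ∫⁻ x, carlesonOdd ε f x ^ p ≤ C * ∫⁻ y, ‖f y‖ₑ ^ p := by
  have p0 : 0 < p := by linarith
  obtain ⟨C1, hC1, H1⟩ := carl hp
  obtain ⟨C2, hC2, c, hc, H2⟩ := high2 h0 h1 hp
  obtain ⟨C3, hC3, H3⟩ := ptw h0
  have e0 : 0 < |ε| := abs_pos.2 h0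
  obtain ⟨D, hD, H4⟩ := sum_p hp (β := |ε| * c / 12) (by positivity)
  have g1 := gs_ne_top (a := p - 1) (by linarith)
  have t1 := e2_ne_top p; have t2 := e2_ne_top (p - 1)
  set C4 := 8 * e2 p * e2 (p - 1) * gs (p - 1)
  refine ⟨3 ^ p * (C3 ^ p * C4 + C3 ^ p * C1 + D * (3 ^ p * (C2 + C2))), by finiteness, fun f => ?_⟩
  set I := ∫⁻ y, ‖f y‖ₑ ^ p
  set X := Mx (fun y => ‖f y‖ₑ)
  set S := fun x => ⨆ M, ‖Hv (mG f M x)‖ₑ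
  have hx : ∀ Λ : ℝ, ∃ G : ℝ → ℝ≥0∞, 1 ≤ |Λ| → Measurable G ∧ (∀ x l, 0 < l → ‖∫ t, (f (x - l * t) * Ko ε Λ t - f (x + l * t) * Ko ε (-Λ) t)‖ₑ ≤ G x) ∧
      ∫⁻ x, G x ^ p ≤ C2 * ENNReal.ofReal (|Λ| ^ (-(1/12) : ℝ)) ^ c * I := fun Λ => by
    by_cases h : 1 ≤ |Λ|
    · have l0 : 0 < |Λ| := by linarith
      obtain ⟨G, hG⟩ := H2 Λ (|Λ| ^ (-(1/12) : ℝ)) (by positivity) (Real.rpow_le_one_of_one_le_of_nonpos h (by norm_num))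
        (by rw [← Real.rpow_natCast, ← Real.rpow_mul l0.le]; norm_num [Real.rpow_neg_one, l0.ne']) f
      exact ⟨G, fun _ => hG⟩
    · exact ⟨0, fun h' => absurd h' h⟩
  choose G hG using hx
  set a : ℕ → ℝ → ℝ≥0∞ := fun m x => G (2 ^ (|ε| * m)) x + G (-2 ^ (|ε| * m)) x
  have o1 : ∀ m : ℕ, 1 ≤ (2:ℝ) ^ (|ε| * m) := fun m => Real.one_le_rpow one_le_two (by positivity)
  have o2 : ∀ m : ℕ, 1 ≤ |(2:ℝ) ^ (|ε| * m)| := fun m => (o1 m).trans (le_abs_self _)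
  have o3 : ∀ m : ℕ, 1 ≤ |-(2:ℝ) ^ (|ε| * m)| := fun m => by rw [abs_neg]; exact o2 m
  have ma : ∀ m, Measurable (a m) := fun m => (hG _ (o2 m)).1.add (hG _ (o3 m)).1
  have hs : ∀ m : ℕ, ENNReal.ofReal (((2:ℝ) ^ (|ε| * m)) ^ (-(1/12) : ℝ)) ^ c = e2 (-(m * (|ε| * c / 12))) := fun m => by
    rw [← Real.rpow_mul two_pos.le, ← e2_ofReal, ← e2_mul]; congr 1; ring
  have ha : ∀ m : ℕ, ∫⁻ x, a m x ^ p ≤ e2 (-(m * (|ε| * c / 12))) * (3 ^ p * (C2 + C2) * I) := fun m => by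
    have b1 := (hG _ (o2 m)).2.2
    have b2 := (hG _ (o3 m)).2.2
    rw [abs_neg] at b2
    rw [abs_of_nonneg (zero_le_one.trans (o1 m)), hs] at b1 b2
    have mb : Measurable fun x => G (2 ^ (|ε| * m)) x ^ p := (hG _ (o2 m)).1.pow_const p
    calc _ ≤ ∫⁻ x, 3 ^ p * (G (2 ^ (|ε| * m)) x ^ p + G (-2 ^ (|ε| * m)) x ^ p) := lintegral_mono fun x => by
          have := rp3 hp (G (2 ^ (|ε| * m)) x) (G (-2 ^ (|ε| * m)) x) 0
          rwa [add_zero, ENNReal.zero_rpow_of_pos p0, add_zero] at this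
      _ ≤ _ := by
          rw [lintegral_const_mul' _ _ (by finiteness), lintegral_add_left mb]
          refine (mul_le_mul' le_rfl (add_le_add b1 b2)).trans (le_of_eq (by ring))
  have pt : ∀ x, carlesonOdd ε f x ^ p ≤ 3 ^ p * ((C3 * X x) ^ p + (∑' m, a m x) ^ p + (C3 * S x) ^ p) := fun x => by
    refine (ENNReal.rpow_le_rpow (H3 f x (fun Λ => G Λ x) fun Λ hΛ l hl => (hG Λ hΛ).2.1 x l hl) p0.le).trans ?_
    refine le_trans (le_of_eq ?_) (rp3 hp _ _ _)
    congr 1; simp only [X, S, a]; ring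
  have m1 : Measurable fun x => (C3 * X x) ^ p := ((Mx_meas _).const_mul _).pow_const p
  have m2 : Measurable fun x => (∑' m, a m x) ^ p := (Measurable.tsum ma).pow_const p
  have m3 : Measurable fun x => (C3 * X x) ^ p + (∑' m, a m x) ^ p := m1.add m2
  have cp : C3 ^ p ≠ ∞ := by finiteness
  have k1 : ∫⁻ x, (C3 * X x) ^ p ≤ C3 ^ p * (C4 * I) := by
    simp_rw [ENNReal.mul_rpow_of_nonneg _ _ p0.le]
    rw [lintegral_const_mul' _ _ cp]
    exact mul_le_mul' le_rfl (Mx_strong hp f.continuous.measurable.enorm)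
  have k2 : ∫⁻ x, (C3 * S x) ^ p ≤ C3 ^ p * (C1 * I) := by
    simp_rw [ENNReal.mul_rpow_of_nonneg _ _ p0.le]
    rw [lintegral_const_mul' _ _ cp]
    exact mul_le_mul' le_rfl (H1 f)
  refine (lintegral_mono pt).trans ?_
  rw [lintegral_const_mul' _ _ (by finiteness), lintegral_add_left m3, lintegral_add_left m1]
  refine (mul_le_mul' le_rfl (add_le_add (add_le_add k1 (H4 a _ ma ha)) k2)).trans (le_of_eq ?_)
  ring

end
end Car

theorem stmt_1 (ε₂ : ℝ) (hε : ε₂ ≠ 0) (p : ℝ) (hp : 1 < p) :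
    ∃ C : ℝ, 0 < C ∧ ∀ f : SchwartzMap ℝ ℂ,
      (∫⁻ x : ℝ, carlesonOdd ε₂ (fun y => f y) x ^ p) ^ (1 / p)
        ≤ ENNReal.ofReal C * eLpNorm (fun y => f y) (ENNReal.ofReal p) volume := by
  have p0 : 0 < p := by linarith
  obtain ⟨C, hC, H⟩ : ∃ C : ℝ≥0∞, C ≠ ∞ ∧ ∀ f : SchwartzMap ℝ ℂ, ∫⁻ x, carlesonOdd ε₂ f x ^ p ≤ C * ∫⁻ y, ‖f y‖ₑ ^ p := by
    by_cases h1 : ε₂ = 1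
    · subst h1; exact Car.main1 hp
    · exact Car.main2 hε h1 hp
  have hD : C ^ (1 / p) ≠ ∞ := by finiteness
  refine ⟨(C ^ (1 / p)).toReal + 1, by positivity, fun f => ?_⟩
  rw [eLpNorm_eq_lintegral_rpow_enorm_toReal (by simpa using p0) ENNReal.ofReal_ne_top, ENNReal.toReal_ofReal p0.le]
  refine (ENNReal.rpow_le_rpow (H f) (by positivity)).trans ?_
  rw [ENNReal.mul_rpow_of_nonneg _ _ (by positivity)]
  refine mul_le_mul' ?_ le_rfl
  rw [ENNReal.ofReal_add ENNReal.toReal_nonneg zero_le_one, ENNReal.ofReal_toReal hD]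
  exact le_self_add
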